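/- If a graph G embeds into a surface S of Euler genus g, then the number of connected components of G that are non-planar is at most g. -/

import Mathlib

/-- A finite (multi)graph: finite types of vertices and edges, each edge with an
ordered pair of endpoints (loops and multiple edges are allowed). -/
structure FinGraph where
  V : Type
  E : Type
  [fintypeV : Fintype V]
  [fintypeE : Fintype E]
  ends : E → V × V

attribute [instance] FinGraph.fintypeV FinGraph.fintypeE

/-- A topological embedding of the realization of a finite graph into a space `S`:
vertices go to distinct points, edges to arcs which are injective on their interiors,
whose interiors avoid the vertices and each other. -/
structure GraphEmb (G : FinGraph) (S : Type*) [TopologicalSpace S] where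
  vmap : G.V → S
  emap : (e : G.E) → Path (vmap (G.ends e).1) (vmap (G.ends e).2)
  vmap_injective : Function.Injective vmap
  emap_injOn : ∀ e : G.E, Set.InjOn (emap e) (Set.Ioo (0 : unitInterval) 1)
  emap_disjoint : ∀ e e' : G.E, e ≠ e' → ∀ t ∈ Set.Ioo (0 : unitInterval) 1,
    ∀ t' ∈ Set.Ioo (0 : unitInterval) 1, emap e t ≠ emap e' t'
  emap_avoid : ∀ e : G.E, ∀ t ∈ Set.Ioo (0 : unitInterval) 1, ∀ v : G.V, emap e t ≠ vmap v

namespace GraphEmb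

variable {G : FinGraph} {S : Type*} [TopologicalSpace S] (Γ : GraphEmb G S)

/-- The image of the graph in `S`. -/
def image : Set S := Set.range Γ.vmap ∪ ⋃ e : G.E, Set.range ⇑(Γ.emap e)

/-- The faces of the embedding are the connected components of the complement. -/
noncomputable def numFaces : ℕ := Nat.card (ConnectedComponents (↥((Γ.image)ᶜ)))

/-- The underlying set of a face of the embedding. -/
def faceSet (c : ConnectedComponents (↥((Γ.image)ᶜ))) : Set S :=
  Subtype.val '' (ConnectedComponents.mk ⁻¹' {c})

/-- An embedding is cellular if each face is homeomorphic to an open disk. -/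
def IsCellular : Prop := ∀ x : S, x ∈ (Γ.image)ᶜ →
  Nonempty ((↥(connectedComponentIn ((Γ.image)ᶜ) x)) ≃ₜ
    (↥(Metric.ball (0 : EuclideanSpace ℝ (Fin 2)) 1)))

end GraphEmb

/-- The Euler characteristic of a (compact, connected) surface, possibly with boundary,
characterized as the minimum of `v - e + f` over all embeddings of nonempty finite
graphs, `f` being the number of connected components of the complement.  The minimum
is attained precisely by the cellular embeddings (Euler's formula). -/
noncomputable def chiInf (X : Type*) [TopologicalSpace X] : ℤ :=
  sInf {z : ℤ | ∃ (G : FinGraph) (Γ : GraphEmb G X), Nonempty G.V ∧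
    z = (Fintype.card G.V : ℤ) - (Fintype.card G.E : ℤ) + (Γ.numFaces : ℤ)}

/-- The Euler genus of a closed surface: `χ = 2 - g`. -/
noncomputable def eulerGenusClosed (X : Type*) [TopologicalSpace X] : ℤ := 2 - chiInf X

/-- The subgraph of `G` determined by a set of vertices and a set of edges whose
endpoints lie in that vertex set. -/
noncomputable def FinGraph.restrict (G : FinGraph) (VS : Set G.V) (ES : Set G.E)
    (h : ∀ e ∈ ES, (G.ends e).1 ∈ VS ∧ (G.ends e).2 ∈ VS) : FinGraph where
  V := ↥VS
  E := ↥ES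
  fintypeV := Fintype.ofFinite _
  fintypeE := Fintype.ofFinite _
  ends := fun e => (⟨(G.ends e.1).1, (h e.1 e.2).1⟩, ⟨(G.ends e.1).2, (h e.1 e.2).2⟩)

/-- Adjacency in a finite multigraph. -/
def FinGraph.Adj (G : FinGraph) (x y : G.V) : Prop :=
  ∃ e : G.E, G.ends e = (x, y) ∨ G.ends e = (y, x)

/-- The connected components of a finite multigraph. -/
def FinGraph.Comp (G : FinGraph) : Type := Quot G.Adj

/-- The vertices of a connected component. -/
def FinGraph.componentVerts (G : FinGraph) (c : G.Comp) : Set G.V :=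
  {v | Quot.mk G.Adj v = c}

/-- The edges of a connected component. -/
def FinGraph.componentEdges (G : FinGraph) (c : G.Comp) : Set G.E :=
  {e | (G.ends e).1 ∈ G.componentVerts c ∧ (G.ends e).2 ∈ G.componentVerts c}

/-- The subgraph of `G` induced by a connected component. -/
noncomputable def FinGraph.componentGraph (G : FinGraph) (c : G.Comp) : FinGraph :=
  G.restrict (G.componentVerts c) (G.componentEdges c) (fun _ he => he)

/-- A connected component is planar if it embeds in the plane. -/
def FinGraph.IsPlanarComponent (G : FinGraph) (c : G.Comp) : Prop :=
  Nonempty (GraphEmb (G.componentGraph c) (EuclideanSpace ℝ (Fin 2)))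


namespace NPG
open Set Filter Topology

/-- continuous logarithm on simply connected spaces -/
lemma exists_clog {A : Type*} [TopologicalSpace A] [SimplyConnectedSpace A]
    [LocallyPathConnectedSpace A] (f : A → ℂ) (hf : Continuous f) (h0 : ∀ x, f x ≠ 0) :
    ∃ l : A → ℂ, Continuous l ∧ ∀ x, Complex.exp (l x) = f x := by
  obtain ⟨a₀⟩ : Nonempty A := inferInstance
  obtain ⟨F, ⟨-, hF⟩, -⟩ := Complex.isCoveringMap_exp.existsUnique_continuousMap_lifts
    (⟨fun x => ⟨f x, h0 x⟩, by fun_prop⟩ : C(A, {z : ℂ // z ≠ 0})) a₀ (Complex.log (f a₀))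
    (Subtype.ext (Complex.exp_log (h0 a₀)))
  exact ⟨F, F.continuous, fun x => congrArg Subtype.val (congrFun hF x)⟩

lemma const_of_pow {g : ℝ → ℂ} (hg : Continuous g) {m : ℕ} (hm : 0 < m) {k : ℂ}
    (h : ∀ t, g t ^ m = k) (s t : ℝ) : g s = g t := by
  have hfin : {z : ℂ | z ^ m = k}.Finite := by
    refine (Polynomial.nthRoots m k).toFinset.finite_toSet.subset ?_
    intro z hz
    simpa [Polynomial.mem_nthRoots hm] using hz
  have hp : IsPreconnected (range g) := isPreconnected_range hg
  have h1 : (range g).Finite := hfin.subset (by rintro _ ⟨t, rfl⟩; exact h t : range g ⊆ _)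
  exact (hp.isDiscrete_iff_subsingleton.1 h1.isDiscrete) ⟨s, rfl⟩ ⟨t, rfl⟩

lemma circle_dvd {a : ℂ} {R : ℝ} (hR : 0 < R) {w : ℂ → ℂ}
    (hw : ContinuousOn w (Metric.sphere a R)) {m : ℕ} (hm : 0 < m) {n : ℤ}
    (h : ∀ z ∈ Metric.sphere a R, w z ^ m = (z - a) ^ n) : (m : ℤ) ∣ n := by
  let p : ℝ → ℂ := fun θ => circleMap a R θ
  have hp : ∀ θ, p θ ∈ Metric.sphere a R := fun θ => circleMap_mem_sphere a hR.le θ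
  let g : ℝ → ℂ := fun θ => w (p θ) * Complex.exp (-(n * (θ * Complex.I)) / m)
  have hg : Continuous g := by
    apply Continuous.mul
    · exact hw.comp_continuous (continuous_circleMap a R) hp
    · fun_prop
  have hm' : (m : ℂ) ≠ 0 := by exact_mod_cast hm.ne'
  have hk : ∀ θ, g θ ^ m = (R : ℂ) ^ n := by
    intro θ
    simp only [g, mul_pow, ← Complex.exp_nat_mul]
    rw [h _ (hp θ), mul_div_cancel₀ _ hm']
    simp only [p, circleMap, add_sub_cancel_left, mul_zpow, ← Complex.exp_int_mul, mul_assoc,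
      ← Complex.exp_add]
    simp
  have := const_of_pow hg hm hk 0 (2 * Real.pi)
  have e : p (2 * Real.pi) = p 0 := by simp [p, circleMap]
  have h0 : g 0 ≠ 0 := by
    intro h0
    have := hk 0
    rw [h0, zero_pow hm.ne'] at this
    exact zpow_ne_zero n (by exact_mod_cast hR.ne' : (R : ℂ) ≠ 0) this.symm
  simp only [g, e] at this
  have h1 : w (p 0) ≠ 0 := fun h' => h0 (by simp [g, h'])
  have h2 := mul_left_cancel₀ h1 this
  simp only [Complex.ofReal_zero, zero_mul, mul_zero, neg_zero, zero_div, Complex.exp_zero] at h2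
  obtain ⟨k, hk⟩ := Complex.exp_eq_one_iff.1 h2.symm
  have hpi : (2 * Real.pi * Complex.I : ℂ) ≠ 0 := Complex.two_pi_I_ne_zero
  refine ⟨-k, ?_⟩
  have h3 : (n : ℂ) * (2 * Real.pi * Complex.I) = (m * (-k)) * (2 * Real.pi * Complex.I) := by
    field_simp at hk
    push_cast at hk
    linear_combination (-1) * (Complex.I) * hk
  exact_mod_cast mul_right_cancel₀ hpi h3

/-- winding obstruction -/
lemma no_ext {F : ℂ → ℂ} (hF : Continuous F) (h0 : ∀ z, F z ≠ 0) {a : ℂ} {n : ℤ} {R : ℝ}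
    (h : ∀ z, R ≤ ‖z - a‖ → F z = (z - a) ^ n) : n = 0 := by
  obtain ⟨l, hl, hle⟩ := exists_clog F hF h0
  by_contra hn
  have hR : 0 < max R 1 := by positivity
  have := circle_dvd (a := a) hR (w := fun z => Complex.exp (l z / (2 * n.natAbs : ℕ)))
    (by fun_prop) (m := 2 * n.natAbs) (by omega) (n := n) (by
      intro z hz
      rw [← Complex.exp_nat_mul, mul_div_cancel₀ _ (by
        have : 2 * n.natAbs ≠ 0 := by omega
        exact_mod_cast this), hle, h]
      rw [mem_sphere_iff_norm] at hz; rw [hz]; exact le_max_left _ _)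
  obtain ⟨k, hk⟩ := this
  push_cast at hk
  have h2 : (|n|) ∣ n := (abs_dvd _ _).2 dvd_rfl
  rcases abs_choice n with h' | h' <;> rw [h'] at hk
  · have : n * (2 * k - 1) = 0 := by linarith
    rcases mul_eq_zero.1 this with h | h <;> omega
  · have : n * (2 * k + 1) = 0 := by linarith
    rcases mul_eq_zero.1 this with h | h <;> omega

/-- the logarithm of `(z-a)/(z-b)` off an arc from `a` to `b` -/
lemma exists_log_arc {A : ℝ → ℂ} (hA : Continuous A) :
    ∃ l : ℂ → ℂ, ContinuousOn l (A '' Icc 0 1)ᶜ ∧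
      ∀ z ∉ A '' Icc 0 1, Complex.exp (l z) = (z - A 0) / (z - A 1) := by
  let X := ↥((A '' Icc (0:ℝ) 1)ᶜ)
  have hne : ∀ (t : unitInterval) (z : X), (z : ℂ) - A t ≠ 0 := fun t z h =>
    z.2 ⟨t, t.2, (sub_eq_zero.1 h).symm⟩
  let H : C(unitInterval × X, {z : ℂ // z ≠ 0}) :=
    ⟨fun q => ⟨((q.2 : ℂ) - A (unitInterval.symm q.1)) / ((q.2 : ℂ) - A 1),
      div_ne_zero (hne _ _) (by simpa using hne 1 q.2)⟩, by
      apply Continuous.subtype_mk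
      have hv : Continuous (fun q : unitInterval × X => (q.2 : ℂ)) :=
        continuous_subtype_val.comp continuous_snd
      apply Continuous.div
      · exact hv.sub (hA.comp (continuous_subtype_val.comp
          (unitInterval.continuous_symm.comp continuous_fst)))
      · exact hv.sub continuous_const
      · intro q; simpa using hne 1 q.2⟩
  let f : C(X, ℂ) := ⟨fun _ => 0, continuous_const⟩
  have H0 : ∀ x, H (0, x) = ⟨Complex.exp (f x), Complex.exp_ne_zero _⟩ := by
    intro x
    apply Subtype.ext
    simp [H, f]
    simpa using hne 1 x
  let Φ := Complex.isCoveringMap_exp.liftHomotopy H f H0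
  have hΦ := Complex.isCoveringMap_exp.liftHomotopy_lifts H f H0
  classical
  refine ⟨fun z => if h : z ∈ (A '' Icc (0:ℝ) 1)ᶜ then Φ (1, ⟨z, h⟩) else 0, ?_, ?_⟩
  · rw [continuousOn_iff_continuous_domRestrict]
    have : ((A '' Icc (0:ℝ) 1)ᶜ).domRestrict
      (fun z => if h : z ∈ (A '' Icc (0:ℝ) 1)ᶜ then Φ (1, ⟨z, h⟩) else 0) = fun x : X => Φ (1, x) := by
      ext x
      exact dif_pos x.2
    rw [this]
    fun_prop
  · intro z hz
    have hz' : z ∈ (A '' Icc (0:ℝ) 1)ᶜ := hz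
    simp only [dif_pos hz']
    have := congrArg Subtype.val (congrFun hΦ (1, ⟨z, hz'⟩))
    refine Eq.trans this ?_
    simp [H]

lemma exists_sqrt_arc {A : ℝ → ℂ} (hA : Continuous A) :
    ∃ s : ℂ → ℂ, ContinuousOn s (A '' Icc 0 1)ᶜ ∧
      ∀ z ∉ A '' Icc 0 1, s z ^ 2 = (z - A 0) / (z - A 1) := by
  obtain ⟨l, hl, h⟩ := exists_log_arc hA
  refine ⟨fun z => Complex.exp (l z / 2), by fun_prop, fun z hz => ?_⟩
  rw [← h z hz, ← Complex.exp_nat_mul]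
  congr 1; push_cast; ring

lemma isClosed_arc {A : ℝ → ℂ} (hA : Continuous A) (a b : ℝ) : IsClosed (A '' Icc a b) :=
  (isCompact_Icc.image hA).isClosed

/-- a continuous injective real function cannot live on the plane -/
lemma no_inj_plane (g : ℂ → ℝ) (hg : Continuous g) : ¬ Function.Injective g := by
  intro hi
  have key : ∀ x y z : ℂ, g x < g y → g y < g z → False := by
    intro x y z h1 h2
    have hc : IsPreconnected ({y}ᶜ : Set ℂ) :=
      (isConnected_compl_singleton_of_one_lt_rank (by simp) y).isPreconnected
    have := (hc.image g hg.continuousOn).ordConnected.out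
      (mem_image_of_mem g (by rintro rfl; exact lt_irrefl _ h1 : x ∈ ({y}ᶜ : Set ℂ)))
      (mem_image_of_mem g (by rintro rfl; exact lt_irrefl _ h2 : z ∈ ({y}ᶜ : Set ℂ)))
      ⟨h1.le, h2.le⟩
    obtain ⟨y', hy', e⟩ := this
    exact hy' (hi e)
  have h01 : g 0 ≠ g 1 := fun h => zero_ne_one (hi h)
  have h02 : g 0 ≠ g 2 := fun h => two_ne_zero (hi h).symm
  have h12 : g 1 ≠ g 2 := fun h => by have := hi h; norm_num at this
  rcases lt_or_gt_of_ne h01 with a | a <;> rcases lt_or_gt_of_ne h02 with b | b <;>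
    rcases lt_or_gt_of_ne h12 with c | c
  · exact key _ _ _ a c
  · exact key _ _ _ b c
  · linarith
  · exact key _ _ _ b a
  · exact key _ _ _ a b
  · linarith
  · exact key _ _ _ c b
  · exact key _ _ _ c a

lemma interior_arc {A : ℝ → ℂ} (hA : Continuous A) (hi : InjOn A (Icc 0 1)) :
    interior (A '' Icc 0 1) = ∅ := by
  by_contra hne
  obtain ⟨x, hx⟩ := nonempty_iff_ne_empty.2 hne
  obtain ⟨r, hr, hb⟩ := Metric.isOpen_iff.1 isOpen_interior x hx
  let A' : Icc (0:ℝ) 1 → ℂ := fun t => A t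
  have hA' : IsClosedEmbedding A' := Continuous.isClosedEmbedding (by fun_prop)
    (fun s t h => Subtype.ext (hi s.2 t.2 h))
  have hr' : range A' = A '' Icc 0 1 := by ext; simp [A']
  let u := OpenPartialHomeomorph.univBall x r
  have hu : ∀ z, u z ∈ range A' := fun z => by
    rw [hr']
    apply interior_subset; apply hb
    have := u.map_source (x := z) (by simp [u])
    simpa [u, OpenPartialHomeomorph.univBall_target x hr] using this
  let e := hA'.isEmbedding.toHomeomorph
  refine no_inj_plane (fun z => (e.symm ⟨u z, hu z⟩ : ℝ)) ?_ ?_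
  · have : Continuous u := OpenPartialHomeomorph.continuous_univBall x r
    fun_prop
  · intro z z' h
    have h1 := e.symm.injective (Subtype.ext h)
    have h2 : u z = u z' := congrArg Subtype.val h1
    exact u.injOn (by simp [u]) (by simp [u]) h2

end NPG

namespace NPG
open Set Filter Topology

lemma interval_ind (Q : ℝ → ℝ → Prop) (hadd : ∀ a b c, a ≤ b → b ≤ c → Q a b → Q b c → Q a c)
    (hloc : ∀ x, ∃ ε > 0, ∀ a b, x - ε ≤ a → a ≤ b → b ≤ x + ε → Q a b)
    (a b : ℝ) (hab : a ≤ b) : Q a b := by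
  let s := {t | a ≤ t → Q a t}
  have h0 : ∀ x, Q x x := fun x => by
    obtain ⟨ε, hε, h⟩ := hloc x
    exact h x x (by linarith) le_rfl (by linarith)
  -- use connectedness style argument through sSup
  by_contra hQ
  let T := {t | t ∈ Icc a b ∧ Q a t}
  have hT : T.Nonempty := ⟨a, ⟨le_rfl, hab⟩, h0 a⟩
  have hbd : BddAbove T := ⟨b, fun t ht => ht.1.2⟩
  set m := sSup T
  have ham : a ≤ m := le_csSup hbd ⟨⟨le_rfl, hab⟩, h0 a⟩
  have hmb : m ≤ b := csSup_le hT fun t ht => ht.1.2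
  obtain ⟨ε, hε, h⟩ := hloc m
  obtain ⟨t, ht, htm⟩ := exists_lt_of_lt_csSup hT (show m - ε < m by linarith)
  have htm' : t ≤ m := le_csSup hbd ht
  have h1 : Q a (min b (m + ε)) := by
    refine hadd a t _ ht.1.1 (le_min ht.1.2 (by linarith)) ht.2 (h _ _ htm.le ?_ (min_le_right _ _))
    exact le_min ht.1.2 (by linarith)
  rcases le_total b (m + ε) with hb | hb
  · rw [min_eq_left hb] at h1; exact hQ h1
  · rw [min_eq_right hb] at h1
    have : m + ε ≤ m := le_csSup hbd ⟨⟨by linarith, hb⟩, h1⟩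
    linarith

/-- a `ℤ/2`-torsor of germs of functions off `Y` -/
structure Tors (Y : Set ℂ) (P : ℂ → (ℂ → ℂ) → Prop) : Prop where
  loc : ∀ x w w', P x w → w =ᶠ[𝓝[Yᶜ] x] w' → P x w'
  uniq : ∀ x w w', P x w → P x w' → (w =ᶠ[𝓝[Yᶜ] x] w') ∨ (w =ᶠ[𝓝[Yᶜ] x] fun y => - w' y)
  neg : ∀ x w, P x w → P x (fun y => - w y)
  ex : ∀ x, ∃ w, ∀ᶠ y in 𝓝 x, P y w
  nz : ∀ x w, P x w → ∀ᶠ y in 𝓝[Yᶜ] x, w y ≠ 0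

lemma isOpen_evEq {X : Type*} [TopologicalSpace X] (Y : Set X) (p : X → Prop) :
    IsOpen {x | ∀ᶠ y in 𝓝[Yᶜ] x, p y} := by
  rw [isOpen_iff_mem_nhds]
  intro x hx
  simp only [mem_ofPred_eq, eventually_nhdsWithin_iff] at hx
  filter_upwards [eventually_eventually_nhds.2 hx] with y hy
  simpa only [mem_ofPred_eq, eventually_nhdsWithin_iff] using hy

lemma convex_rect (a b c d : ℝ) : Convex ℝ (Icc a b ×ℂ Icc c d) :=
  ((convex_Icc a b).is_linear_preimage Complex.reLm.isLinear).inter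
    ((convex_Icc c d).is_linear_preimage Complex.imLm.isLinear)

variable {Y : Set ℂ} {P : ℂ → (ℂ → ℂ) → Prop}

lemma Tors.glue (hP : Tors Y P) (hd : Dense Yᶜ) (f : ℂ → ℝ) (hf : Continuous f) (β : ℝ)
    {R₁ R₂ : Set ℂ} (h1 : ∀ x ∈ R₁, f x ≤ β) (h2 : ∀ x ∈ R₂, β ≤ f x)
    (h12 : ∀ x, f x = β → (x ∈ R₁ ↔ x ∈ R₂)) (hc : IsPreconnected (R₁ ∩ R₂))
    (g1 : ∃ w, ∀ x ∈ R₁, P x w) (g2 : ∃ w, ∀ x ∈ R₂, P x w) :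
    ∃ w, ∀ x ∈ R₁ ∪ R₂, P x w := by
  obtain ⟨w1, hw1⟩ := g1
  obtain ⟨w2, hw2⟩ := g2
  have hnb : ∀ x, (𝓝[Yᶜ] x).NeBot := fun x => mem_closure_iff_nhdsWithin_neBot.1 (hd x)
  -- final gluing
  have fin : ∀ w2, (∀ x ∈ R₂, P x w2) → (∀ x ∈ R₁ ∩ R₂, w1 =ᶠ[𝓝[Yᶜ] x] w2) →
      ∃ w, ∀ x ∈ R₁ ∪ R₂, P x w := by
    intro w2 hw2 he
    classical
    let w : ℂ → ℂ := fun y => if f y < β then w1 y else w2 y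
    have hmid : ∀ x ∈ R₁ ∩ R₂, P x w := by
      intro x hx
      refine hP.loc x w1 w (hw1 x hx.1) ?_
      filter_upwards [he x hx] with y hy
      simp only [w]; split_ifs
      · rfl
      · exact hy
    refine ⟨w, ?_⟩
    rintro x (hx | hx)
    · rcases (h1 x hx).lt_or_eq with hlt | heq
      · refine hP.loc x w1 w (hw1 x hx) ?_
        filter_upwards [mem_nhdsWithin_of_mem_nhds (hf.continuousAt.eventually_lt continuousAt_const hlt)]
          with y hy
        simp only [w]; rw [if_pos hy]
      · exact hmid x ⟨hx, (h12 x heq).1 hx⟩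
    · rcases (h2 x hx).lt_or_eq with hlt | heq
      · refine hP.loc x w2 w (hw2 x hx) ?_
        filter_upwards [mem_nhdsWithin_of_mem_nhds (continuousAt_const.eventually_lt hf.continuousAt hlt)]
          with y hy
        simp only [w]; rw [if_neg (not_lt.2 (le_of_lt hy))]
      · exact hmid x ⟨(h12 x heq.symm).2 hx, hx⟩
  let U := {x | ∀ᶠ y in 𝓝[Yᶜ] x, w1 y = w2 y}
  let V := {x | ∀ᶠ y in 𝓝[Yᶜ] x, w1 y = - w2 y}
  have hU : IsOpen U := isOpen_evEq Y _
  have hV : IsOpen V := isOpen_evEq Y _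
  have hcov : R₁ ∩ R₂ ⊆ U ∪ V := fun x hx => hP.uniq x w1 w2 (hw1 x hx.1) (hw2 x hx.2)
  have hdis : R₁ ∩ R₂ ∩ (U ∩ V) = ∅ := by
    ext x
    simp only [mem_empty_iff_false, iff_false]
    rintro ⟨hx, hu, hv⟩
    have hu : ∀ᶠ y in 𝓝[Yᶜ] x, w1 y = w2 y := hu
    have hv : ∀ᶠ y in 𝓝[Yᶜ] x, w1 y = - w2 y := hv
    obtain ⟨y, hy1, hy2, hy3⟩ := (hu.and (hv.and (hP.nz x w2 (hw2 x hx.2)))).exists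
    rw [hy1] at hy2
    exact hy3 (by linear_combination hy2 / 2)
  rcases (isPreconnected_iff_subset_of_disjoint.1 hc) U V hU hV hcov hdis with h | h
  · exact fin w2 hw2 (fun x hx => h hx)
  · exact fin (fun y => - w2 y) (fun x hx => hP.neg _ _ (hw2 x hx)) (fun x hx => h hx)

lemma Tors.rect (hP : Tors Y P) (hd : Dense Yᶜ) (a b c d : ℝ) (hab : a ≤ b) (hcd : c ≤ d) :
    ∃ w, ∀ x ∈ Icc a b ×ℂ Icc c d, P x w := by
  have strip : ∀ x0 : ℝ, ∃ ε > 0, ∃ w, ∀ x ∈ Icc (x0 - ε) (x0 + ε) ×ℂ Icc c d, P x w := by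
    intro x0
    refine interval_ind
      (fun c d => ∃ ε > 0, ∃ w, ∀ x ∈ Icc (x0 - ε) (x0 + ε) ×ℂ Icc c d, P x w) ?_ ?_ c d hcd
    · rintro c d e hcd hde ⟨ε1, hε1, w1, h1⟩ ⟨ε2, hε2, w2, h2⟩
      refine ⟨min ε1 ε2, lt_min hε1 hε2, ?_⟩
      have key := hP.glue hd Complex.im Complex.continuous_im d
        (R₁ := Icc (x0 - min ε1 ε2) (x0 + min ε1 ε2) ×ℂ Icc c d)
        (R₂ := Icc (x0 - min ε1 ε2) (x0 + min ε1 ε2) ×ℂ Icc d e)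
        (fun x hx => hx.2.2) (fun x hx => hx.2.1) ?_ ?_ ⟨w1, ?_⟩ ⟨w2, ?_⟩
      · obtain ⟨w, hw⟩ := key
        refine ⟨w, fun x hx => hw x ?_⟩
        rcases le_total x.im d with h | h
        · exact Or.inl ⟨hx.1, hx.2.1, h⟩
        · exact Or.inr ⟨hx.1, h, hx.2.2⟩
      · intro x hx
        simp only [Complex.mem_reProdIm, mem_Icc]
        constructor
        · rintro ⟨h, -⟩; exact ⟨h, by linarith, by linarith⟩
        · rintro ⟨h, -⟩; exact ⟨h, by linarith, by linarith⟩
      · apply Convex.isPreconnected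
        apply Convex.inter <;> exact convex_rect _ _ _ _
      · intro x hx
        exact h1 x ⟨⟨by linarith [hx.1.1, min_le_left ε1 ε2], by linarith [hx.1.2, min_le_left ε1 ε2]⟩, hx.2⟩
      · intro x hx
        exact h2 x ⟨⟨by linarith [hx.1.1, min_le_right ε1 ε2], by linarith [hx.1.2, min_le_right ε1 ε2]⟩, hx.2⟩
    · intro y0
      obtain ⟨w, hw⟩ := hP.ex (⟨x0, y0⟩ : ℂ)
      obtain ⟨ε, hε, h⟩ := Metric.eventually_nhds_iff.1 hw
      refine ⟨ε / 3, by positivity, fun c d h1 _ h3 => ⟨ε / 3, by positivity, w, fun x hx => h ?_⟩⟩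
      have h4 : |x.re - x0| ≤ ε / 3 := abs_le.2 ⟨by linarith [hx.1.1], by linarith [hx.1.2]⟩
      have h5 : |x.im - y0| ≤ ε / 3 := abs_le.2 ⟨by linarith [hx.2.1], by linarith [hx.2.2]⟩
      rw [Complex.dist_eq]
      have := Complex.norm_le_abs_re_add_abs_im (x - ⟨x0, y0⟩)
      simp only [Complex.sub_re, Complex.sub_im] at this
      linarith
  refine interval_ind
      (fun a b => ∃ w, ∀ x ∈ Icc a b ×ℂ Icc c d, P x w) ?_ ?_ a b hab
  · rintro a b e hab hbe h1 h2
    have key := hP.glue hd Complex.re Complex.continuous_re b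
      (R₁ := Icc a b ×ℂ Icc c d) (R₂ := Icc b e ×ℂ Icc c d)
      (fun x hx => hx.1.2) (fun x hx => hx.1.1) ?_ ?_ h1 h2
    · obtain ⟨w, hw⟩ := key
      refine ⟨w, fun x hx => hw x ?_⟩
      rcases le_total x.re b with h | h
      · exact Or.inl ⟨⟨hx.1.1, h⟩, hx.2⟩
      · exact Or.inr ⟨⟨h, hx.1.2⟩, hx.2⟩
    · intro x hx
      simp only [Complex.mem_reProdIm, mem_Icc]
      constructor
      · rintro ⟨-, h⟩; exact ⟨⟨by linarith, by linarith⟩, h⟩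
      · rintro ⟨-, h⟩; exact ⟨⟨by linarith, by linarith⟩, h⟩
    · apply Convex.isPreconnected
      apply Convex.inter <;> exact convex_rect _ _ _ _
  · intro x0
    obtain ⟨ε, hε, w, hw⟩ := strip x0
    exact ⟨ε, hε, fun a b h1 _ h2 => ⟨w, fun x hx => hw x
      ⟨⟨by linarith [hx.1.1], by linarith [hx.1.2]⟩, hx.2⟩⟩⟩

end NPG

namespace NPG
open Set Filter Topology

/-- `r` is a continuous square root of `q` near `x` -/
def IsSq (q : ℂ → ℂ) (x : ℂ) (r : ℂ → ℂ) : Prop := ∀ᶠ y in 𝓝 x, ContinuousAt r y ∧ r y ^ 2 = q y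

lemma pm_tendsto {X : Type*} {l : Filter X} [l.NeBot] {u : X → ℂ} {L : ℂ} (h : Tendsto u l (𝓝 L))
    (h2 : ∀ᶠ y in l, u y ^ 2 = 1) : L ^ 2 = 1 ∧ ∀ᶠ y in l, u y = L := by
  have hL : L ^ 2 = 1 := by
    have h3 : Tendsto (fun y => u y ^ 2) l (𝓝 (L ^ 2)) := h.pow 2
    have h4 : Tendsto (fun y => u y ^ 2) l (𝓝 1) :=
      tendsto_const_nhds.congr' (h2.mono fun y hy => hy.symm)
    exact tendsto_nhds_unique h3 h4
  refine ⟨hL, ?_⟩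
  have hne : L ≠ -L := by
    intro h; have : L = 0 := by linear_combination h / 2
    rw [this] at hL; norm_num at hL
  filter_upwards [h2, h.eventually_ne hne] with y h1 h3
  have : (u y - L) * (u y + L) = 0 := by linear_combination h1 - hL
  rcases mul_eq_zero.1 this with h | h
  · linear_combination h
  · exact absurd (by linear_combination h) h3

lemma IsSq.exists {q : ℂ → ℂ} {x : ℂ} (hq : ∀ᶠ y in 𝓝 x, ContinuousAt q y) (h0 : q x ≠ 0) {L : ℂ}
    (hL : L ^ 2 = q x) : ∃ r, IsSq q x r ∧ r x = L := by
  refine ⟨fun y => L * Complex.exp (Complex.log (q y / q x) / 2), ?_, by simp [h0]⟩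
  have hc : ContinuousAt (fun y => q y / q x) x := hq.self_of_nhds.div_const _
  have hs : ∀ᶠ y in 𝓝 x, q y / q x ∈ Complex.slitPlane := by
    apply hc.eventually_mem
    apply Complex.isOpen_slitPlane.mem_nhds
    simp [div_self h0]
  filter_upwards [hq, hs] with y h1 h2
  refine ⟨?_, ?_⟩
  · have : ContinuousAt (fun y => Complex.log (q y / q x)) y := (h1.div_const _).clog h2
    fun_prop
  · rw [mul_pow, ← Complex.exp_nat_mul, hL]
    push_cast
    rw [mul_div_cancel₀ _ two_ne_zero, Complex.exp_log (Complex.slitPlane_ne_zero h2)]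
    field_simp

lemma IsSq.exists' {q : ℂ → ℂ} {x : ℂ} (hq : ∀ᶠ y in 𝓝 x, ContinuousAt q y) (h0 : q x ≠ 0) :
    ∃ r, IsSq q x r := by
  obtain ⟨r, h, -⟩ := IsSq.exists hq h0 (L := Complex.exp (Complex.log (q x) / 2)) (by
    rw [← Complex.exp_nat_mul]
    push_cast
    rw [mul_div_cancel₀ _ two_ne_zero, Complex.exp_log h0])
  exact ⟨r, h⟩

lemma IsSq.ne_zero {q : ℂ → ℂ} {x : ℂ} {r : ℂ → ℂ} (h : IsSq q x r) (h0 : q x ≠ 0) :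
    ∀ᶠ y in 𝓝 x, r y ≠ 0 := by
  refine h.self_of_nhds.1.eventually_ne ?_
  intro h1
  have := h.self_of_nhds.2
  rw [h1] at this
  exact h0 (by simpa using this.symm)

lemma IsSq.ev {q : ℂ → ℂ} {x : ℂ} {r : ℂ → ℂ} (h : IsSq q x r) : ∀ᶠ y in 𝓝 x, IsSq q y r :=
  eventually_eventually_nhds.2 h

lemma IsSq.uniq {q : ℂ → ℂ} {x : ℂ} {r r' : ℂ → ℂ} (h : IsSq q x r) (h' : IsSq q x r')
    (h0 : q x ≠ 0) : (∀ᶠ y in 𝓝 x, r y = r' y) ∨ (∀ᶠ y in 𝓝 x, r y = - r' y) := by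
  have hn := h'.ne_zero h0
  have ht : Tendsto (fun y => r y / r' y) (𝓝 x) (𝓝 (r x / r' x)) :=
    h.self_of_nhds.1.div h'.self_of_nhds.1 hn.self_of_nhds
  have h2 : ∀ᶠ y in 𝓝 x, (r y / r' y) ^ 2 = 1 := by
    filter_upwards [h, h', hn] with y h1 h2 h3
    rw [div_pow, h1.2, ← h2.2, div_self (pow_ne_zero _ h3)]
  obtain ⟨h3, h4⟩ := pm_tendsto ht h2
  rcases mul_self_eq_one_iff.1 ((sq _).symm.trans h3) with h5 | h5
  · left
    filter_upwards [h4, hn] with y h1 h2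
    rw [h5, div_eq_one_iff_eq h2] at h1; exact h1
  · right
    filter_upwards [h4, hn] with y h1 h2
    rw [h5, div_eq_iff h2] at h1; rw [h1]; ring

lemma dense_compl_arc {A : ℝ → ℂ} (hA : Continuous A) (hi : InjOn A (Icc 0 1)) :
    Dense (A '' Icc 0 1)ᶜ := interior_eq_empty_iff_dense_compl.1 (interior_arc hA hi)

/-- the square root of `(z-a)/(z-b)` does not extend across an interior point of the arc -/
lemma no_ext_sqrt {A : ℝ → ℂ} (hA : Continuous A) (hi : InjOn A (Icc 0 1)) {s : ℂ → ℂ}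
    (hs : ContinuousOn s (A '' Icc 0 1)ᶜ)
    (hs2 : ∀ z ∉ A '' Icc 0 1, s z ^ 2 = (z - A 0) / (z - A 1)) {t : ℝ} (ht : t ∈ Ioo (0:ℝ) 1)
    {L : ℂ} (hL : Tendsto s (𝓝[(A '' Icc 0 1)ᶜ] (A t)) (𝓝 L)) : False := by
  set Y := A '' Icc 0 1 with hY
  have hd : Dense Yᶜ := dense_compl_arc hA hi
  have hYc : IsClosed Y := isClosed_arc hA 0 1
  have hnb : ∀ x, (𝓝[Yᶜ] x).NeBot := fun x => mem_closure_iff_nhdsWithin_neBot.1 (hd x)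
  let J := A '' Icc 0 t
  have hJc : IsClosed J := isClosed_arc hA 0 t
  have hJY : J ⊆ Y := image_mono (Icc_subset_Icc le_rfl ht.2.le)
  have haJ : A 0 ∈ J := ⟨0, ⟨le_rfl, ht.1.le⟩, rfl⟩
  have hbJ : A 1 ∉ J := by
    rintro ⟨u, hu, e⟩
    have := hi ⟨hu.1, by linarith [hu.2, ht.2]⟩ ⟨zero_le_one, le_rfl⟩ e
    linarith [hu.2, ht.2]
  have hxJ : A t ∈ J := ⟨t, ⟨ht.1.le, le_rfl⟩, rfl⟩
  have hcs : ∀ y ∉ Y, ContinuousAt s y := fun y hy => hs.continuousAt (hYc.isOpen_compl.mem_nhds hy)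
  have hs0 : ∀ y ∉ Y, s y ≠ 0 := by
    intro y hy h0
    have := hs2 y hy
    rw [h0] at this
    have h1 : y - A 0 ≠ 0 := fun h => hy ⟨0, by simp, (sub_eq_zero.1 h).symm⟩
    have h2 : y - A 1 ≠ 0 := fun h => hy ⟨1, by simp, (sub_eq_zero.1 h).symm⟩
    exact div_ne_zero h1 h2 (by simpa using this.symm)
  have evY : ∀ x, ∀ᶠ y in 𝓝[Yᶜ] x, y ∉ Y := fun x => self_mem_nhdsWithin
  -- local extension
  have hxa : A t - A 0 ≠ 0 := fun h => by
    have := hi ⟨ht.1.le, ht.2.le⟩ ⟨le_rfl, zero_le_one⟩ (sub_eq_zero.1 h)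
    linarith [ht.1]
  have hxb : A t - A 1 ≠ 0 := fun h => hbJ (sub_eq_zero.1 h ▸ hxJ)
  let q : ℂ → ℂ := fun z => (z - A 0) / (z - A 1)
  have hqc : ∀ᶠ y in 𝓝 (A t), ContinuousAt q y := by
    have : ∀ᶠ y in 𝓝 (A t), y - A 1 ≠ 0 :=
      (ContinuousAt.eventually_ne (g := fun y => y - A 1) (by fun_prop) hxb)
    filter_upwards [this] with y hy
    exact ContinuousAt.div (by fun_prop) (by fun_prop) hy
  have hqL : L ^ 2 = q (A t) := by
    have h1 : Tendsto (fun y => s y ^ 2) (𝓝[Yᶜ] (A t)) (𝓝 (L ^ 2)) := hL.pow 2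
    have h2 : Tendsto q (𝓝[Yᶜ] (A t)) (𝓝 (q (A t))) := hqc.self_of_nhds.mono_left nhdsWithin_le_nhds
    exact tendsto_nhds_unique (h1.congr' ((evY _).mono fun y hy => hs2 y hy)) h2
  have hq0 : q (A t) ≠ 0 := div_ne_zero hxa hxb
  obtain ⟨r0, hr0, hr0L⟩ := IsSq.exists hqc hq0 hqL
  have hL0 : L ≠ 0 := by rintro rfl; exact hq0 (by simpa using hqL.symm)
  have hext : ∀ᶠ y in 𝓝[Yᶜ] (A t), s y = r0 y := by
    have h1 : Tendsto (fun y => s y / r0 y) (𝓝[Yᶜ] (A t)) (𝓝 (L / L)) := by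
      apply hL.div _ hL0
      have := hr0.self_of_nhds.1.tendsto
      rw [hr0L] at this
      exact this.mono_left nhdsWithin_le_nhds
    have hn := (hr0.ne_zero hq0)
    have h2 : ∀ᶠ y in 𝓝[Yᶜ] (A t), (s y / r0 y) ^ 2 = 1 := by
      filter_upwards [evY _, mem_nhdsWithin_of_mem_nhds hr0, mem_nhdsWithin_of_mem_nhds hn] with y h1 h2 h3
      rw [div_pow, hs2 y h1, h2.2]
      have := pow_ne_zero 2 h3
      rw [h2.2] at this
      exact div_self this
    obtain ⟨-, h3⟩ := pm_tendsto h1 h2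
    filter_upwards [h3, mem_nhdsWithin_of_mem_nhds hn] with y h1 h2
    rw [div_self hL0, div_eq_one_iff_eq h2] at h1
    exact h1
  let qa : ℂ → ℂ := fun z => z - A 0
  let qb : ℂ → ℂ := fun z => z - A 1
  have hqa : ∀ x, ∀ᶠ y in 𝓝 x, ContinuousAt qa y := fun x => Eventually.of_forall fun y => by
    simp only [qa]; fun_prop
  have hqb : ∀ x, ∀ᶠ y in 𝓝 x, ContinuousAt qb y := fun x => Eventually.of_forall fun y => by
    simp only [qb]; fun_prop
  have qa0 : ∀ x ∉ J, qa x ≠ 0 := fun x hx h => hx (by rw [sub_eq_zero.1 h]; exact haJ)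
  have qb0 : ∀ x ∈ J, qb x ≠ 0 := fun x hx h => hbJ (by rw [← sub_eq_zero.1 h]; exact hx)
  let P : ℂ → (ℂ → ℂ) → Prop := fun x w =>
    (x ∈ J → ∃ r, IsSq qb x r ∧ ∀ᶠ y in 𝓝[Yᶜ] x, w y = s y * r y) ∧
    (x ∉ J → ∃ r, IsSq qa x r ∧ ∀ᶠ y in 𝓝[Yᶜ] x, w y = r y)
  have hneg : ∀ (q : ℂ → ℂ) x r, IsSq q x r → IsSq q x (fun y => - r y) := by
    intro q x r h
    filter_upwards [h] with y hy
    exact ⟨hy.1.neg, by rw [neg_sq, hy.2]⟩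
  have hP : Tors Y P := by
    constructor
    · rintro x w w' ⟨h1, h2⟩ he
      refine ⟨fun hx => ?_, fun hx => ?_⟩
      · obtain ⟨r, hr, h⟩ := h1 hx
        exact ⟨r, hr, by filter_upwards [h, he] with y a b; rw [← b, a]⟩
      · obtain ⟨r, hr, h⟩ := h2 hx
        exact ⟨r, hr, by filter_upwards [h, he] with y a b; rw [← b, a]⟩
    · rintro x w w' ⟨h1, h2⟩ ⟨h1', h2'⟩
      by_cases hx : x ∈ J
      · obtain ⟨r, hr, h⟩ := h1 hx
        obtain ⟨r', hr', h'⟩ := h1' hx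
        rcases hr.uniq hr' (qb0 x hx) with e | e
        · left
          filter_upwards [h, h', mem_nhdsWithin_of_mem_nhds e] with y a b c
          rw [a, b, c]
        · right
          filter_upwards [h, h', mem_nhdsWithin_of_mem_nhds e] with y a b c
          rw [a, b, c]; ring
      · obtain ⟨r, hr, h⟩ := h2 hx
        obtain ⟨r', hr', h'⟩ := h2' hx
        rcases hr.uniq hr' (qa0 x hx) with e | e
        · left
          filter_upwards [h, h', mem_nhdsWithin_of_mem_nhds e] with y a b c
          rw [a, b, c]
        · right
          filter_upwards [h, h', mem_nhdsWithin_of_mem_nhds e] with y a b c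
          rw [a, b, c]
    · rintro x w ⟨h1, h2⟩
      refine ⟨fun hx => ?_, fun hx => ?_⟩
      · obtain ⟨r, hr, h⟩ := h1 hx
        exact ⟨_, hneg _ _ _ hr, by filter_upwards [h] with y a; rw [a]; ring⟩
      · obtain ⟨r, hr, h⟩ := h2 hx
        exact ⟨_, hneg _ _ _ hr, by filter_upwards [h] with y a; rw [a]⟩
    · intro x
      by_cases hx : x ∈ J
      · obtain ⟨r, hr⟩ := IsSq.exists' (hqb x) (qb0 x hx)
        refine ⟨fun y => s y * r y, ?_⟩
        by_cases hxt : x = A t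
        · subst hxt
          have he : ∀ᶠ y in 𝓝 (A t), ∀ᶠ z in 𝓝[Yᶜ] y, s z = r0 z :=
            (isOpen_evEq Y _).mem_nhds hext
          have hb : ∀ᶠ y in 𝓝 (A t), qb y ≠ 0 :=
            (hqb (A t)).self_of_nhds.eventually_ne (qb0 _ hx)
          have hsq : ∀ᶠ y in 𝓝 (A t), IsSq qa y (fun z => r0 z * r z) := by
            rw [← eventually_eventually_nhds] at hb
            filter_upwards [hr0.ev, hr.ev, hb] with y h1 h2 h3
            filter_upwards [h1, h2, h3] with z a b c
            refine ⟨a.1.mul b.1, ?_⟩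
            rw [mul_pow, a.2, b.2]
            exact div_mul_cancel₀ _ c
          filter_upwards [he, hr.ev, hsq] with y h1 h2 h3
          refine ⟨fun hy => ⟨r, h2, Eventually.of_forall fun _ => rfl⟩, fun hy => ?_⟩
          exact ⟨_, h3, by filter_upwards [h1] with z hz; rw [hz]⟩
        · have hJ2 : ∀ᶠ y in 𝓝 x, y ∉ A '' Icc t 1 := by
            apply (isClosed_arc hA t 1).isOpen_compl.mem_nhds
            rintro ⟨v, hv, e⟩
            obtain ⟨u, hu, e'⟩ := hx
            have := hi ⟨hu.1, by linarith [hu.2, ht.2]⟩ ⟨by linarith [hv.1, ht.1], hv.2⟩ (e'.trans e.symm)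
            have h3 : u = t := le_antisymm hu.2 (this ▸ hv.1)
            exact hxt (by rw [← e', h3])
          filter_upwards [hJ2, hr.ev] with y h1 h2
          refine ⟨fun hy => ⟨r, h2, Eventually.of_forall fun _ => rfl⟩, fun hy => ?_⟩
          have hyY : y ∉ Y := by
            rintro ⟨u, hu, e⟩
            rcases le_total u t with h | h
            · exact hy ⟨u, ⟨hu.1, h⟩, e⟩
            · exact h1 ⟨u, ⟨h, hu.2⟩, e⟩
          refine ⟨_, ?_, Eventually.of_forall fun _ => rfl⟩
          filter_upwards [h2, hYc.isOpen_compl.mem_nhds hyY] with z a b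
          refine ⟨(hcs z b).mul a.1, ?_⟩
          rw [mul_pow, hs2 z b, a.2]
          exact div_mul_cancel₀ _ (fun h => b ⟨1, by simp, (sub_eq_zero.1 h).symm⟩)
      · obtain ⟨r, hr⟩ := IsSq.exists' (hqa x) (qa0 x hx)
        refine ⟨r, ?_⟩
        filter_upwards [hr.ev, hJc.isOpen_compl.mem_nhds hx] with y h1 h2
        exact ⟨fun h => absurd h h2, fun _ => ⟨r, h1, Eventually.of_forall fun _ => rfl⟩⟩
    · rintro x w ⟨h1, h2⟩
      by_cases hx : x ∈ J
      · obtain ⟨r, hr, h⟩ := h1 hx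
        filter_upwards [h, mem_nhdsWithin_of_mem_nhds (hr.ne_zero (qb0 x hx)), evY x] with y a b c
        rw [a]; exact mul_ne_zero (hs0 y c) b
      · obtain ⟨r, hr, h⟩ := h2 hx
        filter_upwards [h, mem_nhdsWithin_of_mem_nhds (hr.ne_zero (qa0 x hx))] with y a b
        rw [a]; exact b
  obtain ⟨R, hR0, hR⟩ := (isCompact_Icc.image hA : IsCompact Y).isBounded.subset_ball_lt 0 (A 0)
  obtain ⟨w, hw⟩ := hP.rect hd ((A 0).re - R) ((A 0).re + R) ((A 0).im - R) ((A 0).im + R)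
    (by linarith) (by linarith)
  have hsph : ∀ z ∈ Metric.sphere (A 0) R, z ∉ Y ∧ P z w := by
    intro z hz
    have hz' := mem_sphere_iff_norm.1 hz
    refine ⟨fun h => ?_, hw z ?_⟩
    · have := hR h
      rw [mem_ball_iff_norm] at this; linarith
    · have h1 := abs_le.1 ((Complex.abs_re_le_norm (z - A 0)).trans hz'.le)
      have h2 := abs_le.1 ((Complex.abs_im_le_norm (z - A 0)).trans hz'.le)
      simp only [Complex.sub_re, Complex.sub_im] at h1 h2
      exact ⟨⟨by linarith [h1.1], by linarith [h1.2]⟩, ⟨by linarith [h2.1], by linarith [h2.2]⟩⟩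
  have hev : ∀ z ∈ Metric.sphere (A 0) R, ContinuousAt w z ∧ w z ^ 2 = z - A 0 := by
    intro z hz
    obtain ⟨hzY, hz1, hz2⟩ := hsph z hz
    obtain ⟨r, hr, h⟩ := hz2 (fun h => hzY (hJY h))
    rw [hYc.isOpen_compl.nhdsWithin_eq hzY] at h
    have hr := hr.self_of_nhds
    refine ⟨hr.1.congr (h.mono fun y hy => hy.symm), ?_⟩
    rw [h.self_of_nhds]; exact hr.2
  have := circle_dvd hR0 (w := w) (fun z hz => (hev z hz).1.continuousWithinAt) (m := 2) (n := 1)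
    two_pos (fun z hz => by rw [(hev z hz).2, zpow_one])
  norm_num at this

end NPG

namespace NPG
open Set Filter Topology

lemma arc_continuousOn {A : ℝ → ℂ} (hA : Continuous A) {a b : ℝ} (hi : InjOn A (Icc a b))
    {h : ℂ → ℂ} (hh : ContinuousOn (fun t => h (A t)) (Icc a b)) : ContinuousOn h (A '' Icc a b) := by
  let A' : Icc a b → ℂ := fun t => A t
  have hA' : IsClosedEmbedding A' := Continuous.isClosedEmbedding (by fun_prop)
    (fun s t h => Subtype.ext (hi s.2 t.2 h))
  have hr' : range A' = A '' Icc a b := by ext; simp [A']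
  rw [← hr', continuousOn_iff_continuous_domRestrict]
  let e := hA'.isEmbedding.toHomeomorph
  have : (range A').domRestrict h = (fun t : Icc a b => h (A t)) ∘ e.symm := by
    ext z
    obtain ⟨t, rfl⟩ := e.surjective z
    simp only [Function.comp, e.symm_apply_apply]
    rfl
  rw [this]
  exact (continuousOn_iff_continuous_domRestrict.1 hh).comp e.symm.continuous

lemma borsuk_core {V1 V2 V3 Y : Set ℂ} {x : ℂ} {δ : ℝ} (h1 : IsOpen V1) (h2 : IsOpen V2)
    (h3 : IsOpen V3) (h12 : Disjoint V1 V2) (h13 : Disjoint V1 V3)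
    (hcov : Metric.ball x δ \ Y ⊆ V1 ∪ V2 ∪ V3) (hY : IsClosed Y)
    (hY1 : Disjoint V1 Y) {a1 a2 a3 : ℂ} (ha1 : a1 ∈ V1) (ha1b : a1 ∈ Metric.ball x δ)
    (ha2 : a2 ∈ V2) (ha3 : a3 ∈ V3) {G : ℂ → ℂ}
    (hG : ContinuousOn G (Metric.sphere x δ ∪ Y)) {n1 n2 : ℤ}
    (hGe : ∀ z ∈ Metric.sphere x δ ∪ Y, z ≠ a3 → z ≠ a2 →
      Complex.exp (G z) = ((z - a1) / (z - a3)) ^ n1 * ((z - a2) / (z - a3)) ^ n2) : n1 = 0 := by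
  classical
  set K := Metric.sphere x δ ∪ Y
  have hK : IsClosed K := Metric.isClosed_sphere.union hY
  obtain ⟨G', hG'⟩ := ContinuousMap.exists_restrict_eq hK
    (⟨K.domRestrict G, continuousOn_iff_continuous_domRestrict.1 hG⟩ : C(K, ℂ))
  have hGG : ∀ z ∈ K, G' z = G z := fun z hz => congrArg (fun f : C(K, ℂ) => f ⟨z, hz⟩) hG'
  set D := V1 ∩ Metric.ball x δ
  have hD : IsOpen D := h1.inter Metric.isOpen_ball
  have hn2 : a2 ∉ closure D := fun h => by
    obtain ⟨y, hy, hy'⟩ := mem_closure_iff.1 h V2 h2 ha2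
    exact disjoint_left.1 h12 hy'.1 hy
  have hn3 : a3 ∉ closure D := fun h => by
    obtain ⟨y, hy, hy'⟩ := mem_closure_iff.1 h V3 h3 ha3
    exact disjoint_left.1 h13 hy'.1 hy
  have hfr : frontier D ⊆ K := by
    rintro y ⟨hy, hy'⟩
    rw [hD.interior_eq] at hy'
    have hyb : y ∈ Metric.closedBall x δ :=
      Metric.closure_ball_subset_closedBall (closure_mono inter_subset_right hy)
    rcases (Metric.mem_closedBall.1 hyb).lt_or_eq with h | h
    · by_cases hyY : y ∈ Y
      · exact Or.inr hyY
      · rcases hcov ⟨h, hyY⟩ with (h' | h') | h'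
        · exact absurd ⟨h', h⟩ hy'
        · obtain ⟨z, hz, hz'⟩ := mem_closure_iff.1 hy V2 h2 h'
          exact absurd hz (disjoint_left.1 h12 hz'.1)
        · obtain ⟨z, hz, hz'⟩ := mem_closure_iff.1 hy V3 h3 h'
          exact absurd hz (disjoint_left.1 h13 hz'.1)
    · exact Or.inl h
  let f1 : ℂ → ℂ := fun z => Complex.exp (G' z) * ((z - a3) / (z - a2)) ^ n2 * (z - a3) ^ n1
  let f2 : ℂ → ℂ := fun z => (z - a1) ^ n1
  have hsub : ∀ {z w : ℂ}, z ≠ w → z - w ≠ 0 := fun h => sub_ne_zero.2 h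
  have hne2 : ∀ z ∈ closure D, z ≠ a2 := fun z hz h => hn2 (h ▸ hz)
  have hne3 : ∀ z ∈ closure D, z ≠ a3 := fun z hz h => hn3 (h ▸ hz)
  have ha1D : a1 ∈ D := ⟨ha1, ha1b⟩
  have hne1 : ∀ z ∉ D, z ≠ a1 := fun z hz h => hz (h ▸ ha1D)
  have hFc : Continuous (D.piecewise f1 f2) := by
    apply continuous_piecewise
    · intro z hz
      have hzc := frontier_subset_closure hz
      have z2 := hsub (hne2 z hzc)
      have z3 := hsub (hne3 z hzc)
      have hzK := hfr hz
      simp only [f1, f2]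
      rw [hGG z hzK, hGe z hzK (hne3 z hzc) (hne2 z hzc), mul_assoc, mul_assoc,
        ← mul_assoc (((z - a2) / (z - a3)) ^ n2), ← mul_zpow, div_mul_div_cancel₀ z3, div_self z2,
        one_zpow, one_mul, ← mul_zpow, div_mul_cancel₀ _ z3]
    · intro z hz
      have z2 := hsub (hne2 z hz)
      have z3 := hsub (hne3 z hz)
      apply ContinuousAt.continuousWithinAt
      refine ContinuousAt.mul (ContinuousAt.mul (by fun_prop) ?_) ?_
      · have hd : ContinuousAt (fun z => (z - a3) / (z - a2)) z :=
          ContinuousAt.div (by fun_prop) (by fun_prop) z2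
        exact ContinuousAt.zpow₀ hd _ (Or.inl (div_ne_zero z3 z2))
      · exact ContinuousAt.zpow₀ (by fun_prop) _ (Or.inl z3)
    · intro z hz
      rw [hD.isClosed_compl.closure_eq] at hz
      apply ContinuousAt.continuousWithinAt
      exact ContinuousAt.zpow₀ (by fun_prop) _ (Or.inl (hsub (hne1 z hz)))
  have hF0 : ∀ z, D.piecewise f1 f2 z ≠ 0 := by
    intro z
    by_cases hz : z ∈ D
    · rw [piecewise_eq_of_mem _ _ _ hz]
      have z2 := hsub (hne2 z (subset_closure hz))
      have z3 := hsub (hne3 z (subset_closure hz))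
      exact mul_ne_zero (mul_ne_zero (Complex.exp_ne_zero _) (zpow_ne_zero _ (div_ne_zero z3 z2)))
        (zpow_ne_zero _ z3)
    · rw [piecewise_eq_of_notMem _ _ _ hz]
      exact zpow_ne_zero _ (hsub (hne1 z hz))
  refine no_ext hFc hF0 (a := a1) (R := δ + δ) ?_
  intro z hz
  apply piecewise_eq_of_notMem
  rintro ⟨-, hz'⟩
  rw [mem_ball_iff_norm] at hz' ha1b
  have : ‖z - a1‖ ≤ ‖z - x‖ + ‖x - a1‖ := by
    have := norm_add_le (z - x) (x - a1); simpa using this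
  rw [norm_sub_rev x a1] at this
  linarith

/-- at most two sides of an arc -/
lemma two_sides {A : ℝ → ℂ} (hA : Continuous A) (hi : InjOn A (Icc 0 1)) {τ : ℝ}
    (hτ : τ ∈ Ioo (0:ℝ) 1) {V1 V2 V3 : Set ℂ} (h1 : IsOpen V1) (h2 : IsOpen V2)
    (h3 : IsOpen V3) (h12 : Disjoint V1 V2) (h13 : Disjoint V1 V3) (h23 : Disjoint V2 V3)
    (hY1 : Disjoint V1 (A '' Icc 0 1)) (hY2 : Disjoint V2 (A '' Icc 0 1))
    (hY3 : Disjoint V3 (A '' Icc 0 1))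
    {δ : ℝ} (hδ : 0 < δ) (hcov : Metric.ball (A τ) δ \ (A '' Icc 0 1) ⊆ V1 ∪ V2 ∪ V3)
    (c1 : A τ ∈ closure V1) (c2 : A τ ∈ closure V2) (c3 : A τ ∈ closure V3) : False := by
  classical
  set x := A τ with hx
  set Y := A '' Icc 0 1 with hY
  have hYc : IsClosed Y := isClosed_arc hA 0 1
  -- small subarc
  obtain ⟨η, hη, hηb⟩ := Metric.continuousAt_iff.1 (hA.continuousAt (x := τ)) δ hδ
  obtain ⟨η', hη', h0, h01⟩ : ∃ η' > 0, η' < η ∧ (0 ≤ τ - η' ∧ τ + η' ≤ 1) := by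
    refine ⟨min (η / 2) (min τ (1 - τ)), ?_, ?_, ?_, ?_⟩
    · exact lt_min (by linarith) (lt_min hτ.1 (by linarith [hτ.2]))
    · exact (min_le_left _ _).trans_lt (by linarith)
    · have := (min_le_right (η / 2) (min τ (1 - τ))).trans (min_le_left _ _); linarith
    · have := (min_le_right (η / 2) (min τ (1 - τ))).trans (min_le_right _ _); linarith
  set t1 := τ - η'
  set t2 := τ + η'
  have ht12 : t1 ≤ t2 := by simp only [t1, t2]; linarith
  have hA2 : ∀ t ∈ Icc t1 t2, dist (A t) x < δ := by
    intro t ht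
    apply hηb
    rw [Real.dist_eq, abs_lt]
    simp only [t1, t2] at ht
    constructor <;> linarith [ht.1, ht.2]
  have hsubI : Icc t1 t2 ⊆ Icc 0 1 := Icc_subset_Icc h01.1 h01.2
  set rest := Metric.sphere x δ ∪ (A '' Icc 0 t1 ∪ A '' Icc t2 1) with hrest
  have hrc : IsClosed rest := Metric.isClosed_sphere.union ((isClosed_arc hA _ _).union (isClosed_arc hA _ _))
  have hxr : x ∉ rest := by
    rintro (h | ⟨t, ht, h⟩ | ⟨t, ht, h⟩)
    · simp at h; exact hδ.ne h
    · have := hi ⟨ht.1, by linarith [ht.2, h01.2, ht12]⟩ ⟨hτ.1.le, hτ.2.le⟩ h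
      simp only [t1] at ht; linarith [ht.2]
    · have := hi ⟨by linarith [ht.1, h01.1, ht12], ht.2⟩ ⟨hτ.1.le, hτ.2.le⟩ h
      simp only [t2] at ht; linarith [ht.1]
  obtain ⟨ρ, hρ, hρb⟩ := Metric.isOpen_iff.1 hrc.isOpen_compl x hxr
  have hρd : ∀ z ∈ rest, ρ ≤ dist z x := by
    intro z hz
    by_contra h
    exact hρb (not_le.1 h) hz
  have pick : ∀ V : Set ℂ, x ∈ closure V → ∃ a ∈ V, dist a x < min (ρ / 4) δ := by
    intro V hV
    obtain ⟨a, ha, h⟩ := Metric.mem_closure_iff.1 hV _ (lt_min (by linarith : 0 < ρ / 4) hδ)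
    exact ⟨a, ha, by rwa [dist_comm]⟩
  obtain ⟨a1, ha1, hd1⟩ := pick V1 c1
  obtain ⟨a2, ha2, hd2⟩ := pick V2 c2
  obtain ⟨a3, ha3, hd3⟩ := pick V3 c3
  have hK : Metric.sphere x δ ∪ Y = rest ∪ A '' Icc t1 t2 := by
    have : Y = A '' Icc 0 t1 ∪ A '' Icc t2 1 ∪ A '' Icc t1 t2 := by
      rw [hY, ← Icc_union_Icc_eq_Icc h01.1 (ht12.trans h01.2), ← Icc_union_Icc_eq_Icc ht12 h01.2,
        image_union, image_union, union_comm (A '' Icc t1 t2), union_assoc]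
    rw [this, hrest]; simp only [union_assoc]
  -- logs
  have hnY : ∀ a : ℂ, ∀ V : Set ℂ, a ∈ V → Disjoint V Y → ∀ t ∈ Icc (0:ℝ) 1, A t - a ≠ 0 := by
    intro a V ha hd t ht h
    exact disjoint_left.1 hd ha ⟨t, ht, sub_eq_zero.1 h⟩
  have hlog : ∀ a : ℂ, dist a x < min (ρ / 4) δ → (∀ t ∈ Icc (0:ℝ) 1, A t - a ≠ 0) →
      ∃ l : ℝ → ℂ, ∃ m : ℤ, Continuous l ∧ (∀ t ∈ Icc t1 t2, Complex.exp (l t) = (A t - a) / (A t - a3)) ∧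
        l t1 = Complex.log ((A t1 - a) / (A t1 - a3)) ∧
        l t2 = Complex.log ((A t2 - a) / (A t2 - a3)) + m * (2 * Real.pi * Complex.I) := by
    intro a ha hna
    have hn3 := hnY a3 V3 ha3 hY3
    let p : ℝ → ℝ := fun t => (projIcc t1 t2 ht12 t : ℝ)
    have hp : Continuous p := continuous_subtype_val.comp continuous_projIcc
    have hpm : ∀ t, p t ∈ Icc (0:ℝ) 1 := fun t => hsubI (projIcc t1 t2 ht12 t).2
    have hpe : ∀ t ∈ Icc t1 t2, p t = t := fun t ht => by simp only [p]; rw [projIcc_of_mem ht12 ht]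
    obtain ⟨l, hl, hle⟩ := exists_clog (fun t => (A (p t) - a) / (A (p t) - a3))
      (Continuous.div (by fun_prop) (by fun_prop) (fun t => hn3 _ (hpm t)))
      (fun t => div_ne_zero (hna _ (hpm t)) (hn3 _ (hpm t)))
    have hle' : ∀ t ∈ Icc t1 t2, Complex.exp (l t) = (A t - a) / (A t - a3) := by
      intro t ht; rw [hle, hpe t ht]
    have m1 : t1 ∈ Icc t1 t2 := ⟨le_rfl, ht12⟩
    have m2 : t2 ∈ Icc t1 t2 := ⟨ht12, le_rfl⟩
    let k := l t1 - Complex.log ((A t1 - a) / (A t1 - a3))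
    have hk : Complex.exp k = 1 := by
      simp only [k]
      have h0 := div_ne_zero (hna _ (hsubI m1)) (hn3 _ (hsubI m1))
      rw [Complex.exp_sub, hle' _ m1, Complex.exp_log h0, div_self h0]
    have hk2 : Complex.exp (l t2 - k) = Complex.exp (Complex.log ((A t2 - a) / (A t2 - a3))) := by
      have h0 := div_ne_zero (hna _ (hsubI m2)) (hn3 _ (hsubI m2))
      rw [Complex.exp_sub, hk, hle' _ m2, Complex.exp_log h0, div_one]
    obtain ⟨m, hm⟩ := Complex.exp_eq_exp_iff_exists_int.1 hk2
    refine ⟨fun t => l t - k, m, by fun_prop, ?_, by simp [k], hm⟩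
    intro t ht
    rw [Complex.exp_sub, hk, hle' t ht, div_one]
  obtain ⟨l1, m1, hl1, hl1e, hl11, hl12⟩ := hlog a1 hd1 (hnY a1 V1 ha1 hY1)
  obtain ⟨l2, m2, hl2, hl2e, hl21, hl22⟩ := hlog a2 hd2 (hnY a2 V2 ha2 hY2)
  -- log on rest
  have hslit : ∀ a : ℂ, dist a x < min (ρ / 4) δ → ∀ z ∈ rest, z - a ≠ 0 ∧ z - a3 ≠ 0 ∧
      (z - a) / (z - a3) ∈ Complex.slitPlane := by
    intro a ha z hz
    have hz' := hρd z hz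
    have ha' := ha.trans_le (min_le_left _ _)
    have ha3' := hd3.trans_le (min_le_left _ _)
    rw [dist_eq_norm] at hz' ha' ha3'
    have e1 : ρ ≤ ‖z - a‖ + ‖a - x‖ := hz'.trans (by simpa using norm_add_le (z - a) (a - x))
    have e2 : ρ ≤ ‖z - a3‖ + ‖a3 - x‖ := hz'.trans (by simpa using norm_add_le (z - a3) (a3 - x))
    have n1 : z - a ≠ 0 := by rw [← norm_pos_iff]; linarith
    have n3 : z - a3 ≠ 0 := by rw [← norm_pos_iff]; linarith
    refine ⟨n1, n3, ?_⟩
    apply Complex.ball_one_subset_slitPlane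
    rw [mem_ball_iff_norm, div_sub_one n3, norm_div, div_lt_one (norm_pos_iff.2 n3)]
    have : ‖z - a - (z - a3)‖ ≤ ‖a3 - x‖ + ‖a - x‖ := by
      have := norm_sub_le (a3 - x) (a - x)
      rw [show z - a - (z - a3) = a3 - x - (a - x) by ring]; exact this
    linarith
  have hcore : ∀ n1 n2 : ℤ, n1 * m1 + n2 * m2 = 0 → ∃ G : ℂ → ℂ,
      ContinuousOn G (Metric.sphere x δ ∪ Y) ∧ ∀ z ∈ Metric.sphere x δ ∪ Y,
      Complex.exp (G z) = ((z - a1) / (z - a3)) ^ n1 * ((z - a2) / (z - a3)) ^ n2 := by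
    intro n1 n2 hn
    have hiA : InjOn A (Icc t1 t2) := hi.mono hsubI
    let g : ℂ → ℂ := fun z => n1 * Complex.log ((z - a1) / (z - a3)) + n2 * Complex.log ((z - a2) / (z - a3))
    let h : ℝ → ℂ := fun t => n1 * l1 t + n2 * l2 t
    let G : ℂ → ℂ := fun z => if z ∈ A '' Icc t1 t2 then h (Function.invFunOn A (Icc t1 t2) z) else g z
    have hinv : ∀ t ∈ Icc t1 t2, Function.invFunOn A (Icc t1 t2) (A t) = t := fun t ht =>
      hiA.leftInvOn_invFunOn ht
    have hGA : ∀ t ∈ Icc t1 t2, G (A t) = h t := by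
      intro t ht
      simp only [G]; rw [if_pos ⟨t, ht, rfl⟩, hinv t ht]
    have hGr : ∀ z ∈ rest, G z = g z := by
      intro z hz
      by_cases hzA : z ∈ A '' Icc t1 t2
      · obtain ⟨t, ht, rfl⟩ := hzA
        have ht' := hsubI ht
        rw [hGA t ht]
        have : t = t1 ∨ t = t2 := by
          rcases hz with h | ⟨u, hu, e⟩ | ⟨u, hu, e⟩
          · exact absurd (mem_sphere_iff_norm.1 h) (by
              have := hA2 t ht; rw [dist_eq_norm] at this; exact this.ne)
          · have := hi ⟨hu.1, by linarith [hu.2, ht.1, ht'.2]⟩ ht' e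
            left; exact le_antisymm (this ▸ hu.2) ht.1
          · have := hi ⟨by linarith [hu.1, ht.2, ht'.1], hu.2⟩ ht' e
            right; exact le_antisymm ht.2 (this ▸ hu.1)
        rcases this with rfl | rfl
        · simp only [h, g, hl11, hl21]
        · simp only [h, g, hl12, hl22]
          have hn' : (n1 : ℂ) * m1 + n2 * m2 = 0 := by exact_mod_cast hn
          linear_combination (2 * Real.pi * Complex.I) * hn'
      · simp only [G]; rw [if_neg hzA]
    refine ⟨G, ?_, ?_⟩
    · rw [hK]
      refine ContinuousOn.union_of_isClosed ?_ ?_ hrc (isClosed_arc hA _ _)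
      · refine ContinuousOn.congr ?_ hGr
        intro z hz
        obtain ⟨z1, z3, hs1⟩ := hslit a1 hd1 z hz
        obtain ⟨z2, -, hs2⟩ := hslit a2 hd2 z hz
        apply ContinuousAt.continuousWithinAt
        have e1 : ContinuousAt (fun z => Complex.log ((z - a1) / (z - a3))) z :=
          ContinuousAt.clog (ContinuousAt.div (by fun_prop) (by fun_prop) z3) hs1
        have e2 : ContinuousAt (fun z => Complex.log ((z - a2) / (z - a3))) z :=
          ContinuousAt.clog (ContinuousAt.div (by fun_prop) (by fun_prop) z3) hs2
        simp only [g]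
        fun_prop
      · apply arc_continuousOn hA hiA
        refine ContinuousOn.congr (f := h) (by simp only [h]; fun_prop) ?_
        intro t ht
        exact hGA t ht
    · intro z hz
      rw [hK] at hz
      rcases hz with hz | ⟨t, ht, rfl⟩
      · obtain ⟨z1, z3, hs1⟩ := hslit a1 hd1 z hz
        obtain ⟨z2, -, hs2⟩ := hslit a2 hd2 z hz
        rw [hGr z hz]
        simp only [g]
        rw [Complex.exp_add, Complex.exp_int_mul, Complex.exp_int_mul,
          Complex.exp_log (div_ne_zero z1 z3), Complex.exp_log (div_ne_zero z2 z3)]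
      · rw [hGA t ht]
        simp only [h]
        rw [Complex.exp_add, Complex.exp_int_mul, Complex.exp_int_mul, hl1e t ht, hl2e t ht]
  have hb1 : a1 ∈ Metric.ball x δ := hd1.trans_le (min_le_right _ _)
  have hb2 : a2 ∈ Metric.ball x δ := hd2.trans_le (min_le_right _ _)
  by_cases hm1 : m1 = 0
  · obtain ⟨G, hG, hGe⟩ := hcore 1 0 (by simp [hm1])
    have := borsuk_core h1 h2 h3 h12 h13 hcov hYc hY1 ha1 hb1 ha2 ha3 hG (n1 := 1) (n2 := 0)
      (fun z hz _ _ => hGe z hz)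
    exact one_ne_zero this
  · obtain ⟨G, hG, hGe⟩ := hcore m2 (-m1) (by ring)
    have := borsuk_core h2 h1 h3 h12.symm h23 (by rwa [union_comm V2 V1]) hYc hY2 ha2 hb2 ha1 ha3 hG
      (n1 := -m1) (n2 := m2) (fun z hz _ _ => by rw [hGe z hz, mul_comm])
    exact hm1 (by omega)

end NPG

namespace NPG
open Set Filter Topology

/-- `c` is a sign colouring of the complement of `Y` near `x` -/
def Col {X : Type*} [TopologicalSpace X] (Y : Set X) (x : X) (c : X → ℂ) : Prop :=
  ∀ᶠ y in 𝓝[Yᶜ] x, ContinuousAt c y ∧ c y ^ 2 = 1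

/-- the colouring is constant near `x` -/
def Triv {X : Type*} [TopologicalSpace X] (Y : Set X) (x : X) (c : X → ℂ) : Prop :=
  ∃ κ : ℂ, ∀ᶠ y in 𝓝[Yᶜ] x, c y = κ

section gen
variable {X : Type*} [TopologicalSpace X] {Y : Set X} {x : X} {c c' : X → ℂ}

lemma Col.ev (h : Col Y x c) : ∀ᶠ y in 𝓝 x, Col Y y c := (isOpen_evEq Y _).mem_nhds h

lemma Triv.ev (h : Triv Y x c) : ∀ᶠ y in 𝓝 x, Triv Y y c := by
  obtain ⟨κ, h⟩ := h
  filter_upwards [(isOpen_evEq Y _).mem_nhds h] with y hy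
  exact ⟨κ, hy⟩

lemma Col.mul (h : Col Y x c) (h' : Col Y x c') : Col Y x (fun y => c y * c' y) := by
  filter_upwards [h, h'] with y a b
  exact ⟨a.1.mul b.1, by rw [mul_pow, a.2, b.2, one_mul]⟩

lemma Triv.mul (h : Triv Y x c) (h' : Triv Y x c') : Triv Y x (fun y => c y * c' y) := by
  obtain ⟨κ, h⟩ := h
  obtain ⟨κ', h'⟩ := h'
  exact ⟨κ * κ', by filter_upwards [h, h'] with y a b; rw [a, b]⟩

lemma Triv.congr (h : Triv Y x c) (h' : ∀ᶠ y in 𝓝[Yᶜ] x, c y = c' y) : Triv Y x c' := by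
  obtain ⟨κ, h⟩ := h
  exact ⟨κ, by filter_upwards [h, h'] with y a b; rw [← b, a]⟩

lemma Triv.of_mul (h : Triv Y x c) (hc : Col Y x c) (h' : Triv Y x (fun y => c y * c' y)) :
    Triv Y x c' := by
  refine (h.mul h').congr ?_
  filter_upwards [hc] with y hy
  linear_combination (c' y) * hy.2

lemma Col.triv_of_tendsto [(𝓝[Yᶜ] x).NeBot] (hc : Col Y x c) {L : ℂ}
    (h : Tendsto c (𝓝[Yᶜ] x) (𝓝 L)) : Triv Y x c :=
  ⟨L, (pm_tendsto h (hc.mono fun _ h => h.2)).2⟩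

lemma Triv.tendsto (h : Triv Y x c) : ∃ L, Tendsto c (𝓝[Yᶜ] x) (𝓝 L) := by
  obtain ⟨κ, h⟩ := h
  exact ⟨κ, tendsto_const_nhds.congr' (h.mono fun _ h => h.symm)⟩

lemma Col.pm (hc : Col Y x c) : ∀ᶠ y in 𝓝[Yᶜ] x, c y = 1 ∨ c y = -1 := by
  filter_upwards [hc] with y hy
  exact mul_self_eq_one_iff.1 ((sq _).symm.trans hy.2)

lemma Col.freq (hc : Col Y x c) (h : ¬ Triv Y x c) :
    (∃ᶠ y in 𝓝[Yᶜ] x, c y = 1) ∧ (∃ᶠ y in 𝓝[Yᶜ] x, c y = -1) := by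
  constructor
  · intro h1
    exact h ⟨-1, by filter_upwards [hc.pm, h1] with y a b; exact a.resolve_left b⟩
  · intro h1
    exact h ⟨1, by filter_upwards [hc.pm, h1] with y a b; exact a.resolve_right b⟩

lemma Col.locconst (hc : Col Y x c) : ∀ᶠ y in 𝓝[Yᶜ] x, ∀ᶠ z in 𝓝[Yᶜ] y, c z = c y := by
  have h1 := hc.ev.filter_mono (nhdsWithin_le_nhds (s := Yᶜ))
  have h2 : ∀ᶠ y in 𝓝[Yᶜ] x, y ∈ Yᶜ := self_mem_nhdsWithin
  filter_upwards [h1, hc, h2] with y a b hy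
  have : (𝓝[Yᶜ] y).NeBot := mem_closure_iff_nhdsWithin_neBot.1 (subset_closure hy)
  exact (pm_tendsto (b.1.tendsto.mono_left nhdsWithin_le_nhds) (a.mono fun _ h => h.2)).2

end gen

lemma three_values {α : Type*} {A : ℝ → ℂ} (hA : Continuous A) (hi : InjOn A (Icc 0 1)) {τ : ℝ}
    (hτ : τ ∈ Ioo (0:ℝ) 1) {Y : Set ℂ} (hY : ∀ᶠ y in 𝓝 (A τ), y ∈ Y ↔ y ∈ A '' Icc 0 1)
    {k : ℂ → α} (hk : ∀ᶠ y in 𝓝[Yᶜ] (A τ), ∀ᶠ z in 𝓝[Yᶜ] y, k z = k y) {p q r : α}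
    (hpq : p ≠ q) (hpr : p ≠ r) (hqr : q ≠ r)
    (hp : ∃ᶠ y in 𝓝[Yᶜ] (A τ), k y = p) (hq : ∃ᶠ y in 𝓝[Yᶜ] (A τ), k y = q)
    (hr : ∃ᶠ y in 𝓝[Yᶜ] (A τ), k y = r) : False := by
  rw [eventually_nhdsWithin_iff] at hk
  obtain ⟨δ, hδ, hb⟩ := Metric.eventually_nhds_iff_ball.1 (hY.and hk)
  have hYc := isClosed_arc hA 0 1
  let D := Metric.ball (A τ) δ \ (A '' Icc 0 1)
  have hD : IsOpen D := Metric.isOpen_ball.sdiff hYc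
  have hDl : ∀ y ∈ D, ∀ᶠ z in 𝓝 y, k z = k y := by
    intro y hy
    have hy' := hb y hy.1
    have h1 := hy'.2 (fun h => hy.2 (hy'.1.1 h))
    have : Yᶜ ∈ 𝓝 y := by
      filter_upwards [hD.mem_nhds hy] with z hz hzY
      exact hz.2 ((hb z hz.1).1.1 hzY)
    rwa [nhdsWithin_eq_nhds.2 this] at h1
  have hO : ∀ Q : α → Prop, IsOpen (D ∩ {y | Q (k y)}) := by
    intro Q
    rw [isOpen_iff_mem_nhds]
    rintro y ⟨hy, hQ⟩
    filter_upwards [hD.mem_nhds hy, hDl y hy] with z h1 h2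
    refine ⟨h1, ?_⟩
    have hQ : Q (k y) := hQ
    show Q (k z)
    rwa [h2]
  have hcl : ∀ Q : α → Prop, (∃ᶠ y in 𝓝[Yᶜ] (A τ), Q (k y)) → A τ ∈ closure (D ∩ {y | Q (k y)}) := by
    intro Q hQ
    rw [frequently_nhdsWithin_iff] at hQ
    rw [mem_closure_iff_frequently]
    refine (hQ.and_eventually (Metric.ball_mem_nhds (A τ) hδ)).mono ?_
    rintro y ⟨⟨h1, h2⟩, h3⟩
    exact ⟨⟨h3, fun h => h2 ((hb y h3).1.2 h)⟩, h1⟩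
  have hdY : ∀ Q : α → Prop, Disjoint (D ∩ {y | Q (k y)}) (A '' Icc 0 1) := fun Q =>
    disjoint_left.2 fun y hy h => hy.1.2 h
  refine two_sides hA hi hτ (hO (· = p)) (hO (· = q)) (hO (fun a => a ≠ p ∧ a ≠ q)) ?_ ?_ ?_
    (hdY (· = p)) (hdY (· = q)) (hdY (fun a => a ≠ p ∧ a ≠ q)) hδ ?_ (hcl (· = p) hp) (hcl (· = q) hq) (hcl (fun a => a ≠ p ∧ a ≠ q) ?_)
  · rw [disjoint_left]; rintro y ⟨-, h1⟩ ⟨-, h2⟩; exact hpq (Eq.trans (Eq.symm h1) h2)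
  · rw [disjoint_left]; rintro y ⟨-, h1⟩ ⟨-, h2⟩; exact h2.1 h1
  · rw [disjoint_left]; rintro y ⟨-, h1⟩ ⟨-, h2⟩; exact h2.2 h1
  · intro y hy
    by_cases h1 : k y = p
    · exact Or.inl (Or.inl ⟨hy, h1⟩)
    · by_cases h2 : k y = q
      · exact Or.inl (Or.inr ⟨hy, h2⟩)
      · exact Or.inr ⟨hy, h1, h2⟩
  · exact hr.mono fun y hy => by rw [hy]; exact ⟨hpr.symm, hqr.symm⟩

lemma prop_aux {a b c d : Prop} (a1 : a ∨ b) (a2 : c ∨ d) (b1 : a ∨ c) (b2 : b ∨ d) (d1 : a ∨ d)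
    (d2 : b ∨ c) (k1 : a → b → c → False) (k2 : a → b → d → False) (k3 : a → c → d → False)
    (k4 : b → c → d → False) : False := by tauto

lemma pair_triv {A : ℝ → ℂ} (hA : Continuous A) (hi : InjOn A (Icc 0 1)) {τ : ℝ}
    (hτ : τ ∈ Ioo (0:ℝ) 1) {Y : Set ℂ} (hY : ∀ᶠ y in 𝓝 (A τ), y ∈ Y ↔ y ∈ A '' Icc 0 1)
    {c c' : ℂ → ℂ} (hc : Col Y (A τ) c) (hc' : Col Y (A τ) c') (h : ¬ Triv Y (A τ) c)
    (h' : ¬ Triv Y (A τ) c') : Triv Y (A τ) (fun y => c y * c' y) := by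
  by_contra h2
  have n1 : (1:ℂ) ≠ -1 := by norm_num
  have hk : ∀ᶠ y in 𝓝[Yᶜ] (A τ), ∀ᶠ z in 𝓝[Yᶜ] y, (c z, c' z) = (c y, c' y) := by
    filter_upwards [hc.locconst, hc'.locconst] with y a b
    filter_upwards [a, b] with z h1 h2
    rw [h1, h2]
  have key := fun p q r hpq hpr hqr => three_values (k := fun y => (c y, c' y)) (p := p) (q := q)
    (r := r) hA hi hτ hY hk hpq hpr hqr
  have pm := hc.pm.and hc'.pm
  have fr : ∀ (d : ℂ → ℂ) (u : ℂ) (p q : ℂ × ℂ), (∀ y, (c y = 1 ∨ c y = -1) ∧ (c' y = 1 ∨ c' y = -1) →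
      d y = u → (c y, c' y) = p ∨ (c y, c' y) = q) → (∃ᶠ y in 𝓝[Yᶜ] (A τ), d y = u) →
      (∃ᶠ y in 𝓝[Yᶜ] (A τ), (c y, c' y) = p) ∨ (∃ᶠ y in 𝓝[Yᶜ] (A τ), (c y, c' y) = q) := by
    intro d u p q himp hf
    rw [← frequently_or_distrib]
    exact (hf.and_eventually pm).mono fun y hy => himp y hy.2 hy.1
  have a1 := fr c 1 (1,1) (1,-1) (by rintro y ⟨-, e | e⟩ h <;> simp [e, h]) (hc.freq h).1
  have a2 := fr c (-1) (-1,1) (-1,-1) (by rintro y ⟨-, e | e⟩ h <;> simp [e, h]) (hc.freq h).2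
  have b1 := fr c' 1 (1,1) (-1,1) (by rintro y ⟨e | e, -⟩ h <;> simp [e, h]) (hc'.freq h').1
  have b2 := fr c' (-1) (1,-1) (-1,-1) (by rintro y ⟨e | e, -⟩ h <;> simp [e, h]) (hc'.freq h').2
  have d1 := fr _ 1 (1,1) (-1,-1) (by
    rintro y ⟨e | e, e' | e'⟩ h <;> simp [e, e'] at h ⊢ <;> norm_num at h) ((hc.mul hc').freq h2).1
  have d2 := fr _ (-1) (1,-1) (-1,1) (by
    rintro y ⟨e | e, e' | e'⟩ h <;> simp [e, e'] at h ⊢ <;> norm_num at h) ((hc.mul hc').freq h2).2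
  have k1 := key (1,1) (1,-1) (-1,1) (by simp [n1]) (by simp [n1]) (by simp [n1])
  have k2 := key (1,1) (1,-1) (-1,-1) (by simp [n1]) (by simp [n1]) (by simp [n1])
  have k3 := key (1,1) (-1,1) (-1,-1) (by simp [n1]) (by simp [n1]) (by simp [n1])
  have k4 := key (1,-1) (-1,1) (-1,-1) (by simp [n1]) (by simp [n1]) (by simp [n1])
  exact prop_aux a1 a2 b1 b2 d1 d2 k1 k2 k3 k4

end NPG

namespace NPG
open Set Filter Topology

lemma Col.tri_mul_iff {X : Type*} [TopologicalSpace X] {Y : Set X} {x : X} {c c' : X → ℂ}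
    (hc : Col Y x c) (h : Triv Y x c) : Triv Y x (fun y => c y * c' y) ↔ Triv Y x c' :=
  ⟨fun h2 => h.of_mul hc h2, fun h2 => h.mul h2⟩

lemma nhdsWithin_swap {X : Type*} [TopologicalSpace X] {Y Y' : Set X} {x : X}
    (h : ∀ᶠ y in 𝓝 x, y ∈ Y ↔ y ∈ Y') : 𝓝[Yᶜ] x = 𝓝[Y'ᶜ] x := by
  rw [nhdsWithin_eq_iff_eventuallyEq]
  filter_upwards [h] with y hy
  exact propext (not_congr hy)

/-- a nontrivial local colouring along an arc -/
lemma arc_col {A : ℝ → ℂ} (hA : Continuous A) (hi : InjOn A (Icc 0 1)) {τ : ℝ}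
    (hτ : τ ∈ Ioo (0:ℝ) 1) {Y : Set ℂ} (hY : ∀ᶠ y in 𝓝 (A τ), y ∈ Y ↔ y ∈ A '' Icc 0 1)
    {s : ℂ → ℂ} (hs : ContinuousOn s (A '' Icc 0 1)ᶜ)
    (hs2 : ∀ z ∉ A '' Icc 0 1, s z ^ 2 = (z - A 0) / (z - A 1)) :
    ∃ r, IsSq (fun z => (z - A 0) / (z - A 1)) (A τ) r ∧ (∀ᶠ y in 𝓝 (A τ), r y ≠ 0) ∧
      Col Y (A τ) (fun z => s z / r z) ∧
      ∀ᶠ t in 𝓝 τ, ¬ Triv Y (A t) (fun z => s z / r z) := by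
  have h0 : A τ ≠ A 0 := fun h => hτ.1.ne' (hi (Ioo_subset_Icc_self hτ) (by simp) h)
  have h1 : A τ ≠ A 1 := fun h => hτ.2.ne (hi (Ioo_subset_Icc_self hτ) (by simp) h)
  have hq : ∀ᶠ y in 𝓝 (A τ), ContinuousAt (fun z => (z - A 0) / (z - A 1)) y := by
    filter_upwards [isOpen_ne.mem_nhds h1] with y hy
    exact (continuousAt_id.sub continuousAt_const).div (continuousAt_id.sub continuousAt_const)
      (sub_ne_zero.2 hy)
  have hq0 : (A τ - A 0) / (A τ - A 1) ≠ 0 := div_ne_zero (sub_ne_zero.2 h0) (sub_ne_zero.2 h1)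
  obtain ⟨r, hr⟩ := IsSq.exists' hq hq0
  have hrn := hr.ne_zero hq0
  have hop : IsOpen (A '' Icc 0 1)ᶜ := (isClosed_arc hA 0 1).isOpen_compl
  refine ⟨r, hr, hrn, ?_, ?_⟩
  · have := nhdsWithin_swap hY
    unfold Col
    rw [this, eventually_nhdsWithin_iff]
    filter_upwards [hr, hrn] with y a b hy
    refine ⟨(hs.continuousAt (hop.mem_nhds hy)).div a.1 b, ?_⟩
    rw [div_pow, hs2 y hy, a.2, div_self]
    rw [← a.2]
    exact pow_ne_zero _ b
  · have e1 := (hA.tendsto τ).eventually (eventually_eventually_nhds.2 hY)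
    have e2 := (hA.tendsto τ).eventually (eventually_eventually_nhds.2 hr)
    filter_upwards [e1, e2, Ioo_mem_nhds hτ.1 hτ.2, (hA.tendsto τ).eventually (eventually_eventually_nhds.2 hrn)]
      with t a1 a2 ht hrn ⟨κ, hκ⟩
    rw [nhdsWithin_swap a1] at hκ
    refine no_ext_sqrt hA hi hs hs2 ht (L := κ * r (A t)) ?_
    have : Tendsto (fun y => κ * r y) (𝓝[(A '' Icc 0 1)ᶜ] (A t)) (𝓝 (κ * r (A t))) :=
      (tendsto_const_nhds.mul a2.self_of_nhds.1.tendsto).mono_left nhdsWithin_le_nhds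
    refine this.congr' ?_
    filter_upwards [hκ, hrn.filter_mono nhdsWithin_le_nhds] with y h1 h2
    rw [← h1, div_mul_cancel₀ _ h2]

lemma triv_local {A : ℝ → ℂ} (hA : Continuous A) (hi : InjOn A (Icc 0 1)) {τ : ℝ}
    (hτ : τ ∈ Ioo (0:ℝ) 1) {Y : Set ℂ} (hY : ∀ᶠ y in 𝓝 (A τ), y ∈ Y ↔ y ∈ A '' Icc 0 1)
    {c : ℂ → ℂ} (hc : Col Y (A τ) c) (h : ¬ Triv Y (A τ) c) : ∀ᶠ t in 𝓝 τ, ¬ Triv Y (A t) c := by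
  obtain ⟨s, hs, hs2⟩ := exists_sqrt_arc hA
  obtain ⟨r, -, -, h1, h2⟩ := arc_col hA hi hτ hY hs hs2
  have h3 := pair_triv hA hi hτ hY hc h1 h h2.self_of_nhds
  filter_upwards [(hA.tendsto τ).eventually h3.ev, h2, (hA.tendsto τ).eventually hc.ev] with t a b d e
  exact b (e.of_mul d a)

/-- A star of arcs around `v` which coincides with `Y` near `v` -/
structure Star (Y : Set ℂ) (v : ℂ) {ι : Type} (A : ι → ℝ → ℂ) : Prop where
  cont : ∀ h, Continuous (A h)
  inj : ∀ h, InjOn (A h) (Icc 0 1)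
  zero : ∀ h, A h 0 = v
  disj : ∀ h h', h ≠ h' → ∀ t ∈ Icc (0:ℝ) 1, ∀ t' ∈ Icc (0:ℝ) 1, A h t = A h' t' → t = 0
  near : ∀ᶠ y in 𝓝 v, y ≠ v → (y ∈ Y ↔ ∃ h, y ∈ A h '' Icc 0 1)
  mem : Nonempty ι → v ∈ Y
  dense : Dense Yᶜ

namespace Star
variable {Y : Set ℂ} {v : ℂ} {ι : Type} [Finite ι] {A : ι → ℝ → ℂ}

lemma tend (hS : Star Y v A) (h : ι) : Tendsto (A h) (𝓝[>] 0) (𝓝 v) := by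
  have := (hS.cont h).tendsto 0
  rw [hS.zero] at this
  exact this.mono_left nhdsWithin_le_nhds

lemma ne (hS : Star Y v A) (h : ι) {t : ℝ} (ht : t ∈ Ioc (0:ℝ) 1) : A h t ≠ v := by
  rw [← hS.zero h]
  exact fun e => ht.1.ne' (hS.inj h (Ioc_subset_Icc_self ht) (by simp) e)

lemma notMem (hS : Star Y v A) {h h' : ι} (hh : h ≠ h') {t : ℝ} (ht : t ∈ Ioc (0:ℝ) 1) :
    A h t ∉ (A h') '' Icc 0 1 := by
  rintro ⟨t', ht', e⟩
  exact ht.1.ne' (hS.disj h h' hh t (Ioc_subset_Icc_self ht) t' ht' e.symm)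

lemma nearArc (hS : Star Y v A) (h : ι) : ∀ᶠ t in 𝓝[>] (0:ℝ), t ∈ Ioo (0:ℝ) 1 ∧
    ∀ᶠ y in 𝓝 (A h t), y ∈ Y ↔ y ∈ A h '' Icc 0 1 := by
  have e1 : ∀ᶠ t in 𝓝[>] (0:ℝ), t ∈ Ioo (0:ℝ) 1 := Ioo_mem_nhdsGT one_pos
  have e2 := (hS.tend h).eventually (eventually_eventually_nhds.2 hS.near)
  filter_upwards [e1, e2] with t ht a
  refine ⟨ht, ?_⟩
  have e3 : ∀ᶠ y in 𝓝 (A h t), y ≠ v := isOpen_ne.mem_nhds (hS.ne h (Ioo_subset_Ioc_self ht))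
  have e4 : ∀ᶠ y in 𝓝 (A h t), ∀ h', h ≠ h' → y ∉ (A h') '' Icc 0 1 := by
    rw [eventually_all]
    intro h'
    by_cases hh : h = h'
    · simp [hh]
    · filter_upwards [(isClosed_arc (hS.cont h') 0 1).isOpen_compl.mem_nhds
        (hS.notMem hh (Ioo_subset_Ioc_self ht))] with y hy _
      exact hy
  filter_upwards [a, e3, e4] with y h1 h2 h3
  rw [h1 h2]
  constructor
  · rintro ⟨h', hh'⟩
    by_cases hh : h = h'
    · rwa [hh]
    · exact absurd hh' (h3 _ hh)
  · exact fun hh => ⟨h, hh⟩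

/-- points near `v` on the arcs have small parameters -/
lemma small (hS : Star Y v A) {p : ι → ℝ → Prop} (hp : ∀ h, ∀ᶠ t in 𝓝[>] (0:ℝ), p h t) :
    ∀ᶠ y in 𝓝 v, ∀ h, ∀ t ∈ Ioc (0:ℝ) 1, A h t = y → p h t := by
  rw [eventually_all]
  intro h
  obtain ⟨ε, hε, hb⟩ := mem_nhdsGT_iff_exists_Ioo_subset.1 (hp h)
  have hε : 0 < ε := hε
  have hcl := isClosed_arc (hS.cont h) ε 1
  have hv : v ∉ A h '' Icc ε 1 := by
    rintro ⟨t, ht, e⟩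
    exact hS.ne h ⟨hε.trans_le ht.1, ht.2⟩ e
  filter_upwards [hcl.isOpen_compl.mem_nhds hv] with y hy t ht e
  refine hb ⟨ht.1, ?_⟩
  by_contra hh
  exact hy ⟨t, ⟨not_lt.1 hh, ht.2⟩, e⟩

end Star

end NPG

namespace NPG
open Set Filter Topology
namespace Star
variable {Y : Set ℂ} {v : ℂ} {ι : Type} [Finite ι] {A : ι → ℝ → ℂ}

/-- the square roots used near a star -/
structure Roots (A : ι → ℝ → ℂ) (v : ℂ) (I : Finset ι) (s : ι → ℂ → ℂ) (r : ℂ → ℂ) : Prop where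
  sc : ∀ h, ContinuousOn (s h) (A h '' Icc 0 1)ᶜ
  s2 : ∀ h, ∀ z ∉ A h '' Icc 0 1, s h z ^ 2 = (z - A h 0) / (z - A h 1)
  r2 : ∀ᶠ y in 𝓝 v, ContinuousAt r y ∧ r y ^ 2 = ∏ h ∈ I, (y - A h 1)
  rn : ∀ᶠ y in 𝓝 v, r y ≠ 0

lemma exists_roots (hS : Star Y v A) (I : Finset ι) : ∃ s r, Roots A v I s r := by
  choose s hs hs2 using fun h => exists_sqrt_arc (hS.cont h)
  have h0 : ∏ h ∈ I, (v - A h 1) ≠ 0 := Finset.prod_ne_zero_iff.2 fun h _ =>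
    sub_ne_zero.2 (hS.ne h (by simp)).symm
  obtain ⟨r, hr⟩ := IsSq.exists' (q := fun z => ∏ h ∈ I, (z - A h 1)) (x := v)
    (Eventually.of_forall fun y => Continuous.continuousAt (by fun_prop)) h0
  exact ⟨s, r, hs, hs2, hr, hr.ne_zero h0⟩

lemma Roots.cont {I : Finset ι} {s r} (hR : Roots A v I s r) (hS : Star Y v A) {h : ι} {y : ℂ}
    (hy : y ∉ A h '' Icc 0 1) : ContinuousAt (s h) y :=
  (hR.sc h).continuousAt ((isClosed_arc (hS.cont h) 0 1).isOpen_compl.mem_nhds hy)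

lemma Roots.ne_zero {I : Finset ι} {s r} (hR : Roots A v I s r) (hS : Star Y v A) {h : ι} {y : ℂ}
    (hy : y ∉ A h '' Icc 0 1) : s h y ≠ 0 := by
  intro e
  have := hR.s2 h y hy
  rw [e] at this
  have h2 : (y - A h 0) / (y - A h 1) ≠ 0 := div_ne_zero
    (sub_ne_zero.2 fun e => hy ⟨0, by simp, e.symm⟩) (sub_ne_zero.2 fun e => hy ⟨1, by simp, e.symm⟩)
  exact h2 (by rw [← this]; simp)

lemma Roots.prod_sq {I : Finset ι} {s r} (hR : Roots A v I s r) (hS : Star Y v A) {y : ℂ}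
    (hy : ∀ h ∈ I, y ∉ A h '' Icc 0 1) (h2 : r y ^ 2 = ∏ h ∈ I, (y - A h 1)) :
    ((∏ h ∈ I, s h y) * r y) ^ 2 = (y - v) ^ I.card := by
  rw [mul_pow, h2, ← Finset.prod_pow, ← Finset.prod_mul_distrib, ← Finset.prod_const]
  refine Finset.prod_congr rfl fun h hh => ?_
  rw [hR.s2 h y (hy h hh), div_mul_cancel₀, hS.zero]
  exact sub_ne_zero.2 fun e => hy h hh ⟨1, by simp, e.symm⟩

lemma off (hS : Star Y v A) (hι : Nonempty ι) : ∀ᶠ y in 𝓝[Yᶜ] v, y ≠ v ∧ ∀ h, y ∉ A h '' Icc 0 1 := by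
  rw [eventually_nhdsWithin_iff]
  filter_upwards [hS.near] with y hy hY
  have hne : y ≠ v := fun e => hY (by rw [e]; exact hS.mem hι)
  exact ⟨hne, fun h hh => hY ((hy hne).2 ⟨h, hh⟩)⟩

lemma exists_col (hS : Star Y v A) (I : Finset ι) (hI : Even I.card) :
    ∃ w, Col Y v w ∧ ∀ h, ∀ᶠ t in 𝓝[>] (0:ℝ), (Triv Y (A h t) w ↔ h ∉ I) := by
  classical
  rcases I.eq_empty_or_nonempty with rfl | ⟨h0, hh0⟩
  · exact ⟨fun _ => 1, Eventually.of_forall fun y => ⟨continuousAt_const, by simp⟩, fun h =>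
      Eventually.of_forall fun t => by simpa using ⟨1, Eventually.of_forall fun y => rfl⟩⟩
  obtain ⟨s, r, hR⟩ := hS.exists_roots I
  obtain ⟨m, hm⟩ := hI
  let w : ℂ → ℂ := fun y => (∏ h ∈ I, s h y) * r y / (y - v) ^ m
  have hcol : Col Y v w := by
    filter_upwards [hS.off ⟨h0⟩, hR.r2.filter_mono nhdsWithin_le_nhds] with y ⟨hne, hy⟩ ⟨h1, h2⟩
    have hne' : (y - v) ^ m ≠ 0 := pow_ne_zero _ (sub_ne_zero.2 hne)
    constructor
    · refine ContinuousAt.div (ContinuousAt.mul ?_ h1) (Continuous.continuousAt (by fun_prop)) hne'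
      exact tendsto_finsetProd _ fun h _ => (hR.cont hS (hy h)).tendsto
    · show (_ / _) ^ 2 = _
      rw [div_pow, hR.prod_sq hS (fun h _ => hy h) h2, ← pow_mul, hm, ← mul_two, div_self]
      exact pow_ne_zero _ (sub_ne_zero.2 hne)
  refine ⟨w, hcol, fun h => ?_⟩
  filter_upwards [hS.nearArc h, (hS.tend h).eventually (eventually_eventually_nhds.2 hR.r2),
    (hS.tend h).eventually (eventually_eventually_nhds.2 hR.rn), (hS.tend h).eventually hcol.ev]
    with t ⟨ht, hY⟩ hr hrn hct
  have hne : A h t ≠ v := hS.ne h (Ioo_subset_Ioc_self ht)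
  have hne' : (A h t - v) ^ m ≠ 0 := pow_ne_zero _ (sub_ne_zero.2 hne)
  have hG : ∀ J : Finset ι, h ∉ J → ContinuousAt (fun y => (∏ h ∈ J, s h y) * r y / (y - v) ^ m) (A h t) := by
    intro J hJ
    refine ContinuousAt.div (ContinuousAt.mul ?_ hr.self_of_nhds.1) (Continuous.continuousAt (by fun_prop)) hne'
    refine tendsto_finsetProd _ fun h' hh' => (hR.cont hS (hS.notMem ?_ (Ioo_subset_Ioc_self ht))).tendsto
    rintro rfl
    exact hJ hh'
  constructor
  · intro ⟨κ, hκ⟩ hI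
    let g : ℂ → ℂ := fun y => (∏ h ∈ I.erase h, s h y) * r y / (y - v) ^ m
    have hg : ContinuousAt g (A h t) := hG _ (by simp)
    have hg0 : g (A h t) ≠ 0 := by
      refine div_ne_zero (mul_ne_zero ?_ hrn.self_of_nhds) hne'
      refine Finset.prod_ne_zero_iff.2 fun h' hh' => ?_
      exact hR.ne_zero hS (hS.notMem (Finset.ne_of_mem_erase hh').symm (Ioo_subset_Ioc_self ht))
    rw [nhdsWithin_swap hY] at hκ
    refine no_ext_sqrt (hS.cont h) (hS.inj h) (hR.sc h) (hR.s2 h) ht (L := κ / g (A h t)) ?_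
    have : Tendsto (fun y => κ / g y) (𝓝[(A h '' Icc 0 1)ᶜ] (A h t)) (𝓝 (κ / g (A h t))) :=
      (tendsto_const_nhds.div hg.tendsto hg0).mono_left nhdsWithin_le_nhds
    refine this.congr' ?_
    filter_upwards [hκ, (hg.eventually_ne hg0).filter_mono nhdsWithin_le_nhds] with y h1 h2
    rw [← h1, div_eq_iff h2]
    show (∏ h ∈ I, s h y) * r y / (y - v) ^ m = s h y * ((∏ h ∈ I.erase h, s h y) * r y / (y - v) ^ m)
    rw [← Finset.mul_prod_erase I _ hI]
    ring
  · intro hI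
    have : (𝓝[Yᶜ] (A h t)).NeBot := mem_closure_iff_nhdsWithin_neBot.1 (hS.dense _)
    exact hct.triv_of_tendsto ((hG I hI).tendsto.mono_left nhdsWithin_le_nhds)

lemma even_of_col (hS : Star Y v A) (I : Finset ι) {c : ℂ → ℂ} (hc : Col Y v c)
    (hI : ∀ h, ∀ᶠ t in 𝓝[>] (0:ℝ), (Triv Y (A h t) c ↔ h ∉ I)) : Even I.card := by
  classical
  rcases I.eq_empty_or_nonempty with rfl | ⟨h0, hh0⟩
  · simp
  obtain ⟨s, r, hR⟩ := hS.exists_roots I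
  let u : ℂ → ℂ := fun y => c y * ((∏ h ∈ I, s h y) * r y)
  have hlim : ∀ᶠ y in 𝓝 v, y ≠ v → ∃ L, Tendsto u (𝓝[Yᶜ] y) (𝓝 L) := by
    have hA : ∀ h, ∀ᶠ t in 𝓝[>] (0:ℝ), ∃ L, Tendsto u (𝓝[Yᶜ] (A h t)) (𝓝 L) := by
      intro h
      filter_upwards [hI h, hS.nearArc h, (hS.tend h).eventually (eventually_eventually_nhds.2 hR.r2),
        (hS.tend h).eventually hc.ev] with t hT ⟨ht, hY⟩ hr hct
      have hG : ∀ J : Finset ι, h ∉ J → ContinuousAt (fun y => (∏ h ∈ J, s h y) * r y) (A h t) := by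
        intro J hJ
        refine ContinuousAt.mul ?_ hr.self_of_nhds.1
        refine tendsto_finsetProd _ fun h' hh' =>
          (hR.cont hS (hS.notMem ?_ (Ioo_subset_Ioc_self ht))).tendsto
        rintro rfl
        exact hJ hh'
      by_cases hhI : h ∈ I
      · obtain ⟨r', h1, h2, h3, h4⟩ := arc_col (hS.cont h) (hS.inj h) ht hY (hR.sc h) (hR.s2 h)
        have h5 := pair_triv (hS.cont h) (hS.inj h) ht hY hct h3 (fun hh => hT.1 hh hhI) h4.self_of_nhds
        obtain ⟨L, hL⟩ := h5.tendsto
        refine ⟨_, ((hL.mul (h1.self_of_nhds.1.tendsto.mono_left nhdsWithin_le_nhds)).mul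
          ((hG (I.erase h) (by simp)).tendsto.mono_left nhdsWithin_le_nhds)).congr' ?_⟩
        filter_upwards [h2.filter_mono nhdsWithin_le_nhds] with y hy
        show c y * (s h y / r' y) * r' y * ((∏ h ∈ I.erase h, s h y) * r y) =
          c y * ((∏ h ∈ I, s h y) * r y)
        rw [← Finset.mul_prod_erase I _ hhI]
        field_simp
      · obtain ⟨L, hL⟩ := (hT.2 hhI).tendsto
        exact ⟨_, hL.mul ((hG I hhI).tendsto.mono_left nhdsWithin_le_nhds)⟩
    have hcv := hc.ev
    have h0 : ∀ᶠ y in 𝓝 v, y ∉ Y → ContinuousAt c y := by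
      have := eventually_nhdsWithin_iff.1 hc
      filter_upwards [this] with y hy hY
      exact (hy hY).1
    filter_upwards [hS.small hA, hS.near, h0, hR.r2] with y h1 h2 h3 hr hne
    by_cases hY : y ∈ Y
    · obtain ⟨h, t, ht, e⟩ := (h2 hne).1 hY
      have ht0 : 0 < t := lt_of_le_of_ne ht.1 (by
        rintro rfl
        exact hne (e ▸ (hS.zero h)))
      have := h1 h t ⟨ht0, ht.2⟩ e
      rwa [e] at this
    · refine ⟨_, ContinuousAt.tendsto (f := u) ?_ |>.mono_left nhdsWithin_le_nhds⟩
      refine (h3 hY).mul (ContinuousAt.mul ?_ hr.1)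
      exact tendsto_finsetProd _ fun h _ => (hR.cont hS fun hh => hY ((h2 hne).2 ⟨h, hh⟩)).tendsto
  -- square
  have hsq : ∀ᶠ y in 𝓝 v, y ∉ Y → u y ^ 2 = (y - v) ^ I.card := by
    filter_upwards [hR.r2, eventually_nhdsWithin_iff.1 hc, eventually_nhdsWithin_iff.1 (hS.off ⟨h0⟩)]
      with y h1 h2 h3 hY
    show (c y * _) ^ 2 = _
    rw [mul_pow, (h2 hY).2, one_mul, hR.prod_sq hS (fun h _ => (h3 hY).2 h) h1.2]
  obtain ⟨δ, hδ, hb⟩ := Metric.eventually_nhds_iff_ball.1 (hlim.and hsq)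
  let B : Set ℂ := Metric.ball v δ \ {v}
  have hBo : IsOpen B := Metric.isOpen_ball.sdiff isClosed_singleton
  have hext : ContinuousOn (extendFrom Yᶜ u) B :=
    continuousOn_extendFrom (fun y _ => hS.dense y) fun y hy => (hb y hy.1).1 hy.2
  have hsub : Metric.sphere v (δ / 2) ⊆ B := by
    intro y hy
    rw [mem_sphere_iff_norm] at hy
    refine ⟨by rw [mem_ball_iff_norm, hy]; linarith, ?_⟩
    rintro rfl
    simp at hy
    linarith
  have hdvd := circle_dvd (a := v) (R := δ / 2) (n := I.card) (m := 2) (w := extendFrom Yᶜ u) (half_pos hδ)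
    (hext.mono hsub) two_pos ?_
  · exact even_iff_two_dvd.2 (by exact_mod_cast hdvd)
  intro y hy
  have hyB := hsub hy
  have : (𝓝[Yᶜ] y).NeBot := mem_closure_iff_nhdsWithin_neBot.1 (hS.dense _)
  have t1 := tendsto_extendFrom ((hb y hyB.1).1 hyB.2)
  have t2 : Tendsto (fun y => u y ^ 2) (𝓝[Yᶜ] y) (𝓝 ((y - v) ^ I.card)) := by
    have : Tendsto (fun z : ℂ => (z - v) ^ I.card) (𝓝[Yᶜ] y) (𝓝 ((y - v) ^ I.card)) :=
      (Continuous.tendsto (by fun_prop) y).mono_left nhdsWithin_le_nhds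
    refine this.congr' ?_
    rw [EventuallyEq, eventually_nhdsWithin_iff]
    filter_upwards [Metric.isOpen_ball.mem_nhds hyB.1] with z hz hzY
    exact ((hb z hz).2 hzY).symm
  simpa using tendsto_nhds_unique (t1.pow 2) t2

end Star
end NPG

namespace NPG
open Set Filter Topology

section emb
variable {G : FinGraph} {S : Type*} [TopologicalSpace S] (Γ : GraphEmb G S)

/-- the edges with a real parameter -/
noncomputable def arc (e : G.E) : ℝ → S := (Γ.emap e).extend

lemma arc_cont (e : G.E) : Continuous (arc Γ e) := (Γ.emap e).continuous_extend

lemma arc_zero (e : G.E) : arc Γ e 0 = Γ.vmap (G.ends e).1 := (Γ.emap e).extend_zero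
lemma arc_one (e : G.E) : arc Γ e 1 = Γ.vmap (G.ends e).2 := (Γ.emap e).extend_one

lemma arc_eq (e : G.E) {t : ℝ} (ht : t ∈ Icc (0:ℝ) 1) : arc Γ e t = Γ.emap e ⟨t, ht⟩ :=
  (Γ.emap e).extend_apply ht

lemma arc_inj {e e' : G.E} {t t' : ℝ} (ht : t ∈ Ioo (0:ℝ) 1) (ht' : t' ∈ Ioo (0:ℝ) 1)
    (h : arc Γ e t = arc Γ e' t') : e = e' ∧ t = t' := by
  have h1 := Ioo_subset_Icc_self ht
  have h2 := Ioo_subset_Icc_self ht'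
  rw [arc_eq Γ e h1, arc_eq Γ e' h2] at h
  have m1 : (⟨t, h1⟩ : unitInterval) ∈ Ioo (0:unitInterval) 1 := ⟨ht.1, ht.2⟩
  have m2 : (⟨t', h2⟩ : unitInterval) ∈ Ioo (0:unitInterval) 1 := ⟨ht'.1, ht'.2⟩
  by_cases he : e = e'
  · subst he
    exact ⟨rfl, congrArg Subtype.val (Γ.emap_injOn e m1 m2 h)⟩
  · exact absurd h (Γ.emap_disjoint e e' he _ m1 _ m2)

lemma arc_avoid (e : G.E) {t : ℝ} (ht : t ∈ Ioo (0:ℝ) 1) (v : G.V) : arc Γ e t ≠ Γ.vmap v := by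
  rw [arc_eq Γ e (Ioo_subset_Icc_self ht)]
  exact Γ.emap_avoid e _ ⟨ht.1, ht.2⟩ v

lemma image_eq : Γ.image = range Γ.vmap ∪ ⋃ e, arc Γ e '' Icc 0 1 := by
  unfold GraphEmb.image
  congr 1
  refine iUnion_congr fun e => ?_
  ext y
  constructor
  · rintro ⟨t, rfl⟩
    exact ⟨t, t.2, arc_eq Γ e t.2⟩
  · rintro ⟨t, ht, rfl⟩
    exact ⟨⟨t, ht⟩, (arc_eq Γ e ht).symm⟩

lemma arc_mem (e : G.E) {t : ℝ} (ht : t ∈ Icc (0:ℝ) 1) : arc Γ e t ∈ Γ.image := by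
  rw [image_eq]; exact Or.inr (mem_iUnion.2 ⟨e, t, ht, rfl⟩)

lemma vmap_mem (v : G.V) : Γ.vmap v ∈ Γ.image := Or.inl ⟨v, rfl⟩

lemma image_closed [T2Space S] : IsClosed Γ.image := by
  rw [image_eq]
  refine (finite_range _).isClosed.union (isClosed_iUnion_of_finite fun e => ?_)
  exact (isCompact_Icc.image (arc_cont Γ e)).isClosed

/-- mod 2 boundary -/
noncomputable def bd (z : G.E → ZMod 2) (v : G.V) : ZMod 2 := by
  classical exact ∑ e, ((if (G.ends e).1 = v then z e else 0) + (if (G.ends e).2 = v then z e else 0))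

lemma edge_near [T2Space S] (x : S) {ε : ℝ} (hε : 0 < ε) : ∀ᶠ y in 𝓝 x, y ∈ Γ.image → y ≠ x →
    ∃ e, ∃ τ ∈ Icc (0:ℝ) 1, arc Γ e τ = x ∧ ∃ u ∈ Icc (0:ℝ) 1, |u - τ| < ε ∧ y = arc Γ e u := by
  have h1 : ∀ᶠ y in 𝓝 x, ∀ v, Γ.vmap v ≠ x → y ≠ Γ.vmap v := by
    rw [eventually_all]
    intro v
    by_cases h : Γ.vmap v = x
    · simp [h]
    · filter_upwards [isOpen_ne.mem_nhds (Ne.symm h)] with y hy _ using hy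
  have h2 : ∀ᶠ y in 𝓝 x, ∀ e, y ∉ arc Γ e '' (Icc 0 1 ∩ {u | ∀ τ ∈ Icc (0:ℝ) 1, arc Γ e τ = x → ε ≤ |u - τ|}) := by
    rw [eventually_all]
    intro e
    have hcl : IsClosed {u : ℝ | ∀ τ ∈ Icc (0:ℝ) 1, arc Γ e τ = x → ε ≤ |u - τ|} := by
      have : {u : ℝ | ∀ τ ∈ Icc (0:ℝ) 1, arc Γ e τ = x → ε ≤ |u - τ|} =
        ⋂ τ ∈ Icc (0:ℝ) 1, ⋂ (_ : arc Γ e τ = x), {u | ε ≤ |u - τ|} := by ext u; simp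
      rw [this]
      exact isClosed_biInter fun τ _ => isClosed_iInter fun _ =>
        isClosed_le continuous_const (by fun_prop)
    have hK := (((isCompact_Icc (a := (0:ℝ)) (b := 1)).inter_right hcl).image (arc_cont Γ e)).isClosed
    refine hK.isOpen_compl.mem_nhds ?_
    rintro ⟨u, ⟨hu, hu2⟩, e1⟩
    have := hu2 u hu e1
    simp at this
    linarith
  filter_upwards [h1, h2] with y a b hy hne
  rw [image_eq] at hy
  rcases hy with ⟨v, rfl⟩ | hy
  · exact absurd rfl (a v hne)
  · obtain ⟨e, u, hu, rfl⟩ := mem_iUnion.1 hy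
    have := b e
    by_contra hcon
    push Not at hcon
    exact this ⟨u, ⟨hu, fun τ hτ h1 => not_lt.1 fun h => hcon e τ hτ h1 u hu h rfl⟩, rfl⟩

lemma lift_arc {ψ : ℂ → S} (hψ : IsOpenEmbedding ψ) {g : ℝ → S} (hg : Continuous g)
    (hr : ∀ t, g t ∈ range ψ) : ∃ A : ℝ → ℂ, Continuous A ∧ ∀ t, ψ (A t) = g t := by
  choose A hA using hr
  refine ⟨A, ?_, hA⟩
  rw [hψ.isInducing.continuous_iff]
  convert hg using 1
  exact funext hA

lemma tendsto_preimage {ψ : ℂ → S} (hψ : IsOpenEmbedding ψ) {p : ℂ} {q : S → Prop}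
    (h : ∀ᶠ y in 𝓝 (ψ p), q y) : ∀ᶠ y in 𝓝 p, q (ψ y) :=
  hψ.continuous.continuousAt.eventually h

/-- combined local data: generic star -/
lemma star_gen [T2Space S] {ψ : ℂ → S} (hψ : IsOpenEmbedding ψ) (p : ℂ) {ι : Type} [Finite ι]
    (ed : ι → G.E) (τ σ : ι → ℝ) (h1 : ∀ h, τ h ∈ Icc (0:ℝ) 1 ∧ arc Γ (ed h) (τ h) = ψ p)
    (h2 : ∀ h, ∀ᶠ t in 𝓝[>] (0:ℝ), τ h + σ h * t ∈ Ioo (0:ℝ) 1)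
    (h3 : ∀ h, σ h = 1 ∨ σ h = -1)
    (h4 : ∀ h h', ed h = ed h' → τ h = τ h' → σ h = σ h' → h = h')
    (h5 : ∀ e, ∀ t ∈ Icc (0:ℝ) 1, arc Γ e t = ψ p → ∀ u ∈ Icc (0:ℝ) 1, u ≠ t →
      ∃ h, ed h = e ∧ τ h = t ∧ 0 < σ h * (u - t)) :
    ∃ A : ι → ℝ → ℂ, (Dense (ψ ⁻¹' Γ.image)ᶜ → Star (ψ ⁻¹' Γ.image) p A) ∧
      (∀ h, Continuous (A h)) ∧ (∀ h, InjOn (A h) (Icc 0 1)) ∧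
      (∀ᶠ y in 𝓝 p, y ≠ p → (y ∈ ψ ⁻¹' Γ.image ↔ ∃ h, y ∈ A h '' Icc 0 1)) ∧
      ∀ h, ∀ t ∈ Ioc (0:ℝ) 1, ψ (A h t) ∈ arc Γ (ed h) '' Ioo 0 1 := by
  have c1 : ∀ᶠ ε in 𝓝[>] (0:ℝ), ∀ h, ∀ t ∈ Ioc 0 ε, τ h + σ h * t ∈ Ioo (0:ℝ) 1 := by
    rw [eventually_all]
    intro h
    obtain ⟨δ, hδ, hb⟩ := mem_nhdsGT_iff_exists_Ioo_subset.1 (h2 h)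
    filter_upwards [Ioo_mem_nhdsGT hδ] with ε hε t ht
    exact hb ⟨ht.1, ht.2.trans_lt hε.2⟩
  have c2 : ∀ᶠ ε in 𝓝[>] (0:ℝ), ∀ h, ∀ t ∈ Icc 0 ε, arc Γ (ed h) (τ h + σ h * t) ∈ range ψ := by
    rw [eventually_all]
    intro h
    have hc : Continuous (fun t : ℝ => arc Γ (ed h) (τ h + σ h * t)) :=
      (arc_cont Γ _).comp (by fun_prop)
    have := hc.continuousAt.eventually_mem (x := 0) (hψ.isOpen_range.mem_nhds (by
      simp only [mul_zero, add_zero]; exact ⟨p, (h1 h).2.symm⟩))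
    obtain ⟨δ, hδ, hb⟩ := Metric.eventually_nhds_iff_ball.1 this
    filter_upwards [Ioo_mem_nhdsGT hδ] with ε hε t ht
    refine hb t ?_
    rw [mem_ball_zero_iff, Real.norm_of_nonneg ht.1]
    exact ht.2.trans_lt hε.2
  have c3 : ∀ᶠ ε in 𝓝[>] (0:ℝ), ∀ h h', τ h ≠ τ h' → 2 * ε < |τ h - τ h'| := by
    rw [eventually_all]; intro h
    rw [eventually_all]; intro h'
    by_cases hh : τ h = τ h'
    · simp [hh]
    · have : 0 < |τ h - τ h'| := abs_pos.2 (sub_ne_zero.2 hh)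
      filter_upwards [Ioo_mem_nhdsGT (half_pos this)] with ε hε _
      linarith [hε.2]
  obtain ⟨ε, ⟨c1, c2, c3⟩, hε⟩ := (((c1.and (c2.and c3))).and self_mem_nhdsWithin).exists
  have hε : 0 < ε := hε
  have hcl : ∀ t : ℝ, ε * max 0 (min 1 t) ∈ Icc 0 ε := by
    intro t
    have a1 : 0 ≤ max 0 (min 1 t) := le_max_left _ _
    have a2 : max 0 (min 1 t) ≤ 1 := max_le zero_le_one (min_le_left _ _)
    constructor <;> nlinarith
  have hcl2 : ∀ t ∈ Icc (0:ℝ) 1, max 0 (min 1 t) = t := by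
    intro t ht
    rw [min_eq_right ht.2, max_eq_right ht.1]
  choose A hA hAe using fun h => lift_arc hψ
    (g := fun t => arc Γ (ed h) (τ h + σ h * (ε * max 0 (min 1 t))))
    ((arc_cont Γ _).comp (by fun_prop)) (fun t => c2 h _ (hcl t))
  have hAe' : ∀ h, ∀ t ∈ Icc (0:ℝ) 1, ψ (A h t) = arc Γ (ed h) (τ h + σ h * (ε * t)) := by
    intro h t ht
    rw [hAe, hcl2 t ht]
  have hin : ∀ h, ∀ t ∈ Ioc (0:ℝ) 1, τ h + σ h * (ε * t) ∈ Ioo (0:ℝ) 1 := fun h t ht =>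
    c1 h _ ⟨by have := ht.1; positivity, by nlinarith [ht.2]⟩
  have h0 : ∀ h, A h 0 = p := fun h => hψ.injective (by
    rw [hAe' h 0 (by simp)]; simpa using (h1 h).2)
  have hnv : ∀ h, ∀ t ∈ Ioc (0:ℝ) 1, A h t ≠ p := by
    intro h t ht e
    have e1 : arc Γ (ed h) (τ h + σ h * (ε * t)) = ψ p := by
      rw [← hAe' h t (Ioc_subset_Icc_self ht), e]
    have hτ := h1 h
    rw [← hτ.2] at e1
    by_cases hi : τ h ∈ Ioo (0:ℝ) 1
    · have := (arc_inj Γ (hin h t ht) hi e1).2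
      have h6 : σ h * (ε * t) = 0 := by linarith
      rcases h3 h with h7 | h7 <;> rw [h7] at h6 <;> nlinarith [mul_pos hε ht.1]
    · have : τ h = 0 ∨ τ h = 1 := by
        rcases eq_or_lt_of_le hτ.1.1 with h | h
        · exact Or.inl h.symm
        · rcases eq_or_lt_of_le hτ.1.2 with h' | h'
          · exact Or.inr h'
          · exact absurd ⟨h, h'⟩ hi
      rcases this with h | h
      · rw [h, arc_zero] at e1
        rw [← h] at e1
        exact arc_avoid Γ _ (hin _ t ht) _ (by rw [h] at e1 ⊢; exact e1)
      · rw [h, arc_one] at e1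
        exact arc_avoid Γ _ (hin _ t ht) _ (by rw [h]; exact e1)
  have hs0 : ∀ h, σ h ≠ 0 := fun h => by rcases h3 h with h | h <;> rw [h] <;> norm_num
  have hinj : ∀ h, InjOn (A h) (Icc 0 1) := by
    intro h t ht t' ht' e
    rcases eq_or_lt_of_le ht.1 with r | r
    · rcases eq_or_lt_of_le ht'.1 with r' | r'
      · rw [← r, ← r']
      · rw [← r, h0] at e
        exact absurd e.symm (hnv h t' ⟨r', ht'.2⟩)
    · rcases eq_or_lt_of_le ht'.1 with r' | r'
      · rw [← r', h0] at e
        exact absurd e (hnv h t ⟨r, ht.2⟩)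
      · have := congrArg ψ e
        rw [hAe' h t ht, hAe' h t' ht'] at this
        have := (arc_inj Γ (hin h t ⟨r, ht.2⟩) (hin h t' ⟨r', ht'.2⟩) this).2
        exact mul_left_cancel₀ hε.ne' (mul_left_cancel₀ (hs0 h) (add_left_cancel this))
  have hnear : ∀ᶠ y in 𝓝 p, y ≠ p → (y ∈ ψ ⁻¹' Γ.image ↔ ∃ h, y ∈ A h '' Icc 0 1) := by
    have := tendsto_preimage hψ (edge_near Γ (ψ p) hε)
    filter_upwards [this] with y hy hne
    constructor
    · intro hY
      obtain ⟨e, t, ht, e1, u, hu, hut, e2⟩ := hy hY (fun h => hne (hψ.injective h))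
      have hne' : u ≠ t := by
        rintro rfl
        exact hne (hψ.injective (e2.trans e1))
      obtain ⟨h, rfl, rfl, hs⟩ := h5 e t ht e1 u hu hne'
      refine ⟨h, |u - τ h| / ε, ⟨by positivity, by rw [div_le_one hε]; exact hut.le⟩, ?_⟩
      apply hψ.injective
      rw [hAe' h _ ⟨by positivity, by rw [div_le_one hε]; exact hut.le⟩, e2, mul_div_cancel₀ _ hε.ne']
      congr 1
      rcases h3 h with q | q <;> rw [q] at hs ⊢
      · rw [abs_of_pos (by linarith)]; ring
      · rw [abs_of_neg (by linarith)]; ring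
    · rintro ⟨h, t, ht, rfl⟩
      show ψ (A h t) ∈ Γ.image
      rw [hAe]
      apply arc_mem
      have := hin h t ⟨lt_of_le_of_ne ht.1 (by rintro rfl; exact hne (h0 h)), ht.2⟩
      rw [hcl2 t ht]
      exact Ioo_subset_Icc_self this
  refine ⟨A, fun hd => ⟨hA, hinj, h0, ?_, hnear, ?_, hd⟩, hA, hinj, hnear, ?_⟩
  · intro h h' hne t ht t' ht' e
    by_contra h0'
    have r : 0 < t := lt_of_le_of_ne ht.1 (Ne.symm h0')
    rcases eq_or_lt_of_le ht'.1 with r' | r'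
    · rw [← r', h0] at e
      exact hnv h t ⟨r, ht.2⟩ e
    have := congrArg ψ e
    rw [hAe' h t ht, hAe' h' t' ht'] at this
    obtain ⟨i1, i2⟩ := arc_inj Γ (hin h t ⟨r, ht.2⟩) (hin h' t' ⟨r', ht'.2⟩) this
    have b1 : 0 < ε * t := by positivity
    have b2 : 0 < ε * t' := by positivity
    have b3 : ε * t ≤ ε := by nlinarith [ht.2]
    have b4 : ε * t' ≤ ε := by nlinarith [ht'.2]
    by_cases hτ : τ h = τ h'
    · by_cases hσ : σ h = σ h'
      · exact hne (h4 h h' i1 hτ hσ)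
      · rw [hτ] at i2
        have i3 := add_left_cancel i2
        rcases h3 h with q | q <;> rcases h3 h' with q' | q' <;> rw [q, q'] at i3 hσ
        · exact hσ rfl
        · linarith
        · linarith
        · exact hσ rfl
    · have := c3 h h' hτ
      have i3 : τ h - τ h' = σ h' * (ε * t') - σ h * (ε * t) := by linarith
      rw [i3] at this
      rcases h3 h with q | q <;> rcases h3 h' with q' | q' <;> rw [q, q'] at this <;>
        · rw [lt_abs] at this; rcases this with w | w <;> linarith
  · rintro ⟨h⟩
    show ψ p ∈ Γ.image
    rw [← (h1 h).2]
    exact arc_mem Γ _ (h1 h).1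
  · intro h t ht
    rw [hAe' h t (Ioc_subset_Icc_self ht)]
    exact ⟨_, hin h t ht, rfl⟩

end emb
end NPG

namespace NPG
open Set Filter Topology

section emb
variable {G : FinGraph} {S : Type*} [TopologicalSpace S] (Γ : GraphEmb G S)

lemma arc_eq_vmap {e : G.E} {t : ℝ} (ht : t ∈ Icc (0:ℝ) 1) {v : G.V} (h : arc Γ e t = Γ.vmap v) :
    (t = 0 ∧ (G.ends e).1 = v) ∨ (t = 1 ∧ (G.ends e).2 = v) := by
  rcases eq_or_lt_of_le ht.1 with h0 | h0
  · left
    rw [← h0, arc_zero] at h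
    exact ⟨h0.symm, Γ.vmap_injective h⟩
  rcases eq_or_lt_of_le ht.2 with h1 | h1
  · right
    rw [h1, arc_one] at h
    exact ⟨h1, Γ.vmap_injective h⟩
  exact absurd h (arc_avoid Γ e ⟨h0, h1⟩ v)

lemma arc_eq_arc {e e' : G.E} {t t' : ℝ} (ht : t ∈ Icc (0:ℝ) 1) (ht' : t' ∈ Ioo (0:ℝ) 1)
    (h : arc Γ e t = arc Γ e' t') : e = e' ∧ t = t' := by
  rcases eq_or_lt_of_le ht.1 with h0 | h0
  · rw [← h0, arc_zero] at h
    exact absurd h.symm (arc_avoid Γ e' ht' _)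
  rcases eq_or_lt_of_le ht.2 with h1 | h1
  · rw [h1, arc_one] at h
    exact absurd h.symm (arc_avoid Γ e' ht' _)
  exact arc_inj Γ ⟨h0, h1⟩ ht' h

/-- every point of the image is a vertex or interior to an edge -/
lemma image_cases {x : S} (h : x ∈ Γ.image) : (∃ v, Γ.vmap v = x) ∨ ∃ e, ∃ t ∈ Ioo (0:ℝ) 1, arc Γ e t = x := by
  rw [image_eq] at h
  rcases h with ⟨v, h⟩ | h
  · exact Or.inl ⟨v, h⟩
  obtain ⟨e, t, ht, rfl⟩ := mem_iUnion.1 h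
  rcases eq_or_lt_of_le ht.1 with h0 | h0
  · exact Or.inl ⟨_, by rw [← h0, arc_zero]⟩
  rcases eq_or_lt_of_le ht.2 with h1 | h1
  · exact Or.inl ⟨_, by rw [h1, arc_one]⟩
  exact Or.inr ⟨e, t, ⟨h0, h1⟩, rfl⟩

/-- local structure near any point -/
def HasStar (ψ : ℂ → S) (p : ℂ) (D : Prop) : Prop :=
  ∃ (ι : Type) (_ : Fintype ι) (ed : ι → G.E) (A : ι → ℝ → ℂ),
      (D → Star (ψ ⁻¹' Γ.image) p A) ∧
      (∀ h, Continuous (A h)) ∧ (∀ h, InjOn (A h) (Icc 0 1)) ∧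
      (∀ᶠ y in 𝓝 p, y ≠ p → (y ∈ ψ ⁻¹' Γ.image ↔ ∃ h, y ∈ A h '' Icc 0 1)) ∧
      (∀ h, ∀ t ∈ Ioc (0:ℝ) 1, ψ (A h t) ∈ arc Γ (ed h) '' Ioo 0 1) ∧
      (∀ v, Γ.vmap v = ψ p → ∀ z, ∑ h, z (ed h) = bd z v) ∧
      ((∀ v, Γ.vmap v ≠ ψ p) → ∀ z : G.E → ZMod 2, ∑ h, z (ed h) = 0)

lemma exists_star_pre [T2Space S] {ψ : ℂ → S} (hψ : IsOpenEmbedding ψ) (p : ℂ) :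
    HasStar Γ ψ p (Dense (ψ ⁻¹' Γ.image)ᶜ) := by
  classical
  have hp0 : ∀ᶠ t in 𝓝[>] (0:ℝ), t ∈ Ioo (0:ℝ) 1 := Ioo_mem_nhdsGT one_pos
  by_cases hx : ψ p ∈ Γ.image
  · rcases image_cases Γ hx with ⟨v, hv⟩ | ⟨e0, t0, ht0, he0⟩
    · let ι : Type := {q : G.E × Bool // (if q.2 then (G.ends q.1).1 else (G.ends q.1).2) = v}
      obtain ⟨A, a1, a2, a3, a4, a5⟩ := star_gen Γ hψ p (ι := ι) (fun q => q.1.1)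
        (fun q => if q.1.2 then 0 else 1) (fun q => if q.1.2 then 1 else -1) (by
          rintro ⟨⟨e, _ | _⟩, h⟩
          · simp at h; simp [arc_one, h, hv]
          · simp at h; simp [arc_zero, h, hv]) (by
          rintro ⟨⟨e, _ | _⟩, h⟩
          · filter_upwards [hp0] with t ht
            simp only [Bool.false_eq_true, if_false]
            exact ⟨by linarith [ht.2], by linarith [ht.1]⟩
          · filter_upwards [hp0] with t ht
            simpa using ht) (by
          rintro ⟨⟨e, _ | _⟩, h⟩ <;> simp) (by
          rintro ⟨⟨e, _ | _⟩, h⟩ ⟨⟨e', _ | _⟩, h'⟩ <;> simp <;> rintro rfl <;> rfl) (by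
          intro e t ht h u hu hut
          rw [← hv] at h
          rcases arc_eq_vmap Γ ht h with ⟨rfl, h6⟩ | ⟨rfl, h6⟩
          · refine ⟨⟨(e, true), by simpa using h6⟩, rfl, by simp, ?_⟩
            simpa using lt_of_le_of_ne hu.1 (Ne.symm hut)
          · refine ⟨⟨(e, false), by simpa using h6⟩, rfl, by simp, ?_⟩
            simpa using lt_of_le_of_ne hu.2 hut)
      refine ⟨ι, inferInstance, _, A, a1, a2, a3, a4, a5, ?_, fun h => absurd hv (h v)⟩
      intro v' hv' z
      obtain rfl : v' = v := Γ.vmap_injective (hv'.trans hv.symm)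
      have : ∑ h : ι, z h.1.1 = ∑ q : G.E × Bool,
          if (if q.2 then (G.ends q.1).1 else (G.ends q.1).2) = v' then z q.1 else 0 := by
        rw [← Finset.sum_filter, ← Finset.sum_subtype_eq_sum_filter]
        exact Finset.sum_congr (by ext; simp) fun _ _ => rfl
      rw [this, Fintype.sum_prod_type]
      unfold bd
      exact Finset.sum_congr rfl fun e _ => by rw [Fintype.sum_bool]; simp
    · have hnv : ∀ v, Γ.vmap v ≠ ψ p := fun v h => arc_avoid Γ e0 ht0 v (he0.trans h.symm)
      obtain ⟨A, a1, a2, a3, a4, a5⟩ := star_gen Γ hψ p (ι := Bool) (fun _ => e0)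
        (fun _ => t0) (fun b => if b then 1 else -1)
        (fun _ => ⟨Ioo_subset_Icc_self ht0, he0⟩) (by
          intro b
          have : Tendsto (fun t : ℝ => t0 + (if b then 1 else -1) * t) (𝓝[>] 0) (𝓝 t0) := by
            have : Continuous (fun t : ℝ => t0 + (if b then 1 else -1) * t) := by fun_prop
            have := this.tendsto 0
            simp only [mul_zero, add_zero] at this
            exact this.mono_left nhdsWithin_le_nhds
          exact this.eventually (Ioo_mem_nhds ht0.1 ht0.2)) (by
          rintro (_ | _) <;> simp) (by
          rintro (_ | _) (_ | _) <;> simp <;> norm_num) (by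
          intro e t ht h u hu hut
          rw [← he0] at h
          obtain ⟨rfl, rfl⟩ := arc_eq_arc Γ ht ht0 h
          rcases lt_or_gt_of_ne hut with h | h
          · exact ⟨false, rfl, rfl, by simpa using h⟩
          · exact ⟨true, rfl, rfl, by simpa using h⟩)
      refine ⟨Bool, inferInstance, _, A, a1, a2, a3, a4, a5, fun v h => absurd h (hnv v), ?_⟩
      intro _ z
      rw [Fintype.sum_bool]
      exact CharTwo.add_self_eq_zero _
  · obtain ⟨A, a1, a2, a3, a4, a5⟩ := star_gen Γ hψ p (ι := Empty) (fun h => h.elim) (fun h => h.elim)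
      (fun h => h.elim) (fun h => h.elim) (fun h => h.elim) (fun h => h.elim) (fun h => h.elim)
      (fun e t ht h => absurd (h ▸ arc_mem Γ e ht) hx)
    refine ⟨Empty, inferInstance, _, A, a1, a2, a3, a4, a5, ?_, fun _ _ => by simp⟩
    intro v hv
    exact absurd (hv ▸ vmap_mem Γ v) hx

lemma dense_chart [T2Space S] {ψ : ℂ → S} (hψ : IsOpenEmbedding ψ) :
    Dense (ψ ⁻¹' Γ.image)ᶜ := by
  rw [← interior_eq_empty_iff_dense_compl]
  by_contra hne
  obtain ⟨p, hp⟩ := nonempty_iff_ne_empty.2 hne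
  obtain ⟨ι, _, ed, A, -, a2, a3, a4, -, -⟩ := exists_star_pre Γ hψ p
  obtain ⟨U, hU, hUo, hpU⟩ := eventually_nhds_iff.1 (a4.and (mem_interior_iff_mem_nhds.1 hp))
  have d1 : Dense (⋂ h, (A h '' Icc 0 1)ᶜ) := dense_iInter_of_isOpen
    (fun h => (isClosed_arc (a2 h) 0 1).isOpen_compl) fun h => dense_compl_arc (a2 h) (a3 h)
  have d2 : Dense ((⋂ h, (A h '' Icc 0 1)ᶜ) ∩ {p}ᶜ) :=
    d1.inter_of_isOpen_right (dense_compl_singleton p) isOpen_compl_singleton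
  obtain ⟨y, hyU, hy, hyp⟩ := d2.inter_open_nonempty U hUo ⟨p, hpU⟩
  obtain ⟨h, hh⟩ := ((hU y hyU).1 hyp).1 (hU y hyU).2
  exact mem_iInter.1 hy h hh

lemma exists_star [T2Space S] {ψ : ℂ → S} (hψ : IsOpenEmbedding ψ) (p : ℂ) :
    ∃ (ι : Type) (_ : Fintype ι) (ed : ι → G.E) (A : ι → ℝ → ℂ),
      Star (ψ ⁻¹' Γ.image) p A ∧
      (∀ h, ∀ t ∈ Ioc (0:ℝ) 1, ψ (A h t) ∈ arc Γ (ed h) '' Ioo 0 1) ∧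
      (∀ v, Γ.vmap v = ψ p → ∀ z, ∑ h, z (ed h) = bd z v) ∧
      ((∀ v, Γ.vmap v ≠ ψ p) → ∀ z : G.E → ZMod 2, ∑ h, z (ed h) = 0) := by
  obtain ⟨ι, h1, ed, A, a1, -, -, -, a5, a6, a7⟩ := exists_star_pre Γ hψ p
  exact ⟨ι, h1, ed, A, a1 (dense_chart Γ hψ), a5, a6, a7⟩

/-- an arc through an interior point of an edge -/
lemma edge_chart [T2Space S] {ψ : ℂ → S} (hψ : IsOpenEmbedding ψ) {p : ℂ} {e : G.E} {τ : ℝ}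
    (hτ : τ ∈ Ioo (0:ℝ) 1) (hp : arc Γ e τ = ψ p) : ∃ (A : ℝ → ℂ) (ε : ℝ), 0 < ε ∧ Continuous A ∧
      InjOn A (Icc 0 1) ∧ A (1 / 2) = p ∧ (∀ t ∈ Icc (0:ℝ) 1, ψ (A t) = arc Γ e (τ + ε * (2 * t - 1))) ∧
      ∀ᶠ y in 𝓝 p, y ∈ ψ ⁻¹' Γ.image ↔ y ∈ A '' Icc 0 1 := by
  have c1 : ∀ᶠ u in 𝓝 τ, u ∈ Ioo (0:ℝ) 1 ∧ arc Γ e u ∈ range ψ :=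
    Filter.Eventually.and (Ioo_mem_nhds hτ.1 hτ.2)
    ((arc_cont Γ e).continuousAt.eventually_mem (hψ.isOpen_range.mem_nhds ⟨p, hp.symm⟩))
  obtain ⟨δ, hδ, hb⟩ := Metric.eventually_nhds_iff_ball.1 c1
  obtain ⟨ε, hε, hεδ⟩ := exists_between hδ
  have hcl : ∀ t : ℝ, τ + ε * (2 * max 0 (min 1 t) - 1) ∈ Metric.ball τ δ := by
    intro t
    have a1 : 0 ≤ max 0 (min 1 t) := le_max_left _ _
    have a2 : max 0 (min 1 t) ≤ 1 := max_le zero_le_one (min_le_left _ _)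
    rw [Real.ball_eq_Ioo]
    constructor <;> nlinarith
  have hcl2 : ∀ t ∈ Icc (0:ℝ) 1, max 0 (min 1 t) = t := by
    intro t ht
    rw [min_eq_right ht.2, max_eq_right ht.1]
  obtain ⟨A, hA, hAe⟩ := lift_arc hψ
    (g := fun t => arc Γ e (τ + ε * (2 * max 0 (min 1 t) - 1)))
    ((arc_cont Γ _).comp (by fun_prop)) (fun t => (hb _ (hcl t)).2)
  have hAe' : ∀ t ∈ Icc (0:ℝ) 1, ψ (A t) = arc Γ e (τ + ε * (2 * t - 1)) := by
    intro t ht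
    rw [hAe, hcl2 t ht]
  have hin : ∀ t ∈ Icc (0:ℝ) 1, τ + ε * (2 * t - 1) ∈ Ioo (0:ℝ) 1 := by
    intro t ht
    have := (hb _ (hcl t)).1
    rwa [hcl2 t ht] at this
  have hhalf : A (1 / 2) = p := hψ.injective (by
    rw [hAe' _ (by norm_num), ← hp]; norm_num)
  refine ⟨A, ε, hε, hA, ?_, hhalf, hAe', ?_⟩
  · intro t ht t' ht' h
    have := congrArg ψ h
    rw [hAe' t ht, hAe' t' ht'] at this
    have := (arc_inj Γ (hin t ht) (hin t' ht') this).2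
    have := mul_left_cancel₀ hε.ne' (add_left_cancel this)
    linarith
  · filter_upwards [tendsto_preimage hψ (edge_near Γ (ψ p) hε)] with y hy
    constructor
    · intro hY
      by_cases hyp : y = p
      · exact ⟨1 / 2, by norm_num, by rw [hhalf, hyp]⟩
      obtain ⟨e', t, ht, e1, u, hu, hut, e2⟩ := hy hY (fun h => hyp (hψ.injective h))
      rw [← hp] at e1
      obtain ⟨rfl, rfl⟩ := arc_eq_arc Γ ht hτ e1
      rw [abs_lt] at hut
      have hmem : ((u - t) / ε + 1) / 2 ∈ Icc (0:ℝ) 1 := by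
        have q1 : -1 < (u - t) / ε := by rw [lt_div_iff₀ hε]; linarith
        have q2 : (u - t) / ε < 1 := by rw [div_lt_iff₀ hε]; linarith
        constructor <;> linarith
      refine ⟨((u - t) / ε + 1) / 2, hmem, hψ.injective ?_⟩
      rw [hAe' _ hmem, e2]
      congr 1
      field_simp
      ring
    · rintro ⟨t, ht, rfl⟩
      show ψ (A t) ∈ Γ.image
      rw [hAe' t ht]
      exact arc_mem Γ _ (Ioo_subset_Icc_self (hin t ht))

end emb

lemma exists_chart {S : Type*} [TopologicalSpace S] [ChartedSpace (EuclideanSpace ℝ (Fin 2)) S] (x : S) :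
    ∃ ψ : ℂ → S, IsOpenEmbedding ψ ∧ ψ 0 = x := by
  let φ := chartAt (EuclideanSpace ℝ (Fin 2)) x
  have hx : φ x ∈ φ.target := φ.map_source (mem_chart_source _ x)
  obtain ⟨r, hr, hb⟩ := Metric.isOpen_iff.1 φ.open_target (φ x) hx
  let L : ℂ ≃ₗᵢ[ℝ] EuclideanSpace ℝ (Fin 2) := Complex.orthonormalBasisOneI.repr
  let u := OpenPartialHomeomorph.univBall (φ x) r
  have hu : IsOpenEmbedding u := u.isOpenEmbedding (by simp [u])
  have hur : ∀ y, u y ∈ φ.target := fun y => hb (by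
    have := u.map_source (x := y) (by simp [u])
    rwa [OpenPartialHomeomorph.univBall_target _ hr] at this)
  refine ⟨fun z => φ.symm (u (L z)), ?_, ?_⟩
  · have h1 : IsOpenEmbedding (fun z => u (L z)) := hu.comp L.toHomeomorph.isOpenEmbedding
    refine IsOpenEmbedding.of_continuous_injective_isOpenMap ?_ ?_ ?_
    · exact φ.continuousOn_symm.comp_continuous h1.continuous fun z => hur _
    · intro a b h
      exact h1.injective (φ.symm.injOn (hur _) (hur _) h)
    · intro U hU
      have : (fun z => φ.symm (u (L z))) '' U = φ.symm '' ((fun z => u (L z)) '' U) := by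
        rw [image_image]
      rw [this]
      refine φ.symm.isOpen_image_of_subset_source (h1.isOpenMap U hU) ?_
      rintro _ ⟨z, -, rfl⟩
      exact hur _
  · show φ.symm (u (L 0)) = x
    rw [map_zero, OpenPartialHomeomorph.univBall_apply_zero]
    exact φ.left_inv (mem_chart_source _ x)

end NPG

namespace NPG
open Set Filter Topology

section gen
variable {X : Type*} [TopologicalSpace X] {Y : Set X} {c : X → ℂ}

lemma triv_const {B : Set X} (hB : IsPreconnected B) (hne : B.Nonempty) (hT : ∀ x ∈ B, Triv Y x c)
    (hN : ∀ x ∈ B, (𝓝[Yᶜ] x).NeBot) :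
    ∃ κ : ℂ, ∀ x ∈ B, ∀ᶠ y in 𝓝[Yᶜ] x, c y = κ := by
  obtain ⟨x0, hx0⟩ := hne
  let U : ℂ → Set X := fun κ => {x | ∀ᶠ y in 𝓝[Yᶜ] x, c y = κ}
  by_contra hcon
  push Not at hcon
  have key : ∀ κ x, x ∈ B → (∃ᶠ y in 𝓝[Yᶜ] x, c y ≠ κ) → ∃ κ', κ' ≠ κ ∧ x ∈ U κ' := by
    intro κ x hx hf
    obtain ⟨κ', h⟩ := hT x hx
    refine ⟨κ', ?_, h⟩
    rintro rfl
    exact hf (h.mono fun y hy => not_not.2 hy)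
  obtain ⟨κ, hκ⟩ := hT x0 hx0
  obtain ⟨x1, hx1, h1⟩ := hcon κ
  have hopen : IsOpen (⋃ κ' ∈ {κ' | κ' ≠ κ}, U κ') := isOpen_biUnion fun κ' _ => isOpen_evEq Y _
  obtain ⟨κ', hn, h1'⟩ := key κ x1 hx1 h1
  obtain ⟨x, hx, hx2, hx3⟩ := hB _ _ (isOpen_evEq Y (fun y => c y = κ)) hopen (by
      intro x hx
      obtain ⟨κ', h⟩ := hT x hx
      by_cases hh : κ' = κ
      · exact Or.inl (hh ▸ h)
      · exact Or.inr (mem_biUnion (x := κ') hh h)) ⟨x0, hx0, hκ⟩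
      ⟨x1, hx1, mem_biUnion (x := κ') hn h1'⟩
  obtain ⟨κ'', hn'', h''⟩ := mem_iUnion₂.1 hx3
  have := hN x hx
  have hx2 : ∀ᶠ y in 𝓝[Yᶜ] x, c y = κ := hx2
  have h'' : ∀ᶠ y in 𝓝[Yᶜ] x, c y = κ'' := h''
  obtain ⟨y, a, b⟩ := (hx2.and h'').exists
  exact hn'' (b.symm.trans a)

lemma isPreconnected_punctured (p : ℂ) (δ : ℝ) : IsPreconnected (Metric.ball p δ \ {p}) := by
  have : Metric.ball p δ \ {p} = (fun q : ℝ × ℝ => circleMap p q.1 q.2) '' (Ioo 0 δ ×ˢ univ) := by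
    ext z
    constructor
    · rintro ⟨h1, h2⟩
      have h2 : z ≠ p := h2
      refine ⟨(‖z - p‖, Complex.arg (z - p)), ⟨⟨norm_pos_iff.2 (sub_ne_zero.2 h2), by
        simpa [dist_eq_norm] using h1⟩, trivial⟩, ?_⟩
      simp only [circleMap]
      rw [Complex.norm_mul_exp_arg_mul_I]
      ring
    · rintro ⟨⟨r, θ⟩, ⟨hr, -⟩, rfl⟩
      have hr : 0 < r ∧ r < δ := hr
      constructor
      · rw [mem_ball_iff_norm]
        simp [circleMap, abs_of_pos hr.1, hr.2]
      · simp [circleMap, hr.1.ne']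
  rw [this]
  refine (isPreconnected_Ioo.prod isPreconnected_univ).image _ (Continuous.continuousOn ?_)
  unfold circleMap
  fun_prop

lemma triv_of_punctured {Y : Set ℂ} {p : ℂ} {c : ℂ → ℂ} (hd : Dense Yᶜ) (hC : Col Y p c)
    (hT : ∀ᶠ q in 𝓝[≠] p, Triv Y q c) : Triv Y p c := by
  have hN : ∀ x, (𝓝[Yᶜ] x).NeBot := fun x => mem_closure_iff_nhdsWithin_neBot.1 (hd x)
  by_cases hp : p ∈ Y
  · rw [eventually_nhdsWithin_iff] at hT
    obtain ⟨δ, hδ, hb⟩ := Metric.eventually_nhds_iff_ball.1 (hT.and hC.ev)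
    have hne : (Metric.ball p δ \ {p}).Nonempty := by
      refine ⟨p + (δ / 2 : ℝ), ?_, ?_⟩
      · rw [mem_ball_iff_norm]
        simp only [add_sub_cancel_left, Complex.norm_real, Real.norm_eq_abs]
        rw [abs_of_pos (half_pos hδ)]
        linarith
      · simp [hδ.ne']
    obtain ⟨κ, hκ⟩ := triv_const (isPreconnected_punctured p δ) hne
      (fun x hx => (hb x hx.1).1 hx.2) (fun x _ => hN x)
    refine ⟨κ, ?_⟩
    rw [eventually_nhdsWithin_iff]
    filter_upwards [Metric.ball_mem_nhds p hδ] with y hy hY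
    exact (hκ y ⟨hy, fun h => hY (by rw [mem_singleton_iff.1 h]; exact hp)⟩).self_of_nhdsWithin hY
  · have := hN p
    exact hC.triv_of_tendsto ((hC.self_of_nhdsWithin hp).1.tendsto.mono_left nhdsWithin_le_nhds)

end gen

section transport
variable {S : Type*} [TopologicalSpace S] {ψ : ℂ → S} {Y : Set S} {p : ℂ}
  {c : S → ℂ}

lemma nhds_chart (hψ : IsOpenEmbedding ψ) : 𝓝[Yᶜ] (ψ p) = map ψ (𝓝[(ψ ⁻¹' Y)ᶜ] p) :=
  (hψ.map_nhdsWithin_preimage_eq Yᶜ p).symm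

lemma col_chart (hψ : IsOpenEmbedding ψ) : Col Y (ψ p) c ↔ Col (ψ ⁻¹' Y) p (c ∘ ψ) := by
  unfold Col
  rw [nhds_chart hψ, eventually_map]
  refine eventually_congr (Eventually.of_forall fun y => ?_)
  rw [hψ.continuousAt_iff]
  rfl

lemma triv_chart (hψ : IsOpenEmbedding ψ) : Triv Y (ψ p) c ↔ Triv (ψ ⁻¹' Y) p (c ∘ ψ) := by
  unfold Triv
  rw [nhds_chart hψ]
  rfl

end transport

/-- global colourings -/
def GCol {S : Type*} [TopologicalSpace S] (Y : Set S) (c : S → ℂ) : Prop :=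
  ∀ y ∉ Y, ContinuousAt c y ∧ c y ^ 2 = 1

lemma GCol.col {S : Type*} [TopologicalSpace S] {Y : Set S} {c : S → ℂ} (h : GCol Y c) (x : S) :
    Col Y x c := by
  have : ∀ᶠ y in 𝓝[Yᶜ] x, y ∈ Yᶜ := self_mem_nhdsWithin
  exact this.mono h

lemma GCol.mul {S : Type*} [TopologicalSpace S] {Y : Set S} {c c' : S → ℂ} (h : GCol Y c)
    (h' : GCol Y c') : GCol Y (fun y => c y * c' y) := fun y hy =>
  ⟨(h y hy).1.mul (h' y hy).1, by rw [mul_pow, (h y hy).2, (h' y hy).2, one_mul]⟩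

section surf
variable {G : FinGraph} {S : Type*} [TopologicalSpace S] [ChartedSpace (EuclideanSpace ℝ (Fin 2)) S]
  [T2Space S] (Γ : GraphEmb G S)

lemma dense_compl : Dense (Γ.image)ᶜ := by
  intro x
  obtain ⟨ψ, hψ, rfl⟩ := exists_chart x
  have := dense_chart Γ hψ 0
  rw [mem_closure_iff_nhdsWithin_neBot] at this ⊢
  rw [nhds_chart hψ]
  exact this.map _

lemma neBot_compl (x : S) : (𝓝[(Γ.image)ᶜ] x).NeBot :=
  mem_closure_iff_nhdsWithin_neBot.1 (dense_compl Γ x)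

lemma triv_edge_open {c : S → ℂ} {e : G.E} {τ : ℝ} (hτ : τ ∈ Ioo (0:ℝ) 1)
    (hc : Col Γ.image (arc Γ e τ) c) (h : ¬ Triv Γ.image (arc Γ e τ) c) :
    ∀ᶠ t in 𝓝 τ, ¬ Triv Γ.image (arc Γ e t) c := by
  obtain ⟨ψ, hψ, hp⟩ := exists_chart (arc Γ e τ)
  obtain ⟨A, ε, hε, hA, hi, h12, hAe, hn⟩ := edge_chart Γ hψ hτ hp.symm
  rw [← hp] at hc h
  rw [col_chart hψ] at hc
  rw [triv_chart hψ] at h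
  rw [← h12] at hc h hn
  have := triv_local hA hi (by norm_num) hn hc h
  have ht : Tendsto (fun t : ℝ => ((t - τ) / ε + 1) / 2) (𝓝 τ) (𝓝 (1 / 2)) := by
    have : Continuous (fun t : ℝ => ((t - τ) / ε + 1) / 2) := by fun_prop
    simpa using this.tendsto τ
  have h01 : Icc (0:ℝ) 1 ∈ 𝓝 (1 / 2 : ℝ) := Icc_mem_nhds (by norm_num) (by norm_num)
  filter_upwards [ht.eventually this, ht.eventually h01] with t h1 h2 h3
  apply h1
  rw [← triv_chart hψ, hAe _ h2]
  convert h3 using 2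
  field_simp
  ring

lemma triv_edge {c : S → ℂ} (hc : GCol Γ.image c) {e : G.E} {τ : ℝ} (hτ : τ ∈ Ioo (0:ℝ) 1) :
    Triv Γ.image (arc Γ e τ) c ↔ Triv Γ.image (arc Γ e (1 / 2)) c := by
  have o1 : IsOpen {t | t ∈ Ioo (0:ℝ) 1 ∧ Triv Γ.image (arc Γ e t) c} := by
    rw [isOpen_iff_mem_nhds]
    rintro t ⟨ht, h⟩
    filter_upwards [Ioo_mem_nhds ht.1 ht.2, (arc_cont Γ e).continuousAt.eventually h.ev] with u a b
    exact ⟨a, b⟩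
  have o2 : IsOpen {t | t ∈ Ioo (0:ℝ) 1 ∧ ¬ Triv Γ.image (arc Γ e t) c} := by
    rw [isOpen_iff_mem_nhds]
    rintro t ⟨ht, h⟩
    filter_upwards [Ioo_mem_nhds ht.1 ht.2, triv_edge_open Γ ht (hc.col _) h] with u a b
    exact ⟨a, b⟩
  have hh : (1 / 2 : ℝ) ∈ Ioo (0:ℝ) 1 := by norm_num
  rcases isPreconnected_Ioo.subset_or_subset o1 o2 (disjoint_left.2 fun t h h' => h'.2 h.2)
    (fun t ht => by by_cases h : Triv Γ.image (arc Γ e t) c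
                    · exact Or.inl ⟨ht, h⟩
                    · exact Or.inr ⟨ht, h⟩) with h | h
  · exact iff_of_true (h hτ).2 (h hh).2
  · exact iff_of_false (h hτ).2 (h hh).2

open Classical in
/-- the jump of a colouring along an edge -/
noncomputable def jump (c : S → ℂ) (e : G.E) : ZMod 2 :=
  if Triv Γ.image (arc Γ e (1 / 2)) c then 0 else 1

lemma jump_eq_zero {c : S → ℂ} {e : G.E} : jump Γ c e = 0 ↔ Triv Γ.image (arc Γ e (1 / 2)) c := by
  unfold jump
  split_ifs with h
  · exact iff_of_true rfl h
  · exact iff_of_false one_ne_zero h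

lemma pair_triv_edge {c c' : S → ℂ} {e : G.E} {τ : ℝ} (hτ : τ ∈ Ioo (0:ℝ) 1)
    (hc : Col Γ.image (arc Γ e τ) c) (hc' : Col Γ.image (arc Γ e τ) c')
    (h : ¬ Triv Γ.image (arc Γ e τ) c) (h' : ¬ Triv Γ.image (arc Γ e τ) c') :
    Triv Γ.image (arc Γ e τ) (fun y => c y * c' y) := by
  obtain ⟨ψ, hψ, hp⟩ := exists_chart (arc Γ e τ)
  obtain ⟨A, ε, hε, hA, hi, h12, hAe, hn⟩ := edge_chart Γ hψ hτ hp.symm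
  rw [← hp] at hc h hc' h' ⊢
  rw [col_chart hψ] at hc hc'
  rw [triv_chart hψ] at h h' ⊢
  rw [← h12] at hc h hn hc' h' ⊢
  exact pair_triv hA hi (by norm_num) hn hc hc' h h'

lemma three_values_edge {α : Type*} {e : G.E} {τ : ℝ} (hτ : τ ∈ Ioo (0:ℝ) 1) {k : S → α}
    (hk : ∀ y ∉ Γ.image, ∀ᶠ z in 𝓝[(Γ.image)ᶜ] y, k z = k y) {p q r : α}
    (hpq : p ≠ q) (hpr : p ≠ r) (hqr : q ≠ r)
    (h1 : ∃ᶠ y in 𝓝[(Γ.image)ᶜ] (arc Γ e τ), k y = p) (h2 : ∃ᶠ y in 𝓝[(Γ.image)ᶜ] (arc Γ e τ), k y = q)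
    (h3 : ∃ᶠ y in 𝓝[(Γ.image)ᶜ] (arc Γ e τ), k y = r) : False := by
  obtain ⟨ψ, hψ, hp⟩ := exists_chart (arc Γ e τ)
  obtain ⟨A, ε, hε, hA, hi, h12, hAe, hn⟩ := edge_chart Γ hψ hτ hp.symm
  rw [← hp, nhds_chart hψ, frequently_map] at h1 h2 h3
  rw [← h12] at h1 h2 h3 hn
  refine three_values hA hi (by norm_num) hn (k := k ∘ ψ) ?_ hpq hpr hqr h1 h2 h3
  have : ∀ᶠ y in 𝓝[(ψ ⁻¹' Γ.image)ᶜ] (A (1 / 2)), y ∈ (ψ ⁻¹' Γ.image)ᶜ := self_mem_nhdsWithin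
  filter_upwards [this] with y hy
  have := hk (ψ y) hy
  rwa [nhds_chart hψ, eventually_map] at this

lemma jump_mul {c c' : S → ℂ} (hc : GCol Γ.image c) (hc' : GCol Γ.image c') :
    jump Γ (fun y => c y * c' y) = jump Γ c + jump Γ c' := by
  funext e
  show _ = jump Γ c e + jump Γ c' e
  by_cases h : Triv Γ.image (arc Γ e (1 / 2)) c <;> by_cases h' : Triv Γ.image (arc Γ e (1 / 2)) c'
  · unfold jump
    rw [if_pos h, if_pos h', if_pos (h.mul h'), add_zero]
  · unfold jump
    rw [if_pos h, if_neg h', if_neg (mt ((hc.col _).tri_mul_iff h).1 h'), zero_add]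
  · have := (hc'.col (arc Γ e (1 / 2))).tri_mul_iff (c' := c) h'
    simp_rw [mul_comm (c' _)] at this
    unfold jump
    rw [if_neg h, if_pos h', if_neg (mt this.1 h), add_zero]
  · have := pair_triv_edge Γ (by norm_num) (hc.col _) (hc'.col _) h h'
    unfold jump
    rw [if_neg h, if_neg h', if_pos this]
    rfl

lemma jump_bd {c : S → ℂ} (hc : GCol Γ.image c) : bd (jump Γ c) = 0 := by
  classical
  funext v
  obtain ⟨ψ, hψ, hp⟩ := exists_chart (Γ.vmap v)
  obtain ⟨ι, _, ed, A, hS, hA, h1, -⟩ := exists_star Γ hψ 0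
  rw [← h1 v hp.symm]
  have hz : ∀ h, jump Γ c (ed h) = if h ∈ Finset.univ.filter (fun h => jump Γ c (ed h) ≠ 0) then 1 else 0 := by
    intro h
    simp only [Finset.mem_filter, Finset.mem_univ, true_and, jump_eq_zero, ne_eq]
    unfold jump
    split_ifs <;> simp_all
  have := hS.even_of_col (Finset.univ.filter (fun h => jump Γ c (ed h) ≠ 0)) (c := c ∘ ψ)
    ((col_chart hψ).1 (hc.col _)) (by
      intro h
      have e1 : ∀ᶠ t in 𝓝[>] (0:ℝ), t ∈ Ioo (0:ℝ) 1 := Ioo_mem_nhdsGT one_pos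
      filter_upwards [e1] with t ht
      obtain ⟨u, hu, hu2⟩ := hA h t (Ioo_subset_Ioc_self ht)
      rw [← triv_chart hψ, ← hu2, triv_edge Γ hc hu]
      simp [jump_eq_zero])
  rw [Finset.sum_congr rfl fun h _ => hz h, Finset.sum_ite_mem, Finset.univ_inter, Finset.sum_const]
  obtain ⟨m, hm⟩ := this
  rw [hm]
  simp [CharTwo.add_self_eq_zero]

lemma triv_all {c : S → ℂ} (hc : ∀ x, Col Γ.image x c)
    (h : ∀ e, ∀ t ∈ Ioo (0:ℝ) 1, Triv Γ.image (arc Γ e t) c) (x : S) : Triv Γ.image x c := by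
  obtain ⟨ψ, hψ, rfl⟩ := exists_chart x
  rw [triv_chart hψ]
  obtain ⟨ι, _, ed, A, hS, hA, -, -⟩ := exists_star Γ hψ 0
  refine triv_of_punctured hS.dense ((col_chart hψ).1 (hc _)) ?_
  rw [eventually_nhdsWithin_iff]
  filter_upwards [hS.near] with y hy hne
  by_cases hY : y ∈ ψ ⁻¹' Γ.image
  · obtain ⟨h', t, ht, rfl⟩ := (hy hne).1 hY
    rw [← triv_chart hψ]
    have : t ≠ 0 := by rintro rfl; exact hne (hS.zero h')
    obtain ⟨u, hu, hu2⟩ := hA h' t ⟨lt_of_le_of_ne ht.1 this.symm, ht.2⟩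
    rw [← hu2]
    exact h _ u hu
  · have := mem_closure_iff_nhdsWithin_neBot.1 (hS.dense y)
    have hC := (col_chart hψ).1 (hc (ψ y))
    exact hC.triv_of_tendsto ((hC.self_of_nhdsWithin hY).1.tendsto.mono_left nhdsWithin_le_nhds)

lemma const_of_jump [ConnectedSpace S] {c : S → ℂ} (hc : GCol Γ.image c) (h : jump Γ c = 0) :
    ∃ κ, ∀ y ∉ Γ.image, c y = κ := by
  have hT := triv_all Γ (fun x => hc.col x) (fun e t ht => (triv_edge Γ hc ht).2
    ((jump_eq_zero Γ).1 (congrFun h e)))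
  obtain ⟨κ, hκ⟩ := triv_const isPreconnected_univ univ_nonempty (fun x _ => hT x)
    (fun x _ => neBot_compl Γ x)
  exact ⟨κ, fun y hy => (hκ y trivial).self_of_nhdsWithin hy⟩

end surf
end NPG

namespace NPG
open Set Filter Topology

section surf
variable {G : FinGraph} {S : Type*} [TopologicalSpace S] (Γ : GraphEmb G S)

/-- the set of faces -/
abbrev Fc : Type _ := ConnectedComponents (↥((Γ.image)ᶜ))

open Classical in
/-- the face containing a point -/
noncomputable def faceOf (y : S) : Option (Fc Γ) :=
  if h : y ∈ (Γ.image)ᶜ then some (ConnectedComponents.mk ⟨y, h⟩) else none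

lemma faceOf_eq {y : S} (h : y ∉ Γ.image) : faceOf Γ y = some (ConnectedComponents.mk ⟨y, h⟩) := by
  unfold faceOf
  rw [dif_pos (show y ∈ (Γ.image)ᶜ from h)]

open Classical in
/-- the colouring associated with a function on faces -/
noncomputable def colF (φ : Fc Γ → ZMod 2) (y : S) : ℂ :=
  match faceOf Γ y with
  | none => 1
  | some f => if φ f = 0 then 1 else -1

lemma colF_eq (φ : Fc Γ → ZMod 2) {y : S} (h : y ∉ Γ.image) [Decidable (φ (ConnectedComponents.mk ⟨y, h⟩) = 0)] :
    colF Γ φ y = if φ (ConnectedComponents.mk ⟨y, h⟩) = 0 then 1 else -1 := by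
  unfold colF
  rw [faceOf_eq Γ h]
  dsimp only
  congr

lemma colF_add (φ φ' : Fc Γ → ZMod 2) {y : S} (h : y ∉ Γ.image) :
    colF Γ (φ + φ') y = colF Γ φ y * colF Γ φ' y := by
  rw [colF_eq Γ _ h, colF_eq Γ _ h, colF_eq Γ _ h]
  show (if φ _ + φ' _ = 0 then (1:ℂ) else -1) = _
  generalize φ (ConnectedComponents.mk ⟨y, h⟩) = a
  generalize φ' (ConnectedComponents.mk ⟨y, h⟩) = b
  have h1 : ∀ a : ZMod 2, a = 0 ∨ a = 1 := by decide
  rcases h1 a with rfl | rfl <;> rcases h1 b with rfl | rfl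
  · simp
  · simp
  · simp
  · rw [show (1 + 1 : ZMod 2) = 0 from rfl]; simp

/-- the boundary as a linear map -/
noncomputable def bdL (G : FinGraph) : (G.E → ZMod 2) →ₗ[ZMod 2] (G.V → ZMod 2) where
  toFun := bd
  map_add' z z' := by
    classical
    funext v
    simp only [bd, Pi.add_apply, ← Finset.sum_add_distrib]
    refine Finset.sum_congr rfl fun e _ => ?_
    split_ifs <;> ring
  map_smul' a z := by
    classical
    funext v
    simp only [bd, Pi.smul_apply, RingHom.id_apply, Finset.smul_sum]
    refine Finset.sum_congr rfl fun e _ => ?_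
    split_ifs <;> simp [mul_add]

/-- cycles -/
noncomputable def Zc (G : FinGraph) : Submodule (ZMod 2) (G.E → ZMod 2) := LinearMap.ker (bdL G)

lemma mem_Zc {z : G.E → ZMod 2} : z ∈ Zc G ↔ bd z = 0 := Iff.rfl

lemma jump_congr {c c' : S → ℂ} (h : ∀ y ∉ Γ.image, c y = c' y) : jump Γ c = jump Γ c' := by
  funext e
  have h2 : ∀ᶠ y in 𝓝[(Γ.image)ᶜ] (arc Γ e (1 / 2)), y ∈ (Γ.image)ᶜ := self_mem_nhdsWithin
  have hiff : Triv Γ.image (arc Γ e (1 / 2)) c ↔ Triv Γ.image (arc Γ e (1 / 2)) c' :=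
    ⟨fun h1 => h1.congr (h2.mono h), fun h1 => h1.congr (h2.mono fun y hy => (h y hy).symm)⟩
  unfold jump
  split_ifs with h1 h2 h2
  · rfl
  · exact absurd (hiff.1 h1) h2
  · exact absurd (hiff.2 h2) h1
  · rfl

variable [T2Space S]

lemma exists_colF {c : S → ℂ} (hc : GCol Γ.image c) : ∃ φ, ∀ y ∉ Γ.image, c y = colF Γ φ y := by
  classical
  have hlc : IsLocallyConstant (fun y : ↥((Γ.image)ᶜ) => c y) := by
    rw [IsLocallyConstant.iff_eventually_eq]
    intro y
    have h1 : Tendsto (fun y : ↥((Γ.image)ᶜ) => c y) (𝓝 y) (𝓝 (c y)) :=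
      (hc y y.2).1.comp continuous_subtype_val.continuousAt
    exact (pm_tendsto h1 (Eventually.of_forall fun z => (hc z z.2).2)).2
  obtain ⟨rep, hrep⟩ := (ConnectedComponents.surjective_coe (α := ↥((Γ.image)ᶜ))).hasRightInverse
  refine ⟨fun f => if c (rep f) = 1 then 0 else 1, fun y hy => ?_⟩
  rw [colF_eq Γ _ hy]
  have hcc : connectedComponent (rep
      (ConnectedComponents.mk (⟨y, hy⟩ : ↥((Γ.image)ᶜ)))) = connectedComponent ⟨y, hy⟩ := by
    rw [← ConnectedComponents.coe_eq_coe]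
    exact hrep _
  have he : c (rep (ConnectedComponents.mk (⟨y, hy⟩ : ↥((Γ.image)ᶜ)))) = c y :=
    hlc.apply_eq_of_isPreconnected (isPreconnected_connectedComponent (x := ⟨y, hy⟩))
      (hcc ▸ mem_connectedComponent) mem_connectedComponent
  rw [he]
  rcases mul_self_eq_one_iff.1 ((sq _).symm.trans (hc y hy).2) with h | h
  · simp [h]
  · simp [h]

variable [ChartedSpace (EuclideanSpace ℝ (Fin 2)) S]

lemma faceOf_loc {y : S} (h : y ∉ Γ.image) : ∀ᶠ z in 𝓝 y, z ∉ Γ.image ∧ faceOf Γ z = faceOf Γ y := by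
  have : LocallyConnectedSpace S := ChartedSpace.locallyConnectedSpace (EuclideanSpace ℝ (Fin 2)) S
  have hop := (image_closed Γ).isOpen_compl
  have : LocallyConnectedSpace ↥((Γ.image)ᶜ) := hop.isOpenEmbedding_subtypeVal.locallyConnectedSpace
  have h1 : connectedComponent (⟨y, h⟩ : ↥((Γ.image)ᶜ)) ∈ 𝓝 (⟨y, h⟩ : ↥((Γ.image)ᶜ)) :=
    isOpen_connectedComponent.mem_nhds mem_connectedComponent
  have h2 : Subtype.val '' connectedComponent (⟨y, h⟩ : ↥((Γ.image)ᶜ)) ∈ 𝓝 y :=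
    hop.isOpenMap_subtype_val.image_mem_nhds h1
  filter_upwards [h2] with z hz
  obtain ⟨w, hw, rfl⟩ := hz
  refine ⟨w.2, ?_⟩
  rw [faceOf_eq Γ h, faceOf_eq Γ w.2]
  congr 1
  exact ConnectedComponents.coe_eq_coe'.2 hw

lemma colF_gcol (φ : Fc Γ → ZMod 2) : GCol Γ.image (colF Γ φ) := by
  intro y hy
  constructor
  · refine ContinuousAt.congr (continuousAt_const (y := colF Γ φ y)) ?_
    filter_upwards [faceOf_loc Γ hy] with z hz
    unfold colF
    rw [hz.2]
  · classical
    rw [colF_eq Γ _ hy]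
    split_ifs <;> norm_num

/-- the face boundary map -/
noncomputable def DL : (Fc Γ → ZMod 2) →ₗ[ZMod 2] (G.E → ZMod 2) :=
  AddMonoidHom.toZModLinearMap 2 (AddMonoidHom.mk' (fun φ => jump Γ (colF Γ φ)) (by
    intro φ φ'
    rw [← jump_mul Γ (colF_gcol Γ φ) (colF_gcol Γ φ')]
    exact jump_congr Γ fun y hy => colF_add Γ φ φ' hy))

lemma DL_apply (φ : Fc Γ → ZMod 2) : DL Γ φ = jump Γ (colF Γ φ) := rfl

lemma DL_mem (φ : Fc Γ → ZMod 2) : DL Γ φ ∈ Zc G := jump_bd Γ (colF_gcol Γ φ)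

lemma jump_mem_range {c : S → ℂ} (hc : GCol Γ.image c) : jump Γ c ∈ LinearMap.range (DL Γ) := by
  obtain ⟨φ, hφ⟩ := exists_colF Γ hc
  exact ⟨φ, (jump_congr Γ hφ).symm⟩

lemma DL_two [DecidableEq (Fc Γ)] (e : G.E) {f g h : Fc Γ} (hfg : f ≠ g) (hfh : f ≠ h) (hgh : g ≠ h)
    (h1 : DL Γ (Pi.single f 1) e ≠ 0) (h2 : DL Γ (Pi.single g 1) e ≠ 0)
    (h3 : DL Γ (Pi.single h 1) e ≠ 0) : False := by
  have key : ∀ f, DL Γ (Pi.single f 1) e ≠ 0 →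
      ∃ᶠ y in 𝓝[(Γ.image)ᶜ] (arc Γ e (1 / 2)), faceOf Γ y = some f := by
    intro f hf
    rw [DL_apply, Ne, jump_eq_zero] at hf
    have h2 : ∀ᶠ y in 𝓝[(Γ.image)ᶜ] (arc Γ e (1 / 2)), y ∈ (Γ.image)ᶜ := self_mem_nhdsWithin
    refine ((((colF_gcol Γ (Pi.single f 1)).col _).freq hf).2.and_eventually h2).mono ?_
    rintro y ⟨hy, hy'⟩
    have hy' : y ∉ Γ.image := hy'
    rw [colF_eq Γ _ hy'] at hy
    rw [faceOf_eq Γ hy']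
    congr 1
    by_contra hne
    rw [Pi.single_eq_of_ne hne] at hy
    norm_num at hy
  refine three_values_edge Γ (e := e) (τ := 1 / 2) (by norm_num) (k := faceOf Γ) ?_
    (by simpa using hfg) (by simpa using hfh) (by simpa using hgh) (key f h1) (key g h2) (key h h3)
  intro y hy
  exact ((faceOf_loc Γ hy).mono fun z hz => hz.2).filter_mono nhdsWithin_le_nhds

variable [ConnectedSpace S]

lemma DL_ker {φ : Fc Γ → ZMod 2} (h : DL Γ φ = 0) : ∃ a, φ = fun _ => a := by
  classical
  obtain ⟨κ, hκ⟩ := const_of_jump Γ (colF_gcol Γ φ) h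
  have h01 : ∀ a : ZMod 2, a = 0 ∨ a = 1 := by decide
  refine ⟨if κ = 1 then 0 else 1, ?_⟩
  funext f
  obtain ⟨⟨y, hy⟩, rfl⟩ := ConnectedComponents.surjective_coe f
  have := hκ y hy
  have hy' : y ∉ Γ.image := hy
  rw [colF_eq Γ _ hy'] at this
  rw [← this]
  rcases h01 (φ (ConnectedComponents.mk ⟨y, hy⟩)) with h | h
  · rw [h, if_pos rfl, if_pos rfl]
  · rw [h, if_neg one_ne_zero, if_neg (by norm_num)]

lemma DL_const (a : ZMod 2) : DL Γ (fun _ => a) = 0 := by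
  classical
  funext e
  rw [DL_apply]
  show _ = (0 : ZMod 2)
  rw [jump_eq_zero]
  have h2 : ∀ᶠ y in 𝓝[(Γ.image)ᶜ] (arc Γ e (1 / 2)), y ∈ (Γ.image)ᶜ := self_mem_nhdsWithin
  refine ⟨if a = 0 then 1 else -1, h2.mono fun y hy => ?_⟩
  exact colF_eq Γ (fun _ => a) hy

instance finite_faces : Finite (Fc Γ) := by
  classical
  have h1 : Finite (LinearMap.ker (DL Γ)) := by
    have : (LinearMap.ker (DL Γ) : Set (Fc Γ → ZMod 2)).Finite := by
      refine (Set.finite_range (fun a : ZMod 2 => (fun _ : Fc Γ => a))).subset ?_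
      intro φ hφ
      obtain ⟨a, h⟩ := DL_ker Γ hφ
      exact ⟨a, h.symm⟩
    exact this
  have h2 : Finite (Fc Γ → ZMod 2) := by
    refine Set.finite_univ_iff.1 (Set.Finite.of_finite_fibers (DL Γ) (Set.toFinite _) fun z _ => ?_)
    rw [Set.univ_inter]
    rcases (DL Γ ⁻¹' {z}).eq_empty_or_nonempty with h | ⟨φ0, h0⟩
    · rw [h]; exact Set.finite_empty
    · refine (Set.Finite.image (fun φ => φ0 + φ) (Set.toFinite (LinearMap.ker (DL Γ) : Set (Fc Γ → ZMod 2)))).subset ?_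
      intro φ hφ
      refine ⟨φ - φ0, ?_, by simp⟩
      have h0 : DL Γ φ0 = z := h0
      have hφ : DL Γ φ = z := hφ
      show DL Γ (φ - φ0) = 0
      rw [map_sub, h0, hφ, sub_self]
  refine Finite.of_injective (fun f : Fc Γ => (Pi.single f 1 : Fc Γ → ZMod 2)) ?_
  intro f g h
  by_contra hne
  have := congrFun h f
  simp [Pi.single_eq_of_ne hne] at this

lemma numFaces_eq : Γ.numFaces = 1 + Module.finrank (ZMod 2) (LinearMap.range (DL Γ)) := by
  classical
  have : Fintype (Fc Γ) := Fintype.ofFinite _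
  have h1 := LinearMap.finrank_range_add_finrank_ker (DL Γ)
  rw [Module.finrank_fintype_fun_eq_card] at h1
  have hne : Nonempty (Fc Γ) := by
    obtain ⟨y, hy⟩ := (dense_compl Γ).nonempty
    exact ⟨ConnectedComponents.mk ⟨y, hy⟩⟩
  have h2 : Module.finrank (ZMod 2) (LinearMap.ker (DL Γ)) = 1 := by
    refine finrank_eq_one_iff'.2 ⟨⟨fun _ => 1, DL_const Γ 1⟩, ?_, ?_⟩
    · intro h
      have := congrFun (congrArg Subtype.val h) hne.some
      exact one_ne_zero this
    · rintro ⟨φ, hφ⟩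
      obtain ⟨a, rfl⟩ := DL_ker Γ hφ
      exact ⟨a, by ext f; simp⟩
  have : Γ.numFaces = Fintype.card (Fc Γ) := Nat.card_eq_fintype_card
  rw [this]
  omega

end surf
end NPG

namespace NPG
open Set Filter Topology

section surf
variable {G : FinGraph} {S : Type*} [TopologicalSpace S] [T2Space S]
  [ChartedSpace (EuclideanSpace ℝ (Fin 2)) S] (Γ : GraphEmb G S)

/-- `c` is a local colouring with jumps `z` -/
def GP (z : G.E → ZMod 2) (x : S) (c : S → ℂ) : Prop :=
  Col Γ.image x c ∧ ∀ᶠ q in 𝓝 x, ∀ e, q ∈ arc Γ e '' Ioo 0 1 → (Triv Γ.image q c ↔ z e = 0)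

variable {Γ} {z z' : G.E → ZMod 2} {x : S} {c c' : S → ℂ}

lemma GP.ev (h : GP Γ z x c) : ∀ᶠ y in 𝓝 x, GP Γ z y c :=
  h.1.ev.and (eventually_eventually_nhds.2 h.2)

lemma GP.congr (h : GP Γ z x c) (h' : ∀ᶠ y in 𝓝[(Γ.image)ᶜ] x, c y = c' y) : GP Γ z x c' := by
  have hop := (image_closed Γ).isOpen_compl
  have h2 : ∀ᶠ y in 𝓝 x, ∀ᶠ y' in 𝓝[(Γ.image)ᶜ] y, c y' = c' y' :=
    (isOpen_evEq Γ.image (fun y => c y = c' y)).mem_nhds h'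
  refine ⟨?_, ?_⟩
  · have h3 : ∀ᶠ y in 𝓝[(Γ.image)ᶜ] x, y ∈ (Γ.image)ᶜ := self_mem_nhdsWithin
    filter_upwards [h.1, nhdsWithin_le_nhds h2, h', h3] with y a b d e
    have b : ∀ᶠ y' in 𝓝[(Γ.image)ᶜ] y, c y' = c' y' := b
    rw [hop.nhdsWithin_eq e] at b
    exact ⟨a.1.congr b, d ▸ a.2⟩
  · filter_upwards [h.2, h2] with y a b e he
    rw [← a e he]
    exact ⟨fun t => t.congr (b.mono fun _ h => h.symm), fun t => t.congr b⟩

lemma GP.mul (h : GP Γ z x c) (h' : GP Γ z' x c') : GP Γ (z + z') x (fun y => c y * c' y) := by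
  refine ⟨h.1.mul h'.1, ?_⟩
  filter_upwards [h.2, h'.2, h.1.ev, h'.1.ev] with q a a' b b' e he
  rw [show (z + z') e = z e + z' e from rfl]
  have h1 := a e he
  have h2 := a' e he
  have h01 : ∀ a : ZMod 2, a = 0 ∨ a = 1 := by decide
  by_cases t : Triv Γ.image q c
  · rw [b.tri_mul_iff t, h1.1 t, zero_add, h2]
  · by_cases t' : Triv Γ.image q c'
    · have := b'.tri_mul_iff (c' := c) t'
      simp_rw [mul_comm (c' _)] at this
      rw [this, h2.1 t', add_zero, h1]
    · obtain ⟨τ, hτ, rfl⟩ := he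
      refine iff_of_true (pair_triv_edge Γ hτ b b' t t') ?_
      rw [((h01 _).resolve_left (mt h1.2 t)), ((h01 _).resolve_left (mt h2.2 t'))]
      rfl

lemma GP.triv (h : GP Γ 0 x c) : Triv Γ.image x c := by
  obtain ⟨ψ, hψ, rfl⟩ := exists_chart x
  rw [triv_chart hψ]
  obtain ⟨ι, _, ed, A, hS, hA, -, -⟩ := exists_star Γ hψ 0
  refine triv_of_punctured hS.dense ((col_chart hψ).1 h.1) ?_
  rw [eventually_nhdsWithin_iff]
  filter_upwards [hS.near, hψ.continuous.continuousAt.eventually h.2,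
    hψ.continuous.continuousAt.eventually h.1.ev] with y hy h2 h1 hne
  by_cases hY : y ∈ ψ ⁻¹' Γ.image
  · obtain ⟨h', t, ht, rfl⟩ := (hy hne).1 hY
    rw [← triv_chart hψ]
    have : t ≠ 0 := by rintro rfl; exact hne (hS.zero h')
    exact (h2 _ (hA h' t ⟨lt_of_le_of_ne ht.1 this.symm, ht.2⟩)).2 rfl
  · have := mem_closure_iff_nhdsWithin_neBot.1 (hS.dense y)
    have hC := (col_chart hψ).1 h1
    exact hC.triv_of_tendsto ((hC.self_of_nhdsWithin hY).1.tendsto.mono_left nhdsWithin_le_nhds)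

lemma zmod2_add_self (z : G.E → ZMod 2) : z + z = 0 := by
  funext e
  exact CharTwo.add_self_eq_zero _

lemma GP.uniq (h : GP Γ z x c) (h' : GP Γ z x c') : (c =ᶠ[𝓝[(Γ.image)ᶜ] x] c') ∨
    (c =ᶠ[𝓝[(Γ.image)ᶜ] x] fun y => - c' y) := by
  have h1 := h.mul h'
  rw [zmod2_add_self] at h1
  obtain ⟨κ, hκ⟩ := h1.triv
  have hN := neBot_compl Γ x
  obtain ⟨y, hy1, hy2, hy3⟩ := (hκ.and (h.1.and h'.1)).exists
  have hκ2 : κ ^ 2 = 1 := by rw [← hy1, mul_pow, hy2.2, hy3.2, one_mul]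
  rcases mul_self_eq_one_iff.1 ((sq _).symm.trans hκ2) with rfl | rfl
  · left
    filter_upwards [hκ, h'.1] with y a b
    linear_combination c' y * a - c y * b.2
  · right
    filter_upwards [hκ, h'.1] with y a b
    linear_combination c' y * a - c y * b.2

lemma triv_of_off (hc : Col Γ.image x c) (hx : x ∉ Γ.image) : Triv Γ.image x c := by
  have := neBot_compl Γ x
  exact hc.triv_of_tendsto ((hc.self_of_nhdsWithin hx).1.tendsto.mono_left nhdsWithin_le_nhds)

lemma edge_unique {e : G.E} {τ : ℝ} (hτ : τ ∈ Ioo (0:ℝ) 1) :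
    ∀ᶠ y in 𝓝 (arc Γ e τ), ∀ e', y ∈ (arc Γ e') '' Ioo 0 1 → e' = e := by
  filter_upwards [edge_near Γ (arc Γ e τ) one_pos] with y hy e' he'
  obtain ⟨t, ht, rfl⟩ := he'
  by_cases h : arc Γ e' t = arc Γ e τ
  · exact (arc_inj Γ ht hτ h).1
  · obtain ⟨e1, τ1, hτ1, h1, u, hu, -, h2⟩ := hy (arc_mem Γ e' (Ioo_subset_Icc_self ht)) h
    rw [← (arc_eq_arc Γ hτ1 hτ h1).1]
    exact ((arc_eq_arc Γ hu ht h2.symm).1).symm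

lemma GP.of_punctured (hc : Col Γ.image x c) (h : ∀ᶠ q in 𝓝[≠] x, ∀ e, q ∈ arc Γ e '' Ioo 0 1 →
    (Triv Γ.image q c ↔ z e = 0)) : GP Γ z x c := by
  refine ⟨hc, ?_⟩
  rw [eventually_nhdsWithin_iff] at h
  suffices hx : ∀ e, x ∈ arc Γ e '' Ioo 0 1 → (Triv Γ.image x c ↔ z e = 0) by
    filter_upwards [h] with q hq e he
    by_cases hqx : q = x
    · subst hqx; exact hx e he
    · exact hq hqx e he
  rintro e ⟨τ, hτ, rfl⟩
  constructor
  · intro ht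
    have h1 : ∀ᶠ t in 𝓝 τ, t ∈ Ioo (0:ℝ) 1 ∧ Triv Γ.image (arc Γ e t) c ∧
        (arc Γ e t ∈ ({arc Γ e τ}ᶜ : Set S) → ∀ e', arc Γ e t ∈ (arc Γ e') '' Ioo 0 1 →
          (Triv Γ.image (arc Γ e t) c ↔ z e' = 0)) :=
      Filter.Eventually.and (Ioo_mem_nhds hτ.1 hτ.2)
        (((arc_cont Γ e).continuousAt.eventually ht.ev).and ((arc_cont Γ e).continuousAt.eventually h))
    obtain ⟨t, ⟨h2, h3, h4⟩, h5⟩ := ((h1.filter_mono nhdsWithin_le_nhds).and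
      (self_mem_nhdsWithin (s := {τ}ᶜ))).exists
    refine (h4 ?_ e ⟨t, h2, rfl⟩).1 h3
    intro h6
    exact h5 (arc_inj Γ h2 hτ h6).2
  · intro hz
    obtain ⟨ψ, hψ, hp⟩ := exists_chart (arc Γ e τ)
    have hu := edge_unique (Γ := Γ) (e := e) hτ
    rw [← hp] at hc h hu ⊢
    rw [triv_chart hψ]
    refine triv_of_punctured (dense_chart Γ hψ) ((col_chart hψ).1 hc) ?_
    rw [eventually_nhdsWithin_iff]
    filter_upwards [hψ.continuous.continuousAt.eventually h, hψ.continuous.continuousAt.eventually hu,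
      hψ.continuous.continuousAt.eventually hc.ev, hψ.continuous.continuousAt.eventually
        (edge_near Γ (ψ 0) (lt_min hτ.1 (sub_pos.2 hτ.2)))] with q h1 h2 h3 h4 hq
    have hq' : ψ q ≠ ψ 0 := fun h => hq (hψ.injective h)
    rw [← triv_chart hψ]
    by_cases hY : ψ q ∈ Γ.image
    · obtain ⟨e1, τ1, hτ1, h5, u, hu1, hu2, h6⟩ := h4 hY hq'
      rw [hp] at h5
      obtain ⟨rfl, rfl⟩ := (arc_eq_arc Γ hτ1 hτ h5)
      rw [lt_min_iff, abs_lt, abs_lt] at hu2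
      exact (h1 hq' e1 ⟨u, ⟨by linarith, by linarith⟩, h6.symm⟩).2 hz
    · exact triv_of_off h3 hY

lemma GP.exi (hz : z ∈ Zc G) (x : S) : ∃ c, GP Γ z x c := by
  classical
  obtain ⟨ψ, hψ, rfl⟩ := exists_chart x
  obtain ⟨ι, _, ed, A, hS, hA, a1, a2⟩ := exists_star Γ hψ 0
  have hsum : ∑ h, z (ed h) = 0 := by
    by_cases hv : ∃ v, Γ.vmap v = ψ 0
    · obtain ⟨v, hv⟩ := hv
      rw [a1 v hv, mem_Zc.1 hz]; rfl
    · push Not at hv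
      exact a2 hv z
  have h01 : ∀ a : ZMod 2, a = 0 ∨ a = 1 := by decide
  have hz : ∀ h, z (ed h) = if h ∈ Finset.univ.filter (fun h => z (ed h) ≠ 0) then 1 else 0 := by
    intro h
    rcases h01 (z (ed h)) with h' | h' <;> simp [h']
  rw [Finset.sum_congr rfl fun h _ => hz h, Finset.sum_ite_mem, Finset.univ_inter, Finset.sum_const,
    nsmul_one, ZMod.natCast_eq_zero_iff_even] at hsum
  obtain ⟨w, w1, w2⟩ := hS.exists_col _ hsum
  have hext : (Function.extend ψ w 1) ∘ ψ = w := by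
    funext p; exact hψ.injective.extend_apply _ _ _
  refine ⟨Function.extend ψ w 1, GP.of_punctured ((col_chart hψ).2 (by rw [hext]; exact w1)) ?_⟩
  have hvx : ∀ᶠ y in 𝓝 (0:ℂ), ∀ h, ∀ t ∈ Ioc (0:ℝ) 1, A h t = y →
      (Triv (ψ ⁻¹' Γ.image) (A h t) w ↔ h ∉ Finset.univ.filter (fun h => z (ed h) ≠ 0)) := hS.small w2
  rw [eventually_nhdsWithin_iff, ← hψ.map_nhds_eq, eventually_map]
  filter_upwards [hS.near, hvx] with y h1 h2 hne e he
  have hYy : y ∈ ψ ⁻¹' Γ.image := by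
    obtain ⟨t, ht, h⟩ := he
    show ψ y ∈ Γ.image
    rw [← h]
    exact arc_mem Γ e (Ioo_subset_Icc_self ht)
  have hne : y ≠ 0 := fun h => hne (h ▸ rfl)
  obtain ⟨h, t, ht, rfl⟩ := (h1 hne).1 hYy
  have ht0 : t ≠ 0 := by rintro rfl; exact hne (hS.zero h)
  have ht1 : t ∈ Ioc (0:ℝ) 1 := ⟨lt_of_le_of_ne ht.1 ht0.symm, ht.2⟩
  rw [triv_chart hψ, hext, h2 h t ht1 rfl]
  obtain ⟨u, hu, hu1⟩ := hA h t ht1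
  obtain ⟨u', hu', hu1'⟩ := he
  rw [(arc_inj Γ hu' hu (hu1'.trans hu1.symm)).1]
  simp

end surf
end NPG

namespace NPG
open Set Filter Topology

section surf
variable {G : FinGraph} {S : Type*} [TopologicalSpace S] [T2Space S]
  [ChartedSpace (EuclideanSpace ℝ (Fin 2)) S] {Γ : GraphEmb G S}

lemma tors_chart {z : G.E → ZMod 2} (hz : z ∈ Zc G) {ψ : ℂ → S} (hψ : IsOpenEmbedding ψ) :
    Tors (ψ ⁻¹' Γ.image) (fun p w => GP Γ z (ψ p) (Function.extend ψ w 1)) := by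
  have hext : ∀ (w : ℂ → ℂ) p, Function.extend ψ w 1 (ψ p) = w p := fun w p => hψ.injective.extend_apply _ _ _
  refine ⟨?_, ?_, ?_, ?_, ?_⟩
  · intro p w w' h h'
    refine h.congr ?_
    rw [nhds_chart hψ, eventually_map]
    filter_upwards [h'] with q hq
    rw [hext, hext, hq]
  · intro p w w' h h'
    rcases h.uniq h' with h1 | h1
    · left
      rw [EventuallyEq, nhds_chart hψ, eventually_map] at h1
      filter_upwards [h1] with q hq
      rwa [hext, hext] at hq
    · right
      rw [EventuallyEq, nhds_chart hψ, eventually_map] at h1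
      filter_upwards [h1] with q hq
      rwa [hext, hext] at hq
  · intro p w h
    have h0 : GP Γ 0 (ψ p) (fun _ => -1) := by
      refine ⟨Eventually.of_forall fun y => ⟨continuousAt_const, by norm_num⟩, Eventually.of_forall fun q e _ =>
        iff_of_true ⟨-1, Eventually.of_forall fun _ => rfl⟩ rfl⟩
    have h1 := h0.mul h
    rw [zero_add] at h1
    refine h1.congr ?_
    rw [nhds_chart hψ, eventually_map]
    refine Eventually.of_forall fun q => ?_
    rw [hext, hext]; ring
  · intro p
    obtain ⟨c, hc⟩ := GP.exi (Γ := Γ) hz (ψ p)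
    refine ⟨c ∘ ψ, ?_⟩
    filter_upwards [hψ.continuous.continuousAt.eventually hc.ev] with q hq
    refine hq.congr ?_
    rw [nhds_chart hψ, eventually_map]
    refine Eventually.of_forall fun q => ?_
    rw [hext]; rfl
  · intro p w h
    have := h.1
    rw [Col, nhds_chart hψ, eventually_map] at this
    filter_upwards [this] with q hq h0
    rw [hext, h0] at hq
    norm_num at hq

lemma chart_col (Γ : GraphEmb G S) {z : G.E → ZMod 2} (hz : z ∈ Zc G) {ψ : ℂ → S} (hψ : IsOpenEmbedding ψ) :
    ∃ c : S → ℂ, ∀ y ∈ ψ '' Metric.ball 0 1, GP Γ z y c := by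
  obtain ⟨w, hw⟩ := (tors_chart (Γ := Γ) hz hψ).rect (dense_chart Γ hψ) (-1) 1 (-1) 1 (by norm_num) (by norm_num)
  refine ⟨Function.extend ψ w 1, ?_⟩
  rintro y ⟨p, hp, rfl⟩
  refine hw p ?_
  have hp : ‖p‖ < 1 := by simpa using hp
  rw [Complex.mem_reProdIm]
  exact ⟨abs_le.1 ((Complex.abs_re_le_norm p).trans hp.le), abs_le.1 ((Complex.abs_im_le_norm p).trans hp.le)⟩

lemma cover_conn {K W : Set S} (hK : IsCompact K) (hW : IsOpen W) (h : K ⊆ W) :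
    ∃ T : Finset (Set S), (∀ O ∈ T, IsPreconnected O ∧ O.Nonempty ∧ O ⊆ W) ∧ ∀ x ∈ K, ∃ O ∈ T, x ∈ O := by
  classical
  have : LocallyConnectedSpace S := ChartedSpace.locallyConnectedSpace (EuclideanSpace ℝ (Fin 2)) S
  obtain ⟨t, ht1, ht2⟩ := hK.elim_nhds_subcover (fun x => connectedComponentIn W x)
    (fun x hx => connectedComponentIn_mem_nhds (hW.mem_nhds (h hx)))
  refine ⟨t.image (fun x => connectedComponentIn W x), ?_, ?_⟩
  · intro O hO
    obtain ⟨x, hx, rfl⟩ := Finset.mem_image.1 hO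
    exact ⟨isPreconnected_connectedComponentIn, ⟨x, mem_connectedComponentIn (h (ht1 x hx))⟩,
      connectedComponentIn_subset _ _⟩
  · intro x hx
    obtain ⟨y, hy, hxy⟩ := mem_iUnion₂.1 (ht2 hx)
    exact ⟨_, Finset.mem_image_of_mem _ hy, hxy⟩

lemma compare {z : G.E → ZMod 2} {c c' : S → ℂ} {O : Set S} (hO : IsPreconnected O) (hne : O.Nonempty)
    (h : ∀ y ∈ O, GP Γ z y c) (h' : ∀ y ∈ O, GP Γ z y c') :
    ∃ κ : ℂ, ∀ y ∈ O, y ∉ Γ.image → c y * c' y = κ := by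
  obtain ⟨κ, hκ⟩ := triv_const (Y := Γ.image) (c := fun y => c y * c' y) hO hne (fun x hx => by
    have h1 := (h x hx).mul (h' x hx)
    rw [zmod2_add_self] at h1
    exact h1.triv) (fun x _ => neBot_compl Γ x)
  exact ⟨κ, fun y hy hY => (hκ y hy).self_of_nhdsWithin hY⟩

lemma GP.sq {z : G.E → ZMod 2} {c : S → ℂ} {y : S} (h : GP Γ z y c) (hy : y ∉ Γ.image) : c y ^ 2 = 1 :=
  (h.1.self_of_nhdsWithin hy).2

lemma jump_of_GP {z : G.E → ZMod 2} {c : S → ℂ} (h : ∀ y, GP Γ z y c) : z ∈ LinearMap.range (DL Γ) := by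
  have hg : GCol Γ.image c := fun y hy => (h y).1.self_of_nhdsWithin hy
  have : z = jump Γ c := by
    funext e
    have h1 : Triv Γ.image (arc Γ e (1 / 2)) c ↔ z e = 0 :=
      (h (arc Γ e (1 / 2))).2.self_of_nhds e ⟨1 / 2, by norm_num, rfl⟩
    rw [← jump_eq_zero] at h1
    have h01 : ∀ a b : ZMod 2, (a = 0 ↔ b = 0) → b = a := by decide
    exact h01 _ _ h1
  rw [this]
  exact jump_mem_range Γ hg

variable (S)

lemma exists_bound [CompactSpace S] : ∃ C : ℕ, ∀ (G : FinGraph) (Γ : GraphEmb G S),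
    Module.finrank (ZMod 2) (Zc G) ≤ Module.finrank (ZMod 2) (LinearMap.range (DL Γ)) + C := by
  classical
  choose ψ hψ hψ0 using exists_chart (S := S)
  obtain ⟨t, ht⟩ := CompactSpace.elim_nhds_subcover (fun x => ψ x '' Metric.ball 0 (1 / 2)) (fun x => by
    have := (hψ x).isOpenMap.image_mem_nhds (Metric.ball_mem_nhds (0:ℂ) (ε := 1 / 2) (by norm_num))
    rwa [hψ0] at this)
  have hT : ∀ x y : S, ∃ T : Finset (Set S), (∀ O ∈ T, IsPreconnected O ∧ O.Nonempty ∧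
      O ⊆ ψ x '' Metric.ball 0 1 ∩ ψ y '' Metric.ball 0 1) ∧
      ∀ u ∈ ψ x '' Metric.closedBall 0 (1 / 2) ∩ ψ y '' Metric.closedBall 0 (1 / 2), ∃ O ∈ T, u ∈ O := by
    intro x y
    refine cover_conn (((isCompact_closedBall _ _).image (hψ x).continuous).inter
      ((isCompact_closedBall _ _).image (hψ y).continuous))
      (((hψ x).isOpenMap _ Metric.isOpen_ball).inter ((hψ y).isOpenMap _ Metric.isOpen_ball)) ?_
    exact inter_subset_inter (image_mono (Metric.closedBall_subset_ball (by norm_num)))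
      (image_mono (Metric.closedBall_subset_ball (by norm_num)))
  choose T hT1 hT2 using hT
  let TT : Finset (Set S) := t.biUnion fun x => t.biUnion fun y => T x y
  let I := t × t × TT
  refine ⟨Fintype.card I, fun G Γ => ?_⟩
  have hc : ∀ z : Zc G, ∀ x : S, ∃ c : S → ℂ, ∀ y ∈ ψ x '' Metric.ball 0 1, GP Γ z y c :=
    fun z x => chart_col Γ z.2 (hψ x)
  choose c hc using hc
  let D : Zc G → I → Bool := fun z i => decide (∀ y ∈ (i.2.2 : Set S), y ∉ Γ.image →
    c z i.1 y * c z i.2.1 y = 1)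
  have key : ∀ z z' : Zc G, D z = D z' → (z : G.E → ZMod 2) + z' ∈ LinearMap.range (DL Γ) := by
    intro z z' hD
    have hidx : ∀ y : S, ∃ x ∈ t, y ∈ ψ x '' Metric.ball 0 (1 / 2) := by
      intro y
      have : y ∈ ⋃ x ∈ t, ψ x '' Metric.ball 0 (1 / 2) := ht ▸ mem_univ y
      simpa only [mem_iUnion, exists_prop] using this
    choose i hi1 hi2 using hidx
    have hsub : Metric.ball (0:ℂ) (1 / 2) ⊆ Metric.ball 0 1 := Metric.ball_subset_ball (by norm_num)
    have hcomp : ∀ x ∈ t, ∀ x' ∈ t, ∀ y ∈ ψ x '' Metric.ball 0 (1 / 2), y ∈ (ψ x') '' Metric.ball 0 (1 / 2) →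
        y ∉ Γ.image → c z x y * c z' x y = c z x' y * c z' x' y := by
      intro x hx x' hx' y hy hy' hY
      obtain ⟨O, hO, hyO⟩ := hT2 x x' y ⟨image_mono Metric.ball_subset_closedBall hy,
        image_mono Metric.ball_subset_closedBall hy'⟩
      obtain ⟨h1, h2, h3⟩ := hT1 x x' O hO
      have hOT : O ∈ TT := Finset.mem_biUnion.2 ⟨x, hx, Finset.mem_biUnion.2 ⟨x', hx', hO⟩⟩
      have hDO := congrFun hD (⟨x, hx⟩, ⟨x', hx'⟩, ⟨O, hOT⟩)
      have hDO : (∀ y ∈ O, y ∉ Γ.image → c z x y * c z x' y = 1) ↔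
        (∀ y ∈ O, y ∉ Γ.image → c z' x y * c z' x' y = 1) := by simpa [D] using hDO
      obtain ⟨κ, hκ⟩ := compare (Γ := Γ) h1 h2 (fun y hy => hc z x y (h3 hy).1) (fun y hy => hc z x' y (h3 hy).2)
      obtain ⟨κ', hκ'⟩ := compare (Γ := Γ) h1 h2 (fun y hy => hc z' x y (h3 hy).1) (fun y hy => hc z' x' y (h3 hy).2)
      have s1 := (hc z x y (h3 hyO).1).sq hY
      have s2 := (hc z x' y (h3 hyO).2).sq hY
      have s3 := (hc z' x y (h3 hyO).1).sq hY
      have s4 := (hc z' x' y (h3 hyO).2).sq hY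
      have e1 := hκ y hyO hY
      have e2 := hκ' y hyO hY
      have q1 : κ * κ = 1 := by rw [← e1]; linear_combination s1 * c z x' y ^ 2 + s2
      have q2 : κ' * κ' = 1 := by rw [← e2]; linear_combination s3 * c z' x' y ^ 2 + s4
      have hκκ : κ = κ' := by
        rcases mul_self_eq_one_iff.1 q1 with h | h <;> rcases mul_self_eq_one_iff.1 q2 with h' | h'
        · rw [h, h']
        · have := hDO.1 (fun y hy hY => (hκ y hy hY).trans h) y hyO hY
          rw [e2, h'] at this
          norm_num at this
        · have := hDO.2 (fun y hy hY => (hκ' y hy hY).trans h') y hyO hY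
          rw [e1, h] at this
          norm_num at this
        · rw [h, h']
      rw [← hκκ, ← e1] at e2
      linear_combination (-(c z x y * c z' x y) ) * s2 * 1 + (c z x' y * c z' x y) * 0 +
        (c z x' y * c z' x y) * (e2) * (-1) + (c z x' y * c z' x' y) * s3
    refine jump_of_GP (c := fun y => c z (i y) y * c z' (i y) y) fun y => ?_
    have h1 : GP Γ ((z : G.E → ZMod 2) + z') y (fun u => c z (i y) u * c z' (i y) u) :=
      (hc z (i y) y (image_mono hsub (hi2 y))).mul (hc z' (i y) y (image_mono hsub (hi2 y)))
    refine h1.congr ?_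
    have h2 : ∀ᶠ u in 𝓝[(Γ.image)ᶜ] y, u ∈ ψ (i y) '' Metric.ball 0 (1 / 2) :=
      nhdsWithin_le_nhds (((hψ _).isOpenMap _ Metric.isOpen_ball).mem_nhds (hi2 y))
    filter_upwards [h2, self_mem_nhdsWithin] with u hu hu'
    exact hcomp (i y) (hi1 y) (i u) (hi1 u) u hu (hi2 u) hu'
  let B := (LinearMap.range (DL Γ)).comap (Zc G).subtype
  have hinj : Function.Injective (fun q : Zc G ⧸ B => D q.out) := by
    intro q q' h
    have := key _ _ h
    rw [← Quotient.out_eq' q, ← Quotient.out_eq' q']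
    refine (Submodule.Quotient.eq B).2 ?_
    show ((Quotient.out q - Quotient.out q' : Zc G) : G.E → ZMod 2) ∈ LinearMap.range (DL Γ)
    have h5 : ((Quotient.out q - Quotient.out q' : Zc G) : G.E → ZMod 2) =
        ((Quotient.out q : Zc G) : G.E → ZMod 2) + (Quotient.out q' : Zc G) := by
      funext e
      exact CharTwo.sub_eq_add _ _
    rw [h5]
    exact this
  have h1 : Fintype.card (Zc G ⧸ B) ≤ 2 ^ Fintype.card I := by
    refine (Fintype.card_le_of_injective _ hinj).trans ?_
    simp
  rw [Module.card_eq_pow_finrank (K := ZMod 2), ZMod.card] at h1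
  have h2 := (Nat.pow_le_pow_iff_right (by norm_num)).1 h1
  have h3 := Submodule.finrank_quotient_add_finrank B
  have h4 : Module.finrank (ZMod 2) B ≤ Module.finrank (ZMod 2) (LinearMap.range (DL Γ)) := by
    refine LinearMap.finrank_le_finrank_of_injective (f := ((Zc G).subtype.comp B.subtype).codRestrict
      (LinearMap.range (DL Γ)) fun b => b.2) ?_
    intro a b h
    have h6 : ((a : Zc G) : G.E → ZMod 2) = ((b : Zc G) : G.E → ZMod 2) :=
      congrArg (fun x : ↥(LinearMap.range (DL Γ)) => (x : G.E → ZMod 2)) h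
    exact Subtype.ext (Subtype.ext h6)
  omega

end surf
end NPG

namespace NPG
open Set Filter Topology

section build
variable {G : FinGraph} {S : Type*} [TopologicalSpace S]

/-- building embeddings from arcs parametrised by reals -/
noncomputable def mkEmb (vm : G.V → S) (ar : G.E → ℝ → S) (hc : ∀ e, ContinuousOn (ar e) (Icc 0 1))
    (h0 : ∀ e, ar e 0 = vm (G.ends e).1) (h1 : ∀ e, ar e 1 = vm (G.ends e).2)
    (hv : Function.Injective vm)
    (hi : ∀ e e', ∀ t ∈ Ioo (0:ℝ) 1, ∀ t' ∈ Ioo (0:ℝ) 1, ar e t = ar e' t' → e = e' ∧ t = t')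
    (ha : ∀ e, ∀ t ∈ Ioo (0:ℝ) 1, ∀ v, ar e t ≠ vm v) : GraphEmb G S where
  vmap := vm
  emap e :=
    { toFun := fun t => ar e t
      continuous_toFun := (hc e).comp_continuous continuous_subtype_val fun t => t.2
      source' := by simpa using h0 e
      target' := by simpa using h1 e }
  vmap_injective := hv
  emap_injOn e t ht t' ht' h := Subtype.ext (hi e e t ⟨ht.1, ht.2⟩ t' ⟨ht'.1, ht'.2⟩ h).2
  emap_disjoint e e' hne t ht t' ht' h := hne (hi e e' t ⟨ht.1, ht.2⟩ t' ⟨ht'.1, ht'.2⟩ h).1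
  emap_avoid e t ht v := ha e t ⟨ht.1, ht.2⟩ v

variable {vm : G.V → S} {ar : G.E → ℝ → S} {hc : ∀ e, ContinuousOn (ar e) (Icc 0 1)}
    {h0 : ∀ e, ar e 0 = vm (G.ends e).1} {h1 : ∀ e, ar e 1 = vm (G.ends e).2}
    {hv : Function.Injective vm}
    {hi : ∀ e e', ∀ t ∈ Ioo (0:ℝ) 1, ∀ t' ∈ Ioo (0:ℝ) 1, ar e t = ar e' t' → e = e' ∧ t = t'}
    {ha : ∀ e, ∀ t ∈ Ioo (0:ℝ) 1, ∀ v, ar e t ≠ vm v}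

lemma arc_mkEmb (e : G.E) {t : ℝ} (ht : t ∈ Icc (0:ℝ) 1) : arc (mkEmb vm ar hc h0 h1 hv hi ha) e t = ar e t := by
  rw [arc_eq _ e ht]; rfl

lemma arc_mkEmb_image (e : G.E) : arc (mkEmb vm ar hc h0 h1 hv hi ha) e '' Icc 0 1 = ar e '' Icc 0 1 :=
  image_congr fun _ ht => arc_mkEmb e ht

lemma image_mkEmb : (mkEmb vm ar hc h0 h1 hv hi ha).image = range vm ∪ ⋃ e, ar e '' Icc 0 1 := by
  rw [image_eq]
  simp only [arc_mkEmb_image]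
  rfl

/-- the union of a set of components -/
def partSet {P : Type*} (Γ : GraphEmb G S) (π : G.V → P) (p : P) : Set S :=
  (Γ.vmap '' {v | π v = p}) ∪ ⋃ e ∈ {e | π (G.ends e).1 = p}, arc Γ e '' Icc 0 1

lemma mem_partSet {P : Type*} {Γ : GraphEmb G S} {π : G.V → P} {p : P} {x : S} : x ∈ partSet Γ π p ↔
    (∃ v, π v = p ∧ Γ.vmap v = x) ∨ ∃ e, π (G.ends e).1 = p ∧ x ∈ arc Γ e '' Icc 0 1 := by
  unfold partSet
  rw [mem_union, mem_iUnion₂]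
  refine or_congr Iff.rfl ?_
  exact ⟨fun ⟨e, h, h'⟩ => ⟨e, h, h'⟩, fun ⟨e, h, h'⟩ => ⟨e, h, h'⟩⟩

lemma partSet_closed [T2Space S] {P : Type*} (Γ : GraphEmb G S) (π : G.V → P) (p : P) :
    IsClosed (partSet Γ π p) := by
  refine IsClosed.union ((Set.toFinite _).isClosed) ?_
  refine Set.Finite.isClosed_biUnion (Set.toFinite _) fun e _ => ?_
  exact (isCompact_Icc.image (arc_cont Γ e)).isClosed

lemma partSet_subset {P : Type*} (Γ : GraphEmb G S) (π : G.V → P) (p : P) : partSet Γ π p ⊆ Γ.image := by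
  intro x hx
  rcases mem_partSet.1 hx with ⟨v, -, rfl⟩ | ⟨e, -, t, ht, rfl⟩
  · exact vmap_mem Γ v
  · exact arc_mem Γ e ht

lemma exists_partSet {P : Type*} {Γ : GraphEmb G S} (π : G.V → P) {x : S} (hx : x ∈ Γ.image) :
    ∃ p, x ∈ partSet Γ π p := by
  rcases image_cases Γ hx with ⟨v, rfl⟩ | ⟨e, t, ht, rfl⟩
  · exact ⟨π v, mem_partSet.2 (Or.inl ⟨v, rfl, rfl⟩)⟩
  · exact ⟨_, mem_partSet.2 (Or.inr ⟨e, rfl, t, Ioo_subset_Icc_self ht, rfl⟩)⟩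

lemma vmap_partSet {P : Type*} {Γ : GraphEmb G S} {π : G.V → P} (hπ : ∀ e, π (G.ends e).1 = π (G.ends e).2)
    {v : G.V} {p : P} (h : Γ.vmap v ∈ partSet Γ π p) : π v = p := by
  rcases mem_partSet.1 h with ⟨w, hw, h⟩ | ⟨e, he, t, ht, h⟩
  · rw [← Γ.vmap_injective h, hw]
  · rcases arc_eq_vmap Γ ht h with ⟨-, h⟩ | ⟨-, h⟩
    · rw [← h, he]
    · rw [← h, ← hπ, he]

lemma partSet_disj {P : Type*} {Γ : GraphEmb G S} {π : G.V → P} (hπ : ∀ e, π (G.ends e).1 = π (G.ends e).2)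
    {p q : P} {x : S} (h1 : x ∈ partSet Γ π p) (h2 : x ∈ partSet Γ π q) : p = q := by
  rcases image_cases Γ (partSet_subset Γ π p h1) with ⟨v, rfl⟩ | ⟨e, t, ht, rfl⟩
  · rw [← vmap_partSet hπ h1, ← vmap_partSet hπ h2]
  · have key : ∀ p, arc Γ e t ∈ partSet Γ π p → π (G.ends e).1 = p := by
      intro p h
      rcases mem_partSet.1 h with ⟨w, hw, h⟩ | ⟨e', he, t', ht', h⟩
      · exact absurd h.symm (arc_avoid Γ e ht w)
      · rw [← (arc_eq_arc Γ ht' ht h).1, he]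
    rw [← key p h1, ← key q h2]

/-- subdividing an edge -/
lemma subdivide {P : Type*} (Γ : GraphEmb G S) {π : G.V → P} (hπ : ∀ e, π (G.ends e).1 = π (G.ends e).2)
    {x : S} (hx : x ∈ Γ.image) :
    ∃ (G' : FinGraph) (Γ' : GraphEmb G' S) (π' : G'.V → P), (∀ e, π' (G'.ends e).1 = π' (G'.ends e).2) ∧
      Γ'.image = Γ.image ∧ (∀ p, partSet Γ' π' p = partSet Γ π p) ∧ x ∈ range Γ'.vmap ∧
      range Γ.vmap ⊆ range Γ'.vmap ∧
      (Fintype.card G'.V : ℤ) - Fintype.card G'.E = (Fintype.card G.V : ℤ) - Fintype.card G.E := by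
  classical
  rcases image_cases Γ hx with ⟨v, rfl⟩ | ⟨e0, τ, hτ, rfl⟩
  · exact ⟨G, Γ, π, hπ, rfl, fun _ => rfl, ⟨v, rfl⟩, Subset.rfl, rfl⟩
  let G' : FinGraph :=
    { V := Option G.V
      E := Option G.E
      ends := fun e => match e with
        | none => (none, some (G.ends e0).2)
        | some e => (some (G.ends e).1, if e = e0 then none else some (G.ends e).2) }
  let vm : G'.V → S := fun v => match v with
    | none => arc Γ e0 τ
    | some v => Γ.vmap v
  let par : G'.E → ℝ → ℝ := fun e t => match e with
    | none => τ + (1 - τ) * t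
    | some e => if e = e0 then τ * t else t
  let un : G'.E → G.E := fun e => match e with
    | none => e0
    | some e => e
  have hτ0 := hτ.1
  have hτ1 := hτ.2
  have hpar : ∀ e, ∀ t ∈ Ioo (0:ℝ) 1, par e t ∈ Ioo (0:ℝ) 1 := by
    rintro (_ | e) t ⟨ht0, ht1⟩
    · show τ + (1 - τ) * t ∈ Ioo (0:ℝ) 1
      constructor <;> nlinarith
    · show (if e = e0 then τ * t else t) ∈ Ioo (0:ℝ) 1
      split_ifs
      · constructor <;> nlinarith
      · exact ⟨ht0, ht1⟩
  have hparI : ∀ e, ∀ t ∈ Icc (0:ℝ) 1, par e t ∈ Icc (0:ℝ) 1 := by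
    rintro (_ | e) t ⟨ht0, ht1⟩
    · show τ + (1 - τ) * t ∈ Icc (0:ℝ) 1
      constructor <;> nlinarith
    · show (if e = e0 then τ * t else t) ∈ Icc (0:ℝ) 1
      split_ifs
      · constructor <;> nlinarith
      · exact ⟨ht0, ht1⟩
  have hparc : ∀ e, Continuous (par e) := by
    rintro (_ | e)
    · show Continuous fun t : ℝ => τ + (1 - τ) * t
      fun_prop
    · show Continuous fun t : ℝ => (if e = e0 then τ * t else t)
      split_ifs <;> fun_prop
  have hinj : ∀ e e', ∀ t ∈ Ioo (0:ℝ) 1, ∀ t' ∈ Ioo (0:ℝ) 1, un e = un e' → par e t = par e' t' → e = e' ∧ t = t' := by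
    rintro (_ | e) (_ | e') t ⟨ht0, ht1⟩ t' ⟨ht0', ht1'⟩ h h'
    · have h' : τ + (1 - τ) * t = τ + (1 - τ) * t' := h'
      have : (1 - τ) * (t - t') = 0 := by linarith
      rcases mul_eq_zero.1 this with h | h
      · linarith
      · exact ⟨rfl, by linarith⟩
    · have h' : τ + (1 - τ) * t = (if e' = e0 then τ * t' else t') := h'
      rw [if_pos (show e' = e0 from h.symm)] at h'
      nlinarith
    · have h' : (if e = e0 then τ * t else t) = τ + (1 - τ) * t' := h'
      rw [if_pos (show e = e0 from h)] at h'
      nlinarith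
    · have h : e = e' := h
      subst h
      have h' : (if e = e0 then τ * t else t) = (if e = e0 then τ * t' else t') := h'
      split_ifs at h'
      · exact ⟨rfl, mul_left_cancel₀ hτ0.ne' h'⟩
      · exact ⟨rfl, h'⟩
  have hne : ∀ e, ∀ t ∈ Ioo (0:ℝ) 1, un e = e0 → par e t ≠ τ := by
    rintro (_ | e) t ⟨ht0, ht1⟩ h
    · show τ + (1 - τ) * t ≠ τ
      nlinarith
    · show (if e = e0 then τ * t else t) ≠ τ
      rw [if_pos (show e = e0 from h)]
      nlinarith
  have hst : ∀ e : G.E, arc Γ e 0 = Γ.vmap (G.ends e).1 := arc_zero Γ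
  let Γ' : GraphEmb G' S := mkEmb vm (fun e t => arc Γ (un e) (par e t))
    (fun e => ((arc_cont Γ _).comp (hparc e)).continuousOn)
    (by
      rintro (_ | e)
      · show arc Γ e0 (τ + (1 - τ) * 0) = arc Γ e0 τ
        simp
      · show arc Γ e (if e = e0 then τ * 0 else 0) = Γ.vmap (G.ends e).1
        simp [arc_zero])
    (by
      rintro (_ | e)
      · show arc Γ e0 (τ + (1 - τ) * 1) = Γ.vmap (G.ends e0).2
        simp [arc_one]
      · show arc Γ e (if e = e0 then τ * 1 else 1) = vm (if e = e0 then none else some (G.ends e).2)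
        split_ifs with h
        · rw [mul_one, h]
        · exact arc_one Γ e)
    (by
      rintro (_ | v) (_ | v') h
      · rfl
      · exact absurd h (arc_avoid Γ e0 hτ v')
      · exact absurd h.symm (arc_avoid Γ e0 hτ v)
      · exact congrArg some (Γ.vmap_injective h))
    (by
      intro e e' t ht t' ht' h
      have h2 := arc_inj Γ (hpar e t ht) (hpar e' t' ht') h
      exact hinj e e' t ht t' ht' h2.1 h2.2)
    (by
      rintro e t ht (_ | v) h
      · have h2 := arc_inj Γ (hpar e t ht) hτ h
        exact hne e t ht h2.1 h2.2
      · exact arc_avoid Γ _ (hpar e t ht) v h)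
  let π' : G'.V → P := fun v => match v with
    | none => π (G.ends e0).1
    | some v => π v
  have hun : ∀ e, π' (G'.ends e).1 = π (G.ends (un e)).1 := by rintro (_ | e) <;> rfl
  have harc : ∀ e, ∀ t ∈ Icc (0:ℝ) 1, arc Γ' e t = arc Γ (un e) (par e t) := by
    intro e t ht
    rw [arc_eq _ e ht]; rfl
  have hpart : ∀ p, partSet Γ' π' p = partSet Γ π p := by
    intro p
    ext y
    rw [mem_partSet, mem_partSet]
    constructor
    · rintro (⟨_ | v, hv, rfl⟩ | ⟨e, he, t, ht, rfl⟩)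
      · exact Or.inr ⟨e0, hv, τ, Ioo_subset_Icc_self hτ, rfl⟩
      · exact Or.inl ⟨v, hv, rfl⟩
      · rw [hun] at he
        refine Or.inr ⟨un e, he, par e t, hparI e t ht, ?_⟩
        exact (harc e _ ht).symm
    · rintro (⟨v, hv, rfl⟩ | ⟨e, he, t, ht, rfl⟩)
      · exact Or.inl ⟨some v, hv, rfl⟩
      · right
        by_cases h : e = e0
        · subst h
          rcases le_total t τ with h | h
          · have h2 : t / τ ∈ Icc (0:ℝ) 1 := ⟨div_nonneg ht.1 hτ0.le, (div_le_one hτ0).2 h⟩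
            refine ⟨some e, he, t / τ, h2, ?_⟩
            refine (harc (some e) _ h2).trans ?_
            show arc Γ e (if e = e then τ * (t / τ) else (t / τ)) = _
            rw [if_pos rfl, mul_div_cancel₀ _ hτ0.ne']
          · have h2 : (t - τ) / (1 - τ) ∈ Icc (0:ℝ) 1 := ⟨div_nonneg (by linarith) (by linarith),
              (div_le_one (by linarith)).2 (by linarith [ht.2])⟩
            refine ⟨none, he, _, h2, ?_⟩
            refine (harc none _ h2).trans ?_
            show arc Γ e (τ + (1 - τ) * ((t - τ) / (1 - τ))) = _
            rw [mul_div_cancel₀ _ (by linarith)]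
            congr 1; ring
        · refine ⟨some e, he, t, ht, ?_⟩
          refine (harc (some e) _ ht).trans ?_
          show arc Γ e (if e = e0 then τ * t else t) = _
          rw [if_neg h]
  refine ⟨G', Γ', π', ?_, ?_, hpart, ⟨none, rfl⟩, ?_, ?_⟩
  · rintro (_ | e)
    · exact hπ e0
    · show π (G.ends e).1 = π' (if e = e0 then none else some (G.ends e).2)
      split_ifs with h
      · show _ = π (G.ends e0).1
        rw [h]
      · exact hπ e
  · ext y
    constructor
    · intro h
      obtain ⟨p, hp⟩ := exists_partSet π' h
      rw [hpart] at hp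
      exact partSet_subset _ _ _ hp
    · intro h
      obtain ⟨p, hp⟩ := exists_partSet π h
      rw [← hpart] at hp
      exact partSet_subset _ _ _ hp
  · rintro _ ⟨v, rfl⟩
    exact ⟨some v, rfl⟩
  · have h1 : Fintype.card G'.V = Fintype.card G.V + 1 := by
      rw [← Nat.card_eq_fintype_card, ← Nat.card_eq_fintype_card]
      exact Finite.card_option
    have h2 : Fintype.card G'.E = Fintype.card G.E + 1 := by
      rw [← Nat.card_eq_fintype_card, ← Nat.card_eq_fintype_card]
      exact Finite.card_option
    rw [h1, h2]; push_cast; ring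

end build
end NPG

namespace NPG
open Set Filter Topology

section arcs
variable {S : Type*} [TopologicalSpace S]

/-- `γ` is an arc from `x` to `y` -/
def IsArc (γ : ℝ → S) (x y : S) : Prop := Continuous γ ∧ InjOn γ (Icc 0 1) ∧ γ 0 = x ∧ γ 1 = y

lemma arc_sub {γ : ℝ → S} (hc : Continuous γ) {a b : ℝ} (hab : a < b) (hi : InjOn γ (Icc a b)) :
    IsArc (fun t => γ (a + (b - a) * t)) (γ a) (γ b) := by
  refine ⟨by fun_prop, ?_, by simp, by simp⟩
  intro t ht t' ht' h
  have h2 : ∀ t ∈ Icc (0:ℝ) 1, a + (b - a) * t ∈ Icc a b := by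
    intro t ht
    constructor <;> nlinarith [ht.1, ht.2]
  have := hi (h2 t ht) (h2 t' ht') h
  have h3 : (b - a) * t = (b - a) * t' := by linarith
  exact mul_left_cancel₀ (by linarith) h3

lemma IsArc.symm {γ : ℝ → S} {x y : S} (h : IsArc γ x y) : IsArc (fun t => γ (1 - t)) y x := by
  obtain ⟨h1, h2, h3, h4⟩ := h
  refine ⟨by fun_prop, ?_, by simpa, by simpa⟩
  intro t ht t' ht' h
  have := h2 ⟨by linarith [ht.2], by linarith [ht.1]⟩ ⟨by linarith [ht'.2], by linarith [ht'.1]⟩ h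
  linarith

lemma IsArc.concat {γ γ' : ℝ → S} {x y z : S} (h : IsArc γ x y) (h' : IsArc γ' y z)
    (hd : ∀ u ∈ Icc (0:ℝ) 1, ∀ v ∈ Icc (0:ℝ) 1, γ u = γ' v → u = 1) :
    ∃ δ, IsArc δ x z := by
  obtain ⟨h1, h2, h3, h4⟩ := h
  obtain ⟨h1', h2', h3', h4'⟩ := h'
  refine ⟨fun t => if t ≤ 1 / 2 then γ (2 * t) else γ' (2 * t - 1), ?_, ?_, ?_, ?_⟩
  · refine Continuous.if_le (by fun_prop) (by fun_prop) continuous_id continuous_const ?_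
    rintro t rfl
    norm_num [h4, h3']
  · have key : ∀ t ∈ Icc (0:ℝ) 1, ∀ t' ∈ Icc (0:ℝ) 1, t ≤ 1 / 2 → ¬ t' ≤ 1 / 2 → γ (2 * t) = γ' (2 * t' - 1) → False := by
      intro t ht t' ht' ha hb h
      push Not at hb
      have m1 : 2 * t ∈ Icc (0:ℝ) 1 := ⟨by linarith [ht.1], by linarith⟩
      have m2 : 2 * t' - 1 ∈ Icc (0:ℝ) 1 := ⟨by linarith, by linarith [ht'.2]⟩
      have e1 := hd _ m1 _ m2 h
      rw [e1, h4, ← h3'] at h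
      have := h2' ⟨le_rfl, zero_le_one⟩ m2 h
      linarith
    intro t ht t' ht' h
    dsimp only at h
    split_ifs at h with ha hb hb
    · have := h2 (show 2 * t ∈ Icc (0:ℝ) 1 from ⟨by linarith [ht.1], by linarith⟩)
        (show 2 * t' ∈ Icc (0:ℝ) 1 from ⟨by linarith [ht'.1], by linarith⟩) h
      linarith
    · exact (key t ht t' ht' ha hb h).elim
    · exact (key t' ht' t ht hb ha h.symm).elim
    · push Not at ha hb
      have := h2' (show 2 * t - 1 ∈ Icc (0:ℝ) 1 from ⟨by linarith, by linarith [ht.2]⟩)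
        (show 2 * t' - 1 ∈ Icc (0:ℝ) 1 from ⟨by linarith, by linarith [ht'.2]⟩) h
      linarith
  · norm_num [h3]
  · norm_num [h4']

/-- joined by an arc -/
def ArcJ (x y : S) : Prop := x = y ∨ ∃ γ, IsArc γ x y

lemma first_hit [T2Space S] {γ : ℝ → S} (hc : Continuous γ) {K : Set S} (hK : IsClosed K)
    {b : ℝ} (hb : 0 ≤ b) (h : γ b ∈ K) :
    ∃ t ∈ Icc 0 b, γ t ∈ K ∧ ∀ u ∈ Ico 0 t, γ u ∉ K := by
  have hcl : IsCompact (Icc 0 b ∩ γ ⁻¹' K) := isCompact_Icc.inter_right (hK.preimage hc)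
  obtain ⟨t, ht, hmin⟩ := hcl.exists_isLeast ⟨b, ⟨hb, le_rfl⟩, h⟩
  refine ⟨t, ht.1, ht.2, fun u hu hK => ?_⟩
  have := hmin ⟨⟨hu.1, hu.2.le.trans ht.1.2⟩, hK⟩
  exact absurd hu.2 (not_lt.2 this)

lemma last_hit [T2Space S] {γ : ℝ → S} (hc : Continuous γ) {K : Set S} (hK : IsClosed K)
    {b : ℝ} (hb : 0 ≤ b) (h : γ 0 ∈ K) :
    ∃ t ∈ Icc 0 b, γ t ∈ K ∧ ∀ u ∈ Ioc t b, γ u ∉ K := by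
  have hcl : IsCompact (Icc 0 b ∩ γ ⁻¹' K) := isCompact_Icc.inter_right (hK.preimage hc)
  obtain ⟨t, ht, hmax⟩ := hcl.exists_isGreatest ⟨0, ⟨le_rfl, hb⟩, h⟩
  refine ⟨t, ht.1, ht.2, fun u hu hK => ?_⟩
  have := hmax ⟨⟨ht.1.1.trans hu.1.le, hu.2⟩, hK⟩
  exact absurd hu.1 (not_lt.2 this)

lemma ArcJ.trans [T2Space S] {x y z : S} (h : ArcJ x y) (h' : ArcJ y z) : ArcJ x z := by
  rcases h with rfl | ⟨γ, hγ⟩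
  · exact h'
  rcases h' with rfl | ⟨γ', hγ'⟩
  · exact Or.inr ⟨γ, hγ⟩
  obtain ⟨h1, h2, rfl, h4⟩ := hγ
  obtain ⟨h1', h2', h3', rfl⟩ := hγ'
  have hK : IsClosed ((γ') '' Icc 0 1) := (isCompact_Icc.image h1').isClosed
  obtain ⟨t, ht, ⟨s, hs, hst⟩, hu⟩ := first_hit h1 hK zero_le_one
    (by rw [h4, ← h3']; exact ⟨0, ⟨le_rfl, zero_le_one⟩, rfl⟩)
  by_cases hs1 : s = 1
  · subst hs1
    by_cases ht0 : t = 0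
    · left; rw [hst, ht0]
    · right
      rw [hst]
      exact ⟨_, arc_sub h1 (lt_of_le_of_ne ht.1 (Ne.symm ht0)) (h2.mono (Icc_subset_Icc le_rfl ht.2))⟩
  · right
    have hs1 : s < 1 := lt_of_le_of_ne hs.2 hs1
    have b1 := arc_sub h1' hs1 (h2'.mono (Icc_subset_Icc hs.1 le_rfl))
    by_cases ht0 : t = 0
    · subst ht0
      rw [← hst]
      exact ⟨_, b1⟩
    · have b2 := arc_sub h1 (lt_of_le_of_ne ht.1 (Ne.symm ht0)) (h2.mono (Icc_subset_Icc le_rfl ht.2))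
      rw [hst] at b1
      have ht0 : 0 < t := lt_of_le_of_ne ht.1 (Ne.symm ht0)
      refine b2.concat b1 ?_
      intro u hu1 v hv h
      by_contra hne
      have hlt : u < 1 := lt_of_le_of_ne hu1.2 hne
      refine hu (0 + (t - 0) * u) ⟨by nlinarith [hu1.1], by nlinarith⟩ ?_
      exact ⟨s + (1 - s) * v, ⟨by nlinarith [hv.1, hs.1], by nlinarith [hv.2]⟩, h.symm⟩

lemma ArcJ.symm {x y : S} (h : ArcJ x y) : ArcJ y x := by
  rcases h with rfl | ⟨γ, hγ⟩
  · exact Or.inl rfl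
  · exact Or.inr ⟨_, hγ.symm⟩

lemma arcJ_all [T2Space S] [ConnectedSpace S] [ChartedSpace (EuclideanSpace ℝ (Fin 2)) S] (x y : S) : ArcJ x y := by
  refine PreconnectedSpace.induction₂' ArcJ (fun x => ?_) ⟨fun _ _ _ => ArcJ.trans⟩ x y
  obtain ⟨ψ, hψ, rfl⟩ := exists_chart x
  have : ∀ᶠ y in 𝓝 (ψ 0), y ∈ range ψ := hψ.isOpen_range.mem_nhds ⟨0, rfl⟩
  filter_upwards [this] with y hy
  obtain ⟨p, rfl⟩ := hy
  suffices h : ArcJ (ψ 0) (ψ p) from ⟨h, h.symm⟩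
  by_cases hp : p = 0
  · left; rw [hp]
  right
  refine ⟨fun t => ψ (t * p), hψ.continuous.comp (by fun_prop), ?_, by simp, by simp⟩
  intro t _ t' _ h
  have := mul_right_cancel₀ hp (hψ.injective h)
  exact_mod_cast this

end arcs

section bridge
variable {G : FinGraph} {S : Type*} [TopologicalSpace S]

lemma sum_bd (G : FinGraph) (Q : G.V → Prop) [DecidablePred Q] (z : G.E → ZMod 2) :
    ∑ v ∈ Finset.univ.filter Q, bd z v =
      ∑ e, ((if Q (G.ends e).1 then z e else 0) + (if Q (G.ends e).2 then z e else 0)) := by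
  classical
  unfold bd
  rw [Finset.sum_comm]
  refine Finset.sum_congr rfl fun e _ => ?_
  rw [Finset.sum_add_distrib, Finset.sum_ite_eq, Finset.sum_ite_eq]
  simp

/-- a free arc joining two different parts -/
lemma exists_free_arc [T2Space S] [ConnectedSpace S] [ChartedSpace (EuclideanSpace ℝ (Fin 2)) S]
    {P : Type*} [Finite P] (Γ : GraphEmb G S) {π : G.V → P}
    (hπ : ∀ e, π (G.ends e).1 = π (G.ends e).2) (hs : Function.Surjective π) {p q : P} (hpq : p ≠ q) :
    ∃ γ x y q', p ≠ q' ∧ IsArc γ x y ∧ x ∈ partSet Γ π p ∧ y ∈ partSet Γ π q' ∧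
      ∀ t ∈ Ioo (0:ℝ) 1, γ t ∉ Γ.image := by
  obtain ⟨v, hv⟩ := hs p
  obtain ⟨w, hw⟩ := hs q
  have hvw : Γ.vmap v ≠ Γ.vmap w := by
    intro h
    rw [Γ.vmap_injective h] at hv
    exact hpq (hv.symm.trans hw)
  obtain ⟨γ, h1, h2, h3, h4⟩ := (arcJ_all (Γ.vmap v) (Γ.vmap w)).resolve_left hvw
  have hK : IsClosed (⋃ q ∈ {q | p ≠ q}, partSet Γ π q) :=
    Set.Finite.isClosed_biUnion (Set.toFinite _) fun q _ => partSet_closed Γ π q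
  obtain ⟨t, ht, hb, ht2⟩ := first_hit h1 hK zero_le_one (by
    rw [h4]
    exact mem_iUnion₂.2 ⟨q, hpq, mem_partSet.2 (Or.inl ⟨w, hw, rfl⟩)⟩)
  obtain ⟨q', hq', hb⟩ := mem_iUnion₂.1 hb
  obtain ⟨s, hs1, ha, hs2⟩ := last_hit h1 (partSet_closed Γ π p) ht.1 (by
    rw [h3]; exact mem_partSet.2 (Or.inl ⟨v, hv, rfl⟩))
  have hst : s < t := by
    refine lt_of_le_of_ne hs1.2 ?_
    rintro rfl
    exact hq' (partSet_disj hπ ha hb)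
  refine ⟨_, _, _, q', hq', arc_sub h1 hst (h2.mono (Icc_subset_Icc hs1.1 ht.2)), ha, hb, ?_⟩
  intro u hu hY
  have m1 : s < s + (t - s) * u := by nlinarith [hu.1]
  have m2 : s + (t - s) * u < t := by nlinarith [hu.2]
  obtain ⟨r, hr⟩ := exists_partSet π hY
  by_cases hrp : p = r
  · subst hrp
    exact hs2 _ ⟨m1, m2.le⟩ hr
  · exact ht2 _ ⟨hs1.1.trans m1.le, m2⟩ (mem_iUnion₂.2 ⟨r, hrp, hr⟩)

/-- adding a bridge -/
lemma add_bridge [T2Space S] [ConnectedSpace S] [ChartedSpace (EuclideanSpace ℝ (Fin 2)) S]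
    {P : Type*} (Γ : GraphEmb G S) {π : G.V → P}
    (hπ : ∀ e, π (G.ends e).1 = π (G.ends e).2) {a b : G.V} (hab : π a ≠ π b) {γ : ℝ → S}
    (hγ : IsArc γ (Γ.vmap a) (Γ.vmap b)) (hfree : ∀ t ∈ Ioo (0:ℝ) 1, γ t ∉ Γ.image) :
    ∃ (E' : Type) (_ : Fintype E') (en : E' → G.V × G.V) (Γ' : GraphEmb ⟨G.V, E', en⟩ S),
      Fintype.card E' = Fintype.card G.E + 1 ∧ Γ'.numFaces ≤ Γ.numFaces ∧
      (∀ e, en e = (a, b) ∨ ∃ e0, en e = G.ends e0) := by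
  classical
  let en : Option G.E → G.V × G.V := fun e => match e with
    | none => (a, b)
    | some e => G.ends e
  let G' : FinGraph := ⟨G.V, Option G.E, en⟩
  obtain ⟨g1, g2, g3, g4⟩ := hγ
  let ar : G'.E → ℝ → S := fun e => match e with
    | none => γ
    | some e => arc Γ e
  let Γ' : GraphEmb G' S := mkEmb Γ.vmap ar
    (by rintro (_ | e); exacts [g1.continuousOn, (arc_cont Γ e).continuousOn])
    (by rintro (_ | e); exacts [g3, arc_zero Γ e])
    (by rintro (_ | e); exacts [g4, arc_one Γ e])
    Γ.vmap_injective
    (by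
      rintro (_ | e) (_ | e') t ht t' ht' h
      · exact ⟨rfl, g2 (Ioo_subset_Icc_self ht) (Ioo_subset_Icc_self ht') h⟩
      · have h : γ t = arc Γ e' t' := h
        exact absurd (h ▸ arc_mem Γ e' (Ioo_subset_Icc_self ht')) (hfree t ht)
      · have h : arc Γ e t = γ t' := h
        exact absurd (h ▸ arc_mem Γ e (Ioo_subset_Icc_self ht)) (hfree t' ht')
      · have := arc_inj Γ ht ht' h
        exact ⟨congrArg some this.1, this.2⟩)
    (by
      rintro (_ | e) t ht v h
      · have h : γ t = Γ.vmap v := h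
        exact absurd (h ▸ vmap_mem Γ v) (hfree t ht)
      · exact arc_avoid Γ e ht v h)
  have harc : ∀ e, ∀ t ∈ Icc (0:ℝ) 1, arc Γ' e t = ar e t := by
    intro e t ht
    rw [arc_eq _ e ht]; rfl
  have him : ∀ y, y ∈ Γ'.image ↔ y ∈ Γ.image ∨ ∃ t ∈ Ioo (0:ℝ) 1, y = arc Γ' none t := by
    intro y
    constructor
    · intro h
      rcases image_cases Γ' h with ⟨v, rfl⟩ | ⟨_ | e, t, ht, rfl⟩
      · exact Or.inl (vmap_mem Γ v)
      · exact Or.inr ⟨t, ht, rfl⟩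
      · left
        rw [harc _ _ (Ioo_subset_Icc_self ht)]
        exact arc_mem Γ e (Ioo_subset_Icc_self ht)
    · rintro (h | ⟨t, ht, rfl⟩)
      · rcases image_cases Γ h with ⟨v, rfl⟩ | ⟨e, t, ht, rfl⟩
        · exact vmap_mem Γ' v
        · have := harc (some e) t (Ioo_subset_Icc_self ht)
          have h2 : arc Γ' (some e) t = arc Γ e t := this
          rw [← h2]
          exact arc_mem Γ' _ (Ioo_subset_Icc_self ht)
      · exact arc_mem Γ' _ (Ioo_subset_Icc_self ht)
  refine ⟨Option G.E, inferInstance, en, Γ', Fintype.card_option, ?_, ?_⟩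
  swap
  · rintro (_ | e)
    · exact Or.inl rfl
    · exact Or.inr ⟨e, rfl⟩
  -- every colouring is trivial along the bridge
  have hbr : ∀ z ∈ Zc G', z none = 0 := by
    intro z hz
    have h1 : ∑ v ∈ Finset.univ.filter (fun v : G'.V => π v = π a), bd (G := G') z v = 0 := by
      rw [mem_Zc.1 hz]; simp
    rw [sum_bd] at h1
    have h2 : ∀ e ∈ Finset.univ, e ≠ (none : G'.E) →
        ((if π (G'.ends e).1 = π a then z e else 0) + (if π (G'.ends e).2 = π a then z e else 0)) = 0 := by
      rintro (_ | e) _ he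
      · exact absurd rfl he
      · have : π (G'.ends (some e)).1 = π (G'.ends (some e)).2 := hπ e
        rw [this]
        exact CharTwo.add_self_eq_zero _
    rw [Finset.sum_eq_single_of_mem (none : G'.E) (Finset.mem_univ _) h2] at h1
    have h3 : (G'.ends none) = (a, b) := rfl
    rw [h3, if_pos rfl, if_neg hab.symm, add_zero] at h1
    exact h1
  have hsub : (Γ'.image)ᶜ ⊆ (Γ.image)ᶜ := fun y hy h => hy ((him y).2 (Or.inl h))
  refine Nat.card_le_card_of_injective ((continuous_inclusion hsub).connectedComponentsMap) ?_
  intro f g hfg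
  obtain ⟨y, rfl⟩ := ConnectedComponents.surjective_coe f
  obtain ⟨y', rfl⟩ := ConnectedComponents.surjective_coe g
  by_contra hne
  have hcc : (ConnectedComponents.mk (inclusion hsub y)) = ConnectedComponents.mk (inclusion hsub y') := hfg
  rw [ConnectedComponents.coe_eq_coe'] at hcc
  let c := colF Γ' (Pi.single (ConnectedComponents.mk y : Fc Γ') 1)
  have hc : GCol Γ'.image c := colF_gcol Γ' _
  have hT : ∀ x ∈ Subtype.val '' connectedComponent (inclusion hsub y'), Triv Γ'.image x c := by
    rintro _ ⟨x, -, rfl⟩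
    by_cases hx : (x : S) ∈ Γ'.image
    · obtain ⟨t, ht, h⟩ := ((him _).1 hx).resolve_left x.2
      rw [h, triv_edge Γ' hc ht, ← jump_eq_zero]
      exact hbr _ (jump_bd Γ' hc)
    · exact triv_of_off (hc.col _) hx
  obtain ⟨κ, hκ⟩ := triv_const (isPreconnected_connectedComponent.image _ continuous_subtype_val.continuousOn)
    ⟨_, _, mem_connectedComponent, rfl⟩ hT (fun x _ => neBot_compl Γ' x)
  have e1 : c y = κ := (hκ _ ⟨_, hcc, rfl⟩).self_of_nhdsWithin y.2
  have e2 : c y' = κ := (hκ _ ⟨_, mem_connectedComponent, rfl⟩).self_of_nhdsWithin y'.2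
  have e3 : c y = -1 := by
    rw [show c y = _ from colF_eq Γ' _ y.2]
    rw [Pi.single_eq_same, if_neg one_ne_zero]
  have e4 : c y' = 1 := by
    rw [show c y' = _ from colF_eq Γ' _ y'.2]
    rw [if_pos]
    exact Pi.single_eq_of_ne (Ne.symm hne) _
  rw [e1, ← e2, e4] at e3
  norm_num at e3

/-- merging all parts -/
lemma merge [T2Space S] [ConnectedSpace S] [ChartedSpace (EuclideanSpace ℝ (Fin 2)) S] (n : ℕ) :
    ∀ (G : FinGraph) (Γ : GraphEmb G S) (P : Type) (_ : Finite P) (π : G.V → P),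
    (∀ e, π (G.ends e).1 = π (G.ends e).2) → Function.Surjective π → Nat.card P = n + 1 →
    ∃ (G' : FinGraph) (Γ' : GraphEmb G' S), Nonempty G'.V ∧
      (Fintype.card G'.V : ℤ) - Fintype.card G'.E + Γ'.numFaces ≤
        (Fintype.card G.V : ℤ) - Fintype.card G.E + Γ.numFaces - n := by
  classical
  induction n with
  | zero =>
    intro G Γ P _ π hπ hs hP
    have : Nonempty P := (Nat.card_pos_iff.1 (by omega)).1
    obtain ⟨v, -⟩ := hs this.some
    exact ⟨G, Γ, ⟨v⟩, by simp⟩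
  | succ n ih =>
    intro G Γ P _ π hπ hs hP
    have hnt : Nontrivial P := (Finite.one_lt_card_iff_nontrivial).1 (by omega)
    obtain ⟨p, q0, hpq0⟩ := exists_pair_ne P
    obtain ⟨γ, x, y, q, hpq, hγ, hx, hy, hfree⟩ := exists_free_arc Γ hπ hs hpq0
    obtain ⟨G1, Γ1, π1, a1, a2, a3, ⟨u1, a4⟩, a5, a6⟩ := subdivide Γ hπ (partSet_subset _ _ _ hx)
    obtain ⟨G2, Γ2, π2, b1, b2, b3, ⟨w, b4⟩, b5, b6⟩ := subdivide Γ1 a1 (x := y) (by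
      rw [a2]; exact partSet_subset _ _ _ hy)
    obtain ⟨v, hv⟩ := b5 ⟨u1, rfl⟩
    rw [a4] at hv
    have him : Γ2.image = Γ.image := b2.trans a2
    have hpt : ∀ p, partSet Γ2 π2 p = partSet Γ π p := fun p => (b3 p).trans (a3 p)
    have hvp : π2 v = p := vmap_partSet b1 (by rw [hv, hpt]; exact hx)
    have hwq : π2 w = q := vmap_partSet b1 (by rw [b4, hpt]; exact hy)
    have hs2 : Function.Surjective π2 := by
      intro r
      obtain ⟨v, hv⟩ := hs r
      have h1 : Γ.vmap v ∈ partSet Γ2 π2 r := by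
        rw [hpt]; exact mem_partSet.2 (Or.inl ⟨v, hv, rfl⟩)
      rcases mem_partSet.1 h1 with ⟨w, hw, -⟩ | ⟨e, he, -⟩
      · exact ⟨w, hw⟩
      · exact ⟨_, he⟩
    have hnf : Γ2.numFaces = Γ.numFaces := by
      unfold GraphEmb.numFaces
      rw [him]
    rw [← hv, ← b4] at hγ
    obtain ⟨E', _, en, Γ', c1, c2, c3⟩ := add_bridge Γ2 b1 (by rw [hvp, hwq]; exact hpq) hγ (by rwa [him])
    let μ : P → {r : P // r ≠ q} := fun r => if h : r = q then ⟨p, hpq⟩ else ⟨r, h⟩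
    have hμq : μ q = ⟨p, hpq⟩ := dif_pos rfl
    have hμ : ∀ r (h : r ≠ q), μ r = ⟨r, h⟩ := fun r h => dif_neg h
    have hcard : Nat.card {r : P // r ≠ q} = n + 1 := by
      have := Fintype.ofFinite P
      rw [Nat.card_eq_fintype_card] at hP ⊢
      rw [Fintype.card_subtype_compl, hP]
      simp
    obtain ⟨G', Γ'', d1, d2⟩ := ih ⟨G2.V, E', en⟩ Γ' {r : P // r ≠ q} inferInstance (fun v => μ (π2 v))
      (by
        intro e
        show μ (π2 (en e).1) = μ (π2 (en e).2)
        rcases c3 e with h | ⟨e0, h⟩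
        · rw [h, hvp, hwq, hμq, hμ p hpq]
        · rw [h, b1])
      (by
        rintro ⟨r, hr⟩
        obtain ⟨v, hv⟩ := hs2 r
        exact ⟨v, by show μ (π2 v) = _; rw [hv, hμ r hr]⟩) hcard
    refine ⟨G', Γ'', d1, d2.trans ?_⟩
    have e1 : (Fintype.card (FinGraph.mk G2.V E' en).V : ℤ) = Fintype.card G2.V := rfl
    have e2 : (Fintype.card (FinGraph.mk G2.V E' en).E : ℤ) = Fintype.card G2.E + 1 := by
      exact_mod_cast c1
    rw [e1, e2]
    rw [hnf] at c2
    push_cast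
    have : (Γ'.numFaces : ℤ) ≤ Γ.numFaces := by exact_mod_cast c2
    linarith

end bridge
end NPG

namespace NPG
open Set Filter Topology

variable {G : FinGraph}

lemma bd_def' (z : G.E → ZMod 2) (v : G.V) [DecidableEq G.V] :
    bd z v = ∑ e, ((if (G.ends e).1 = v then z e else 0) + (if (G.ends e).2 = v then z e else 0)) := by
  unfold bd
  congr!

lemma bd_single [DecidableEq G.E] [DecidableEq G.V] (e : G.E) :
    bd (Pi.single e (1 : ZMod 2)) = Pi.single (G.ends e).1 1 + Pi.single (G.ends e).2 1 := by
  funext v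
  rw [bd_def', Finset.sum_eq_single e]
  · simp only [Pi.single_eq_same, Pi.add_apply, Pi.single_apply, eq_comm]
  · intro e' _ h
    simp [Pi.single_eq_of_ne h]
  · simp

lemma adj_range [DecidableEq G.V] {v w : G.V} (h : Quot.mk G.Adj v = Quot.mk G.Adj w) :
    (Pi.single v 1 + Pi.single w 1 : G.V → ZMod 2) ∈ LinearMap.range (bdL G) := by
  classical
  have h' := Quot.eqvGen_exact h
  induction h' with
  | rel x y hxy =>
    obtain ⟨e, he | he⟩ := hxy
    · refine ⟨Pi.single e 1, ?_⟩
      show bd _ = _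
      rw [bd_single, he]
    · refine ⟨Pi.single e 1, ?_⟩
      show bd _ = _
      rw [bd_single, he, add_comm]
  | refl x =>
    have : (Pi.single x 1 + Pi.single x 1 : G.V → ZMod 2) = 0 := by
      funext v; exact CharTwo.add_self_eq_zero _
    rw [this]; exact zero_mem _
  | symm x y hxy ih =>
    rw [add_comm]; exact ih (Quot.eqvGen_sound hxy)
  | trans x y z h1 h2 i1 i2 =>
    have := add_mem (i1 (Quot.eqvGen_sound h1)) (i2 (Quot.eqvGen_sound h2))
    have e : (Pi.single x 1 + Pi.single z 1 : G.V → ZMod 2) =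
      Pi.single x 1 + Pi.single y 1 + (Pi.single y 1 + Pi.single z 1) := by
      funext v
      simp only [Pi.add_apply]
      have := CharTwo.add_self_eq_zero ((Pi.single y 1 : G.V → ZMod 2) v)
      linear_combination -this
    rw [e]; exact this

instance : Finite G.Comp := inferInstanceAs (Finite (Quot G.Adj))

lemma card_le_rank : Fintype.card G.V ≤ Module.finrank (ZMod 2) (LinearMap.range (bdL G)) + Nat.card G.Comp := by
  classical
  have := Fintype.ofFinite G.Comp
  let r : G.Comp → G.V := Quot.out
  let T : (LinearMap.range (bdL G)) × (G.Comp → ZMod 2) →ₗ[ZMod 2] (G.V → ZMod 2) :=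
    LinearMap.coprod (Submodule.subtype _) (Fintype.linearCombination (ZMod 2) (fun c => Pi.single (r c) (1:ZMod 2)))
  have hT : Function.Surjective T := by
    rw [← LinearMap.range_eq_top, eq_top_iff, ← (Pi.basisFun (ZMod 2) G.V).span_eq, Submodule.span_le]
    rintro _ ⟨v, rfl⟩
    obtain ⟨cv, hcv⟩ : ∃ cv : G.Comp, cv = Quot.mk G.Adj v := ⟨_, rfl⟩
    have h : Quot.mk G.Adj v = Quot.mk G.Adj (r cv) := by rw [← hcv]; exact (Quot.out_eq cv).symm
    refine ⟨(⟨_, adj_range h⟩, Pi.single cv 1), ?_⟩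
    simp only [T, LinearMap.coprod_apply, Submodule.subtype_apply]
    rw [Fintype.linearCombination_apply_single, one_smul, Pi.basisFun_apply]
    funext w
    simp only [Pi.add_apply]
    have := CharTwo.add_self_eq_zero ((Pi.single (r cv) 1 : G.V → ZMod 2) w)
    linear_combination this
  have := LinearMap.finrank_le_finrank_of_surjective hT
  simpa [Nat.card_eq_fintype_card] using this

lemma rank_null : Module.finrank (ZMod 2) (LinearMap.range (bdL G)) + Module.finrank (ZMod 2) (Zc G) = Fintype.card G.E := by
  have := (bdL G).finrank_range_add_finrank_ker
  rw [Module.finrank_fintype_fun_eq_card] at this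
  exact this

lemma rank_le : Module.finrank (ZMod 2) (LinearMap.range (bdL G)) ≤ Fintype.card G.V := by
  have := Submodule.finrank_le (LinearMap.range (bdL G))
  simpa using this

/-- restriction of chains to a component -/
noncomputable def res (c : G.Comp) : (G.E → ZMod 2) →ₗ[ZMod 2] ((G.componentGraph c).E → ZMod 2) :=
  LinearMap.funLeft _ _ Subtype.val

lemma comp_ends (e : G.E) : (Quot.mk G.Adj (G.ends e).1) = Quot.mk G.Adj (G.ends e).2 :=
  Quot.sound ⟨e, Or.inl rfl⟩

lemma bd_res (c : G.Comp) (z : G.E → ZMod 2) (v : (G.componentGraph c).V) : bd (res c z) v = bd z v.1 := by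
  classical
  rw [bd_def', bd_def']
  have h1 : ∀ e : G.E, (if (G.ends e).1 = v.1 then z e else 0) + (if (G.ends e).2 = v.1 then z e else 0) ≠ 0 →
      e ∈ G.componentEdges c := by
    intro e he
    have hv : Quot.mk G.Adj v.1 = c := v.2
    have := comp_ends e
    by_cases h1 : (G.ends e).1 = v.1
    · exact ⟨by show _ = _; rw [h1, hv], by show _ = _; rw [← this, h1, hv]⟩
    by_cases h2 : (G.ends e).2 = v.1
    · exact ⟨by show _ = _; rw [this, h2, hv], by show _ = _; rw [h2, hv]⟩
    simp [h1, h2] at he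
  rw [← Finset.sum_filter_of_ne (p := fun e => e ∈ G.componentEdges c) (fun e _ h => h1 e h)]
  symm
  refine Finset.sum_bij' (fun e he => (⟨e, (Finset.mem_filter.1 he).2⟩ : (G.componentGraph c).E))
    (fun e _ => e.1) ?_ ?_ ?_ ?_ ?_
  · intros; exact Finset.mem_univ _
  · intro e _; simp only [Finset.mem_filter, Finset.mem_univ, true_and]; exact e.2
  · intros; rfl
  · intros; rfl
  · intro e he
    congr 1
    · exact if_congr ⟨fun h => Subtype.ext h, fun h => congrArg Subtype.val h⟩ rfl rfl
    · exact if_congr ⟨fun h => Subtype.ext h, fun h => congrArg Subtype.val h⟩ rfl rfl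

/-- extension by zero -/
noncomputable def extz (c : G.Comp) (z : (G.componentGraph c).E → ZMod 2) (e : G.E) : ZMod 2 := by
  classical exact if h : e ∈ G.componentEdges c then z ⟨e, h⟩ else 0

lemma res_ext (c : G.Comp) (z : (G.componentGraph c).E → ZMod 2) : res c (extz c z) = z := by
  funext e
  show extz c z e.1 = z e
  rw [extz, dif_pos e.2]; rfl

lemma res_ext' {c c' : G.Comp} (h : c ≠ c') (z : (G.componentGraph c).E → ZMod 2) : res c' (extz c z) = 0 := by
  funext e
  show extz c z e.1 = 0
  rw [extz, dif_neg]
  intro h'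
  have h1 : Quot.mk G.Adj (G.ends e.1).1 = c := h'.1
  have h2 : Quot.mk G.Adj (G.ends e.1).1 = c' := e.2.1
  exact h (h1.symm.trans h2)

lemma ext_mem (c : G.Comp) {z : (G.componentGraph c).E → ZMod 2} (hz : z ∈ Zc _) : extz c z ∈ Zc G := by
  classical
  rw [mem_Zc] at hz ⊢
  funext v
  by_cases hv : v ∈ G.componentVerts c
  · have := bd_res c (extz c z) ⟨v, hv⟩
    rw [res_ext, hz] at this
    exact this.symm
  · rw [bd_def']
    refine Finset.sum_eq_zero fun e _ => ?_
    by_cases he : e ∈ G.componentEdges c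
    · have h1 : (G.ends e).1 ≠ v := fun h => hv (h ▸ he.1)
      have h2 : (G.ends e).2 ≠ v := fun h => hv (h ▸ he.2)
      simp [h1, h2]
    · simp [extz, he]

lemma res_mem (c : G.Comp) {z : G.E → ZMod 2} (hz : z ∈ Zc G) : res c z ∈ Zc _ := by
  rw [mem_Zc] at hz ⊢
  funext v
  rw [bd_res, hz]; rfl

variable {S : Type*} [TopologicalSpace S]

lemma rank_np [T2Space S] [ConnectedSpace S] [ChartedSpace (EuclideanSpace ℝ (Fin 2)) S] (Γ : GraphEmb G S)
    {N : Type*} [Finite N] (ι : N → G.Comp) (hι : Function.Injective ι)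
    (h : ∀ n, ∃ z ∈ Zc (G.componentGraph (ι n)), z ∉ (LinearMap.range (DL Γ)).map (res (ι n))) :
    Module.finrank (ZMod 2) (LinearMap.range (DL Γ)) + Nat.card N ≤ Module.finrank (ZMod 2) (Zc G) := by
  classical
  have := Fintype.ofFinite N
  choose z hz hz' using h
  let T : (LinearMap.range (DL Γ)) × (N → ZMod 2) →ₗ[ZMod 2] (G.E → ZMod 2) :=
    LinearMap.coprod (Submodule.subtype _) (Fintype.linearCombination (ZMod 2) (fun n => extz (ι n) (z n)))
  have hT : Function.Injective T := by
    rw [injective_iff_map_eq_zero]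
    rintro ⟨⟨x, hx⟩, a⟩ h0
    simp only [T, LinearMap.coprod_apply, Submodule.subtype_apply, Fintype.linearCombination_apply] at h0
    have ha : a = 0 := by
      funext n
      by_contra hn
      have hn1 : a n = 1 := by
        have : ∀ y : ZMod 2, y ≠ 0 → y = 1 := by decide
        exact this _ hn
      have := congrArg (res (ι n)) h0
      rw [map_add, map_sum, Finset.sum_eq_single n, map_smul, res_ext, hn1, one_smul, map_zero] at this
      · apply hz' n
        refine ⟨-x, neg_mem hx, ?_⟩
        rw [map_neg]
        exact (eq_neg_of_add_eq_zero_right this).symm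
      · intro m _ hm
        rw [map_smul, res_ext' (hι.ne hm), smul_zero]
      · simp
    subst ha
    simpa using h0
  have hm : ∀ x, T x ∈ Zc G := by
    rintro ⟨⟨x, ⟨φ, rfl⟩⟩, a⟩
    simp only [T, LinearMap.coprod_apply, Submodule.subtype_apply, Fintype.linearCombination_apply]
    exact add_mem (DL_mem Γ φ) (Submodule.sum_mem _ fun n _ => Submodule.smul_mem _ _ (ext_mem _ (hz n)))
  have := LinearMap.finrank_le_finrank_of_injective (f := T.codRestrict (Zc G) hm) (fun x y h => hT (congrArg Subtype.val h))
  simpa [Nat.card_eq_fintype_card] using this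

lemma exists_small [T2Space S] [ConnectedSpace S] [CompactSpace S] [ChartedSpace (EuclideanSpace ℝ (Fin 2)) S] (Γ : GraphEmb G S)
    {N : Type*} [Finite N] (ι : N → G.Comp) (hι : Function.Injective ι) [Nonempty G.V]
    (h : ∀ n, ∃ z ∈ Zc (G.componentGraph (ι n)), z ∉ (LinearMap.range (DL Γ)).map (res (ι n))) :
    ∃ (G' : FinGraph) (Γ' : GraphEmb G' S), Nonempty G'.V ∧
      (Fintype.card G'.V : ℤ) - Fintype.card G'.E + Γ'.numFaces ≤ 2 - Nat.card N := by
  have : Nonempty G.Comp := ⟨Quot.mk _ (Classical.arbitrary G.V)⟩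
  obtain ⟨n, hn⟩ : ∃ n, Nat.card G.Comp = n + 1 := ⟨Nat.card G.Comp - 1, by have := Nat.card_pos (α := G.Comp); omega⟩
  obtain ⟨G', Γ', h1, h2⟩ := merge n G Γ G.Comp inferInstance (Quot.mk G.Adj) comp_ends Quot.mk_surjective hn
  refine ⟨G', Γ', h1, h2.trans ?_⟩
  have a1 := rank_np Γ ι hι h
  have a2 := card_le_rank (G := G)
  have a3 := rank_null (G := G)
  have a4 := numFaces_eq Γ
  omega

lemma bounded [T2Space S] [ConnectedSpace S] [CompactSpace S] [ChartedSpace (EuclideanSpace ℝ (Fin 2)) S] :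
    BddBelow {z : ℤ | ∃ (G : FinGraph) (Γ : GraphEmb G S), Nonempty G.V ∧
    z = (Fintype.card G.V : ℤ) - (Fintype.card G.E : ℤ) + (Γ.numFaces : ℤ)} := by
  obtain ⟨C, hC⟩ := exists_bound S
  refine ⟨1 - C, ?_⟩
  rintro _ ⟨G, Γ, _, rfl⟩
  have a1 := hC G Γ
  have a2 := rank_le (G := G)
  have a3 := rank_null (G := G)
  have a4 := numFaces_eq Γ
  omega

lemma final_bound [T2Space S] [ConnectedSpace S] [CompactSpace S] [ChartedSpace (EuclideanSpace ℝ (Fin 2)) S] (Γ : GraphEmb G S)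
    (g : ℕ) (hg : eulerGenusClosed S = (g : ℤ))
    (h : ∀ c, ¬ G.IsPlanarComponent c → ∃ z ∈ Zc (G.componentGraph c), z ∉ (LinearMap.range (DL Γ)).map (res c)) :
    Nat.card {c : G.Comp // ¬ G.IsPlanarComponent c} ≤ g := by
  rcases isEmpty_or_nonempty G.V with hV | hV
  · have : IsEmpty G.Comp := ⟨fun c => by
      obtain ⟨v, _⟩ := Quot.mk_surjective (r := G.Adj) c
      exact hV.elim v⟩
    simp
  · obtain ⟨G', Γ', h1, h2⟩ := exists_small Γ (Subtype.val : {c : G.Comp // ¬ G.IsPlanarComponent c} → G.Comp)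
      Subtype.val_injective (fun n => h n.1 n.2)
    have h3 := csInf_le (bounded (S := S)) ⟨G', Γ', h1, rfl⟩
    have h4 : 2 - sInf _ = (g : ℤ) := hg
    omega

end NPG

namespace NPG
open Set Filter Topology

variable {K : FinGraph}

abbrev Pt (K : FinGraph) := K.V ⊕ K.E × ℝ

def inc (e : K.E) (v : K.V) : Prop := (K.ends e).1 = v ∨ (K.ends e).2 = v

def VS (H : Set K.E) : Set K.V := {v | ∃ e ∈ H, inc e v}

def pts (H : Set K.E) : Set (Pt K) :=
  {x | (∃ v ∈ VS H, x = Sum.inl v) ∨ ∃ e ∈ H, ∃ t ∈ Ioo (0:ℝ) 1, x = Sum.inr (e, t)}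

noncomputable def nrm (e : K.E) (t : ℝ) : Pt K :=
  if t ≤ 0 then Sum.inl (K.ends e).1 else if 1 ≤ t then Sum.inl (K.ends e).2 else Sum.inr (e, t)

lemma nrm_zero (e : K.E) : nrm e 0 = Sum.inl (K.ends e).1 := by simp [nrm]
lemma nrm_one (e : K.E) : nrm e 1 = Sum.inl (K.ends e).2 := by simp [nrm]
lemma nrm_mid (e : K.E) {t : ℝ} (h : t ∈ Ioo (0:ℝ) 1) : nrm e t = Sum.inr (e, t) := by
  rw [nrm, if_neg (not_le.2 h.1), if_neg (not_le.2 h.2)]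

lemma mem_VS {H : Set K.E} {v : K.V} : v ∈ VS H ↔ ∃ e ∈ H, inc e v := Iff.rfl
lemma VS_1 {H : Set K.E} {e : K.E} (h : e ∈ H) : (K.ends e).1 ∈ VS H := ⟨e, h, Or.inl rfl⟩
lemma VS_2 {H : Set K.E} {e : K.E} (h : e ∈ H) : (K.ends e).2 ∈ VS H := ⟨e, h, Or.inr rfl⟩

lemma inl_mem {H : Set K.E} {v : K.V} : (Sum.inl v : Pt K) ∈ pts H ↔ v ∈ VS H := by
  constructor
  · rintro (⟨w, hw, h⟩ | ⟨e, _, t, _, h⟩)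
    · cases h; exact hw
    · cases h
  · intro h; exact Or.inl ⟨v, h, rfl⟩

lemma inr_mem {H : Set K.E} {e : K.E} {t : ℝ} : (Sum.inr (e, t) : Pt K) ∈ pts H ↔ e ∈ H ∧ t ∈ Ioo (0:ℝ) 1 := by
  constructor
  · rintro (⟨w, hw, h⟩ | ⟨e, he, t, ht, h⟩)
    · cases h
    · cases h; exact ⟨he, ht⟩
  · rintro ⟨h, h'⟩; exact Or.inr ⟨e, h, t, h', rfl⟩

lemma nrm_mem {H : Set K.E} {e : K.E} (h : e ∈ H) {t : ℝ} (ht : t ∈ Icc (0:ℝ) 1) : nrm e t ∈ pts H := by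
  rcases eq_or_lt_of_le ht.1 with h0 | h0
  · rw [← h0, nrm_zero, inl_mem]; exact VS_1 h
  rcases eq_or_lt_of_le ht.2 with h1 | h1
  · rw [h1, nrm_one, inl_mem]; exact VS_2 h
  rw [nrm_mid e ⟨h0, h1⟩, inr_mem]; exact ⟨h, h0, h1⟩

lemma pts_cases {H : Set K.E} {x : Pt K} (h : x ∈ pts H) : ∃ e ∈ H, ∃ t ∈ Icc (0:ℝ) 1, x = nrm e t := by
  rcases h with ⟨v, ⟨e, he, h | h⟩, rfl⟩ | ⟨e, he, t, ht, rfl⟩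
  · exact ⟨e, he, 0, by simp, by rw [nrm_zero, h]⟩
  · exact ⟨e, he, 1, by simp, by rw [nrm_one, h]⟩
  · exact ⟨e, he, t, Ioo_subset_Icc_self ht, (nrm_mid e ht).symm⟩

lemma VS_mono {H H' : Set K.E} (h : H ⊆ H') : VS H ⊆ VS H' := fun _ ⟨e, he, h'⟩ => ⟨e, h he, h'⟩

lemma pts_mono {H H' : Set K.E} (h : H ⊆ H') : pts H ⊆ pts H' := by
  rintro x (⟨v, hv, rfl⟩ | ⟨e, he, t, ht, rfl⟩)
  · exact Or.inl ⟨v, VS_mono h hv, rfl⟩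
  · exact Or.inr ⟨e, h he, t, ht, rfl⟩

lemma VS_union (H H' : Set K.E) : VS (H ∪ H') = VS H ∪ VS H' := by
  ext v
  constructor
  · rintro ⟨e, he | he, h⟩
    · exact Or.inl ⟨e, he, h⟩
    · exact Or.inr ⟨e, he, h⟩
  · rintro (h | h)
    · exact VS_mono subset_union_left h
    · exact VS_mono subset_union_right h

lemma pts_union (H H' : Set K.E) : pts (H ∪ H') = pts H ∪ pts H' := by
  apply Subset.antisymm
  · intro x hx
    obtain ⟨e, he | he, t, ht, rfl⟩ := pts_cases hx
    · exact Or.inl (nrm_mem he ht)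
    · exact Or.inr (nrm_mem he ht)
  · exact union_subset (pts_mono subset_union_left) (pts_mono subset_union_right)

lemma pts_inter {H H' : Set K.E} (h : Disjoint H H') {x : Pt K} (h1 : x ∈ pts H) (h2 : x ∈ pts H') :
    ∃ v ∈ VS H ∩ VS H', x = Sum.inl v := by
  rcases h1 with ⟨v, hv, rfl⟩ | ⟨e, he, t, ht, rfl⟩
  · exact ⟨v, ⟨hv, inl_mem.1 h2⟩, rfl⟩
  · exact (Set.disjoint_left.1 h he (inr_mem.1 h2).1).elim

/-- drawing of an edge set -/
structure Dr (H : Set K.E) (D : Pt K → ℂ) : Prop where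
  inj : InjOn D (pts H)
  cont : ∀ e ∈ H, ContinuousOn (fun t => D (nrm e t)) (Icc 0 1)

lemma Dr.mono {H H' : Set K.E} {D : Pt K → ℂ} (h : Dr H' D) (hs : H ⊆ H') : Dr H D :=
  ⟨h.inj.mono (pts_mono hs), fun e he => h.cont e (hs he)⟩

lemma Dr.congr {H : Set K.E} {D D' : Pt K → ℂ} (h : Dr H D) (hs : EqOn D D' (pts H)) : Dr H D' :=
  ⟨h.inj.congr hs, fun e he => (h.cont e he).congr fun t ht => (hs (nrm_mem he ht)).symm⟩

lemma Dr.comp {H : Set K.E} {D : Pt K → ℂ} (h : Dr H D) {s : Set ℂ} (hm : MapsTo D (pts H) s) {f : ℂ → ℂ}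
    (hf : ContinuousOn f s) (hi : InjOn f s) : Dr H (f ∘ D) :=
  ⟨hi.comp h.inj hm, fun e he => hf.comp (h.cont e he) fun t ht => hm (nrm_mem he ht)⟩

lemma pts_eq (H : Set K.E) : pts H = ⋃ e ∈ H, nrm e '' Icc 0 1 := by
  ext x
  simp only [mem_iUnion, exists_prop]
  constructor
  · intro h
    obtain ⟨e, he, t, ht, rfl⟩ := pts_cases h
    exact ⟨e, he, t, ht, rfl⟩
  · rintro ⟨e, he, t, ht, rfl⟩
    exact nrm_mem he ht

lemma Dr.compact {H : Set K.E} {D : Pt K → ℂ} (h : Dr H D) : IsCompact (D '' pts H) := by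
  rw [pts_eq, image_iUnion₂]
  refine Set.Finite.isCompact_biUnion (Set.toFinite H) fun e he => ?_
  rw [← image_comp]
  exact isCompact_Icc.image_of_continuousOn (h.cont e he)

lemma Dr.union {H H' : Set K.E} {D : Pt K → ℂ} (h : Dr H D) (h' : Dr H' D)
    (hd : ∀ x ∈ pts H, ∀ y ∈ pts H', D x = D y → x = y) : Dr (H ∪ H') D := by
  refine ⟨?_, ?_⟩
  · rw [pts_union]
    rintro x (hx | hx) y (hy | hy) hxy
    · exact h.inj hx hy hxy
    · exact hd x hx y hy hxy
    · exact (hd y hy x hx hxy.symm).symm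
    · exact h'.inj hx hy hxy
  · rintro e (he | he)
    · exact h.cont e he
    · exact h'.cont e he

/-- walks -/
def Wk (x : ℕ → K.V) (p : ℕ → K.E) (n : ℕ) : Prop :=
  ∀ i < n, K.ends (p i) = (x i, x (i+1)) ∨ K.ends (p i) = (x (i+1), x i)

def eset (p : ℕ → K.E) (n : ℕ) : Set K.E := {e | ∃ i < n, p i = e}

lemma VS_eset {x : ℕ → K.V} {p : ℕ → K.E} {n : ℕ} (h : Wk x p n) {v : K.V} (hv : v ∈ VS (eset p n)) :
    ∃ i ≤ n, v = x i := by
  obtain ⟨e, ⟨i, hi, rfl⟩, h' | h'⟩ := hv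
  · rcases h i hi with h1 | h1
    · exact ⟨i, hi.le, by rw [← h', h1]⟩
    · exact ⟨i+1, hi, by rw [← h', h1]⟩
  · rcases h i hi with h1 | h1
    · exact ⟨i+1, hi, by rw [← h', h1]⟩
    · exact ⟨i, hi.le, by rw [← h', h1]⟩

lemma mem_VS_eset {x : ℕ → K.V} {p : ℕ → K.E} {n : ℕ} (h : Wk x p n) (hn : 0 < n) {i : ℕ} (hi : i ≤ n) :
    x i ∈ VS (eset p n) := by
  rcases Nat.lt_or_ge i n with h1 | h1
  · rcases h i h1 with h2 | h2
    · exact ⟨p i, ⟨i, h1, rfl⟩, Or.inl (by rw [h2])⟩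
    · exact ⟨p i, ⟨i, h1, rfl⟩, Or.inr (by rw [h2])⟩
  · obtain ⟨j, rfl⟩ : ∃ j, i = j + 1 := ⟨i - 1, by omega⟩
    have h1 : j < n := by omega
    rcases h j h1 with h2 | h2
    · exact ⟨p j, ⟨j, h1, rfl⟩, Or.inr (by rw [h2])⟩
    · exact ⟨p j, ⟨j, h1, rfl⟩, Or.inl (by rw [h2])⟩

/-- drawing a walk along a curve -/
lemma path_model {x : ℕ → K.V} {p : ℕ → K.E} {n : ℕ} (hw : Wk x p n) (hn : 0 < n)
    (hx : InjOn x (Iio n)) (hp : InjOn p (Iio n)) {γ : ℝ → ℂ} (hγ : ContinuousOn γ (Icc 0 n))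
    (hi1 : InjOn γ (Ico 0 n))
    (hc : (x n = x 0 ∧ γ n = γ 0) ∨ (InjOn γ (Icc 0 n) ∧ InjOn x (Iic n)))
    (base : Pt K → ℂ) (h0 : base (Sum.inl (x 0)) = γ 0) (hb : base (Sum.inl (x n)) = γ n) :
    ∃ D : Pt K → ℂ, (∀ v, (∀ i, 0 < i → i < n → v ≠ x i) → D (Sum.inl v) = base (Sum.inl v)) ∧
      (∀ e, e ∉ eset p n → ∀ t, D (Sum.inr (e, t)) = base (Sum.inr (e, t))) ∧
      Dr (eset p n) D ∧ (∀ i ≤ n, D (Sum.inl (x i)) = γ i) ∧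
      D '' pts (eset p n) = γ '' Icc 0 n := by
  classical
  let D : Pt K → ℂ := fun y => match y with
    | Sum.inl v => if h : ∃ i, 0 < i ∧ i < n ∧ v = x i then γ (h.choose) else base (Sum.inl v)
    | Sum.inr (e, t) => if h : ∃ i, i < n ∧ p i = e then
        (if K.ends e = (x h.choose, x (h.choose + 1)) then γ (h.choose + t) else γ (h.choose + (1 - t)))
        else base (Sum.inr (e, t))
  have d1 : ∀ i, 0 < i → i < n → D (Sum.inl (x i)) = γ i := by
    intro i h1 h2
    have h : ∃ j, 0 < j ∧ j < n ∧ x i = x j := ⟨i, h1, h2, rfl⟩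
    have e : h.choose = i := (hx h2 h.choose_spec.2.1 h.choose_spec.2.2).symm
    show (if h : _ then _ else _) = _
    rw [dif_pos h, e]
  have d2 : ∀ v, (∀ i, 0 < i → i < n → v ≠ x i) → D (Sum.inl v) = base (Sum.inl v) := by
    intro v hv
    show (if h : _ then _ else _) = _
    rw [dif_neg]
    rintro ⟨i, h1, h2, h3⟩
    exact hv i h1 h2 h3
  have d3 : ∀ i < n, (K.ends (p i) = (x i, x (i+1)) ∧ ∀ t, D (Sum.inr (p i, t)) = γ (i + t)) ∨
      (K.ends (p i) = (x (i+1), x i) ∧ ∀ t, D (Sum.inr (p i, t)) = γ (i + (1 - t))) := by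
    intro i hi
    have h : ∃ j, j < n ∧ p j = p i := ⟨i, hi, rfl⟩
    have e : h.choose = i := hp h.choose_spec.1 hi h.choose_spec.2
    by_cases h' : K.ends (p i) = (x i, x (i+1))
    · refine Or.inl ⟨h', fun t => ?_⟩
      show (if h : _ then _ else _) = _
      rw [dif_pos h, e, if_pos h']
    · refine Or.inr ⟨(hw i hi).resolve_left h', fun t => ?_⟩
      show (if h : _ then _ else _) = _
      rw [dif_pos h, e, if_neg h']
  have hI : ∀ i, 0 < i → i < n → x i ≠ x 0 := fun i h1 h2 h => by
    have := hx h2 (show 0 < n from hn) h; omega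
  have hN : ∀ i, 0 < i → i < n → x i ≠ x n := fun i h1 h2 h => by
    rcases hc with h' | h'
    · exact hI i h1 h2 (h.trans h'.1)
    · have := h'.2 (show i ≤ n from h2.le) (show n ≤ n from le_rfl) h; omega
  have d4 : ∀ i ≤ n, D (Sum.inl (x i)) = γ i := by
    intro i hi
    rcases Nat.eq_zero_or_pos i with rfl | h1
    · rw [d2 _ fun j a b => (hI j a b).symm, h0, Nat.cast_zero]
    rcases Nat.lt_or_ge i n with h2 | h2
    · exact d1 i h1 h2
    · obtain rfl : i = n := by omega
      rw [d2 _ fun j a b => (hN j a b).symm, hb]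
  have d5 : ∀ i < n, (∀ t ∈ Icc (0:ℝ) 1, D (nrm (p i) t) = γ (i + t)) ∨
      (∀ t ∈ Icc (0:ℝ) 1, D (nrm (p i) t) = γ (i + (1 - t))) := by
    intro i hi
    rcases d3 i hi with ⟨h1, h2⟩ | ⟨h1, h2⟩
    · left
      intro t ht
      rcases eq_or_lt_of_le ht.1 with a | a
      · rw [← a, nrm_zero, h1, d4 i hi.le, add_zero]
      rcases eq_or_lt_of_le ht.2 with b | b
      · rw [b, nrm_one, h1, d4 _ hi]; push_cast; rfl
      · rw [nrm_mid _ ⟨a, b⟩, h2]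
    · right
      intro t ht
      rcases eq_or_lt_of_le ht.1 with a | a
      · rw [← a, nrm_zero, h1, d4 _ hi]; push_cast; rw [sub_zero]
      rcases eq_or_lt_of_le ht.2 with b | b
      · rw [b, nrm_one, h1, d4 _ hi.le, sub_self, add_zero]
      · rw [nrm_mid _ ⟨a, b⟩, h2]
  have hcast : ∀ i < n, (i : ℝ) + 1 ≤ n := fun i hi => by exact_mod_cast hi
  have hmapI : ∀ i < n, ∀ t ∈ Icc (0:ℝ) 1, (i + t : ℝ) ∈ Icc (0:ℝ) n := fun i hi t ht =>
    ⟨add_nonneg (Nat.cast_nonneg _) ht.1, by have := hcast i hi; linarith [ht.2]⟩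
  have hflip : ∀ t : ℝ, t ∈ Icc (0:ℝ) 1 → 1 - t ∈ Icc (0:ℝ) 1 := fun t ht => ⟨by linarith [ht.2], by linarith [ht.1]⟩
  -- positions
  have d6 : ∀ y ∈ pts (eset p n), (∃ i < n, y = Sum.inl (x i) ∧ D y = γ i) ∨ (y = Sum.inl (x n) ∧ D y = γ n) ∨
      ∃ i < n, ∃ s ∈ Ioo (0:ℝ) 1, D y = γ (i + s) ∧
        ((K.ends (p i) = (x i, x (i+1)) ∧ y = Sum.inr (p i, s)) ∨ 
          (K.ends (p i) ≠ (x i, x (i+1)) ∧ y = Sum.inr (p i, 1 - s))) := by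
    rintro y (⟨v, hv, rfl⟩ | ⟨e, ⟨i, hi, rfl⟩, t, ht, rfl⟩)
    · obtain ⟨i, hi, rfl⟩ := VS_eset hw hv
      rcases Nat.lt_or_ge i n with h2 | h2
      · exact Or.inl ⟨i, h2, rfl, d4 i hi⟩
      · obtain rfl : i = n := by omega
        exact Or.inr (Or.inl ⟨rfl, d4 _ hi⟩)
    · right; right
      by_cases h' : K.ends (p i) = (x i, x (i+1))
      · refine ⟨i, hi, t, ht, ?_, Or.inl ⟨h', rfl⟩⟩
        have h : ∃ j, j < n ∧ p j = p i := ⟨i, hi, rfl⟩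
        have e : h.choose = i := hp h.choose_spec.1 hi h.choose_spec.2
        show (if h : _ then _ else _) = _
        rw [dif_pos h, e, if_pos h']
      · refine ⟨i, hi, 1 - t, ⟨by linarith [ht.2], by linarith [ht.1]⟩, ?_, Or.inr ⟨h', by rw [sub_sub_cancel]⟩⟩
        have h : ∃ j, j < n ∧ p j = p i := ⟨i, hi, rfl⟩
        have e : h.choose = i := hp h.choose_spec.1 hi h.choose_spec.2
        show (if h : _ then _ else _) = _
        rw [dif_pos h, e, if_neg h']
  have hIco : ∀ i < n, ∀ s ∈ Ioo (0:ℝ) 1, (i + s : ℝ) ∈ Ico (0:ℝ) n := fun i hi t ht =>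
    ⟨add_nonneg (Nat.cast_nonneg _) ht.1.le, by have := hcast i hi; linarith [ht.2]⟩
  have hIco' : ∀ i < n, (i : ℝ) ∈ Ico (0:ℝ) n := fun i hi => ⟨Nat.cast_nonneg _, by exact_mod_cast hi⟩
  have hfrac : ∀ (i j : ℕ) (s : ℝ), s ∈ Ioo (0:ℝ) 1 → (i : ℝ) + s ≠ j := by
    intro i j s hs h
    have h1 : (i : ℝ) < j := by linarith [hs.1]
    have h2 : (j : ℝ) < i + 1 := by linarith [hs.2]
    have h1' : i < j := by exact_mod_cast h1
    have h2' : j < i + 1 := by exact_mod_cast h2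
    omega
  have hfrac2 : ∀ (i j : ℕ) (s t : ℝ), s ∈ Ioo (0:ℝ) 1 → t ∈ Ioo (0:ℝ) 1 → (i : ℝ) + s = j + t → i = j ∧ s = t := by
    intro i j s t hs ht h
    have h1 : (i : ℝ) < j + 1 := by linarith [hs.1, ht.2]
    have h2 : (j : ℝ) < i + 1 := by linarith [hs.2, ht.1]
    have h1' : i < j + 1 := by exact_mod_cast h1
    have h2' : j < i + 1 := by exact_mod_cast h2
    obtain rfl : i = j := by omega
    exact ⟨rfl, by linarith⟩
  have hlast : ∀ s ∈ Ioo (0:ℝ) n, γ s = γ n → False := by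
    intro s hs h
    rcases hc with h' | h'
    · rw [h'.2] at h
      have := hi1 ⟨hs.1.le, hs.2⟩ ⟨le_rfl, by linarith [hs.1, hs.2]⟩ h
      linarith [hs.1]
    · have := h'.1 ⟨hs.1.le, hs.2.le⟩ ⟨by linarith [hs.1, hs.2], le_rfl⟩ h
      linarith [hs.2]
  have hlast' : ∀ i < n, γ i = γ n → x i = x n := by
    intro i hi h
    rcases Nat.eq_zero_or_pos i with rfl | h1
    · rcases hc with h' | h'
      · exact h'.1.symm
      · have := h'.1 ⟨by simp, by simp⟩ ⟨Nat.cast_nonneg _, le_rfl⟩ h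
        have : 0 = n := by exact_mod_cast this
        omega
    · exact (hlast i ⟨by exact_mod_cast h1, by exact_mod_cast hi⟩ h).elim
  have key : ∀ y ∈ pts (eset p n), ∀ y' ∈ pts (eset p n), D y = D y' → y = y' := by
    intro y hy y' hy' h
    rcases d6 y hy with ⟨i, hi, rfl, e1⟩ | ⟨rfl, e1⟩ | ⟨i, hi, s, hs, e1, h1⟩ <;>
    rcases d6 y' hy' with ⟨j, hj, rfl, e2⟩ | ⟨rfl, e2⟩ | ⟨j, hj, t, ht, e2, h2⟩ <;> replace h := e1.symm.trans (h.trans e2)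
    · have := hi1 (hIco' i hi) (hIco' j hj) h
      have : i = j := by exact_mod_cast this
      rw [this]
    · rw [hlast' i hi h]
    · exact (hfrac j i t ht (hi1 (hIco' i hi) (hIco j hj t ht) h).symm).elim
    · rw [hlast' j hj h.symm]
    · rfl
    · exact (hlast _ ⟨by have := ht.1; positivity, (hIco j hj t ht).2⟩ h.symm).elim
    · exact (hfrac i j s hs (hi1 (hIco i hi s hs) (hIco' j hj) h)).elim
    · exact (hlast _ ⟨by have := hs.1; positivity, (hIco i hi s hs).2⟩ h).elim
    · obtain ⟨rfl, rfl⟩ := hfrac2 i j s t hs ht (hi1 (hIco i hi s hs) (hIco j hj t ht) h)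
      rcases h1 with ⟨a, rfl⟩ | ⟨a, rfl⟩ <;> rcases h2 with ⟨b, rfl⟩ | ⟨b, rfl⟩
      · rfl
      · exact (b a).elim
      · exact (a b).elim
      · rfl
  refine ⟨D, d2, ?_, ⟨fun y hy y' hy' h => key y hy y' hy' h, ?_⟩, d4, ?_⟩
  · intro e he t
    show (if h : _ then _ else _) = _
    exact dif_neg he
  · rintro e ⟨i, hi, rfl⟩
    rcases d5 i hi with h | h
    · refine ContinuousOn.congr (f := fun t : ℝ => γ (i + t)) ?_ h
      exact hγ.comp (by fun_prop) fun t ht => hmapI i hi t ht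
    · refine ContinuousOn.congr (f := fun t : ℝ => γ (i + (1 - t))) ?_ h
      exact hγ.comp (by fun_prop) fun t ht => hmapI i hi _ (hflip t ht)
  · apply Subset.antisymm
    · rintro _ ⟨y, hy, rfl⟩
      obtain ⟨e, ⟨i, hi, rfl⟩, t, ht, rfl⟩ := pts_cases hy
      rcases d5 i hi with h | h
      · rw [h t ht]; exact ⟨_, hmapI i hi t ht, rfl⟩
      · rw [h t ht]; exact ⟨_, hmapI i hi _ (hflip t ht), rfl⟩
    · rintro _ ⟨s, hs, rfl⟩
      have hs0 := hs.1
      obtain ⟨i, hi, hi1, hi2⟩ : ∃ i < n, (i:ℝ) ≤ s ∧ s ≤ i + 1 := by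
        rcases eq_or_lt_of_le hs.2 with h | h
        · obtain ⟨j, rfl⟩ : ∃ j, n = j + 1 := ⟨n - 1, by omega⟩
          exact ⟨j, by omega, by rw [h]; push_cast; linarith, by rw [h]; push_cast; linarith⟩
        · exact ⟨⌊s⌋₊, (Nat.floor_lt hs.1).2 h, Nat.floor_le hs.1, (Nat.lt_floor_add_one s).le⟩
      have ht : s - i ∈ Icc (0:ℝ) 1 := ⟨by linarith, by linarith⟩
      rcases d5 i hi with h | h
      · exact ⟨_, nrm_mem (show p i ∈ eset p n from ⟨i, hi, rfl⟩) ht, by rw [h _ ht]; ring_nf⟩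
      · exact ⟨_, nrm_mem (show p i ∈ eset p n from ⟨i, hi, rfl⟩) (hflip _ ht), by rw [h _ (hflip _ ht)]; ring_nf⟩

end NPG

namespace NPG
open Set Filter Topology

lemma disc_param {s : Set ℂ} (hc : Convex ℝ s) (hcl : IsClosed s) (hne : (interior s).Nonempty)
    (hb : Bornology.IsBounded s) : ∃ h : ℂ ≃ₜ ℂ, h '' Metric.ball 0 1 = interior s ∧
      h '' Metric.closedBall 0 1 = s ∧ h '' Metric.sphere 0 1 = frontier s := by
  obtain ⟨h, h1, h2, h3⟩ := exists_homeomorph_image_interior_closure_frontier_eq_unitBall hc hne hb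
  refine ⟨h.symm, ?_, ?_, ?_⟩
  · rw [← h1, ← image_comp]; simp
  · rw [← h2, ← image_comp, hcl.closure_eq]; simp
  · rw [← h3, ← image_comp]; simp

lemma cap_preconn {c : ℝ} (h1 : -1 ≤ c) (h2 : c ≤ 1) : IsPreconnected {z : ℂ | ‖z‖ = 1 ∧ c < z.re} := by
  have : {z : ℂ | ‖z‖ = 1 ∧ c < z.re} = (fun θ : ℝ => Complex.exp (θ * Complex.I)) '' Ioo (-Real.arccos c) (Real.arccos c) := by
    ext z
    constructor
    · rintro ⟨hz, hc⟩
      have e : Complex.exp (z.arg * Complex.I) = z := by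
        have := Complex.norm_mul_exp_arg_mul_I z
        rwa [hz, Complex.ofReal_one, one_mul] at this
      have e2 : z.re = Real.cos |z.arg| := by
        rw [Real.cos_abs, ← Complex.exp_ofReal_mul_I_re, e]
      have e3 : |z.arg| < Real.arccos c := by
        have := Real.arccos_lt_arccos h1 (e2 ▸ hc) (Real.cos_le_one _)
        rwa [Real.arccos_cos (abs_nonneg _) (Complex.abs_arg_le_pi z)] at this
      exact ⟨z.arg, abs_lt.1 e3, e⟩
    · rintro ⟨θ, hθ, rfl⟩
      refine ⟨Complex.norm_exp_ofReal_mul_I θ, ?_⟩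
      show c < (Complex.exp (θ * Complex.I)).re
      rw [Complex.exp_ofReal_mul_I_re, ← Real.cos_abs]
      have := Real.cos_lt_cos_of_nonneg_of_le_pi (abs_nonneg θ) (Real.arccos_le_pi c) (abs_lt.2 hθ)
      rwa [Real.cos_arccos h1 h2] at this
  rw [this]
  exact isPreconnected_Ioo.image _ (by fun_prop)

lemma cap_preconn' {q : ℂ} (hq : ‖q‖ = 1) {c : ℝ} (h1 : -1 ≤ c) (h2 : c ≤ 1) :
    IsPreconnected {z : ℂ | ‖z‖ = 1 ∧ c < (z * q).re} := by
  have hq0 : q ≠ 0 := by rintro rfl; simp at hq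
  have : {z : ℂ | ‖z‖ = 1 ∧ c < (z * q).re} = (fun z => z * q⁻¹) '' {z : ℂ | ‖z‖ = 1 ∧ c < z.re} := by
    ext z
    constructor
    · rintro ⟨a, b⟩
      refine ⟨z * q, ⟨by rw [norm_mul, a, hq, one_mul], b⟩, ?_⟩
      show z * q * q⁻¹ = z
      rw [mul_assoc, mul_inv_cancel₀ hq0, mul_one]
    · rintro ⟨w, ⟨a, b⟩, rfl⟩
      refine ⟨by simp [a, hq], ?_⟩
      show c < (w * q⁻¹ * q).re
      rwa [mul_assoc, inv_mul_cancel₀ hq0, mul_one]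
  rw [this]
  exact (cap_preconn h1 h2).image _ (by fun_prop)

lemma half_param {q : ℂ} (hq : ‖q‖ = 1) {c : ℝ} (h1 : -1 < c) (h2 : c < 1) :
    ∃ h : ℂ ≃ₜ ℂ, h '' Metric.ball 0 1 = {z : ℂ | ‖z‖ < 1 ∧ c < (z * q).re} ∧
      h '' Metric.sphere 0 1 = {z : ℂ | ‖z‖ ≤ 1 ∧ c ≤ (z * q).re ∧ (‖z‖ = 1 ∨ (z * q).re = c)} := by
  have hq0 : q ≠ 0 := by rintro rfl; simp at hq
  let f : ℂ → ℝ := fun z => (z * q).re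
  have hf : Continuous f := by fun_prop
  have hfo : IsOpenMap f := Complex.isOpenMap_re.comp (Homeomorph.mulRight₀ q hq0).isOpenMap
  let s : Set ℂ := Metric.closedBall 0 1 ∩ f ⁻¹' Ici c
  have hinner : interior s = Metric.ball 0 1 ∩ f ⁻¹' Ioi c := by
    rw [interior_inter, interior_closedBall _ one_ne_zero, ← hfo.preimage_interior_eq_interior_preimage hf, interior_Ici]
  have hcl : IsClosed s := Metric.isClosed_closedBall.inter (isClosed_Ici.preimage hf)
  have hconv : Convex ℝ s := by
    refine (convex_closedBall 0 1).inter ?_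
    have hl : IsLinearMap ℝ f := ⟨fun x y => by simp [f]; ring, fun r x => by simp [f]; ring⟩
    exact (convex_Ici c).is_linear_preimage hl
  have hne : (interior s).Nonempty := by
    rw [hinner]
    refine ⟨(((c + 1) / 2 : ℝ) : ℂ) * q⁻¹, ?_, ?_⟩
    · rw [mem_ball_zero_iff, norm_mul, norm_inv, hq, inv_one, mul_one, Complex.norm_real, Real.norm_eq_abs, abs_lt]
      constructor <;> linarith
    · show c < (_ * q⁻¹ * q).re
      rw [mul_assoc, inv_mul_cancel₀ hq0, mul_one, Complex.ofReal_re]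
      linarith
  obtain ⟨h, a1, a2, a3⟩ := disc_param hconv hcl hne (Metric.isBounded_closedBall.subset inter_subset_left)
  refine ⟨h, ?_, ?_⟩
  · rw [a1, hinner]
    ext z
    simp only [mem_inter_iff, mem_ball_zero_iff]
    rfl
  · rw [a3, hcl.frontier_eq, hinner]
    ext z
    simp only [Set.mem_sdiff, s, mem_inter_iff, mem_ball_zero_iff, mem_closedBall_zero_iff]
    show (‖z‖ ≤ 1 ∧ c ≤ (z*q).re) ∧ ¬ (‖z‖ < 1 ∧ c < (z*q).re) ↔ ‖z‖ ≤ 1 ∧ c ≤ (z * q).re ∧ (‖z‖ = 1 ∨ (z * q).re = c)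
    constructor
    · rintro ⟨⟨b1, b2⟩, b3⟩
      refine ⟨b1, b2, ?_⟩
      by_contra hh
      push Not at hh
      exact b3 ⟨lt_of_le_of_ne b1 hh.1, lt_of_le_of_ne b2 (Ne.symm hh.2)⟩
    · rintro ⟨b1, b2, b3⟩
      refine ⟨⟨b1, b2⟩, ?_⟩
      rintro ⟨b4, b5⟩
      rcases b3 with b3 | b3 <;> linarith

lemma chord {α β : ℂ} (hα : ‖α‖ = 1) (hβ : ‖β‖ = 1) (hne : α ≠ β) : ∃ f : ℂ → ℝ,
    IsPreconnected {z : ℂ | ‖z‖ = 1 ∧ 0 < f z} ∧ IsPreconnected {z : ℂ | ‖z‖ = 1 ∧ f z < 0} ∧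
    f α = 0 ∧ f β = 0 ∧ (∀ z, ‖z‖ = 1 → f z = 0 → z = α ∨ z = β) ∧
    (∀ z, ‖z‖ ≤ 1 ∧ f z = 0 ↔ z ∈ segment ℝ α β) ∧
    (∃ h : ℂ ≃ₜ ℂ, h '' Metric.ball 0 1 = {z : ℂ | ‖z‖ < 1 ∧ 0 < f z} ∧
      h '' Metric.sphere 0 1 = {z : ℂ | ‖z‖ ≤ 1 ∧ 0 ≤ f z ∧ (‖z‖ = 1 ∨ f z = 0)}) ∧
    (∃ h : ℂ ≃ₜ ℂ, h '' Metric.ball 0 1 = {z : ℂ | ‖z‖ < 1 ∧ f z < 0} ∧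
      h '' Metric.sphere 0 1 = {z : ℂ | ‖z‖ ≤ 1 ∧ f z ≤ 0 ∧ (‖z‖ = 1 ∨ f z = 0)}) := by
  have hd : β - α ≠ 0 := sub_ne_zero.2 hne.symm
  obtain ⟨q, hq, hq2⟩ : ∃ q : ℂ, ‖q‖ = 1 ∧ ((β - α) * q).re = 0 := by
    refine ⟨Complex.I * (starRingEnd ℂ (β - α)) / (‖β - α‖ : ℝ), ?_, ?_⟩
    · rw [norm_div, norm_mul, Complex.norm_I, RCLike.norm_conj, one_mul, Complex.norm_real, norm_norm]
      exact div_self (norm_ne_zero_iff.2 hd)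
    · have : (β - α) * (Complex.I * (starRingEnd ℂ (β - α)) / (‖β - α‖ : ℝ)) =
          ((Complex.normSq (β - α) / ‖β - α‖ : ℝ) : ℂ) * Complex.I := by
        push_cast
        rw [← Complex.mul_conj]; ring
      rw [this]; simp
  have hq0 : q ≠ 0 := by rintro rfl; simp at hq
  set c := (α * q).re with hc
  have hcβ : (β * q).re = c := by
    rw [sub_mul, Complex.sub_re] at hq2; linarith
  have sq : ∀ z : ℂ, (z * q).re ^ 2 + (z * q).im ^ 2 = ‖z‖ ^ 2 := by
    intro z
    have := Complex.normSq_add_mul_I (z*q).re (z*q).im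
    rw [Complex.re_add_im, Complex.normSq_eq_norm_sq, norm_mul, hq, mul_one] at this
    exact this.symm
  have ext' : ∀ z w : ℂ, (z * q).re = (w * q).re → (z * q).im = (w * q).im → z = w := fun z w a b =>
    mul_right_cancel₀ hq0 (Complex.ext a b)
  have hsα := sq α
  have hsβ := sq β
  rw [hα] at hsα
  rw [hβ] at hsβ
  set s := (α * q).im with hs
  have hsim : (β * q).im = -s := by
    have : (β * q).im ^ 2 = s ^ 2 := by rw [hcβ] at hsβ; linarith
    rcases sq_eq_sq_iff_eq_or_eq_neg.1 this with h | h
    · exact (hne (ext' α β hcβ.symm h.symm)).elim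
    · exact h
  have hs0 : s ≠ 0 := fun h => hne (ext' α β hcβ.symm (by rw [hsim, ← hs, h, neg_zero]))
  have hs2 : 0 < s ^ 2 := by positivity
  have c1 : c < 1 := by nlinarith
  have c2 : -1 < c := by nlinarith
  refine ⟨fun z => (z * q).re - c, ?_, ?_, sub_self _, by simp [hcβ], ?_, ?_, ?_, ?_⟩
  · simpa only [sub_pos] using cap_preconn' hq c2.le c1.le
  · have := cap_preconn' (q := -q) (by rwa [norm_neg]) (c := -c) (by linarith) (by linarith)
    convert this using 4 with z
    rw [mul_neg, Complex.neg_re, neg_lt_neg_iff, sub_neg]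
  · intro z hz h0
    have h0' : (z * q).re = c := sub_eq_zero.1 h0
    have := sq z
    rw [hz, h0'] at this
    have : (z * q).im ^ 2 = s ^ 2 := by linarith
    rcases sq_eq_sq_iff_eq_or_eq_neg.1 this with h | h
    · exact Or.inl (ext' _ _ h0' h)
    · exact Or.inr (ext' _ _ (h0'.trans hcβ.symm) (h.trans hsim.symm))
  · intro z
    constructor
    · rintro ⟨h, h0⟩
      have h0' : (z * q).re = c := sub_eq_zero.1 h0
      have h3 := sq z
      rw [h0'] at h3
      have h4 : (z * q).im ^ 2 ≤ s ^ 2 := by nlinarith [norm_nonneg z]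
      have h5 := abs_le_of_sq_le_sq' (h4.trans_eq (sq_abs s).symm) (abs_nonneg s)
      set u := (z * q).im / s with hu
      have hus : u * s = (z * q).im := div_mul_cancel₀ _ hs0
      have hu2 : u ^ 2 ≤ 1 := by
        rw [hu, div_pow]; exact (div_le_one hs2).2 h4
      have hu3 : -1 ≤ u ∧ u ≤ 1 := abs_le.1 (abs_le_one_iff_mul_self_le_one.2 (by nlinarith))
      refine ⟨(1 + u) / 2, (1 - u) / 2, by linarith, by linarith, by ring, ?_⟩
      apply ext'
      · rw [add_mul, Complex.add_re, smul_mul_assoc, smul_mul_assoc, Complex.smul_re, Complex.smul_re, ← hc, hcβ, h0']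
        simp only [smul_eq_mul]; ring
      · rw [add_mul, Complex.add_im, smul_mul_assoc, smul_mul_assoc, Complex.smul_im, Complex.smul_im, ← hs, hsim, ← hus]
        simp only [smul_eq_mul]; ring
    · rintro ⟨a, b, ha, hb, hab, rfl⟩
      constructor
      · calc ‖a • α + b • β‖ ≤ ‖a • α‖ + ‖b • β‖ := norm_add_le _ _
          _ = 1 := by rw [norm_smul, norm_smul, hα, hβ, Real.norm_of_nonneg ha, Real.norm_of_nonneg hb]; linarith
      · show ((a • α + b • β) * q).re - c = 0
        rw [add_mul, Complex.add_re, smul_mul_assoc, smul_mul_assoc, Complex.smul_re, Complex.smul_re, ← hc, hcβ]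
        simp only [smul_eq_mul]
        linear_combination c * hab
  · obtain ⟨h, h1, h2⟩ := half_param hq c2 c1
    refine ⟨h, ?_, ?_⟩
    · simpa only [sub_pos] using h1
    · simpa only [sub_nonneg, sub_eq_zero] using h2
  · obtain ⟨h, h1, h2⟩ := half_param (q := -q) (by rwa [norm_neg]) (c := -c) (by linarith) (by linarith)
    refine ⟨h, ?_, ?_⟩
    · rw [h1]
      ext z
      show ‖z‖ < 1 ∧ -c < (z * -q).re ↔ ‖z‖ < 1 ∧ (z * q).re - c < 0
      rw [mul_neg, Complex.neg_re, neg_lt_neg_iff, sub_neg]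
    · rw [h2]
      ext z
      show ‖z‖ ≤ 1 ∧ -c ≤ (z * -q).re ∧ (‖z‖ = 1 ∨ (z * -q).re = -c) ↔
        ‖z‖ ≤ 1 ∧ (z * q).re - c ≤ 0 ∧ (‖z‖ = 1 ∨ (z * q).re - c = 0)
      rw [mul_neg, Complex.neg_re, neg_le_neg_iff, sub_nonpos, neg_inj, sub_eq_zero]

end NPG

namespace NPG
open Set Filter Topology

variable {K : FinGraph}

noncomputable def chi (X : Set K.E) (e : K.E) : ZMod 2 := by
  classical exact if e ∈ X then 1 else 0

lemma chi_pos {X : Set K.E} {e : K.E} (h : e ∈ X) : chi X e = 1 := if_pos h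
lemma chi_neg {X : Set K.E} {e : K.E} (h : e ∉ X) : chi X e = 0 := if_neg h
lemma chi_ne {X : Set K.E} {e : K.E} (h : chi X e ≠ 0) : e ∈ X := by
  by_contra h'; exact h (chi_neg h')

lemma z2_cases (a : ZMod 2) : a = 0 ∨ a = 1 := by
  revert a; decide
lemma z2_ne {a : ZMod 2} (h : a ≠ 0) : a = 1 := (z2_cases a).resolve_left h
lemma z2_add_eq {a b : ZMod 2} (h : a + b = 0) : a = b := by
  revert a b; decide
lemma z2_self (a : ZMod 2) : a + a = 0 := CharTwo.add_self_eq_zero _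

lemma bd_add (z z' : K.E → ZMod 2) : bd (z + z') = bd z + bd z' := (bdL K).map_add z z'
lemma bd_zero : bd (0 : K.E → ZMod 2) = 0 := (bdL K).map_zero

lemma bd_ne {z : K.E → ZMod 2} {w : K.V} (h : bd z w ≠ 0) : ∃ e, inc e w ∧ z e ≠ 0 := by
  classical
  rw [bd_def'] at h
  obtain ⟨e, _, he⟩ := Finset.exists_ne_zero_of_sum_ne_zero h
  refine ⟨e, ?_, ?_⟩
  · by_contra hi
    have : ¬ (K.ends e).1 = w ∧ ¬ (K.ends e).2 = w := not_or.1 hi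
    simp [this.1, this.2] at he
  · intro h0; simp [h0] at he

lemma bd_other {z : K.E → ZMod 2} {w : K.V} (h : bd z w = 0) {e : K.E} (he : inc e w) (hz : z e ≠ 0)
    (hl : (K.ends e).1 ≠ (K.ends e).2) : ∃ e', e' ≠ e ∧ inc e' w ∧ z e' ≠ 0 := by
  classical
  by_contra hcon
  push Not at hcon
  rw [bd_def', Finset.sum_eq_single e] at h
  · rcases he with he | he
    · have h2 : ¬ (K.ends e).2 = w := fun h' => hl (he.trans h'.symm)
      rw [if_pos he, if_neg h2, add_zero] at h
      exact hz h
    · have h2 : ¬ (K.ends e).1 = w := fun h' => hl (h'.trans he.symm)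
      rw [if_pos he, if_neg h2, zero_add] at h
      exact hz h
  · intro e' _ hne
    by_cases hi : inc e' w
    · rw [hcon e' hne hi]; simp
    · have : ¬ (K.ends e').1 = w ∧ ¬ (K.ends e').2 = w := not_or.1 hi
      simp [this.1, this.2]
  · simp

lemma bd_eset [DecidableEq K.V] {x : ℕ → K.V} {p : ℕ → K.E} {n : ℕ} (hw : Wk x p n) (hp : InjOn p (Iio n)) :
    bd (chi (eset p n)) = Pi.single (x 0) 1 + Pi.single (x n) 1 := by
  classical
  induction n with
  | zero =>
    have : chi (eset p 0) = 0 := by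
      funext e; exact chi_neg (by rintro ⟨i, hi, _⟩; omega)
    rw [this, bd_zero]
    funext v; exact (z2_self _).symm
  | succ n ih =>
    have e1 : chi (eset p (n+1)) = chi (eset p n) + Pi.single (p n) 1 := by
      funext e
      rw [Pi.add_apply]
      by_cases h1 : e = p n
      · subst h1
        rw [Pi.single_eq_same, chi_pos (X := eset p (n+1)) (show p n ∈ eset p (n+1) from ⟨n, by omega, rfl⟩), chi_neg, zero_add]
        rintro ⟨i, hi, h⟩
        have := hp (show i < n + 1 by omega) (show n < n + 1 by omega) h
        omega
      · rw [Pi.single_eq_of_ne h1, add_zero]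
        by_cases h2 : e ∈ eset p n
        · obtain ⟨i, hi, h⟩ := h2
          rw [chi_pos (show e ∈ eset p n from ⟨i, hi, h⟩), chi_pos (show e ∈ eset p (n+1) from ⟨i, by omega, h⟩)]
        · rw [chi_neg h2, chi_neg]
          rintro ⟨i, hi, h⟩
          rcases Nat.lt_or_ge i n with h3 | h3
          · exact h2 ⟨i, h3, h⟩
          · obtain rfl : i = n := by omega
            exact h1 h.symm
    rw [e1, bd_add, ih (fun i hi => hw i (by omega)) (hp.mono fun i (hi : i < n) => show i < n + 1 by omega), bd_single]
    have e2 : (Pi.single (K.ends (p n)).1 1 + Pi.single (K.ends (p n)).2 1 : K.V → ZMod 2) =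
        Pi.single (x n) 1 + Pi.single (x (n+1)) 1 := by
      rcases hw n (by omega) with h | h
      · rw [h]
      · rw [h, add_comm]
    rw [e2]
    funext v
    simp only [Pi.add_apply]
    have := z2_self ((Pi.single (x n) 1 : K.V → ZMod 2) v)
    linear_combination this

lemma p_inj {x : ℕ → K.V} {p : ℕ → K.E} {n : ℕ} (hw : Wk x p n) (hx : InjOn x (Iic n)) : InjOn p (Iio n) := by
  intro i hi j hj h
  have hi : i < n := hi
  have hj : j < n := hj
  have hx' : ∀ a b, a ≤ n → b ≤ n → x a = x b → a = b := fun a b ha hb h => hx ha hb h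
  rcases hw i hi with h1 | h1 <;> rcases hw j hj with h2 | h2 <;> rw [h, h2, Prod.mk.injEq] at h1
  · exact hx' _ _ hi.le hj.le h1.1.symm
  · have a := hx' _ _ hj hi.le h1.1
    have b := hx' _ _ hj.le hi h1.2
    omega
  · have a := hx' _ _ hj.le hi h1.1
    have b := hx' _ _ hj hi.le h1.2
    omega
  · exact hx' _ _ hi.le hj.le h1.2.symm

def NT (C : Set K.E) : Prop := ∀ w e1 e2 e3, e1 ∈ C → e2 ∈ C → e3 ∈ C → inc e1 w → inc e2 w → inc e3 w →
  e1 ≠ e2 → e1 ≠ e3 → e2 ≠ e3 → False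

lemma chi_sdiff {C Q : Set K.E} (h : Q ⊆ C) : chi (C \ Q) = chi C + chi Q := by
  funext e
  rw [Pi.add_apply]
  by_cases h1 : e ∈ Q
  · rw [chi_pos h1, chi_pos (h h1), chi_neg (fun h' => h'.2 h1)]; rfl
  · by_cases h2 : e ∈ C
    · rw [chi_pos h2, chi_neg h1, chi_pos (show e ∈ C \ Q from ⟨h2, h1⟩), add_zero]
    · rw [chi_neg h2, chi_neg h1, chi_neg fun h' => h2 h'.1, add_zero]

lemma split {C : Set K.E} {m : Pt K → ℂ} (hC : Dr C m) (him : m '' pts C = Metric.sphere 0 1) (hNT : NT C)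
    (hloop : ∀ e ∈ C, (K.ends e).1 ≠ (K.ends e).2) (hbC : bd (chi C) = 0)
    {x : ℕ → K.V} {p : ℕ → K.E} {n : ℕ} (hw : Wk x p n) (hn : 0 < n) (hx : InjOn x (Iic n))
    (hinner : ∀ i, 0 < i → i < n → x i ∉ VS C) (hpC : ∀ i < n, p i ∉ C) {Q : Set K.E} (hQC : Q ⊆ C)
    (hbd : bd (chi (eset p n) + chi Q) = 0) :
    ∃ (D1 : Pt K → ℂ) (hQ hR : ℂ ≃ₜ ℂ), EqOn D1 m (pts C) ∧ Dr (C ∪ eset p n) D1 ∧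
      MapsTo D1 (pts (C ∪ eset p n)) (Metric.closedBall 0 1) ∧
      (∀ y ∈ pts (eset p n), D1 y ∈ Metric.ball (0:ℂ) 1 ∨ y ∈ pts C) ∧
      hQ '' Metric.ball 0 1 ⊆ Metric.ball 0 1 ∧ hR '' Metric.ball 0 1 ⊆ Metric.ball 0 1 ∧
      Disjoint (hQ '' Metric.ball 0 1) (hR '' Metric.ball 0 1) ∧
      (∀ z ∈ hQ '' Metric.ball 0 1, z ∉ D1 '' pts (C ∪ eset p n)) ∧
      (∀ z ∈ hR '' Metric.ball 0 1, z ∉ D1 '' pts (C ∪ eset p n)) ∧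
      hQ '' Metric.sphere 0 1 = D1 '' pts (eset p n ∪ Q) ∧
      hR '' Metric.sphere 0 1 = D1 '' pts (eset p n ∪ (C \ Q)) := by
  classical
  have hp := p_inj hw hx
  have hab : x 0 ≠ x n := fun h => by
    have := hx (show 0 ≤ n by omega) (show n ≤ n from le_rfl) h; omega
  have hbP := bd_eset hw hp
  have hbQ : ∀ v, bd (chi Q) v = (Pi.single (x 0) 1 + Pi.single (x n) 1 : K.V → ZMod 2) v := by
    intro v
    rw [← hbP]
    have := congrFun hbd v
    rw [bd_add] at this
    exact (z2_add_eq this).symm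
  have hbR : ∀ v, bd (chi (C \ Q)) v = bd (chi Q) v := by
    intro v
    rw [chi_sdiff hQC, bd_add, hbC, zero_add]
  have q0 : bd (chi Q) (x 0) = 1 := by rw [hbQ]; simp [hab]
  have qn : bd (chi Q) (x n) = 1 := by rw [hbQ]; simp [hab.symm]
  have vs : ∀ X : Set K.E, ∀ v, bd (chi X) v = 1 → v ∈ VS X := by
    intro X v h
    obtain ⟨e, h1, h2⟩ := bd_ne (by rw [h]; exact one_ne_zero)
    exact ⟨e, chi_ne h2, h1⟩
  have a1 := vs Q _ q0
  have b1 := vs Q _ qn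
  have a2 := vs (C \ Q) _ ((hbR _).trans q0)
  have b2 := vs (C \ Q) _ ((hbR _).trans qn)
  have aC := VS_mono hQC a1
  have bC := VS_mono hQC b1
  set α := m (Sum.inl (x 0)) with hα
  set β := m (Sum.inl (x n)) with hβ
  have nα : ‖α‖ = 1 := by
    have : α ∈ m '' pts C := ⟨_, inl_mem.2 aC, rfl⟩
    rw [him] at this; simpa using this
  have nβ : ‖β‖ = 1 := by
    have : β ∈ m '' pts C := ⟨_, inl_mem.2 bC, rfl⟩
    rw [him] at this; simpa using this
  have hαβ : α ≠ β := fun h => hab (Sum.inl_injective (hC.inj (inl_mem.2 aC) (inl_mem.2 bC) h))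
  -- drawing
  have hn' : (0:ℝ) < n := by exact_mod_cast hn
  let γ : ℝ → ℂ := fun s => AffineMap.lineMap α β (s / n)
  have γ0 : γ 0 = α := by simp [γ]
  have γn : γ n = β := by simp [γ, hn'.ne']
  have γinj : InjOn γ (Icc 0 n) := by
    intro s _ t _ h
    have := AffineMap.lineMap_injective ℝ hαβ h
    field_simp at this
    exact this
  have γim : γ '' Icc 0 n = segment ℝ α β := by
    rw [segment_eq_image_lineMap]
    ext z
    constructor
    · rintro ⟨s, hs, rfl⟩
      exact ⟨s / n, ⟨by have := hs.1; positivity, (div_le_one hn').2 hs.2⟩, rfl⟩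
    · rintro ⟨s, hs, rfl⟩
      refine ⟨s * n, ⟨by have := hs.1; positivity, by nlinarith [hs.2]⟩, ?_⟩
      simp [γ, hn'.ne']
  have γc : ContinuousOn γ (Icc 0 n) := by
    apply Continuous.continuousOn
    simp only [γ, AffineMap.lineMap_apply_module]
    fun_prop
  obtain ⟨D, D1, D2, D3, D4, D5⟩ := path_model hw hn (hx.mono fun i (hi : i < n) => show i ≤ n from hi.le) hp
    γc (γinj.mono Ico_subset_Icc_self) (Or.inr ⟨γinj, hx⟩) m γ0.symm γn.symm
  rw [γim] at D5
  have DC : EqOn D m (pts C) := by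
    rintro y (⟨v, hv, rfl⟩ | ⟨e, he, t, ht, rfl⟩)
    · exact D1 v fun i h1 h2 h => hinner i h1 h2 (h ▸ hv)
    · refine D2 e ?_ t
      rintro ⟨i, hi, rfl⟩
      exact hpC i hi he
  have DimC : ∀ y ∈ pts C, ‖D y‖ = 1 := by
    intro y hy
    have : m y ∈ m '' pts C := ⟨y, hy, rfl⟩
    rw [him] at this
    rw [DC hy]; simpa using this
  have endP : ∀ y ∈ pts (eset p n), (D y = α → y = Sum.inl (x 0)) ∧ (D y = β → y = Sum.inl (x n)) := by
    intro y hy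
    constructor
    · intro h
      apply D3.inj hy (inl_mem.2 (mem_VS_eset hw hn (Nat.zero_le _)))
      rw [h, D4 0 (Nat.zero_le _), Nat.cast_zero, γ0]
    · intro h
      apply D3.inj hy (inl_mem.2 (mem_VS_eset hw hn le_rfl))
      rw [h, D4 n le_rfl, γn]
  have endC : ∀ y ∈ pts C, (D y = α → y = Sum.inl (x 0)) ∧ (D y = β → y = Sum.inl (x n)) := by
    intro y hy
    rw [DC hy]
    exact ⟨fun h => hC.inj hy (inl_mem.2 aC) h, fun h => hC.inj hy (inl_mem.2 bC) h⟩
  obtain ⟨f, f1, f2, f3, f4, f5, f6, ⟨hp', f7, f8⟩, ⟨hm', f9, f10⟩⟩ := chord nα nβ hαβ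
  have segP : ∀ y ∈ pts (eset p n), ‖D y‖ ≤ 1 ∧ f (D y) = 0 := fun y hy =>
    (f6 _).2 (D5 ▸ ⟨y, hy, rfl⟩)
  have hDr : Dr (C ∪ eset p n) D := by
    refine (hC.congr DC.symm).union D3 fun y hy y' hy' h => ?_
    have h2 := (segP y' hy').2
    rw [← h] at h2
    rcases f5 _ (DimC y hy) h2 with h3 | h3
    · rw [(endC y hy).1 h3, (endP y' hy').1 (h ▸ h3)]
    · rw [(endC y hy).2 h3, (endP y' hy').2 (h ▸ h3)]
  have hball : MapsTo D (pts (C ∪ eset p n)) (Metric.closedBall 0 1) := by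
    intro y hy
    rw [mem_closedBall_zero_iff]
    rw [pts_union] at hy
    rcases hy with hy | hy
    · exact (DimC y hy).le
    · exact (segP y hy).1
  have hPb : ∀ y ∈ pts (eset p n), D y ∈ Metric.ball (0:ℂ) 1 ∨ y ∈ pts C := by
    intro y hy
    rcases lt_or_eq_of_le (segP y hy).1 with h | h
    · left; rwa [mem_ball_zero_iff]
    · right
      rcases f5 _ h (segP y hy).2 with h3 | h3
      · rw [(endP y hy).1 h3]; exact inl_mem.2 aC
      · rw [(endP y hy).2 h3]; exact inl_mem.2 bC
  -- the two sides
  set XQ := D '' pts Q with hXQ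
  set XR := D '' pts (C \ Q) with hXR
  have hU : XQ ∪ XR = {z | ‖z‖ = 1} := by
    rw [hXQ, hXR, ← image_union, ← pts_union, union_diff_cancel hQC, DC.image_eq, him]
    ext z; simp
  have hI : ∀ z, z ∈ XQ → z ∈ XR → z = α ∨ z = β := by
    rintro z ⟨y, hy, rfl⟩ ⟨y', hy', h⟩
    have hyC := pts_mono hQC hy
    have hyC' := pts_mono (sdiff_subset : C \ Q ⊆ C) hy'
    have : y' = y := hC.inj hyC' hyC (by rw [← DC hyC, ← DC hyC', h])
    subst this
    obtain ⟨v, ⟨hv1, hv2⟩, rfl⟩ := pts_inter disjoint_sdiff_right hy hy'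
    by_cases h0 : v = x 0
    · left; rw [h0, DC (inl_mem.2 aC)]
    by_cases h1 : v = x n
    · right; rw [h1, DC (inl_mem.2 bC)]
    exfalso
    obtain ⟨e, he, hev⟩ := hv1
    obtain ⟨e', he', hev'⟩ := hv2
    have hb0 : bd (chi Q) v = 0 := by rw [hbQ]; simp [h0, h1]
    obtain ⟨e'', h3, h4, h5⟩ := bd_other hb0 hev (by rw [chi_pos he]; exact one_ne_zero) (hloop e (hQC he))
    have h6 := chi_ne h5
    refine hNT v e e'' e' (hQC he) (hQC h6) he'.1 hev h4 hev' h3.symm ?_ ?_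
    · rintro rfl; exact he'.2 he
    · rintro rfl; exact he'.2 h6
  have clQ : IsClosed XQ := ((hC.congr DC.symm).mono hQC).compact.isClosed
  have clR : IsClosed XR := ((hC.congr DC.symm).mono sdiff_subset).compact.isClosed
  have αQ : α ∈ XQ := ⟨_, inl_mem.2 a1, DC (inl_mem.2 aC)⟩
  have βQ : β ∈ XQ := ⟨_, inl_mem.2 b1, DC (inl_mem.2 bC)⟩
  have αR : α ∈ XR := ⟨_, inl_mem.2 a2, DC (inl_mem.2 aC)⟩
  have βR : β ∈ XR := ⟨_, inl_mem.2 b2, DC (inl_mem.2 bC)⟩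
  have side : ∀ A : Set ℂ, IsPreconnected A → (∀ z ∈ A, ‖z‖ = 1 ∧ f z ≠ 0) → A ⊆ XQ ∨ A ⊆ XR := by
    intro A hA h
    refine isPreconnected_iff_subset_of_disjoint_closed.1 hA _ _ clQ clR ?_ ?_
    · rw [hU]; exact fun z hz => (h z hz).1
    · rw [Set.eq_empty_iff_forall_notMem]
      rintro z ⟨hz, h1, h2⟩
      rcases hI z h1 h2 with rfl | rfl
      · exact (h _ hz).2 f3
      · exact (h _ hz).2 f4
  -- nontriviality
  have nontriv : ∀ X : Set K.E, X ⊆ C → ∀ v ∈ VS X, ∃ z ∈ D '' pts X, z ≠ α ∧ z ≠ β := by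
    rintro X hX v ⟨e, he, _⟩
    have ht : (1/2:ℝ) ∈ Ioo (0:ℝ) 1 := by norm_num
    have hm1 : (Sum.inr (e, 1/2) : Pt K) ∈ pts X := inr_mem.2 ⟨he, ht⟩
    refine ⟨_, ⟨_, hm1, rfl⟩, fun h => ?_, fun h => ?_⟩
    · cases (endC _ (pts_mono hX hm1)).1 h
    · cases (endC _ (pts_mono hX hm1)).2 h
  have fin : ∀ g : ℂ → ℝ, g α = 0 → g β = 0 → (∀ z, ‖z‖ = 1 → g z = 0 → z = α ∨ z = β) →
      (∀ z, ‖z‖ ≤ 1 ∧ g z = 0 ↔ z ∈ segment ℝ α β) → ∀ h1 h2 : ℂ ≃ₜ ℂ,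
      h1 '' Metric.ball 0 1 = {z : ℂ | ‖z‖ < 1 ∧ 0 < g z} →
      h1 '' Metric.sphere 0 1 = {z : ℂ | ‖z‖ ≤ 1 ∧ 0 ≤ g z ∧ (‖z‖ = 1 ∨ g z = 0)} →
      h2 '' Metric.ball 0 1 = {z : ℂ | ‖z‖ < 1 ∧ g z < 0} →
      h2 '' Metric.sphere 0 1 = {z : ℂ | ‖z‖ ≤ 1 ∧ g z ≤ 0 ∧ (‖z‖ = 1 ∨ g z = 0)} →
      {z : ℂ | ‖z‖ = 1 ∧ 0 < g z} ⊆ XQ → {z : ℂ | ‖z‖ = 1 ∧ g z < 0} ⊆ XR →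
      h1 '' Metric.ball 0 1 ⊆ Metric.ball 0 1 ∧ h2 '' Metric.ball 0 1 ⊆ Metric.ball 0 1 ∧
      Disjoint (h1 '' Metric.ball 0 1) (h2 '' Metric.ball 0 1) ∧
      (∀ z ∈ h1 '' Metric.ball 0 1, z ∉ D '' pts (C ∪ eset p n)) ∧
      (∀ z ∈ h2 '' Metric.ball 0 1, z ∉ D '' pts (C ∪ eset p n)) ∧
      h1 '' Metric.sphere 0 1 = D '' pts (eset p n ∪ Q) ∧
      h2 '' Metric.sphere 0 1 = D '' pts (eset p n ∪ (C \ Q)) := by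
    intro g g1 g2 g3 g4 h1 h2 k1 k2 k3 k4 s1 s2
    have eQ : XQ = {z | ‖z‖ = 1 ∧ 0 ≤ g z} := by
      ext z
      constructor
      · intro hz
        have hz1 : ‖z‖ = 1 := by
          have : z ∈ XQ ∪ XR := Or.inl hz
          rw [hU] at this; exact this
        refine ⟨hz1, ?_⟩
        by_contra hlt
        have hz2 := s2 ⟨hz1, not_le.1 hlt⟩
        rcases hI z hz hz2 with rfl | rfl
        · exact hlt g1.ge
        · exact hlt g2.ge
      · rintro ⟨hz1, hz2⟩
        rcases eq_or_lt_of_le hz2 with h | h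
        · rcases g3 z hz1 h.symm with rfl | rfl
          · exact αQ
          · exact βQ
        · exact s1 ⟨hz1, h⟩
    have eR : XR = {z | ‖z‖ = 1 ∧ g z ≤ 0} := by
      ext z
      constructor
      · intro hz
        have hz1 : ‖z‖ = 1 := by
          have : z ∈ XQ ∪ XR := Or.inr hz
          rw [hU] at this; exact this
        refine ⟨hz1, ?_⟩
        by_contra hlt
        have hz2 := s1 ⟨hz1, not_le.1 hlt⟩
        rcases hI z hz2 hz with rfl | rfl
        · exact hlt g1.le
        · exact hlt g2.le
      · rintro ⟨hz1, hz2⟩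
        rcases eq_or_lt_of_le hz2 with h | h
        · rcases g3 z hz1 h with rfl | rfl
          · exact αR
          · exact βR
        · exact s2 ⟨hz1, h⟩
    have noim : ∀ z : ℂ, ‖z‖ < 1 → g z ≠ 0 → z ∉ D '' pts (C ∪ eset p n) := by
      rintro _ hz1 hz2 ⟨y, hy, rfl⟩
      rw [pts_union] at hy
      rcases hy with hy | hy
      · exact absurd (DimC y hy) hz1.ne
      · exact hz2 ((g4 _).2 (D5 ▸ ⟨y, hy, rfl⟩)).2
    refine ⟨?_, ?_, ?_, ?_, ?_, ?_, ?_⟩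
    · rw [k1]; intro z hz; rw [mem_ball_zero_iff]; exact hz.1
    · rw [k3]; intro z hz; rw [mem_ball_zero_iff]; exact hz.1
    · rw [k1, k3, Set.disjoint_left]
      intro z hz hz'
      exact lt_asymm hz.2 hz'.2
    · rw [k1]; intro z hz; exact noim z hz.1 hz.2.ne'
    · rw [k3]; intro z hz; exact noim z hz.1 hz.2.ne
    · rw [k2, pts_union, image_union, D5, ← hXQ, eQ]
      ext z
      constructor
      · rintro ⟨h1, h2, h3 | h3⟩
        · exact Or.inr ⟨h3, h2⟩
        · exact Or.inl ((g4 z).1 ⟨h1, h3⟩)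
      · rintro (h | ⟨h1, h2⟩)
        · have := (g4 z).2 h
          exact ⟨this.1, this.2.ge, Or.inr this.2⟩
        · exact ⟨h1.le, h2, Or.inl h1⟩
    · rw [k4, pts_union, image_union, D5, ← hXR, eR]
      ext z
      constructor
      · rintro ⟨h1, h2, h3 | h3⟩
        · exact Or.inr ⟨h3, h2⟩
        · exact Or.inl ((g4 z).1 ⟨h1, h3⟩)
      · rintro (h | ⟨h1, h2⟩)
        · have := (g4 z).2 h
          exact ⟨this.1, this.2.le, Or.inr this.2⟩
        · exact ⟨h1.le, h2, Or.inl h1⟩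
  have dich : ∀ z, ‖z‖ = 1 → z ≠ α → z ≠ β → 0 < f z ∨ f z < 0 := by
    intro z hz h1 h2
    rcases lt_trichotomy (f z) 0 with h | h | h
    · exact Or.inr h
    · rcases f5 z hz h with h | h
      · exact (h1 h).elim
      · exact (h2 h).elim
    · exact Or.inl h
  have s1 := side _ f1 (fun z hz => ⟨hz.1, hz.2.ne'⟩)
  have s2 := side _ f2 (fun z hz => ⟨hz.1, hz.2.ne⟩)
  have good : ({z : ℂ | ‖z‖ = 1 ∧ 0 < f z} ⊆ XQ ∧ {z : ℂ | ‖z‖ = 1 ∧ f z < 0} ⊆ XR) ∨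
      ({z : ℂ | ‖z‖ = 1 ∧ 0 < f z} ⊆ XR ∧ {z : ℂ | ‖z‖ = 1 ∧ f z < 0} ⊆ XQ) := by
    rcases s1 with s1 | s1 <;> rcases s2 with s2 | s2
    · exfalso
      obtain ⟨z, hz, z1, z2⟩ := nontriv (C \ Q) sdiff_subset _ a2
      have hz1 : ‖z‖ = 1 := by
        have : z ∈ XQ ∪ XR := Or.inr hz
        rw [hU] at this; exact this
      rcases dich z hz1 z1 z2 with h | h
      · rcases hI z (s1 ⟨hz1, h⟩) hz with h | h
        · exact z1 h
        · exact z2 h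
      · rcases hI z (s2 ⟨hz1, h⟩) hz with h | h
        · exact z1 h
        · exact z2 h
    · exact Or.inl ⟨s1, s2⟩
    · exact Or.inr ⟨s1, s2⟩
    · exfalso
      obtain ⟨z, hz, z1, z2⟩ := nontriv Q hQC _ a1
      have hz1 : ‖z‖ = 1 := by
        have : z ∈ XQ ∪ XR := Or.inl hz
        rw [hU] at this; exact this
      rcases dich z hz1 z1 z2 with h | h
      · rcases hI z hz (s1 ⟨hz1, h⟩) with h | h
        · exact z1 h
        · exact z2 h
      · rcases hI z hz (s2 ⟨hz1, h⟩) with h | h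
        · exact z1 h
        · exact z2 h
  rcases good with ⟨s1, s2⟩ | ⟨s1, s2⟩
  · exact ⟨D, hp', hm', DC, hDr, hball, hPb, fin f f3 f4 f5 f6 hp' hm' f7 f8 f9 f10 s1 s2⟩
  · refine ⟨D, hm', hp', DC, hDr, hball, hPb, fin (fun z => - f z) (by simp [f3]) (by simp [f4])
      (fun z h1 h2 => f5 z h1 (neg_eq_zero.1 h2)) (fun z => by rw [neg_eq_zero]; exact f6 z) hm' hp' ?_ ?_ ?_ ?_ ?_ ?_⟩
    · simpa only [neg_pos] using f9
    · simpa only [neg_nonneg, neg_eq_zero] using f10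
    · simpa only [neg_neg_iff_pos] using f7
    · simpa only [neg_nonpos, neg_eq_zero] using f8
    · simpa only [neg_pos] using s2
    · simpa only [neg_neg_iff_pos] using s1

end NPG

namespace NPG
open Set Filter Topology

variable {K : FinGraph}

/-- any two complementary nonempty parts share two vertices -/
def Block (E' : Set K.E) : Prop := ∀ E1 ⊆ E', E1.Nonempty → (E' \ E1).Nonempty →
  ∃ a b, a ≠ b ∧ a ∈ VS E1 ∧ a ∈ VS (E' \ E1) ∧ b ∈ VS E1 ∧ b ∈ VS (E' \ E1)

/-- reachable from `a` by a path through vertices off `H` -/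
def Rch (E' H : Set K.E) (a w : K.V) : Prop := ∃ (x : ℕ → K.V) (p : ℕ → K.E) (n : ℕ), Wk x p n ∧ x 0 = a ∧ x n = w ∧
  InjOn x (Iic n) ∧ (∀ i, 0 < i → i ≤ n → x i ∉ VS H) ∧ ∀ i < n, p i ∈ E' \ H

lemma inc_two {e : K.E} {w b : K.V} (h1 : inc e w) (h2 : inc e b) (h : w ≠ b) :
    K.ends e = (w, b) ∨ K.ends e = (b, w) := by
  rcases h1 with h1 | h1 <;> rcases h2 with h2 | h2
  · exact (h (h1.symm.trans h2)).elim
  · exact Or.inl (Prod.ext h1 h2)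
  · exact Or.inr (Prod.ext h2 h1)
  · exact (h (h1.symm.trans h2)).elim

lemma walk_ext {x : ℕ → K.V} {p : ℕ → K.E} {n : ℕ} (hw : Wk x p n) {e : K.E} {b : K.V}
    (he : K.ends e = (x n, b) ∨ K.ends e = (b, x n)) :
    Wk (Function.update x (n+1) b) (Function.update p n e) (n+1) := by
  intro i hi
  rcases Nat.lt_or_ge i n with h | h
  · rw [Function.update_of_ne (by omega), Function.update_of_ne (by omega), Function.update_of_ne (by omega)]
    exact hw i h
  · obtain rfl : i = n := by omega
    rw [Function.update_self, Function.update_self, Function.update_of_ne (by omega)]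
    exact he

lemma inj_ext {x : ℕ → K.V} {n : ℕ} (hx : InjOn x (Iic n)) {b : K.V} (hb : ∀ i ≤ n, x i ≠ b) :
    InjOn (Function.update x (n+1) b) (Iic (n+1)) := by
  intro i hi j hj h
  have hi : i ≤ n + 1 := hi
  have hj : j ≤ n + 1 := hj
  rcases Nat.lt_or_ge n i with h1 | h1 <;> rcases Nat.lt_or_ge n j with h2 | h2
  · omega
  · obtain rfl : i = n+1 := by omega
    rw [Function.update_self, Function.update_of_ne (by omega)] at h
    exact (hb j h2 h.symm).elim
  · obtain rfl : j = n+1 := by omega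
    rw [Function.update_self, Function.update_of_ne (by omega)] at h
    exact (hb i h1 h).elim
  · rw [Function.update_of_ne (by omega), Function.update_of_ne (by omega)] at h
    exact hx h1 h2 h

lemma Rch.ext {E' H : Set K.E} {a w b : K.V} (h : Rch E' H a w) {e : K.E} (he : e ∈ E' \ H)
    (hwb : K.ends e = (w, b) ∨ K.ends e = (b, w)) (hb : b ∉ VS H) : Rch E' H a b := by
  obtain ⟨x, p, n, hw, h0, rfl, hx, hv, hp⟩ := h
  by_cases hc : ∃ i ≤ n, x i = b
  · obtain ⟨i, hi, rfl⟩ := hc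
    exact ⟨x, p, i, fun j hj => hw j (by omega), h0, rfl, hx.mono fun j (hj : j ≤ i) => (show j ≤ n by omega),
      fun j h1 h2 => hv j h1 (by omega), fun j hj => hp j (by omega)⟩
  · push Not at hc
    refine ⟨_, _, n+1, walk_ext hw hwb, ?_, Function.update_self _ _ _, inj_ext hx hc, ?_, ?_⟩
    · rw [Function.update_of_ne (by omega), h0]
    · intro i h1 h2
      rcases Nat.lt_or_ge n i with h3 | h3
      · obtain rfl : i = n+1 := by omega
        rwa [Function.update_self]
      · rw [Function.update_of_ne (by omega)]; exact hv i h1 h3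
    · intro i hi
      rcases Nat.lt_or_ge i n with h3 | h3
      · rw [Function.update_of_ne (by omega)]; exact hp i h3
      · obtain rfl : i = n := by omega
        rwa [Function.update_self]

lemma ear {E' H : Set K.E} (hB : Block E') (hH : H ⊆ E') (hn : H.Nonempty) (hn' : (E' \ H).Nonempty) :
    ∃ (x : ℕ → K.V) (p : ℕ → K.E) (n : ℕ), 0 < n ∧ Wk x p n ∧ x 0 ∈ VS H ∧ x n ∈ VS H ∧ InjOn x (Iic n) ∧
      (∀ i, 0 < i → i < n → x i ∉ VS H) ∧ ∀ i < n, p i ∈ E' \ H := by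
  obtain ⟨a, _, _, ha, ha', _⟩ := hB H hH hn hn'
  set E1 : Set K.E := {e | e ∈ E' \ H ∧ ∃ w, inc e w ∧ Rch E' H a w} with hE1
  have hraa : Rch E' H a a := by
    obtain ⟨e, _⟩ := hn
    exact ⟨fun _ => a, fun _ => e, 0, fun i hi => by omega, rfl, rfl,
      fun i (hi : i ≤ 0) j (hj : j ≤ 0) _ => by omega, fun i _ _ => by omega, fun i _ => by omega⟩
  have hs : E1 ⊆ E' := fun e he => he.1.1
  have hHs : H ⊆ E' \ E1 := fun e he => ⟨hH he, fun h => h.1.2 he⟩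
  obtain ⟨b1, b2, hne, h1, h1', h2, h2'⟩ := hB E1 hs (by
    obtain ⟨e, he, hi⟩ := ha'
    exact ⟨e, he, a, hi, hraa⟩) (hn.mono hHs)
  have key : ∀ b, b ≠ a → b ∈ VS E1 → b ∈ VS (E' \ E1) → ∃ (x : ℕ → K.V) (p : ℕ → K.E) (n : ℕ), 0 < n ∧ Wk x p n ∧ x 0 ∈ VS H ∧ x n ∈ VS H ∧ InjOn x (Iic n) ∧
      (∀ i, 0 < i → i < n → x i ∉ VS H) ∧ ∀ i < n, p i ∈ E' \ H := by
    intro b hba hb hb'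
    obtain ⟨e, ⟨he, w, hew, hrw⟩, heb⟩ := hb
    have hbH : b ∈ VS H := by
      by_contra hbH
      have hr : Rch E' H a b := by
        by_cases hwb : w = b
        · rwa [← hwb]
        · exact hrw.ext he (inc_two hew heb hwb) hbH
      obtain ⟨e', he', hi⟩ := hb'
      exact he'.2 ⟨⟨he'.1, fun h => hbH ⟨e', h, hi⟩⟩, b, hi, hr⟩
    obtain ⟨x, p, n, hw, h0, rfl, hx, hv, hp⟩ := hrw
    have hwb : x n ≠ b := by
      rintro rfl
      rcases Nat.eq_zero_or_pos n with rfl | hn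
      · exact hba h0
      · exact hv n hn le_rfl hbH
    refine ⟨_, _, n+1, by omega, walk_ext hw (inc_two hew heb hwb), ?_, ?_, inj_ext hx ?_, ?_, ?_⟩
    · rwa [Function.update_of_ne (by omega), h0]
    · rwa [Function.update_self]
    · intro i hi h
      rcases Nat.eq_zero_or_pos i with rfl | h3
      · exact hba (h.symm.trans h0)
      · exact hv i h3 hi (h ▸ hbH)
    · intro i h1 h2
      rw [Function.update_of_ne (by omega)]; exact hv i h1 (by omega)
    · intro i hi
      rcases Nat.lt_or_ge i n with h3 | h3
      · rw [Function.update_of_ne (by omega)]; exact hp i h3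
      · obtain rfl : i = n := by omega
        rwa [Function.update_self]
  by_cases h : b1 = a
  · exact key b2 (fun h' => hne (h.trans h'.symm)) h2 h2'
  · exact key b1 h h1 h1'

lemma noloop {E' : Set K.E} (hB : Block E') {e f : K.E} (he : e ∈ E') (hf : f ∈ E') (hef : f ≠ e) :
    (K.ends e).1 ≠ (K.ends e).2 := by
  intro h
  obtain ⟨a, b, hab, ha, _, hb, _⟩ := hB {e} (by simpa using he) ⟨e, rfl⟩ ⟨f, hf, hef⟩
  apply hab
  obtain ⟨e1, he1, ha⟩ := ha
  obtain ⟨e2, he2, hb⟩ := hb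
  obtain rfl : e1 = e := he1
  obtain rfl : e2 = e1 := he2
  have h1 : (K.ends e2).1 = a := ha.elim id fun h' => h.trans h'
  have h2 : (K.ends e2).1 = b := hb.elim id fun h' => h.trans h'
  exact h1.symm.trans h2

lemma wk_inc {x : ℕ → K.V} {p : ℕ → K.E} {n : ℕ} (hw : Wk x p n) {i : ℕ} (hi : i < n) {w : K.V} (h : inc (p i) w) :
    w = x i ∨ w = x (i+1) := by
  rcases hw i hi with h1 | h1 <;> rcases h with h | h <;> rw [h1] at h
  · exact Or.inl h.symm
  · exact Or.inr h.symm
  · exact Or.inr h.symm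
  · exact Or.inl h.symm

lemma nt_closed {x : ℕ → K.V} {p : ℕ → K.E} {n : ℕ} (hw : Wk x p n) (hx : InjOn x (Iio n)) (hc : x n = x 0) :
    NT (eset p n) := by
  rintro w _ _ _ ⟨i, hi, rfl⟩ ⟨j, hj, rfl⟩ ⟨k, hk, rfl⟩ h1 h2 h3 h12 h13 h23
  have hx' : ∀ a b, a < n → b < n → x a = x b → a = b := fun a b ha hb h => hx ha hb h
  have key : ∀ i < n, inc (p i) w → ∃ s < n, w = x s ∧ (i = s ∨ i + 1 = s ∨ (s = 0 ∧ i + 1 = n)) := by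
    intro i hi h
    rcases wk_inc hw hi h with h | h
    · exact ⟨i, hi, h, Or.inl rfl⟩
    · rcases Nat.lt_or_ge (i+1) n with h4 | h4
      · exact ⟨i+1, h4, h, Or.inr (Or.inl rfl)⟩
      · refine ⟨0, by omega, ?_, Or.inr (Or.inr ⟨rfl, by omega⟩)⟩
        rw [h, ← hc]; congr 1; omega
  obtain ⟨s, hs, e1, a1⟩ := key i hi h1
  obtain ⟨s', hs', e2, a2⟩ := key j hj h2
  obtain ⟨s'', hs'', e3, a3⟩ := key k hk h3
  obtain rfl := hx' _ _ hs hs' (e1.symm.trans e2)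
  obtain rfl := hx' _ _ hs hs'' (e1.symm.trans e3)
  have hij : i ≠ j := fun h => h12 (by rw [h])
  have hik : i ≠ k := fun h => h13 (by rw [h])
  have hjk : j ≠ k := fun h => h23 (by rw [h])
  omega

lemma nt_ear {C : Set K.E} (hNT : NT C) (hloop : ∀ e ∈ C, (K.ends e).1 ≠ (K.ends e).2)
    {x : ℕ → K.V} {p : ℕ → K.E} {n : ℕ} (hw : Wk x p n) (hx : InjOn x (Iic n))
    (hinner : ∀ i, 0 < i → i < n → x i ∉ VS C) {Q : Set K.E} (hQC : Q ⊆ C)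
    (hbd : bd (chi (eset p n) + chi Q) = 0) : NT (eset p n ∪ Q) := by
  classical
  have hx' : ∀ a b, a ≤ n → b ≤ n → x a = x b → a = b := fun a b ha hb h => hx ha hb h
  have hbQ : ∀ w, bd (chi Q) w = (Pi.single (x 0) 1 + Pi.single (x n) 1 : K.V → ZMod 2) w := by
    intro v
    rw [← bd_eset hw (p_inj hw hx)]
    have := congrFun hbd v
    rw [bd_add] at this
    exact (z2_add_eq this).symm
  -- a path edge at a vertex of C excludes two Q-edges there
  have key : ∀ w e1 e2 e3, e1 ∈ eset p n → e2 ∈ Q → e3 ∈ Q → inc e1 w → inc e2 w → inc e3 w → e2 ≠ e3 → False := by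
    rintro w _ e2 e3 ⟨i, hi, rfl⟩ q2 q3 h1 h2 h3 h23
    have hwC : w ∈ VS C := ⟨e2, hQC q2, h2⟩
    have hend : (w = x 0 ∨ w = x n) ∧ x 0 ≠ x n := by
      refine ⟨?_, fun h => by have := hx' _ _ (by omega) le_rfl h; omega⟩
      rcases wk_inc hw hi h1 with h | h
      · rcases Nat.eq_zero_or_pos i with rfl | h0
        · exact Or.inl h
        · exact (hinner i h0 hi (h ▸ hwC)).elim
      · rcases Nat.lt_or_ge (i+1) n with h4 | h4
        · exact (hinner (i+1) (by omega) h4 (h ▸ hwC)).elim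
        · right; rw [h]; congr 1; omega
    have hb : bd (chi Q) w = 1 := by
      rw [hbQ]
      rcases hend with ⟨rfl | rfl, hne⟩
      · simp [hne]
      · simp [hne.symm]
    have hb2 : bd (chi ({e2, e3} : Set K.E)) w = 1 := by
      rw [← hb]
      rw [bd_def', bd_def']
      refine Finset.sum_congr rfl fun e _ => ?_
      by_cases hi : inc e w
      · suffices hs : chi ({e2, e3} : Set K.E) e = chi Q e by rw [hs]
        by_cases he : e ∈ Q
        · rw [chi_pos he, chi_pos]
          by_contra hcon
          have : ¬ (e = e2 ∨ e = e3) := hcon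
          exact hNT w e e2 e3 (hQC he) (hQC q2) (hQC q3) hi h2 h3 (fun h => this (Or.inl h)) (fun h => this (Or.inr h)) h23
        · rw [chi_neg he, chi_neg]
          rintro (h | h)
          · rw [h] at he; exact he q2
          · have h : e = e3 := h
            rw [h] at he; exact he q3
      · have := not_or.1 hi
        simp [this.1, this.2]
    have e4 : chi ({e2, e3} : Set K.E) = Pi.single e2 1 + Pi.single e3 1 := by
      funext e
      rw [Pi.add_apply]
      by_cases a : e = e2
      · subst a
        rw [chi_pos (by simp), Pi.single_eq_same, Pi.single_eq_of_ne h23, add_zero]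
      · by_cases b : e = e3
        · subst b
          rw [chi_pos (by simp), Pi.single_eq_same, Pi.single_eq_of_ne a, zero_add]
        · rw [chi_neg (by simp [a, b]), Pi.single_eq_of_ne a, Pi.single_eq_of_ne b, add_zero]
    have one : ∀ e, inc e w → (K.ends e).1 ≠ (K.ends e).2 → bd (Pi.single e 1) w = 1 := by
      intro e hi hl
      rw [bd_single]
      rcases hi with rfl | rfl
      · rw [Pi.add_apply, Pi.single_eq_same, Pi.single_eq_of_ne hl, add_zero]
      · rw [Pi.add_apply, Pi.single_eq_same, Pi.single_eq_of_ne hl.symm, zero_add]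
    rw [e4, bd_add, Pi.add_apply, one _ h2 (hloop _ (hQC q2)), one _ h3 (hloop _ (hQC q3))] at hb2
    revert hb2; decide
  -- at most two path edges at a vertex; with a Q edge only one
  have key2 : ∀ w i j, i < n → j < n → inc (p i) w → inc (p j) w → i < j → ∃ s, 0 < s ∧ s < n ∧ w = x s ∧ i + 1 = s ∧ j = s := by
    intro w i j hi hj h1 h2 hij
    rcases wk_inc hw hi h1 with e1 | e1 <;> rcases wk_inc hw hj h2 with e2 | e2 <;>
      have e3 := hx' _ _ (by omega) (by omega) (e1.symm.trans e2)
    · omega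
    · omega
    · exact ⟨j, by omega, hj, e2, e3, rfl⟩
    · omega
  have key3 : ∀ w i j, i < n → j < n → i ≠ j → inc (p i) w → inc (p j) w → w ∉ VS C := by
    intro w i j hi hj hij h1 h2
    rcases Nat.lt_or_ge i j with h | h
    · obtain ⟨s, a, b, rfl, _⟩ := key2 w i j hi hj h1 h2 h
      exact hinner s a b
    · obtain ⟨s, a, b, rfl, _⟩ := key2 w j i hj hi h2 h1 (by omega)
      exact hinner s a b
  have key4 : ∀ w e1 e2 e3, e1 ∈ Q → e2 ∈ eset p n → e3 ∈ eset p n → inc e1 w → inc e2 w → inc e3 w → e2 ≠ e3 → False := by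
    rintro w e1 _ _ q1 ⟨i, hi, rfl⟩ ⟨j, hj, rfl⟩ h1 h2 h3 h23
    exact key3 w i j hi hj (fun h => h23 (by rw [h])) h2 h3 ⟨e1, hQC q1, h1⟩
  rintro w e1 e2 e3 (a1 | a1) (a2 | a2) (a3 | a3) h1 h2 h3 h12 h13 h23
  · obtain ⟨i, hi, rfl⟩ := a1
    obtain ⟨j, hj, rfl⟩ := a2
    obtain ⟨k, hk, rfl⟩ := a3
    have hij : i ≠ j := fun h => h12 (by rw [h])
    have hik : i ≠ k := fun h => h13 (by rw [h])
    have hjk : j ≠ k := fun h => h23 (by rw [h])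
    have K1 : ∀ i j, i < n → j < n → inc (p i) w → inc (p j) w → i < j → i + 1 = j := by
      intro i j hi hj h1 h2 hij
      obtain ⟨s, _, _, _, h3, h4⟩ := key2 w i j hi hj h1 h2 hij
      omega
    have a := K1 i j hi hj h1 h2
    have b := K1 i k hi hk h1 h3
    have c := K1 j k hj hk h2 h3
    have a' := K1 j i hj hi h2 h1
    have b' := K1 k i hk hi h3 h1
    have c' := K1 k j hk hj h3 h2
    omega
  · exact key4 w e3 e1 e2 a3 a1 a2 h3 h1 h2 h12
  · exact key4 w e2 e1 e3 a2 a1 a3 h2 h1 h3 h13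
  · exact key w e1 e2 e3 a1 a2 a3 h1 h2 h3 h23
  · exact key4 w e1 e2 e3 a1 a2 a3 h1 h2 h3 h23
  · exact key w e2 e1 e3 a2 a1 a3 h2 h1 h3 h13
  · exact key w e3 e1 e2 a3 a1 a2 h3 h1 h2 h12
  · exact hNT w e1 e2 e3 (hQC a1) (hQC a2) (hQC a3) h1 h2 h3 h12 h13 h23

/-- every vertex is joined to `v` by a chain -/
def Conn (H : Set K.E) (v : K.V) : Prop := by
  classical exact ∀ b ∈ VS H, ∃ y : K.E → ZMod 2, (∀ e ∉ H, y e = 0) ∧ bd y = Pi.single v 1 + Pi.single b 1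

/-- circle with a model -/
structure Circ (C : Set K.E) (m : Pt K → ℂ) : Prop where
  dr : Dr C m
  im : m '' pts C = Metric.sphere 0 1
  nt : NT C

lemma Circ.conn {C : Set K.E} {m : Pt K → ℂ} (h : Circ C m) {v : K.V} (hv : v ∈ VS C) : Conn C v := by
  classical
  set A : Set K.V := {b | ∃ y : K.E → ZMod 2, (∀ e ∉ C, y e = 0) ∧ bd y = Pi.single v 1 + Pi.single b 1} with hA
  have hvA : v ∈ A := ⟨0, fun _ _ => rfl, by rw [bd_zero]; funext w; exact (z2_self _).symm⟩
  have hstep : ∀ e ∈ C, ((K.ends e).1 ∈ A ↔ (K.ends e).2 ∈ A) := by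
    intro e he
    have aux : ∀ y : K.E → ZMod 2, (∀ e ∉ C, y e = 0) → ∀ e' ∉ C, (y + Pi.single e 1 : K.E → ZMod 2) e' = 0 := by
      intro y hy e' he'
      rw [Pi.add_apply, hy e' he', zero_add, Pi.single_eq_of_ne]
      rintro rfl; exact he' he
    constructor
    · rintro ⟨y, h1, h2⟩
      refine ⟨_, aux y h1, ?_⟩
      rw [bd_add, h2, bd_single]
      funext w
      simp only [Pi.add_apply]
      linear_combination z2_self ((Pi.single (K.ends e).1 1 : K.V → ZMod 2) w)
    · rintro ⟨y, h1, h2⟩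
      refine ⟨_, aux y h1, ?_⟩
      rw [bd_add, h2, bd_single]
      funext w
      simp only [Pi.add_apply]
      linear_combination z2_self ((Pi.single (K.ends e).2 1 : K.V → ZMod 2) w)
  have hinc : ∀ e ∈ C, ∀ w, inc e w → (w ∈ A ↔ (K.ends e).1 ∈ A) := by
    rintro e he w (rfl | rfl)
    · rfl
    · exact (hstep e he).symm
  set C1 : Set K.E := {e | e ∈ C ∧ (K.ends e).1 ∈ A}
  have hC1 : C1 ⊆ C := fun e he => he.1
  have hU : C = C1 ∪ (C \ C1) := (union_sdiff_cancel hC1).symm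
  have hdis : ∀ x ∈ pts C1, x ∈ pts (C \ C1) → False := by
    intro x h1 h2
    obtain ⟨w, ⟨⟨e, he, hi⟩, ⟨e', he', hi'⟩⟩, rfl⟩ := pts_inter disjoint_sdiff_right h1 h2
    exact he'.2 ⟨he'.1, (hinc e' he'.1 w hi').1 ((hinc e he.1 w hi).2 he.2)⟩
  have hpre : IsPreconnected (Metric.sphere (0:ℂ) 1) := by
    apply isPreconnected_sphere
    rw [← Module.finrank_eq_rank, Complex.finrank_real_complex]; norm_num
  by_cases hne : (C \ C1).Nonempty
  · exfalso
    have h1 := (h.dr.mono hC1).compact.isClosed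
    have h2 := (h.dr.mono (sdiff_subset (s := C) (t := C1))).compact.isClosed
    have hcov : Metric.sphere (0:ℂ) 1 ⊆ m '' pts C1 ∪ m '' pts (C \ C1) := by
      rw [← image_union, ← pts_union, ← hU, h.im]
    obtain ⟨z, _, ⟨x, hx, rfl⟩, ⟨y, hy, hxy⟩⟩ := isPreconnected_closed_iff.1 hpre _ _ h1 h2 hcov (by
        obtain ⟨e, he, hi⟩ := hv
        have : e ∈ C1 := ⟨he, (hinc e he v hi).1 hvA⟩
        exact ⟨m (nrm e 0), by rw [← h.im]; exact mem_image_of_mem _ (nrm_mem he (by simp)),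
          mem_image_of_mem _ (nrm_mem this (by simp))⟩) (by
        obtain ⟨e, he⟩ := hne
        exact ⟨m (nrm e 0), by rw [← h.im]; exact mem_image_of_mem _ (nrm_mem he.1 (by simp)),
          mem_image_of_mem _ (nrm_mem he (by simp))⟩)
    have := h.dr.inj (pts_mono sdiff_subset hy) (pts_mono hC1 hx) hxy
    exact hdis x hx (this ▸ hy)
  · rw [not_nonempty_iff_eq_empty] at hne
    rintro b ⟨e, he, hi⟩
    have : e ∈ C1 := by
      by_contra h'
      have : e ∈ C \ C1 := ⟨he, h'⟩
      rw [hne] at this; exact this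
    exact (hinc e he b hi).2 this.2

end NPG

namespace NPG
open Set Filter Topology

variable {K : FinGraph}

lemma circ_curve {n : ℕ} (hn : 0 < n) : ∃ γ : ℝ → ℂ, Continuous γ ∧ InjOn γ (Ico 0 n) ∧ γ n = γ 0 ∧
    γ '' Icc 0 n = Metric.sphere 0 1 := by
  have hn' : (0:ℝ) < n := by exact_mod_cast hn
  have hpi := Real.pi_pos
  refine ⟨fun s => Complex.exp ((2 * Real.pi * (s / n) : ℝ) * Complex.I), by fun_prop, ?_, ?_, ?_⟩
  · intro s hs t ht h
    obtain ⟨k, hk⟩ := Complex.exp_eq_exp_iff_exists_int.1 h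
    have h2 : (2 * Real.pi * (s / n) : ℝ) = 2 * Real.pi * (t / n) + k * (2 * Real.pi) := by
      have := congrArg Complex.im hk
      simpa using this
    have h3 : s = t + k * n := by
      field_simp at h2
      linarith
    have hk1 : (k:ℝ) < 1 := by
      by_contra hc
      have : (1:ℝ) * n ≤ k * n := mul_le_mul_of_nonneg_right (not_lt.1 hc) hn'.le
      linarith [hs.2, ht.1]
    have hk2 : (-1:ℝ) < k := by
      by_contra hc
      have : (k:ℝ) * n ≤ (-1) * n := mul_le_mul_of_nonneg_right (not_lt.1 hc) hn'.le
      linarith [hs.1, ht.2]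
    have : k = 0 := by
      have a : k < 1 := by exact_mod_cast hk1
      have b : -1 < k := by exact_mod_cast hk2
      omega
    rw [h3, this]; simp
  · simp only [div_self hn'.ne', zero_div, mul_one, mul_zero]
    simp [Complex.exp_two_pi_mul_I]
  · apply Subset.antisymm
    · rintro _ ⟨s, _, rfl⟩
      rw [mem_sphere_zero_iff_norm, Complex.norm_exp_ofReal_mul_I]
    · intro z hz
      rw [mem_sphere_zero_iff_norm] at hz
      have hz' : Complex.exp (z.arg * Complex.I) = z := by
        have := Complex.norm_mul_exp_arg_mul_I z
        rw [hz] at this; simpa using this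
      have h1 := Complex.neg_pi_lt_arg z
      have h2 := Complex.arg_le_pi z
      by_cases h0 : 0 ≤ z.arg
      · refine ⟨z.arg / (2 * Real.pi) * n, ⟨by positivity, ?_⟩, ?_⟩
        · have : z.arg / (2 * Real.pi) ≤ 1 := by rw [div_le_one (by positivity)]; linarith
          calc _ ≤ 1 * (n:ℝ) := mul_le_mul_of_nonneg_right this hn'.le
            _ = n := one_mul _
        · have : 2 * Real.pi * (z.arg / (2 * Real.pi) * n / n) = z.arg := by field_simp
          simp only [this, hz']
      · refine ⟨(z.arg / (2 * Real.pi) + 1) * n, ⟨?_, ?_⟩, ?_⟩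
        · have : -1 ≤ z.arg / (2 * Real.pi) := by rw [le_div_iff₀ (by positivity)]; linarith
          exact mul_nonneg (by linarith) hn'.le
        · have : z.arg / (2 * Real.pi) ≤ 0 := div_nonpos_of_nonpos_of_nonneg (not_le.1 h0).le (by positivity)
          calc _ ≤ 1 * (n:ℝ) := mul_le_mul_of_nonneg_right (by linarith) hn'.le
            _ = n := one_mul _
        · have : 2 * Real.pi * ((z.arg / (2 * Real.pi) + 1) * n / n) = z.arg + 2 * Real.pi := by field_simp
          simp only [this]
          rw [Complex.ofReal_add, add_mul, Complex.exp_add, hz']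
          simp [Complex.exp_two_pi_mul_I]

lemma circ_walk {x : ℕ → K.V} {p : ℕ → K.E} {n : ℕ} (hw : Wk x p n) (hn : 0 < n) (hx : InjOn x (Iio n))
    (hp : InjOn p (Iio n)) (hc : x n = x 0) : (∃ m, Circ (eset p n) m) ∧ bd (chi (eset p n)) = 0 := by
  classical
  obtain ⟨γ, h1, h2, h3, h4⟩ := circ_curve hn
  obtain ⟨D, _, _, h5, _, h6⟩ := path_model hw hn hx hp h1.continuousOn h2 (Or.inl ⟨hc, h3⟩) (fun _ => γ 0) rfl h3.symm
  refine ⟨⟨D, h5, h6.trans h4, nt_closed hw hx hc⟩, ?_⟩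
  rw [bd_eset hw hp, hc]
  funext w; exact z2_self _

lemma circuit {E' : Set K.E} (hB : Block E') {v : K.V} (hv : v ∈ VS E')
    (h1 : ∀ e, E' = {e} → (K.ends e).1 = (K.ends e).2) :
    ∃ C m, C ⊆ E' ∧ v ∈ VS C ∧ Circ C m ∧ bd (chi C) = 0 := by
  obtain ⟨e, he, hi⟩ := hv
  by_cases hl : (K.ends e).1 = (K.ends e).2
  · have hw : Wk (fun _ => v) (fun _ => e) 1 := by
      intro i _
      left
      rcases hi with hi | hi
      · exact Prod.ext hi (hl.symm.trans hi)
      · exact Prod.ext (hl.trans hi) hi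
    obtain ⟨⟨m, hm⟩, hb⟩ := circ_walk hw (by omega) (fun i (hi : i < 1) j (hj : j < 1) _ => by omega)
      (fun i (hi : i < 1) j (hj : j < 1) _ => by omega) rfl
    refine ⟨_, m, ?_, ⟨e, show ∃ i < 1, (fun _ => e) i = e from ⟨0, by omega, rfl⟩, hi⟩, hm, hb⟩
    rintro _ ⟨_, _, rfl⟩; exact he
  · have hne : (E' \ {e}).Nonempty := by
      by_contra hc
      rw [not_nonempty_iff_eq_empty, sdiff_eq_empty] at hc
      exact hl (h1 e (Subset.antisymm hc (by simpa using he)))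
    obtain ⟨x, p, n, hn, hw, h0, hxn, hx, hinner, hp⟩ := ear hB (H := {e}) (by simpa using he) ⟨e, rfl⟩ hne
    have hx' : ∀ a b, a ≤ n → b ≤ n → x a = x b → a = b := fun a b ha hb h => hx ha hb h
    obtain ⟨e0, he0, h0⟩ := h0
    obtain rfl : e0 = e := he0
    obtain ⟨e1, he1, hxn⟩ := hxn
    obtain rfl : e1 = e0 := he1
    have hee := inc_two hxn h0 (fun h => by have := hx' _ _ le_rfl (by omega) h; omega)
    have hpi := p_inj hw hx
    obtain ⟨⟨m, hm⟩, hb⟩ := circ_walk (walk_ext hw hee) (by omega) (by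
        intro i hi j hj h
        have hi : i < n + 1 := hi
        have hj : j < n + 1 := hj
        rw [Function.update_of_ne (by omega), Function.update_of_ne (by omega)] at h
        exact hx' _ _ (by omega) (by omega) h) (by
        intro i hi j hj h
        have hi : i < n + 1 := hi
        have hj : j < n + 1 := hj
        rcases Nat.lt_or_ge i n with a | a <;> rcases Nat.lt_or_ge j n with b | b
        · rw [Function.update_of_ne (by omega), Function.update_of_ne (by omega)] at h
          exact hpi a b h
        · obtain rfl : j = n := by omega
          rw [Function.update_self, Function.update_of_ne (by omega)] at h
          exact ((hp i a).2 h).elim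
        · obtain rfl : i = n := by omega
          rw [Function.update_self, Function.update_of_ne (by omega)] at h
          exact ((hp j b).2 h.symm).elim
        · omega) (by
        rw [Function.update_self, Function.update_of_ne (by omega)])
    refine ⟨_, m, ?_, ⟨e1, show ∃ i < n+1, Function.update p n e1 i = e1 from ⟨n, by omega, Function.update_self _ _ _⟩, hi⟩, hm, hb⟩
    rintro _ ⟨i, hi, rfl⟩
    rcases Nat.lt_or_ge i n with a | a
    · rw [Function.update_of_ne (by omega)]; exact (hp i a).1
    · obtain rfl : i = n := by omega
      rwa [Function.update_self]

/-- coboundary on `E'` of a face function -/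
noncomputable def dl {F : Type*} (E' : Set K.E) (fa fb : K.E → F) (χ : F → ZMod 2) (e : K.E) : ZMod 2 := by
  classical exact if e ∈ E' then χ (fa e) + χ (fb e) else 0

lemma dl_pos {F : Type*} {E' : Set K.E} {fa fb : K.E → F} {χ : F → ZMod 2} {e : K.E} (h : e ∈ E') :
    dl E' fa fb χ e = χ (fa e) + χ (fb e) := if_pos h
lemma dl_neg {F : Type*} {E' : Set K.E} {fa fb : K.E → F} {χ : F → ZMod 2} {e : K.E} (h : e ∉ E') :
    dl E' fa fb χ e = 0 := if_neg h

/-- the face functions describe exactly the cycle space of `E'` -/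
structure Dual {F : Type*} (E' : Set K.E) (fa fb : K.E → F) : Prop where
  cyc : ∀ χ, bd (dl E' fa fb χ) = 0
  ex : ∀ z : K.E → ZMod 2, (∀ e ∉ E', z e = 0) → bd z = 0 → ∃ χ, z = dl E' fa fb χ

def Cl {F : Type*} (fa fb : K.E → F) (H : Set K.E) (κ : F → ℕ) (φ : ℕ) : Set K.E := {e | e ∈ H ∧ (κ (fa e) = φ ∨ κ (fb e) = φ)}

noncomputable def ind {F : Type*} (A : Set F) (χ : F → ZMod 2) (f : F) : ZMod 2 := by
  classical exact if f ∈ A then χ f else 0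

lemma ind_pos {F : Type*} {A : Set F} {χ : F → ZMod 2} {f : F} (h : f ∈ A) : ind A χ f = χ f := if_pos h
lemma ind_neg {F : Type*} {A : Set F} {χ : F → ZMod 2} {f : F} (h : f ∉ A) : ind A χ f = 0 := if_neg h

/-- labelling invariant -/
structure Lab {F : Type*} (E' : Set K.E) (fa fb : K.E → F) (H : Set K.E) (κ : F → ℕ) : Prop where
  sub : H ⊆ E'
  out : ∀ e ∈ E', e ∉ H → κ (fa e) = κ (fb e)
  on : ∀ e ∈ H, κ (fa e) ≠ κ (fb e)

lemma chi_union {P Q : Set K.E} (h : Disjoint P Q) : chi (P ∪ Q) = chi P + chi Q := by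
  funext e
  rw [Pi.add_apply]
  by_cases h1 : e ∈ P
  · rw [chi_pos (Or.inl h1), chi_pos h1, chi_neg (Set.disjoint_left.1 h h1), add_zero]
  · by_cases h2 : e ∈ Q
    · rw [chi_pos (Or.inr h2), chi_neg h1, chi_pos h2, zero_add]
    · rw [chi_neg h1, chi_neg h2, chi_neg (by rintro (h | h); exacts [h1 h, h2 h]), add_zero]

lemma Lab.dl_one {F : Type*} {E' : Set K.E} {fa fb : K.E → F} {H : Set K.E} {κ : F → ℕ} (h : Lab E' fa fb H κ) (φ : ℕ) :
    dl E' fa fb (ind {f | κ f = φ} 1) = chi (Cl fa fb H κ φ) := by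
  funext e
  have hp : ∀ f, κ f = φ → ind {f | κ f = φ} 1 f = 1 := fun f hf => ind_pos hf
  have hn : ∀ f, κ f ≠ φ → ind {f | κ f = φ} 1 f = 0 := fun f hf => ind_neg hf
  by_cases he : e ∈ E'
  · rw [dl_pos he]
    by_cases hH : e ∈ H
    · have hne := h.on e hH
      by_cases h1 : κ (fa e) = φ
      · rw [hp _ h1, hn _ (fun h' => hne (h1.trans h'.symm)), chi_pos (show e ∈ Cl fa fb H κ φ from ⟨hH, Or.inl h1⟩), add_zero]
      · by_cases h2 : κ (fb e) = φ
        · rw [hn _ h1, hp _ h2, chi_pos (show e ∈ Cl fa fb H κ φ from ⟨hH, Or.inr h2⟩), zero_add]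
        · rw [hn _ h1, hn _ h2, chi_neg fun h' => h'.2.elim h1 h2, add_zero]
    · have heq := h.out e he hH
      rw [chi_neg fun h' => hH h'.1]
      by_cases h1 : κ (fa e) = φ
      · rw [hp _ h1, hp _ (heq ▸ h1)]; rfl
      · rw [hn _ h1, hn _ (heq ▸ h1)]; rfl
  · rw [dl_neg he, chi_neg fun h' => he (h.sub h'.1)]

lemma ear_split {F : Type*} {E' : Set K.E} {fa fb : K.E → F} (hD : Dual E' fa fb) {H : Set K.E} {κ : F → ℕ}
    (hL : Lab E' fa fb H κ) {v : K.V} (hc : Conn H v) (hnl : ∀ e ∈ E', (K.ends e).1 ≠ (K.ends e).2)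
    {x : ℕ → K.V} {p : ℕ → K.E} {n : ℕ} (hn : 0 < n) (hw : Wk x p n) (h0 : x 0 ∈ VS H) (hxn : x n ∈ VS H)
    (hx : InjOn x (Iic n)) (hinner : ∀ i, 0 < i → i < n → x i ∉ VS H) (hp : ∀ i < n, p i ∈ E' \ H) :
    ∃ (χ : F → ZMod 2) (φ : ℕ) (Q : Set K.E), (∀ i < n, κ (fa (p i)) = φ) ∧ (∀ i < n, χ (fa (p i)) ≠ χ (fb (p i))) ∧
      (∀ e ∈ E', e ∉ H → e ∉ eset p n → χ (fa e) = χ (fb e)) ∧ Q ⊆ Cl fa fb H κ φ ∧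
      (∀ e ∈ H, e ∈ Q ↔ (κ (fa e) = φ ∧ χ (fa e) = 1) ∨ (κ (fb e) = φ ∧ χ (fb e) = 1)) ∧
      dl E' fa fb (ind {f | κ f = φ} χ) = chi (eset p n ∪ Q) ∧ bd (chi (eset p n) + chi Q) = 0 := by
  classical
  have hpi := p_inj hw hx
  have hx' : ∀ a b, a ≤ n → b ≤ n → x a = x b → a = b := fun a b ha hb h => hx ha hb h
  have hPE : ∀ e ∈ eset p n, e ∈ E' ∧ e ∉ H := by rintro _ ⟨i, hi, rfl⟩; exact hp i hi
  obtain ⟨y, hy, hby⟩ := hc _ h0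
  obtain ⟨y', hy', hby'⟩ := hc _ hxn
  obtain ⟨χ, hχ⟩ := hD.ex (chi (eset p n) + (y + y')) (by
      intro e he
      have h1 : e ∉ H := fun h => he (hL.sub h)
      rw [Pi.add_apply, Pi.add_apply, hy e h1, hy' e h1, chi_neg fun h => he (hPE e h).1]; rfl) (by
      rw [bd_add, bd_add, bd_eset hw hpi, hby, hby']
      funext w
      simp only [Pi.add_apply, Pi.zero_apply]
      linear_combination z2_self ((Pi.single v 1 : K.V → ZMod 2) w) +
        z2_self ((Pi.single (x 0) 1 : K.V → ZMod 2) w) + z2_self ((Pi.single (x n) 1 : K.V → ZMod 2) w))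
  have hχ' : ∀ e ∈ E', e ∉ H → chi (eset p n) e = χ (fa e) + χ (fb e) := by
    intro e he hH
    have := congrFun hχ e
    rw [Pi.add_apply, Pi.add_apply, hy e hH, hy' e hH, dl_pos he] at this
    simpa using this
  have hχ1 : ∀ e ∈ eset p n, χ (fa e) ≠ χ (fb e) := by
    intro e he h
    have := hχ' e (hPE e he).1 (hPE e he).2
    rw [chi_pos he, h, z2_self] at this
    exact one_ne_zero this
  have hχ0 : ∀ e ∈ E', e ∉ H → e ∉ eset p n → χ (fa e) = χ (fb e) := by
    intro e he hH hP
    have := hχ' e he hH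
    rw [chi_neg hP] at this
    exact z2_add_eq this.symm
  have hpe : ∀ i < n, p i ∈ eset p n := fun i hi => ⟨i, hi, rfl⟩
  set φ := κ (fa (p 0)) with hφ
  set ζ := dl E' fa fb (ind {f | κ f = φ} χ) with hζ
  have ip : ∀ f, κ f = φ → ind {f | κ f = φ} χ f = χ f := fun f hf => ind_pos hf
  have iN : ∀ f, κ f ≠ φ → ind {f | κ f = φ} χ f = 0 := fun f hf => ind_neg hf
  have hζ0 : ∀ e, e ∉ H → ζ e ≠ 0 → e ∈ eset p n ∧ κ (fa e) = φ := by
    intro e hH hne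
    have he : e ∈ E' := by by_contra h; exact hne (dl_neg h)
    rw [hζ, dl_pos he] at hne
    have heq := hL.out e he hH
    by_cases h1 : κ (fa e) = φ
    · refine ⟨?_, h1⟩
      by_contra hP
      rw [ip _ h1, ip _ (heq ▸ h1), hχ0 e he hH hP, z2_self] at hne
      exact hne rfl
    · rw [iN _ h1, iN _ (heq ▸ h1)] at hne
      exact (hne rfl).elim
  have hζ1 : ∀ e ∈ eset p n, κ (fa e) = φ → ζ e = 1 := by
    intro e he h1
    have heq := hL.out e (hPE e he).1 (hPE e he).2
    rw [hζ, dl_pos (hPE e he).1, ip _ h1, ip _ (heq ▸ h1)]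
    apply z2_ne
    intro h
    exact hχ1 e he (z2_add_eq h)
  have hsame : ∀ i < n, κ (fa (p i)) = φ := by
    intro i
    induction i with
    | zero => intro _; rfl
    | succ i ih =>
      intro hi
      have h1 := ih (by omega)
      have h2 := hζ1 _ (hpe i (by omega)) h1
      obtain ⟨e', hne, hi', hz⟩ := bd_other (congrFun (hD.cyc (ind {f | κ f = φ} χ)) (x (i+1))) (e := p i) (by
          rcases hw i (by omega) with h | h
          · right; rw [h]
          · left; rw [h]) (by rw [← hζ, h2]; exact one_ne_zero) (hnl _ (hp i (by omega)).1)
      have hH : e' ∉ H := fun h => hinner (i+1) (by omega) hi ⟨e', h, hi'⟩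
      obtain ⟨⟨j, hj, rfl⟩, hk⟩ := hζ0 e' hH hz
      rcases wk_inc hw hj hi' with h | h
      · have := hx' _ _ (by omega) (by omega) h
        rw [this]; exact hk
      · have := hx' _ _ (by omega) (by omega) h
        obtain rfl : i = j := by omega
        exact (hne rfl).elim
  set Q : Set K.E := {e | e ∈ H ∧ ζ e ≠ 0} with hQ
  have hQH : ∀ e ∈ H, e ∈ Q ↔ (κ (fa e) = φ ∧ χ (fa e) = 1) ∨ (κ (fb e) = φ ∧ χ (fb e) = 1) := by
    intro e he
    have hne := hL.on e he
    have : e ∈ Q ↔ ζ e ≠ 0 := ⟨fun h => h.2, fun h => ⟨he, h⟩⟩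
    rw [this, hζ, dl_pos (hL.sub he)]
    by_cases h1 : κ (fa e) = φ
    · have h2 : κ (fb e) ≠ φ := fun h => hne (h1.trans h.symm)
      rw [ip _ h1, iN _ h2, add_zero]
      constructor
      · intro h; exact Or.inl ⟨h1, z2_ne h⟩
      · rintro (h | h)
        · rw [h.2]; exact one_ne_zero
        · exact (h2 h.1).elim
    · rw [iN _ h1, zero_add]
      by_cases h2 : κ (fb e) = φ
      · rw [ip _ h2]
        constructor
        · intro h; exact Or.inr ⟨h2, z2_ne h⟩
        · rintro (h | h)
          · exact (h1 h.1).elim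
          · rw [h.2]; exact one_ne_zero
      · rw [iN _ h2]
        constructor
        · intro h; exact (h rfl).elim
        · rintro (h | h)
          · exact (h1 h.1).elim
          · exact (h2 h.1).elim
  have hζe : ζ = chi (eset p n ∪ Q) := by
    funext e
    by_cases he : e ∈ eset p n ∪ Q
    · rw [chi_pos he]
      rcases he with he | he
      · obtain ⟨i, hi, rfl⟩ := he
        exact hζ1 _ (hpe i hi) (hsame i hi)
      · exact z2_ne he.2
    · rw [chi_neg he]
      by_contra h
      by_cases hH : e ∈ H
      · exact he (Or.inr ⟨hH, h⟩)
      · exact he (Or.inl (hζ0 e hH h).1)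
  refine ⟨χ, φ, Q, hsame, fun i hi => hχ1 _ (hpe i hi), hχ0, ?_, hQH, hζe, ?_⟩
  · intro e he
    exact ⟨he.1, ((hQH e he.1).1 he).imp (fun h => h.1) fun h => h.1⟩
  · rw [← chi_union, ← hζe]
    · exact hD.cyc _
    · rw [Set.disjoint_left]
      intro e h1 h2; exact (hPE e h1).2 h2.1

end NPG

namespace NPG
open Set Filter Topology

variable {K : FinGraph}

lemma circ_pull {Y X : Set K.E} {D1 : Pt K → ℂ} (h : Dr Y D1) (hs : X ⊆ Y) {k : ℂ ≃ₜ ℂ}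
    (hk : k '' Metric.sphere 0 1 = D1 '' pts X) (hnt : NT X) : Circ X (k.symm ∘ D1) := by
  refine ⟨(h.mono hs).comp (mapsTo_univ _ _) k.symm.continuous.continuousOn k.symm.injective.injOn, ?_, hnt⟩
  rw [image_comp, ← hk, ← image_comp]
  simp

structure CellD (H X : Set K.E) (T : Set ℂ) (D : Pt K → ℂ) (U : Set ℂ) (m : Pt K → ℂ) (d : ℂ → ℂ) : Prop where
  circ : Circ X m
  cont : ContinuousOn d (Metric.closedBall 0 1)
  inj : InjOn d (Metric.closedBall 0 1)
  maps : MapsTo d (Metric.closedBall 0 1) T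
  eq : ∀ y ∈ pts X, D y = d (m y)
  im : d '' Metric.ball 0 1 = U
  av : ∀ u ∈ U, u ∉ D '' pts H

structure St {F : Type*} (E' : Set K.E) (fa fb : K.E → F) (T : Set ℂ) (J : Set F) (v : K.V) (H : Set K.E) (κ : F → ℕ)
    (D : Pt K → ℂ) (U : ℕ → Set ℂ) : Prop where
  lab : Lab E' fa fb H κ
  vH : v ∈ VS H
  conn : Conn H v
  zero : ∀ f, κ f = 0 ↔ f ∈ J
  dr : Dr H D
  v0 : D (Sum.inl v) = 0
  mT : MapsTo D (pts H) T
  cell : ∀ φ ∈ range κ, φ ≠ 0 → ∃ m d, CellD H (Cl fa fb H κ φ) T D (U φ) m d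
  disj : ∀ φ ∈ range κ, φ ≠ 0 → ∀ ψ ∈ range κ, ψ ≠ 0 → φ ≠ ψ → Disjoint (U φ) (U ψ)

lemma Conn.ear {H : Set K.E} {v : K.V} (hc : Conn H v) {x : ℕ → K.V} {p : ℕ → K.E} {n : ℕ} (hw : Wk x p n)
    (h0 : x 0 ∈ VS H) (hx : InjOn x (Iic n)) : Conn (H ∪ eset p n) v := by
  classical
  intro b hb
  rw [VS_union] at hb
  rcases hb with hb | hb
  · obtain ⟨y, h1, h2⟩ := hc b hb
    exact ⟨y, fun e he => h1 e fun h => he (Or.inl h), h2⟩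
  · obtain ⟨i, hi, rfl⟩ := VS_eset hw hb
    obtain ⟨y, h1, h2⟩ := hc _ h0
    refine ⟨y + chi (eset p i), ?_, ?_⟩
    · intro e he
      rw [Pi.add_apply, h1 e fun h => he (Or.inl h), chi_neg, add_zero]
      rintro ⟨j, hj, rfl⟩
      exact he (Or.inr (show p j ∈ eset p n from ⟨j, by omega, rfl⟩))
    · rw [bd_add, h2, bd_eset (fun j hj => hw j (by omega))
        ((p_inj hw hx).mono fun j (hj : j < i) => (show j < n by omega))]
      funext w
      simp only [Pi.add_apply]
      linear_combination z2_self ((Pi.single (x 0) 1 : K.V → ZMod 2) w)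

lemma step {F : Type*} [Finite F] {E' : Set K.E} {fa fb : K.E → F} {T : Set ℂ} {J : Set F} {v : K.V} {H : Set K.E} {κ : F → ℕ}
    {D : Pt K → ℂ} {U : ℕ → Set ℂ} (hS : St E' fa fb T J v H κ D U) (hD : Dual E' fa fb)
    (hnl : ∀ e ∈ E', (K.ends e).1 ≠ (K.ends e).2)
    {x : ℕ → K.V} {p : ℕ → K.E} {n : ℕ} (hn : 0 < n) (hw : Wk x p n) (h0 : x 0 ∈ VS H)
    (hx : InjOn x (Iic n)) (hinner : ∀ i, 0 < i → i < n → x i ∉ VS H) (hp : ∀ i < n, p i ∈ E' \ H)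
    {χ : F → ZMod 2} {φ : ℕ} {Q : Set K.E} (hφ : ∀ i < n, κ (fa (p i)) = φ)
    (hχ1 : ∀ i < n, χ (fa (p i)) ≠ χ (fb (p i)))
    (hχ0 : ∀ e ∈ E', e ∉ H → e ∉ eset p n → χ (fa e) = χ (fb e)) (hQC : Q ⊆ Cl fa fb H κ φ)
    (hQ : ∀ e ∈ H, e ∈ Q ↔ (κ (fa e) = φ ∧ χ (fa e) = 1) ∨ (κ (fb e) = φ ∧ χ (fb e) = 1))
    (hbd : bd (chi (eset p n) + chi Q) = 0) (hne : φ ≠ 0) :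
    ∃ κ' D' U', St E' fa fb T J v (H ∪ eset p n) κ' D' U' := by
  classical
  obtain ⟨L, hL⟩ : ∃ L : ℕ, ∀ f, κ f < L := by
    obtain ⟨B, hB⟩ := (Set.finite_range κ).bddAbove
    exact ⟨B + 1, fun f => Nat.lt_succ_of_le (hB ⟨f, rfl⟩)⟩
  set P := eset p n with hP
  set X := Cl fa fb H κ φ with hX
  have hXH : X ⊆ H := fun e he => he.1
  have hPH : ∀ e ∈ P, e ∈ E' ∧ e ∉ H := by rintro _ ⟨i, hi, rfl⟩; exact hp i hi
  have hPa : ∀ e ∈ P, κ (fa e) = φ ∧ κ (fb e) = φ ∧ χ (fa e) ≠ χ (fb e) := by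
    rintro _ ⟨i, hi, rfl⟩
    exact ⟨hφ i hi, (hS.lab.out _ (hp i hi).1 (hp i hi).2) ▸ hφ i hi, hχ1 i hi⟩
  have hφr : φ ∈ range κ := ⟨_, hφ 0 hn⟩
  obtain ⟨m, d, hc⟩ := hS.cell φ hφr hne
  have hbX : bd (chi X) = 0 := by rw [hX, ← hS.lab.dl_one φ]; exact hD.cyc _
  have hlX : ∀ e ∈ X, (K.ends e).1 ≠ (K.ends e).2 := fun e he => hnl e (hS.lab.sub (hXH he))
  have hintX : ∀ i, 0 < i → i < n → x i ∉ VS X := fun i a b h => hinner i a b (VS_mono hXH h)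
  obtain ⟨D1, kQ, kR, h1, h2, h3, h4, h5, h6, h7, h8, h9, h10, h11⟩ := split hc.circ.dr hc.circ.im hc.circ.nt
    hlX hbX hw hn hx hintX
    (fun i hi h => (hp i hi).2 (hXH h)) hQC hbd
  have hbR : bd (chi P + chi (X \ Q)) = 0 := by
    rw [chi_sdiff hQC, bd_add, bd_add, hbX, zero_add, ← bd_add]; exact hbd
  have ntQ := nt_ear hc.circ.nt hlX hw hx hintX hQC hbd
  have ntR := nt_ear hc.circ.nt hlX hw hx hintX (sdiff_subset (s := X) (t := Q)) hbR
  have sQ : P ∪ Q ⊆ X ∪ P := union_subset subset_union_right (hQC.trans subset_union_left)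
  have sR : P ∪ (X \ Q) ⊆ X ∪ P := union_subset subset_union_right (sdiff_subset.trans subset_union_left)
  have cQ := circ_pull h2 sQ h10 ntQ
  have cR := circ_pull h2 sR h11 ntR
  -- the new drawing
  set D' : Pt K → ℂ := fun y => if y ∈ pts H then D y else d (D1 y) with hD'
  have dH : ∀ y ∈ pts H, D' y = D y := fun y hy => if_pos hy
  have hbP : ∀ y ∈ pts P, y ∈ pts H → y ∈ pts X := by
    intro y hy hyH
    obtain ⟨w, ⟨hwP, hwH⟩, rfl⟩ := pts_inter (Set.disjoint_left.2 fun e a b => (hPH e a).2 b) hy hyH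
    rw [inl_mem]
    obtain ⟨i, hi, rfl⟩ := VS_eset hw hwP
    have hb : bd (chi Q) (x i) ≠ 0 := by
      have e1 := congrFun hbd (x i)
      rw [bd_add, bd_eset hw (p_inj hw hx)] at e1
      have e2 := z2_add_eq e1
      rw [← e2]
      have hab : x 0 ≠ x n := fun h => by
        have := hx (show 0 ≤ n by omega) (show n ≤ n from le_rfl) h; omega
      rcases Nat.eq_zero_or_pos i with rfl | hi0
      · simp [hab]
      · rcases Nat.lt_or_ge i n with hin | hin
        · exact (hinner i hi0 hin hwH).elim
        · obtain rfl : i = n := by omega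
          simp [hab.symm]
    obtain ⟨e, he, hz⟩ := bd_ne hb
    exact ⟨e, hQC (chi_ne hz), he⟩
  have dXP : ∀ y ∈ pts (X ∪ P), D' y = d (D1 y) := by
    have aux : ∀ y ∈ pts X, D' y = d (D1 y) := by
      intro y hy
      rw [dH y (pts_mono hXH hy), hc.eq y hy, h1 hy]
    intro y hy
    rw [pts_union] at hy
    rcases hy with hy | hy
    · exact aux y hy
    · by_cases hyH : y ∈ pts H
      · exact aux y (hbP y hy hyH)
      · exact if_neg hyH
  have hbc : Metric.ball (0:ℂ) 1 ⊆ Metric.closedBall 0 1 := Metric.ball_subset_closedBall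
  have hPX : pts P ⊆ pts (X ∪ P) := pts_mono subset_union_right
  have hUb : ∀ z ∈ Metric.ball (0:ℂ) 1, d z ∈ U φ := fun z hz => hc.im ▸ mem_image_of_mem d hz
  have drP : Dr P D' := ((h2.mono subset_union_right).comp (fun y hy => h3 (hPX hy)) hc.cont hc.inj).congr
    fun y hy => (dXP y (hPX hy)).symm
  have drH : Dr H D' := hS.dr.congr fun y hy => (dH y hy).symm
  have drU : Dr (H ∪ P) D' := by
    refine drH.union drP ?_
    intro y hy y' hy' hyy
    by_cases hy'H : y' ∈ pts H
    · rw [dH y hy, dH y' hy'H] at hyy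
      exact hS.dr.inj hy hy'H hyy
    · rcases h4 y' hy' with hb | hb
      · rw [dH y hy, dXP y' (hPX hy')] at hyy
        exact (hc.av _ (hUb _ hb) ⟨y, hy, hyy⟩).elim
      · exact (hy'H (pts_mono hXH hb)).elim
  -- the new labels
  set κ' : F → ℕ := fun f => if κ f = φ ∧ χ f = 1 then L else κ f with hκ'
  have kp : ∀ f, κ f = φ → χ f = 1 → κ' f = L := fun f a b => if_pos ⟨a, b⟩
  have kn : ∀ f, ¬ (κ f = φ ∧ χ f = 1) → κ' f = κ f := fun f a => if_neg a
  have hφL : φ < L := by rw [← hφ 0 hn]; exact hL _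
  have kL : ∀ f, κ' f = L ↔ κ f = φ ∧ χ f = 1 := by
    intro f
    constructor
    · intro h; by_contra hcon; rw [kn f hcon] at h; have := hL f; omega
    · rintro ⟨a, b⟩; exact kp f a b
  have kφ : ∀ f, κ' f = φ ↔ κ f = φ ∧ χ f ≠ 1 := by
    intro f
    constructor
    · intro h
      by_cases hcon : κ f = φ ∧ χ f = 1
      · rw [kp f hcon.1 hcon.2] at h; omega
      · rw [kn f hcon] at h; exact ⟨h, fun h' => hcon ⟨h, h'⟩⟩
    · rintro ⟨a, b⟩; rw [kn f (fun h => b h.2), a]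
  have ko : ∀ ψ, ψ ≠ φ → ψ ≠ L → ∀ f, κ' f = ψ ↔ κ f = ψ := by
    intro ψ h1 h2 f
    by_cases hcon : κ f = φ ∧ χ f = 1
    · rw [kp f hcon.1 hcon.2]
      constructor
      · intro h; exact (h2 h.symm).elim
      · intro h; exact (h1 (h.symm.trans hcon.1)).elim
    · rw [kn f hcon]
  have clL : Cl fa fb (H ∪ P) κ' L = P ∪ Q := by
    ext e
    constructor
    · rintro ⟨he | he, h⟩
      · rw [kL, kL] at h
        exact Or.inr ((hQ e he).2 h)
      · exact Or.inl he
    · rintro (he | he)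
      · refine ⟨Or.inr he, ?_⟩
        obtain ⟨a, b, c⟩ := hPa e he
        rw [kL, kL]
        rcases z2_cases (χ (fa e)) with h | h
        · rcases z2_cases (χ (fb e)) with h' | h'
          · exact (c (h.trans h'.symm)).elim
          · exact Or.inr ⟨b, h'⟩
        · exact Or.inl ⟨a, h⟩
      · refine ⟨Or.inl (hXH (hQC he)), ?_⟩
        rw [kL, kL]
        exact (hQ e (hXH (hQC he))).1 he
  have clφ : Cl fa fb (H ∪ P) κ' φ = P ∪ (X \ Q) := by
    ext e
    constructor
    · rintro ⟨he | he, h⟩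
      · rw [kφ, kφ] at h
        refine Or.inr ⟨⟨he, h.imp (fun h => h.1) fun h => h.1⟩, ?_⟩
        rw [hQ e he]
        have hon := hS.lab.on e he
        rintro (h' | h') <;> rcases h with h | h
        · exact h.2 h'.2
        · exact hon (h'.1.trans h.1.symm)
        · exact hon (h.1.trans h'.1.symm)
        · exact h.2 h'.2
      · exact Or.inl he
    · rintro (he | he)
      · refine ⟨Or.inr he, ?_⟩
        obtain ⟨a, b, c⟩ := hPa e he
        rw [kφ, kφ]
        by_cases h : χ (fa e) = 1
        · exact Or.inr ⟨b, fun h' => c (h.trans h'.symm)⟩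
        · exact Or.inl ⟨a, h⟩
      · refine ⟨Or.inl he.1.1, ?_⟩
        rw [kφ, kφ]
        have hq := he.2
        rw [hQ e he.1.1] at hq
        rcases he.1.2 with h | h
        · exact Or.inl ⟨h, fun h' => hq (Or.inl ⟨h, h'⟩)⟩
        · exact Or.inr ⟨h, fun h' => hq (Or.inr ⟨h, h'⟩)⟩
  have clo : ∀ ψ, ψ ≠ φ → ψ ≠ L → Cl fa fb (H ∪ P) κ' ψ = Cl fa fb H κ ψ := by
    intro ψ hψ1 hψ2
    ext e
    constructor
    · rintro ⟨he | he, h⟩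
      · rw [ko ψ hψ1 hψ2, ko ψ hψ1 hψ2] at h
        exact ⟨he, h⟩
      · rw [ko ψ hψ1 hψ2, ko ψ hψ1 hψ2] at h
        obtain ⟨a, b, c⟩ := hPa e he
        rcases h with h | h
        · exact (hψ1 (h.symm.trans a)).elim
        · exact (hψ1 (h.symm.trans b)).elim
    · rintro ⟨he, h⟩
      refine ⟨Or.inl he, ?_⟩
      rwa [ko ψ hψ1 hψ2, ko ψ hψ1 hψ2]
  have lab' : Lab E' fa fb (H ∪ P) κ' := by
    refine ⟨union_subset hS.lab.sub fun e he => (hPH e he).1, ?_, ?_⟩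
    · intro e he hn'
      have a := hS.lab.out e he fun h => hn' (Or.inl h)
      have b := hχ0 e he (fun h => hn' (Or.inl h)) fun h => hn' (Or.inr h)
      simp only [hκ', a, b]
    · rintro e (he | he)
      · have hon := hS.lab.on e he
        have := hL (fa e)
        have := hL (fb e)
        simp only [hκ']
        split_ifs with c1 c2 c2
        · exact (hon (c1.1.trans c2.1.symm)).elim
        · omega
        · omega
        · exact hon
      · obtain ⟨a, b, c⟩ := hPa e he
        intro h
        by_cases h' : χ (fa e) = 1
        · rw [kp _ a h'] at h
          exact c (h'.trans ((kL _).1 h.symm).2.symm)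
        · rw [(kφ _).2 ⟨a, h'⟩] at h
          have h'' := ((kφ _).1 h.symm).2
          rcases z2_cases (χ (fa e)) with u | u
          · rcases z2_cases (χ (fb e)) with w | w
            · exact c (u.trans w.symm)
            · exact h'' w
          · exact h' u
  -- cells
  have newcell : ∀ (Y : Set K.E) (k : ℂ ≃ₜ ℂ), Y ⊆ X ∪ P → Circ Y (k.symm ∘ D1) →
      k '' Metric.sphere 0 1 = D1 '' pts Y → k '' Metric.ball 0 1 ⊆ Metric.ball 0 1 →
      (∀ z ∈ k '' Metric.ball 0 1, z ∉ D1 '' pts (X ∪ P)) →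
      CellD (H ∪ P) Y T D' ((d ∘ k) '' Metric.ball 0 1) (k.symm ∘ D1) (d ∘ k) := by
    intro Y k hY hcY hk1 hk2 hk3
    have hcl : MapsTo k (Metric.closedBall 0 1) (Metric.closedBall 0 1) := by
      intro z hz
      rw [← Metric.ball_union_sphere] at hz
      rcases hz with hz | hz
      · exact hbc (hk2 (mem_image_of_mem k hz))
      · have : k z ∈ D1 '' pts Y := hk1 ▸ mem_image_of_mem k hz
        obtain ⟨y, hy, hyz⟩ := this
        rw [← hyz]; exact h3 (pts_mono hY hy)
    refine ⟨hcY, hc.cont.comp k.continuous.continuousOn hcl, hc.inj.comp k.injective.injOn hcl,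
      hc.maps.comp hcl, ?_, rfl, ?_⟩
    · intro y hy
      rw [dXP y (pts_mono hY hy)]; simp
    · rintro _ ⟨b, hb, rfl⟩ ⟨y, hy, hyb⟩
      have hkb : k b ∈ Metric.ball (0:ℂ) 1 := hk2 (mem_image_of_mem k hb)
      rw [pts_union] at hy
      have hyH : y ∈ pts H → False := by
        intro hyH
        rw [dH y hyH] at hyb
        exact hc.av _ (hUb _ hkb) ⟨y, hyH, hyb⟩
      rcases hy with hy | hy
      · exact hyH hy
      · rw [dXP y (hPX hy)] at hyb
        have := hc.inj (h3 (hPX hy)) (hbc hkb) hyb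
        exact hk3 _ (mem_image_of_mem k hb) ⟨y, hPX hy, this⟩
  have cellQ := newcell _ kQ sQ cQ h10 h5 h8
  have cellR := newcell _ kR sR cR h11 h6 h9
  have sub1 : ∀ k : ℂ ≃ₜ ℂ, k '' Metric.ball 0 1 ⊆ Metric.ball 0 1 → (d ∘ k) '' Metric.ball 0 1 ⊆ U φ := by
    rintro k hk _ ⟨b, hb, rfl⟩
    exact hUb _ (hk (mem_image_of_mem k hb))
  set U' : ℕ → Set ℂ := fun ψ => if ψ = L then (d ∘ kQ) '' Metric.ball 0 1 else
    if ψ = φ then (d ∘ kR) '' Metric.ball 0 1 else U ψ with hU'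
  have UL : U' L = (d ∘ kQ) '' Metric.ball 0 1 := if_pos rfl
  have Uφ : U' φ = (d ∘ kR) '' Metric.ball 0 1 := by simp only [hU']; rw [if_neg (by omega), if_pos trivial]
  have Uo : ∀ ψ, ψ ≠ φ → ψ ≠ L → U' ψ = U ψ := by
    intro ψ a b; simp only [hU']; rw [if_neg b, if_neg a]
  have ro : ∀ ψ, ψ ≠ φ → ψ ≠ L → ψ ∈ range κ' → ψ ∈ range κ := by
    rintro ψ a b ⟨f, hf⟩; exact ⟨f, (ko ψ a b f).1 hf⟩
  have dQR : Disjoint (U' L) (U' φ) := by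
    rw [UL, Uφ, Set.disjoint_left]
    rintro _ ⟨b, hb, rfl⟩ ⟨b', hb', he⟩
    have e1 : kR b' ∈ kR '' Metric.ball 0 1 := mem_image_of_mem _ hb'
    have e2 : kQ b ∈ kQ '' Metric.ball 0 1 := mem_image_of_mem _ hb
    have := hc.inj (hbc (h6 e1)) (hbc (h5 e2)) he
    exact Set.disjoint_left.1 h7 e2 (this ▸ e1)
  have dο : ∀ ψ, ψ ≠ φ → ψ ≠ L → ψ ∈ range κ' → ψ ≠ 0 → Disjoint (U' L) (U' ψ) ∧ Disjoint (U' φ) (U' ψ) := by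
    intro ψ a b hr h0
    have := hS.disj φ hφr hne ψ (ro ψ a b hr) h0 (Ne.symm a)
    rw [UL, Uφ, Uo ψ a b]
    exact ⟨this.mono_left (sub1 _ h5), this.mono_left (sub1 _ h6)⟩
  refine ⟨κ', D', U', lab', VS_mono subset_union_left hS.vH, hS.conn.ear hw h0 hx, ?_, drU, ?_, ?_, ?_, ?_⟩
  · intro f
    rw [← hS.zero f]
    exact ko 0 (Ne.symm hne) (by omega) f
  · rw [dH _ (inl_mem.2 hS.vH), hS.v0]
  · intro y hy
    rw [pts_union] at hy
    rcases hy with hy | hy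
    · rw [dH y hy]; exact hS.mT hy
    · rw [dXP y (hPX hy)]; exact hc.maps (h3 (hPX hy))
  · intro ψ hr h0
    by_cases a : ψ = L
    · subst a
      rw [clL, UL]; exact ⟨_, _, cellQ⟩
    · by_cases b : ψ = φ
      · rw [b, clφ, Uφ]; exact ⟨_, _, cellR⟩
      · rw [clo ψ b a, Uo ψ b a]
        obtain ⟨m2, d2, hc2⟩ := hS.cell ψ (ro ψ b a hr) h0
        refine ⟨m2, d2, hc2.circ, hc2.cont, hc2.inj, hc2.maps, ?_, hc2.im, ?_⟩
        · intro y hy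
          rw [dH y (pts_mono (fun e he => he.1) hy)]; exact hc2.eq y hy
        · rintro u hu ⟨y, hy, rfl⟩
          by_cases hyH : y ∈ pts H
          · exact hc2.av _ hu ⟨y, hyH, (dH y hyH).symm⟩
          · rw [pts_union] at hy
            have hy := hy.resolve_left hyH
            rw [dXP y (hPX hy)] at hu
            rcases h4 y hy with hb | hb
            · exact Set.disjoint_left.1 (hS.disj φ hφr hne ψ (ro ψ b a hr) h0 (Ne.symm b)) (hUb _ hb) hu
            · exact hyH (pts_mono hXH hb)
  · intro ψ hr h0 ψ' hr' h0' hne'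
    by_cases a : ψ = L
    · by_cases b : ψ' = φ
      · rw [a, b]; exact dQR
      · rw [a]; exact (dο ψ' b (fun h => hne' (a.trans h.symm)) hr' h0').1
    · by_cases b : ψ = φ
      · by_cases c : ψ' = L
        · rw [b, c]; exact dQR.symm
        · rw [b]; exact (dο ψ' (fun h => hne' (b.trans h.symm)) c hr' h0').2
      · by_cases c : ψ' = L
        · rw [c]; exact (dο ψ b a hr h0).1.symm
        · by_cases e : ψ' = φ
          · rw [e]; exact (dο ψ b a hr h0).2.symm
          · rw [Uo ψ b a, Uo ψ' e c]
            exact hS.disj ψ (ro ψ b a hr) h0 ψ' (ro ψ' e c hr') h0' hne'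

end NPG

namespace NPG
open Set Filter Topology

variable {K : FinGraph}

/-- the sector into which everything is drawn -/
def TT : Set ℂ := {z | 0 ≤ z.re ∧ z.re ≤ 1 ∧ |z.im| ≤ z.re}

/-- pointed planar drawing with a free wedge at each vertex -/
def PP (E' : Set K.E) (v : K.V) : Prop := ∃ D : Pt K → ℂ, Dr E' D ∧ D (Sum.inl v) = 0 ∧ MapsTo D (pts E') TT ∧
  ∀ w ∈ VS E', ∃ ω : ℂ → ℂ, ContinuousOn ω TT ∧ InjOn ω TT ∧ MapsTo ω TT TT ∧ ω 0 = D (Sum.inl w) ∧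
    ∀ t ∈ TT, ω t ∈ D '' pts E' → t = 0

structure Good {F : Type*} (E' : Set K.E) (fa fb : K.E → F) (v : K.V) (J : Set F) (C : Set K.E) (m : Pt K → ℂ) : Prop where
  dl : dl E' fa fb (ind J 1) = chi C
  circ : Circ C m
  v : v ∈ VS C
  sub : C ⊆ E'

lemma chi_inj {X Y : Set K.E} (h : chi X = chi Y) : X = Y := by
  ext e
  have := congrFun h e
  constructor
  · intro h1; rw [chi_pos h1] at this; exact chi_ne (by rw [← this]; exact one_ne_zero)
  · intro h1; rw [chi_pos h1] at this; exact chi_ne (by rw [this]; exact one_ne_zero)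

lemma dl_add {F : Type*} (E' : Set K.E) (fa fb : K.E → F) (χ χ' : F → ZMod 2) :
    dl E' fa fb (χ + χ') = dl E' fa fb χ + dl E' fa fb χ' := by
  funext e
  rw [Pi.add_apply]
  by_cases h : e ∈ E'
  · rw [dl_pos h, dl_pos h, dl_pos h, Pi.add_apply, Pi.add_apply]; ring
  · rw [dl_neg h, dl_neg h, dl_neg h, add_zero]

lemma outer {F : Type*} [Finite F] {E' : Set K.E} {fa fb : K.E → F} {J : Set F} {v : K.V} {H : Set K.E} {κ : F → ℕ}
    (hlab : Lab E' fa fb H κ) (hz : ∀ f, κ f = 0 ↔ f ∈ J) (hD : Dual E' fa fb)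
    (hnl : ∀ e ∈ E', (K.ends e).1 ≠ (K.ends e).2) {C : Set K.E} {m : Pt K → ℂ} (hg : Good E' fa fb v J C m)
    (hmin : ∀ J' C' m', Good E' fa fb v J' C' m' → J.ncard ≤ J'.ncard)
    {x : ℕ → K.V} {p : ℕ → K.E} {n : ℕ} (hn : 0 < n) (hw : Wk x p n)
    (hx : InjOn x (Iic n)) (hinner : ∀ i, 0 < i → i < n → x i ∉ VS H) (hp : ∀ i < n, p i ∈ E' \ H)
    {χ : F → ZMod 2} {Q : Set K.E} (hφ : ∀ i < n, κ (fa (p i)) = 0)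
    (hχ1 : ∀ i < n, χ (fa (p i)) ≠ χ (fb (p i))) (hQC : Q ⊆ Cl fa fb H κ 0)
    (hdl : dl E' fa fb (ind {f | κ f = 0} χ) = chi (eset p n ∪ Q))
    (hbd : bd (chi (eset p n) + chi Q) = 0) : False := by
  classical
  have hJ : {f | κ f = 0} = J := by ext f; exact hz f
  have hCl : Cl fa fb H κ 0 = C := by
    apply chi_inj
    rw [← hlab.dl_one 0, hJ, hg.dl]
  rw [hCl] at hQC
  rw [hJ] at hdl
  have hXH : C ⊆ H := by rw [← hCl]; exact fun e he => he.1
  have hbX : bd (chi C) = 0 := by rw [← hg.dl]; exact hD.cyc _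
  have hlX : ∀ e ∈ C, (K.ends e).1 ≠ (K.ends e).2 := fun e he => hnl e (hg.sub he)
  have hintX : ∀ i, 0 < i → i < n → x i ∉ VS C := fun i a b h => hinner i a b (VS_mono hXH h)
  obtain ⟨D1, kQ, kR, h1, h2, h3, h4, h5, h6, h7, h8, h9, h10, h11⟩ := split hg.circ.dr hg.circ.im hg.circ.nt
    hlX hbX hw hn hx hintX
    (fun i hi h => (hp i hi).2 (hXH h)) hQC hbd
  set P := eset p n with hP
  have hPE : P ⊆ E' := by rintro _ ⟨i, hi, rfl⟩; exact (hp i hi).1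
  have hbR : bd (chi P + chi (C \ Q)) = 0 := by
    rw [chi_sdiff hQC, bd_add, bd_add, hbX, zero_add, ← bd_add]; exact hbd
  have ntQ := nt_ear hg.circ.nt hlX hw hx hintX hQC hbd
  have ntR := nt_ear hg.circ.nt hlX hw hx hintX (sdiff_subset (s := C) (t := Q)) hbR
  have cQ := circ_pull h2 (union_subset subset_union_right (hQC.trans subset_union_left)) h10 ntQ
  have cR := circ_pull h2 (union_subset subset_union_right (sdiff_subset.trans subset_union_left)) h11 ntR
  have ha : fa (p 0) ∈ J := (hz _).1 (hφ 0 hn)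
  have hb : fb (p 0) ∈ J := (hz _).1 ((hlab.out _ (hp 0 hn).1 (hp 0 hn).2) ▸ hφ 0 hn)
  have hab : ∀ c : ZMod 2, ∃ f ∈ J, χ f ≠ c := by
    intro c
    by_cases h : χ (fa (p 0)) = c
    · exact ⟨_, hb, fun h' => hχ1 0 hn (h.trans h'.symm)⟩
    · exact ⟨_, ha, h⟩
  have key : ∀ c : ZMod 2, ∀ J' : Set F, J' = {f | f ∈ J ∧ χ f = c} → ∀ C' m', Good E' fa fb v J' C' m' → False := by
    rintro c J' rfl C' m' h
    obtain ⟨f, hf, hfc⟩ := hab c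
    have := hmin _ _ _ h
    have h' := Set.ncard_lt_ncard (s := {f | f ∈ J ∧ χ f = c}) (t := J) ⟨fun f hf => hf.1, fun hs => hfc (hs hf).2⟩ (Set.toFinite _)
    omega
  have hvQ : v ∈ VS Q ∨ v ∈ VS (C \ Q) := by
    have := hg.v
    rw [← union_sdiff_cancel hQC, VS_union] at this
    exact this
  rcases hvQ with hv | hv
  · refine key 1 _ rfl _ _ ⟨?_, cQ, VS_mono subset_union_right hv, union_subset hPE (hQC.trans hg.sub)⟩
    rw [← hdl]
    congr 1
    funext f
    by_cases hf : f ∈ J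
    · rw [ind_pos hf]
      rcases z2_cases (χ f) with h | h
      · rw [ind_neg, h]
        intro h'; have h' := h'.2; rw [h] at h'; exact zero_ne_one h'
      · rw [ind_pos (show f ∈ {f | f ∈ J ∧ χ f = 1} from ⟨hf, h⟩), h]; rfl
    · rw [ind_neg hf, ind_neg fun h => hf h.1]
  · refine key 0 _ rfl _ _ ⟨?_, cR, VS_mono subset_union_right hv, union_subset hPE (sdiff_subset.trans hg.sub)⟩
    have e1 : ind {f | f ∈ J ∧ χ f = 0} 1 = ind J 1 + ind J χ := by
      funext f
      rw [Pi.add_apply]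
      by_cases hf : f ∈ J
      · rw [ind_pos hf, ind_pos hf]
        rcases z2_cases (χ f) with h | h
        · rw [ind_pos (show f ∈ {f | f ∈ J ∧ χ f = 0} from ⟨hf, h⟩), h, add_zero]
        · rw [ind_neg, h]
          · rfl
          · intro h'; have h' := h'.2; rw [h] at h'; exact one_ne_zero h'
      · rw [ind_neg hf, ind_neg hf, ind_neg fun h => hf h.1, add_zero]
    have dPC : Disjoint P C := by
      rw [Set.disjoint_left]; rintro _ ⟨i, hi, rfl⟩ h; exact (hp i hi).2 (hXH h)
    rw [e1, dl_add, hdl, hg.dl, chi_union (dPC.mono_right hQC), chi_union (dPC.mono_right sdiff_subset), chi_sdiff hQC]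
    ring

lemma grow {F : Type*} [Finite F] {E' : Set K.E} (hB : Block E') {fa fb : K.E → F} {T : Set ℂ} {J : Set F} {v : K.V}
    (hD : Dual E' fa fb) {C : Set K.E} {m : Pt K → ℂ} (hg : Good E' fa fb v J C m)
    (hmin : ∀ J' C' m', Good E' fa fb v J' C' m' → J.ncard ≤ J'.ncard) :
    ∀ (k : ℕ) (H : Set K.E) (κ : F → ℕ) (D : Pt K → ℂ) (U : ℕ → Set ℂ), (E' \ H).ncard ≤ k →
      St E' fa fb T J v H κ D U → ∃ κ D U, St E' fa fb T J v E' κ D U := by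
  intro k
  induction k with
  | zero =>
    intro H κ D U hk hS
    have : E' \ H = ∅ := (Set.ncard_eq_zero (Set.toFinite _)).1 (by omega)
    rw [sdiff_eq_empty] at this
    obtain rfl := Subset.antisymm this hS.lab.sub
    exact ⟨_, _, _, hS⟩
  | succ k ih =>
    intro H κ D U hk hS
    by_cases hne : (E' \ H).Nonempty
    · obtain ⟨e0, he0, hi0⟩ := hS.vH
      obtain ⟨x, p, n, hn, hw, h0, hxn, hx, hinner, hp⟩ := ear hB hS.lab.sub ⟨e0, he0⟩ hne
      have hnl : ∀ e ∈ E', (K.ends e).1 ≠ (K.ends e).2 := by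
        intro e he
        by_cases h : e = e0
        · obtain ⟨f, hf⟩ := hne
          exact noloop hB he hf.1 (fun h' => hf.2 (h' ▸ h ▸ he0))
        · exact noloop hB he (hS.lab.sub he0) (Ne.symm h)
      obtain ⟨χ, φ, Q, h1, h2, h3, h4, h5, h6, h7⟩ := ear_split hD hS.lab hS.conn hnl hn hw h0 hxn hx hinner hp
      by_cases hφ : φ = 0
      · subst hφ
        exact (outer hS.lab hS.zero hD hnl hg hmin hn hw hx hinner hp h1 h2 h4 h6 h7).elim
      · obtain ⟨κ', D', U', hS'⟩ := step hS hD hnl hn hw h0 hx hinner hp h1 h2 h3 h4 h5 h7 hφ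
        refine ih _ κ' D' U' ?_ hS'
        have : (E' \ (H ∪ eset p n)).ncard < (E' \ H).ncard := by
          refine Set.ncard_lt_ncard ⟨fun e he => ⟨he.1, fun h => he.2 (Or.inl h)⟩, fun hs => ?_⟩ (Set.toFinite _)
          exact (hs (hp 0 hn)).2 (Or.inr (show p 0 ∈ eset p n from ⟨0, hn, rfl⟩))
        omega
    · rw [not_nonempty_iff_eq_empty, sdiff_eq_empty] at hne
      obtain rfl := Subset.antisymm hne hS.lab.sub
      exact ⟨_, _, _, hS⟩

lemma TT_convex : Convex ℝ TT := by
  intro z hz w hw a b ha hb hab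
  obtain ⟨h1, h2, h3⟩ := hz
  obtain ⟨k1, k2, k3⟩ := hw
  rw [abs_le] at h3 k3
  refine ⟨?_, ?_, ?_⟩
  · simp; positivity
  · simp; nlinarith
  · rw [abs_le]; simp; constructor <;> nlinarith

lemma TT_closed : IsClosed TT := by
  have : TT = {z : ℂ | 0 ≤ z.re} ∩ ({z | z.re ≤ 1} ∩ {z | |z.im| ≤ z.re}) := rfl
  rw [this]
  exact (isClosed_le continuous_const Complex.continuous_re).inter
    ((isClosed_le Complex.continuous_re continuous_const).inter
      (isClosed_le Complex.continuous_im.abs Complex.continuous_re))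

lemma TT_bdd : Bornology.IsBounded TT := by
  refine (Metric.isBounded_closedBall (x := (0:ℂ)) (r := 2)).subset ?_
  rintro z ⟨h1, h2, h3⟩
  rw [mem_closedBall_zero_iff]
  have := Complex.norm_le_abs_re_add_abs_im z
  rw [abs_of_nonneg h1] at this
  linarith

lemma TT_int : (interior TT).Nonempty := by
  refine ⟨(1/2 : ℝ), mem_interior.2 ⟨{z : ℂ | 0 < z.re} ∩ ({z | z.re < 1} ∩ {z | |z.im| < z.re}), ?_, ?_, ?_⟩⟩
  · rintro z ⟨h1, h2, h3⟩
    exact ⟨le_of_lt h1, le_of_lt h2, le_of_lt h3⟩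
  · exact (isOpen_lt continuous_const Complex.continuous_re).inter
      ((isOpen_lt Complex.continuous_re continuous_const).inter
        (isOpen_lt Complex.continuous_im.abs Complex.continuous_re))
  · refine ⟨?_, ?_, ?_⟩
    · show (0:ℝ) < ((1/2 : ℝ) : ℂ).re
      rw [Complex.ofReal_re]; norm_num
    · show ((1/2 : ℝ) : ℂ).re < 1
      rw [Complex.ofReal_re]; norm_num
    · show |((1/2 : ℝ) : ℂ).im| < ((1/2 : ℝ) : ℂ).re
      rw [Complex.ofReal_re, Complex.ofReal_im]; norm_num

lemma TT_zero : (0:ℂ) ∈ frontier TT := by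
  rw [frontier, TT_closed.closure_eq]
  refine ⟨⟨le_rfl, by simp, by simp⟩, fun h => ?_⟩
  obtain ⟨ε, hε, hs⟩ := Metric.isOpen_iff.1 isOpen_interior _ h
  have : ((-(ε/2) : ℝ) : ℂ) ∈ Metric.ball (0:ℂ) ε := by
    rw [mem_ball_zero_iff, Complex.norm_real, Real.norm_eq_abs, abs_neg, abs_of_pos (by linarith)]; linarith
  have := (interior_subset (hs this)).1
  rw [Complex.ofReal_re] at this
  linarith

lemma block_PP {F : Type*} [Finite F] {E' : Set K.E} (hB : Block E') {fa fb : K.E → F} (hD : Dual E' fa fb) {v : K.V}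
    (hv : v ∈ VS E') (h1 : ∀ e, E' = {e} → (K.ends e).1 = (K.ends e).2) : PP E' v := by
  classical
  obtain ⟨J, hJ, hmin⟩ : ∃ J : Set F, (∃ C m, Good E' fa fb v J C m) ∧
      ∀ J' C' m', Good E' fa fb v J' C' m' → J.ncard ≤ J'.ncard := by
    have hex : ∃ k : ℕ, ∃ J : Set F, (∃ C m, Good E' fa fb v J C m) ∧ J.ncard = k := by
      obtain ⟨C, m, h2, h3, h4, h5⟩ := circuit hB hv h1
      obtain ⟨χ, hχ⟩ := hD.ex (chi C) (fun e he => chi_neg fun h => he (h2 h)) h5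
      refine ⟨_, {f | χ f = 1}, ⟨C, m, ?_, h4, h3, h2⟩, rfl⟩
      rw [hχ]; congr 1
      funext f
      rcases z2_cases (χ f) with h | h
      · rw [ind_neg, h]
        intro h' ; have h' : χ f = 1 := h'
        rw [h] at h'; exact zero_ne_one h'
      · rw [ind_pos (show f ∈ {f | χ f = 1} from h), h]; rfl
    obtain ⟨J, hJ, hk⟩ := Nat.find_spec hex
    refine ⟨J, hJ, fun J' C' m' h => ?_⟩
    rw [hk]
    exact Nat.find_min' hex ⟨J', ⟨C', m', h⟩, rfl⟩
  obtain ⟨C, m, hg⟩ := hJ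
  obtain ⟨h, hb, hcb, hs⟩ := disc_param TT_convex TT_closed TT_int TT_bdd
  obtain ⟨η, hη, hη0⟩ : (0:ℂ) ∈ h '' Metric.sphere 0 1 := hs ▸ TT_zero
  have hζ : m (Sum.inl v) ∈ Metric.sphere (0:ℂ) 1 := hg.circ.im ▸ mem_image_of_mem m (inl_mem.2 hg.v)
  rw [mem_sphere_zero_iff_norm] at hη hζ
  set ζ := m (Sum.inl v)
  have hζ0 : ζ ≠ 0 := fun h => by rw [h, norm_zero] at hζ; exact zero_ne_one hζ
  have hη1 : η ≠ 0 := fun h => by rw [h, norm_zero] at hη; exact zero_ne_one hη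
  set d : ℂ → ℂ := fun z => h (z * (η / ζ)) with hd
  have hq : ‖η / ζ‖ = 1 := by rw [norm_div, hη, hζ, div_one]
  have hq0 : η / ζ ≠ 0 := div_ne_zero hη1 hζ0
  have hdc : Continuous d := h.continuous.comp (continuous_id.mul continuous_const)
  have hdi : Function.Injective d := fun z w e => mul_right_cancel₀ hq0 (h.injective e)
  have hdm : MapsTo d (Metric.closedBall 0 1) TT := by
    intro z hz
    rw [← hcb]
    refine mem_image_of_mem h ?_
    rw [mem_closedBall_zero_iff] at hz ⊢
    rwa [norm_mul, hq, mul_one]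
  set κ : F → ℕ := fun f => if f ∈ J then 0 else 1 with hκ
  have k0 : ∀ f, f ∈ J → κ f = 0 := fun f hf => if_pos hf
  have k1 : ∀ f, f ∉ J → κ f = 1 := fun f hf => if_neg hf
  have kz : ∀ f, κ f = 0 ↔ f ∈ J := by
    intro f
    refine ⟨fun h => ?_, k0 f⟩
    by_contra hf; rw [k1 f hf] at h; exact one_ne_zero h
  have hdle : ∀ e ∈ E', ind J 1 (fa e) + ind J 1 (fb e) = chi C e := by
    intro e he; rw [← hg.dl, dl_pos he]
  have hlab : Lab E' fa fb C κ := by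
    refine ⟨hg.sub, fun e he hC => ?_, fun e he heq => ?_⟩
    · have := hdle e he
      rw [chi_neg hC] at this
      by_cases a : fa e ∈ J <;> by_cases b : fb e ∈ J
      · rw [k0 _ a, k0 _ b]
      · rw [ind_pos a, ind_neg b, add_zero] at this; exact (one_ne_zero this).elim
      · rw [ind_neg a, ind_pos b, zero_add] at this; exact (one_ne_zero this).elim
      · rw [k1 _ a, k1 _ b]
    · have := hdle e (hg.sub he)
      rw [chi_pos he] at this
      by_cases a : fa e ∈ J <;> by_cases b : fb e ∈ J
      · rw [ind_pos a, ind_pos b] at this; exact zero_ne_one ((z2_self _).symm.trans this)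
      · rw [k0 _ a, k1 _ b] at heq; exact zero_ne_one heq
      · rw [k1 _ a, k0 _ b] at heq; exact one_ne_zero heq
      · rw [ind_neg a, ind_neg b, add_zero] at this; exact zero_ne_one this
  have hr : ∀ φ ∈ range κ, φ ≠ 0 → φ = 1 := by
    rintro _ ⟨f, rfl⟩ h
    exact k1 f fun hf => h (k0 f hf)
  have hCl : Cl fa fb C κ 1 = C := by
    ext e
    refine ⟨fun h => h.1, fun he => ⟨he, ?_⟩⟩
    have := hlab.on e he
    by_cases a : fa e ∈ J
    · right; apply k1; intro b; exact this ((k0 _ a).trans (k0 _ b).symm)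
    · left; exact k1 _ a
  have hmb : MapsTo m (pts C) (Metric.sphere 0 1) := fun y hy => hg.circ.im ▸ mem_image_of_mem m hy
  have hmb' : MapsTo m (pts C) (Metric.closedBall 0 1) := fun y hy => Metric.sphere_subset_closedBall (hmb hy)
  have hS : St E' fa fb TT J v C κ (d ∘ m) (fun _ => d '' Metric.ball 0 1) := by
    refine ⟨hlab, hg.v, hg.circ.conn hg.v, kz, hg.circ.dr.comp hmb' hdc.continuousOn hdi.injOn, ?_, ?_, ?_, ?_⟩
    · show h (ζ * (η / ζ)) = 0
      rw [mul_div_cancel₀ _ hζ0, hη0]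
    · exact hdm.comp hmb'
    · intro φ hφ hne
      rw [hr φ hφ hne, hCl]
      refine ⟨m, d, hg.circ, hdc.continuousOn, hdi.injOn, hdm, fun _ _ => rfl, rfl, ?_⟩
      rintro _ ⟨b, hb, rfl⟩ ⟨y, hy, hyb⟩
      have h1 := hmb hy
      rw [hdi hyb, mem_sphere_zero_iff_norm] at h1
      rw [mem_ball_zero_iff] at hb
      linarith
    · intro φ hφ hne ψ hψ hne' hh
      exact (hh ((hr φ hφ hne).trans (hr ψ hψ hne').symm)).elim
  obtain ⟨κ', D, U, hF⟩ := grow hB hD hg hmin _ C κ _ _ le_rfl hS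
  refine ⟨D, hF.dr, hF.v0, hF.mT, ?_⟩
  rintro w ⟨e, he, hi⟩
  obtain ⟨φ, hφr, hφ0, heφ⟩ : ∃ φ ∈ range κ', φ ≠ 0 ∧ e ∈ Cl fa fb E' κ' φ := by
    by_cases a : κ' (fa e) = 0
    · exact ⟨κ' (fb e), ⟨_, rfl⟩, fun b => hF.lab.on e he (a.trans b.symm), he, Or.inr rfl⟩
    · exact ⟨κ' (fa e), ⟨_, rfl⟩, a, he, Or.inl rfl⟩
  obtain ⟨μ, δ, hc⟩ := hF.cell φ hφr hφ0
  have hwp : (Sum.inl w : Pt K) ∈ pts (Cl fa fb E' κ' φ) := inl_mem.2 ⟨e, heφ, hi⟩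
  have hξ : μ (Sum.inl w) ∈ Metric.sphere (0:ℂ) 1 := hc.circ.im ▸ mem_image_of_mem μ hwp
  rw [mem_sphere_zero_iff_norm] at hξ
  set ξ := μ (Sum.inl w) with hξd
  have hξ0 : ξ ≠ 0 := fun h => by rw [h, norm_zero] at hξ; exact zero_ne_one hξ
  have hin : ∀ t ∈ TT, t ≠ 0 → ξ * (1 - t / 2) ∈ Metric.ball (0:ℂ) 1 := by
    rintro t ⟨t1, t2, t3⟩ ht
    rw [mem_ball_zero_iff, norm_mul, hξ, one_mul]
    have hpos : 0 < t.re := by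
      rcases eq_or_lt_of_le t1 with h | h
      · exfalso
        rw [← h] at t3
        exact ht (Complex.ext h.symm (abs_eq_zero.1 (le_antisymm t3 (abs_nonneg _))))
      · exact h
    rw [abs_le] at t3
    have hsq : ‖1 - t / 2‖ ^ 2 < 1 := by
      rw [← Complex.normSq_eq_norm_sq, Complex.normSq_apply]
      have e1 : (1 - t / 2).re = 1 - t.re / 2 := by simp
      have e2 : (1 - t / 2).im = - (t.im / 2) := by simp
      rw [e1, e2]
      nlinarith
    nlinarith [norm_nonneg (1 - t / 2)]
  have hin' : MapsTo (fun t : ℂ => ξ * (1 - t / 2)) TT (Metric.closedBall 0 1) := by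
    intro t ht
    by_cases h0 : t = 0
    · subst h0
      show ξ * (1 - 0 / 2) ∈ _
      rw [mem_closedBall_zero_iff]; simp [hξ]
    · exact Metric.ball_subset_closedBall (hin t ht h0)
  refine ⟨fun t => δ (ξ * (1 - t / 2)), hc.cont.comp (by fun_prop) hin', ?_, hc.maps.comp hin', ?_, ?_⟩
  · refine hc.inj.comp ?_ hin'
    intro s _ t _ hst
    have h1 := mul_left_cancel₀ hξ0 hst
    linear_combination (-2) * h1
  · rw [hc.eq _ hwp]; simp [hξd]
  · intro t ht hmem
    by_contra h0
    exact hc.av _ (hc.im ▸ mem_image_of_mem δ (hin t ht h0)) hmem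

end NPG

namespace NPG
open Set Filter Topology

variable {K : FinGraph}

noncomputable def L1 (z : ℂ) : ℂ := ⟨z.re, (z.im + 2 * z.re) / 4⟩
noncomputable def L2 (z : ℂ) : ℂ := ⟨z.re, (z.im - 2 * z.re) / 4⟩

lemma L1_cont : Continuous L1 := by
  have : L1 = fun z : ℂ => (z.re : ℂ) + (((z.im + 2 * z.re) / 4 : ℝ) : ℂ) * Complex.I := by
    funext z; apply Complex.ext <;> simp [L1]
  rw [this]; fun_prop

lemma L2_cont : Continuous L2 := by
  have : L2 = fun z : ℂ => (z.re : ℂ) + (((z.im - 2 * z.re) / 4 : ℝ) : ℂ) * Complex.I := by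
    funext z; apply Complex.ext <;> simp [L2]
  rw [this]; fun_prop

lemma L1_zero : L1 0 = 0 := by apply Complex.ext <;> simp [L1]
lemma L2_zero : L2 0 = 0 := by apply Complex.ext <;> simp [L2]

lemma mem_TT {z : ℂ} : z ∈ TT ↔ 0 ≤ z.re ∧ z.re ≤ 1 ∧ |z.im| ≤ z.re := Iff.rfl

lemma L1_inj : Function.Injective L1 := by
  intro z z' h
  have h1 : z.re = z'.re := by
    have := congrArg Complex.re h
    exact this
  have h2 : (z.im + 2 * z.re) / 4 = (z'.im + 2 * z'.re) / 4 := by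
    have := congrArg Complex.im h
    exact this
  apply Complex.ext <;> linarith

lemma L2_inj : Function.Injective L2 := by
  intro z z' h
  have h1 : z.re = z'.re := by
    have := congrArg Complex.re h
    exact this
  have h2 : (z.im - 2 * z.re) / 4 = (z'.im - 2 * z'.re) / 4 := by
    have := congrArg Complex.im h
    exact this
  apply Complex.ext <;> linarith

lemma L1_maps {z : ℂ} (h : z ∈ TT) : L1 z ∈ TT := by
  rw [mem_TT, abs_le] at h ⊢
  simp only [L1]
  refine ⟨h.1, h.2.1, ?_, ?_⟩ <;> linarith

lemma L2_maps {z : ℂ} (h : z ∈ TT) : L2 z ∈ TT := by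
  rw [mem_TT, abs_le] at h ⊢
  simp only [L2]
  refine ⟨h.1, h.2.1, ?_, ?_⟩ <;> linarith

lemma zero_TT : (0:ℂ) ∈ TT := by simp [mem_TT]

lemma L1_real {z : ℂ} (h : z ∈ TT) (h' : (L1 z).im = 0) : z = 0 := by
  rw [mem_TT, abs_le] at h
  simp only [L1] at h'
  apply Complex.ext
  · rw [Complex.zero_re]; linarith
  · rw [Complex.zero_im]; linarith

lemma L1_L2 {z z' : ℂ} (h : z ∈ TT) (h' : z' ∈ TT) (e : L1 z = L2 z') : z = 0 ∧ z' = 0 := by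
  rw [mem_TT, abs_le] at h h'
  have h1 : z.re = z'.re := by
    have := congrArg Complex.re e
    exact this
  have h2 : (z.im + 2 * z.re) / 4 = (z'.im - 2 * z'.re) / 4 := by
    have := congrArg Complex.im e
    exact this
  constructor
  · apply Complex.ext
    · rw [Complex.zero_re]; linarith
    · rw [Complex.zero_im]; linarith
  · apply Complex.ext
    · rw [Complex.zero_re]; linarith
    · rw [Complex.zero_im]; linarith

lemma PP_single {e : K.E} (he : (K.ends e).1 ≠ (K.ends e).2) {v : K.V} (hv : v ∈ VS {e}) : PP {e} v := by
  obtain ⟨u, hvu, huv⟩ : ∃ u, v ≠ u ∧ (K.ends e = (v, u) ∨ K.ends e = (u, v)) := by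
    obtain ⟨e', he', h | h⟩ := hv
    · obtain rfl : e' = e := he'
      exact ⟨(K.ends e').2, by rw [← h]; exact he, Or.inl (by rw [← h])⟩
    · obtain rfl : e' = e := he'
      exact ⟨(K.ends e').1, by rw [← h]; exact he.symm, Or.inr (by rw [← h])⟩
  let x : ℕ → K.V := fun n => if n = 0 then v else u
  have x0 : x 0 = v := rfl
  have x1 : x 1 = u := rfl
  have hw : Wk x (fun _ => e) 1 := by
    intro i hi
    obtain rfl : i = 0 := by omega
    exact huv
  have hset : eset (fun _ : ℕ => e) 1 = {e} := by
    ext f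
    constructor
    · rintro ⟨i, _, rfl⟩; rfl
    · intro h
      obtain rfl : f = e := h
      exact ⟨0, one_pos, rfl⟩
  have hi1 : ∀ i j : ℕ, i < 1 → j < 1 → i = j := by intro i j; omega
  have hγ : Function.Injective (fun s : ℝ => ((s / 2 : ℝ) : ℂ)) := by
    intro a b h
    have := Complex.ofReal_injective h
    linarith
  have hxI : InjOn x (Iic 1) := by
    intro i hi j hj h
    have hi : i ≤ 1 := hi
    have hj : j ≤ 1 := hj
    interval_cases i <;> interval_cases j
    · rfl
    · exact (hvu h).elim
    · exact (hvu h.symm).elim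
    · rfl
  obtain ⟨D, -, -, hD, hDx, hDi⟩ := path_model hw one_pos (hxI.mono fun i (hi : i < 1) => (show i ≤ 1 from hi.le))
    (fun i hi j hj _ => hi1 i j hi hj) (γ := fun s : ℝ => ((s / 2 : ℝ) : ℂ)) (by fun_prop) hγ.injOn
    (Or.inr ⟨hγ.injOn, hxI⟩) (by
      classical
      exact fun y => if y = Sum.inl v then 0 else (1 / 2 : ℝ)) (by simp [x]) (by simp [x, hvu.symm])
  rw [hset] at hD hDi
  have hD0 : D (Sum.inl v) = 0 := by have := hDx 0 (by simp); simpa [x] using this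
  have hD1 : D (Sum.inl u) = ((1 / 2 : ℝ) : ℂ) := by have := hDx 1 le_rfl; simpa [x] using this
  have him : ∀ z ∈ D '' pts {e}, z.im = 0 ∧ 0 ≤ z.re ∧ z.re ≤ 1 := by
    intro z hz
    rw [hDi] at hz
    obtain ⟨s, hs, rfl⟩ := hz
    have h2 : s ≤ 1 := by simpa using hs.2
    have h1 := hs.1
    exact ⟨Complex.ofReal_im _, by rw [Complex.ofReal_re]; linarith, by rw [Complex.ofReal_re]; linarith⟩
  refine ⟨D, hD, hD0, ?_, ?_⟩
  · intro y hy
    obtain ⟨h1, h2, h3⟩ := him _ ⟨y, hy, rfl⟩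
    exact mem_TT.2 ⟨h2, h3, by rw [h1, abs_zero]; exact h2⟩
  · intro w hw'
    rw [← hset] at hw'
    obtain ⟨i, hi, rfl⟩ := VS_eset hw hw'
    interval_cases i
    · exact ⟨L1, L1_cont.continuousOn, L1_inj.injOn, fun t ht => L1_maps ht, by rw [L1_zero, x0, hD0],
        fun t ht h => L1_real ht (him _ h).1⟩
    · refine ⟨fun t => ((1 / 2 : ℝ) : ℂ) + ((1 / 2 : ℝ) : ℂ) * L1 t, ?_, ?_, ?_, ?_, ?_⟩
      · have := L1_cont
        fun_prop
      · intro a _ b _ h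
        have h := add_left_cancel h
        exact L1_inj (mul_left_cancel₀ (by norm_num) h)
      · intro t ht
        have := L1_maps ht
        rw [mem_TT, abs_le] at this ⊢
        simp only [Complex.add_re, Complex.add_im, Complex.re_ofReal_mul, Complex.im_ofReal_mul, Complex.ofReal_re, Complex.ofReal_im]
        refine ⟨?_, ?_, ?_, ?_⟩ <;> linarith
      · simp only [L1_zero, x1, hD1, mul_zero, add_zero]
      · intro t ht h
        have h := (him _ h).1
        simp only [Complex.add_im, Complex.im_ofReal_mul, Complex.ofReal_im] at h
        exact L1_real ht (by linarith)

lemma TT_smul {r : ℝ} (h0 : 0 ≤ r) (h1 : r ≤ 1) {z : ℂ} (h : z ∈ TT) : (r : ℂ) * z ∈ TT := by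
  rw [mem_TT] at h ⊢
  rw [Complex.re_ofReal_mul, Complex.im_ofReal_mul, abs_mul, abs_of_nonneg h0]
  exact ⟨mul_nonneg h0 h.1, mul_le_one₀ h1 h.1 h.2.1, mul_le_mul_of_nonneg_left h.2.2 h0⟩

lemma TT_compact : IsCompact TT := Metric.isCompact_of_isClosed_isBounded TT_closed TT_bdd

lemma PP_glue {E1 E2 : Set K.E} (hd : Disjoint E1 E2) {v w : K.V} (hv : v ∈ VS E1) (hw1 : w ∈ VS E1)
    (hw2 : w ∈ VS E2) (hs : ∀ u ∈ VS E1, u ∈ VS E2 → u = w) (h1 : PP E1 v) (h2 : PP E2 w) : PP (E1 ∪ E2) v := by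
  classical
  obtain ⟨D1, d1, d1v, m1, W1⟩ := h1
  obtain ⟨D2, d2, d2w, m2, W2⟩ := h2
  obtain ⟨ω, ωc, ωi, ωm, ω0, ωf⟩ := W1 w hw1
  let D : Pt K → ℂ := fun y => if y ∈ pts E1 then D1 y else ω (L1 (D2 y))
  have e1 : ∀ y ∈ pts E1, D y = D1 y := fun y hy => if_pos hy
  have e2 : ∀ y ∈ pts E2, D y = ω (L1 (D2 y)) := by
    intro y hy
    by_cases h : y ∈ pts E1
    · obtain ⟨u, hu, rfl⟩ := pts_inter hd h hy
      obtain rfl := hs u hu.1 hu.2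
      rw [e1 _ h, d2w, L1_zero, ω0]
    · exact if_neg h
  have m2' : ∀ y ∈ pts E2, L1 (D2 y) ∈ TT := fun y hy => L1_maps (m2 hy)
  have d2z : ∀ y ∈ pts E2, D2 y = 0 → y = Sum.inl w := fun y hy h =>
    d2.inj hy (inl_mem.2 hw2) (h.trans d2w.symm)
  have hL0 : ∀ z, L1 z = 0 → z = 0 := fun z h => L1_inj (h.trans L1_zero.symm)
  have hdr2 : Dr E2 (ω ∘ (L1 ∘ D2)) :=
    (d2.comp m2 L1_cont.continuousOn L1_inj.injOn).comp (s := TT) (fun y hy => m2' y hy) ωc ωi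
  have hdr : Dr (E1 ∪ E2) D := by
    refine (d1.congr fun y hy => (e1 y hy).symm).union (hdr2.congr fun y hy => (e2 y hy).symm) ?_
    intro y hy y' hy' h
    rw [e1 y hy, e2 y' hy'] at h
    have h0 := ωf _ (m2' y' hy') ⟨y, hy, h⟩
    have hy'w := d2z y' hy' (hL0 _ h0)
    rw [h0, ω0] at h
    rw [hy'w]
    exact d1.inj hy (inl_mem.2 hw1) h
  have him : ∀ z, z ∈ D '' pts (E1 ∪ E2) → z ∈ D1 '' pts E1 ∨ ∃ y ∈ pts E2, z = ω (L1 (D2 y)) := by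
    rintro _ ⟨y, hy, rfl⟩
    rw [pts_union] at hy
    rcases hy with hy | hy
    · exact Or.inl ⟨y, hy, (e1 y hy).symm⟩
    · exact Or.inr ⟨y, hy, e2 y hy⟩
  refine ⟨D, hdr, by rw [e1 _ (inl_mem.2 hv), d1v], ?_, ?_⟩
  · intro y hy
    rw [pts_union] at hy
    rcases hy with hy | hy
    · rw [e1 y hy]; exact m1 hy
    · rw [e2 y hy]; exact ωm (m2' y hy)
  intro u hu
  by_cases huw : u = w
  · subst huw
    refine ⟨ω ∘ L2, ωc.comp L2_cont.continuousOn fun t ht => L2_maps ht,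
      ωi.comp L2_inj.injOn fun t ht => L2_maps ht, fun t ht => ωm (L2_maps ht), ?_, ?_⟩
    · show ω (L2 0) = _
      rw [L2_zero, ω0, e1 _ (inl_mem.2 hw1)]
    · intro t ht h
      rcases him _ h with h | ⟨y, hy, h⟩
      · have := ωf _ (L2_maps ht) h
        exact L2_inj (this.trans L2_zero.symm)
      · have := ωi (L2_maps ht) (m2' y hy) h
        exact (L1_L2 (m2 hy) ht this.symm).2
  rw [VS_union] at hu
  rcases hu with hu | hu
  · obtain ⟨ρ, ρc, ρi, ρm, ρ0, ρf⟩ := W1 u hu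
    have hcl : IsClosed (ω '' TT) := (TT_compact.image_of_continuousOn ωc).isClosed
    have hn : ρ 0 ∉ ω '' TT := by
      rintro ⟨t, ht, h⟩
      have h0 := ωf t ht (by rw [h, ρ0]; exact ⟨_, inl_mem.2 hu, rfl⟩)
      rw [h0, ω0, ρ0] at h
      have := d1.inj (inl_mem.2 hw1) (inl_mem.2 hu) h
      exact huw (Sum.inl_injective this).symm
    obtain ⟨δ, hδ, hball⟩ : ∃ δ > 0, ∀ t ∈ TT, ‖t‖ < δ → ρ t ∉ ω '' TT := by
      have hev : ∀ᶠ t in 𝓝[TT] (0:ℂ), ρ t ∈ (ω '' TT)ᶜ :=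
        (ρc 0 zero_TT).eventually (hcl.isOpen_compl.mem_nhds hn)
      rw [eventually_nhdsWithin_iff, Metric.eventually_nhds_iff] at hev
      obtain ⟨δ, hδ, h⟩ := hev
      exact ⟨δ, hδ, fun t ht h' => h (by rwa [dist_zero_right]) ht⟩
    obtain ⟨B, hB⟩ := TT_bdd.exists_norm_le
    have hB0 : 0 ≤ B := (norm_nonneg _).trans (hB 0 zero_TT)
    obtain ⟨r, hr0, hr1, hr⟩ : ∃ r : ℝ, 0 < r ∧ r ≤ 1 ∧ r * B < δ := by
      refine ⟨min 1 (δ / (2 * (B + 1))), by positivity, min_le_left _ _, ?_⟩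
      have h1 : min 1 (δ / (2 * (B + 1))) * B ≤ δ / (2 * (B + 1)) * (B + 1) :=
        mul_le_mul (min_le_right _ _) (by linarith) hB0 (by positivity)
      have h2 : δ / (2 * (B + 1)) * (B + 1) = δ / 2 := by field_simp
      linarith
    have hrT : ∀ t ∈ TT, (r : ℂ) * t ∈ TT := fun t ht => TT_smul hr0.le hr1 ht
    have hrn : (r : ℂ) ≠ 0 := by exact_mod_cast hr0.ne'
    refine ⟨fun t => ρ (r * t), ρc.comp (by fun_prop) hrT, ?_, fun t ht => ρm (hrT t ht), ?_, ?_⟩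
    · intro a ha b hb h
      exact mul_left_cancel₀ hrn (ρi (hrT a ha) (hrT b hb) h)
    · show ρ (r * 0) = _
      rw [mul_zero, ρ0, e1 _ (inl_mem.2 hu)]
    · intro t ht h
      rcases him _ h with h | ⟨y, hy, h⟩
      · exact (mul_eq_zero.1 (ρf _ (hrT t ht) h)).resolve_left hrn
      · refine (hball _ (hrT t ht) ?_ ⟨_, m2' y hy, h.symm⟩).elim
        rw [norm_mul, Complex.norm_real, Real.norm_of_nonneg hr0.le]
        exact (mul_le_mul_of_nonneg_left (hB t ht) hr0.le).trans_lt hr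
  · obtain ⟨ρ, ρc, ρi, ρm, ρ0, ρf⟩ := W2 u hu
    have hT : ∀ t ∈ TT, L1 (ρ t) ∈ TT := fun t ht => L1_maps (ρm ht)
    refine ⟨fun t => ω (L1 (ρ t)), ωc.comp (L1_cont.comp_continuousOn ρc) hT, ?_, fun t ht => ωm (hT t ht), ?_, ?_⟩
    · intro a ha b hb h
      exact ρi ha hb (L1_inj (ωi (hT a ha) (hT b hb) h))
    · show ω (L1 (ρ 0)) = _
      rw [ρ0, e2 _ (inl_mem.2 hu)]
    · intro t ht h
      rcases him _ h with h | ⟨y, hy, h⟩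
      · have := hL0 _ (ωf _ (hT t ht) h)
        exact ρf t ht ⟨_, inl_mem.2 hw2, by rw [this, d2w]⟩
      · have := L1_inj (ωi (hT t ht) (m2' y hy) h)
        exact ρf t ht ⟨y, hy, this.symm⟩

def PConn (E' : Set K.E) : Prop := ∀ E1 ⊆ E', E1.Nonempty → (E' \ E1).Nonempty →
  ∃ a, a ∈ VS E1 ∧ a ∈ VS (E' \ E1)

lemma PConn.restr {E' E1 : Set K.E} (h : PConn E') (h1 : E1 ⊆ E') {w : K.V}
    (hs : ∀ u ∈ VS E1, u ∈ VS (E' \ E1) → u = w) : PConn E1 := by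
  intro A hA hn hn'
  by_contra hcon
  push Not at hcon
  have key : ∀ B ⊆ E1, B.Nonempty → (E1 \ B).Nonempty → w ∉ VS B → ∃ a, a ∈ VS B ∧ a ∈ VS (E1 \ B) := by
    intro B hB hn hn' hw
    obtain ⟨a, ha, e, ⟨he, heB⟩, hi⟩ := h B (hB.trans h1) hn (hn'.mono (sdiff_subset_sdiff_left h1))
    by_cases he1 : e ∈ E1
    · exact ⟨a, ha, e, ⟨he1, heB⟩, hi⟩
    · obtain rfl := hs a (VS_mono hB ha) ⟨e, ⟨he, he1⟩, hi⟩
      exact (hw ha).elim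
  by_cases hw : w ∈ VS A
  · obtain ⟨a, ha, ha'⟩ := key (E1 \ A) sdiff_subset hn' (by rwa [sdiff_sdiff_cancel_left hA]) (hcon w hw)
    rw [sdiff_sdiff_cancel_left hA] at ha'
    exact hcon a ha' ha
  · obtain ⟨a, ha, ha'⟩ := key A hA hn hn' hw
    exact hcon a ha ha'

lemma bd_total (z : K.E → ZMod 2) : ∑ v, bd z v = 0 := by
  classical
  simp only [bd_def']
  rw [Finset.sum_comm]
  refine Finset.sum_eq_zero fun e _ => ?_
  rw [Finset.sum_add_distrib, Finset.sum_ite_eq, Finset.sum_ite_eq, if_pos (Finset.mem_univ _), if_pos (Finset.mem_univ _)]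
  exact z2_self _

lemma Dual.restr {F : Type*} {E' E1 : Set K.E} {fa fb : K.E → F} (h : Dual E' fa fb) (h1 : E1 ⊆ E') {w : K.V}
    (hs : ∀ u ∈ VS E1, u ∈ VS (E' \ E1) → u = w) : Dual E1 fa fb := by
  classical
  constructor
  · intro χ
    have hsum : dl E' fa fb χ = dl E1 fa fb χ + dl (E' \ E1) fa fb χ := by
      funext e
      rw [Pi.add_apply]
      by_cases he : e ∈ E1
      · rw [dl_pos (h1 he), dl_pos he, dl_neg (fun h => h.2 he), add_zero]
      by_cases he' : e ∈ E'
      · rw [dl_pos he', dl_neg he, dl_pos (show e ∈ E' \ E1 from ⟨he', he⟩), zero_add]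
      · rw [dl_neg he', dl_neg he, dl_neg (fun h => he' h.1), zero_add]
    have hz := h.cyc χ
    rw [hsum, bd_add] at hz
    have hVS : ∀ (A : Set K.E) u, bd (dl A fa fb χ) u ≠ 0 → u ∈ VS A := by
      intro A u hu
      obtain ⟨e, he, hne⟩ := bd_ne hu
      refine ⟨e, ?_, he⟩
      by_contra hA
      exact hne (dl_neg hA)
    have hoff : ∀ u, u ≠ w → bd (dl E1 fa fb χ) u = 0 := by
      intro u hu
      by_contra hne
      have h2 : u ∉ VS (E' \ E1) := fun h' => hu (hs u (hVS _ _ hne) h')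
      have h3 : bd (dl (E' \ E1) fa fb χ) u = 0 := by
        by_contra h'; exact h2 (hVS _ _ h')
      have h4 := congrFun hz u
      rw [Pi.add_apply, h3, add_zero] at h4
      exact hne h4
    funext u
    by_cases hu : u = w
    · subst hu
      have := bd_total (dl E1 fa fb χ)
      rwa [Finset.sum_eq_single u (fun b _ hb => hoff b hb) (fun h => (h (Finset.mem_univ _)).elim)] at this
    · exact hoff u hu
  · intro z hz hb
    obtain ⟨χ, hχ⟩ := h.ex z (fun e he => hz e fun h' => he (h1 h')) hb
    refine ⟨χ, ?_⟩
    funext e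
    by_cases he : e ∈ E1
    · rw [hχ, dl_pos he, dl_pos (h1 he)]
    · rw [hz e he, dl_neg he]

lemma PP_main {F : Type*} [Finite F] {fa fb : K.E → F} : ∀ (k : ℕ) (E' : Set K.E), E'.ncard ≤ k → PConn E' →
    Dual E' fa fb → ∀ v ∈ VS E', PP E' v := by
  intro k
  induction k with
  | zero =>
    intro E' hk _ _ v hv
    have : E' = ∅ := (Set.ncard_eq_zero (Set.toFinite _)).1 (by omega)
    obtain ⟨e, he, _⟩ := hv
    rw [this] at he; exact he.elim
  | succ k ih =>
    intro E' hk hP hD v hv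
    by_cases hB : Block E'
    · by_cases h1 : ∀ e, E' = {e} → (K.ends e).1 = (K.ends e).2
      · exact block_PP hB hD hv h1
      · push Not at h1
        obtain ⟨e, rfl, he⟩ := h1
        exact PP_single he hv
    · have hB' : ∃ E1 ⊆ E', E1.Nonempty ∧ (E' \ E1).Nonempty ∧ ∀ a b, a ∈ VS E1 → a ∈ VS (E' \ E1) → 
          b ∈ VS E1 → b ∈ VS (E' \ E1) → a = b := by
        by_contra hc
        apply hB
        intro E1 h1 h2 h3
        by_contra hc'
        apply hc
        refine ⟨E1, h1, h2, h3, fun a b ha ha' hb hb' => ?_⟩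
        by_contra hab
        exact hc' ⟨a, b, hab, ha, ha', hb, hb'⟩
      obtain ⟨E1, h1, hn, hn', hu⟩ := hB'
      have key : ∀ E1 ⊆ E', E1.Nonempty → (E' \ E1).Nonempty → (∀ a b, a ∈ VS E1 → a ∈ VS (E' \ E1) → 
          b ∈ VS E1 → b ∈ VS (E' \ E1) → a = b) → v ∈ VS E1 → PP E' v := by
        intro E1 h1 hn hn' hu hv1
        obtain ⟨w, hw1, hw2⟩ := hP E1 h1 hn hn'
        have hs : ∀ u ∈ VS E1, u ∈ VS (E' \ E1) → u = w := fun u a b => hu u w a b hw1 hw2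
        have hs' : ∀ u ∈ VS (E' \ E1), u ∈ VS (E' \ (E' \ E1)) → u = w := by
          rw [sdiff_sdiff_cancel_left h1]
          exact fun u a b => hs u b a
        have c1 : E1.ncard < E'.ncard := by
          apply Set.ncard_lt_ncard _ (Set.toFinite _)
          refine ⟨h1, fun h => ?_⟩
          obtain ⟨e, he, he'⟩ := hn'
          exact he' (h he)
        have c2 : (E' \ E1).ncard < E'.ncard := by
          apply Set.ncard_lt_ncard _ (Set.toFinite _)
          refine ⟨sdiff_subset, fun h => ?_⟩
          obtain ⟨e, he⟩ := hn
          exact (h (h1 he)).2 he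
        have p1 := ih E1 (by omega) (hP.restr h1 hs) (hD.restr h1 hs) v hv1
        have p2 := ih (E' \ E1) (by omega) (hP.restr sdiff_subset hs') (hD.restr sdiff_subset hs') w hw2
        have := PP_glue disjoint_sdiff_right hv1 hw1 hw2 hs p1 p2
        rwa [union_sdiff_cancel h1] at this
      have hv' : v ∈ VS E1 ∪ VS (E' \ E1) := by rw [← VS_union, union_sdiff_cancel h1]; exact hv
      rcases hv' with hv' | hv'
      · exact key E1 h1 hn hn' hu hv'
      · refine key (E' \ E1) sdiff_subset hn' ?_ ?_ hv'
        · rwa [sdiff_sdiff_cancel_left h1]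
        · rw [sdiff_sdiff_cancel_left h1]
          exact fun a b p q r s => hu a b q p s r

end NPG

namespace NPG
open Set Filter Topology

variable {G : FinGraph} {S : Type*} [TopologicalSpace S]

lemma two_faces [T2Space S] [ConnectedSpace S] [ChartedSpace (EuclideanSpace ℝ (Fin 2)) S] (Γ : GraphEmb G S) (e : G.E) :
    ∃ f1 f2 : Option (Fc Γ), ∀ χ : Option (Fc Γ) → ZMod 2, DL Γ (fun f => χ (some f)) e = χ f1 + χ f2 := by
  classical
  have := Fintype.ofFinite (Fc Γ)
  have hsum : ∀ φ : Fc Γ → ZMod 2, DL Γ φ e = ∑ f, φ f * DL Γ (Pi.single f 1) e := by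
    intro φ
    have h := LinearMap.pi_apply_eq_sum_univ (LinearMap.proj e ∘ₗ DL Γ) φ
    have h' : DL Γ φ e = ∑ f, φ f • DL Γ (fun j => if f = j then 1 else 0) e := h
    rw [h']
    refine Finset.sum_congr rfl fun f _ => ?_
    rw [smul_eq_mul]
    have hs : (fun j => if f = j then (1 : ZMod 2) else 0) = Pi.single f 1 := by
      funext j
      by_cases hj : f = j
      · subst hj; simp
      · rw [if_neg hj, Pi.single_eq_of_ne (Ne.symm hj)]
    rw [hs]
  have hc := hsum (fun _ => 1)
  rw [DL_const, Pi.zero_apply] at hc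
  simp only [one_mul] at hc
  by_cases hall : ∀ f, DL Γ (Pi.single f 1) e = 0
  · refine ⟨none, none, fun χ => ?_⟩
    rw [hsum, z2_self]
    exact Finset.sum_eq_zero fun f _ => by rw [hall f, mul_zero]
  push Not at hall
  obtain ⟨f, hf⟩ := hall
  have hg : ∃ g, g ≠ f ∧ DL Γ (Pi.single g 1) e ≠ 0 := by
    by_contra hcon
    push Not at hcon
    rw [Finset.sum_eq_single f (fun b _ hb => hcon b hb) (fun h => (h (Finset.mem_univ _)).elim)] at hc
    exact hf hc.symm
  obtain ⟨g, hgf, hg⟩ := hg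
  refine ⟨some f, some g, fun χ => ?_⟩
  rw [hsum, Finset.sum_eq_add f g hgf.symm, z2_ne hf, z2_ne hg, mul_one, mul_one]
  · intro k _ hk
    by_contra hne
    have : DL Γ (Pi.single k 1) e ≠ 0 := fun h => hne (by rw [h, mul_zero])
    exact DL_two Γ e hgf.symm hk.1.symm hk.2.symm hf hg this
  · intro h; exact (h (Finset.mem_univ _)).elim
  · intro h; exact (h (Finset.mem_univ _)).elim

lemma comp_closed (c : G.Comp) {X : Set (G.componentGraph c).V}
    (hX : ∀ e, ((G.componentGraph c).ends e).1 ∈ X ↔ ((G.componentGraph c).ends e).2 ∈ X)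
    {v : (G.componentGraph c).V} (hv : v ∈ X) (u : (G.componentGraph c).V) : u ∈ X := by
  let P : G.V → Prop := fun x => ∀ h : x ∈ G.componentVerts c, (⟨x, h⟩ : (G.componentGraph c).V) ∈ X
  have hedge : ∀ e : G.E, P (G.ends e).1 ↔ P (G.ends e).2 := by
    intro e
    have hce := comp_ends e
    constructor
    · intro h h'
      have h1 : (G.ends e).1 ∈ G.componentVerts c := hce.trans h'
      exact (hX ⟨e, h1, h'⟩).1 (h h1)
    · intro h h'
      have h1 : (G.ends e).2 ∈ G.componentVerts c := hce.symm.trans h'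
      exact (hX ⟨e, h', h1⟩).2 (h h1)
  have hadj : ∀ x y, G.Adj x y → P x = P y := by
    rintro x y ⟨e, h | h⟩
    · have := hedge e
      rw [h] at this
      exact propext this
    · have := hedge e
      rw [h] at this
      exact propext this.symm
  have hvc : Quot.mk G.Adj v.1 = c := v.2
  have huc : Quot.mk G.Adj u.1 = c := u.2
  have h := congrArg (Quot.lift P hadj) (hvc.trans huc.symm)
  have h : P v.1 = P u.1 := h
  have hu : P u.1 := by rw [← h]; intro _; exact hv
  exact hu u.2

lemma planar_of [T2Space S] [ConnectedSpace S] [ChartedSpace (EuclideanSpace ℝ (Fin 2)) S] (Γ : GraphEmb G S)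
    (c : G.Comp) (h : ∀ z ∈ Zc (G.componentGraph c), z ∈ (LinearMap.range (DL Γ)).map (res c)) :
    G.IsPlanarComponent c := by
  have hedges : ∀ e : (G.componentGraph c).E, ∃ f1 f2 : Option (Fc Γ), ∀ χ : Option (Fc Γ) → ZMod 2,
      res c (DL Γ (fun f => χ (some f))) e = χ f1 + χ f2 := fun e => two_faces Γ e.1
  have hconn := @comp_closed G c
  have hcyc : ∀ φ, res c (DL Γ φ) ∈ Zc (G.componentGraph c) := fun φ => res_mem c (DL_mem Γ φ)
  obtain ⟨v0, hv0⟩ : ∃ v : (G.componentGraph c).V, True := by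
    obtain ⟨v, hv⟩ := Quot.exists_rep c
    exact ⟨⟨v, hv⟩, trivial⟩
  unfold FinGraph.IsPlanarComponent
  generalize hr : (res c : _ →ₗ[ZMod 2] _) = r at *
  clear hr
  generalize G.componentGraph c = K at *
  by_cases hE : Nonempty K.E
  swap
  · have hE : IsEmpty K.E := not_nonempty_iff.1 hE
    refine ⟨mkEmb (fun _ => 0) (fun _ _ => 0) (fun e => (hE.false e).elim) (fun e => (hE.false e).elim)
      (fun e => (hE.false e).elim) ?_ (fun e => (hE.false e).elim) (fun e => (hE.false e).elim)⟩
    intro a b _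
    have : b ∈ ({a} : Set K.V) := hconn (X := {a}) (fun e => (hE.false e).elim) (mem_singleton a) b
    exact (show b = a from this).symm
  obtain ⟨e0⟩ := hE
  choose fa fb hf using hedges
  have hfin : Finite (Option (Fc Γ)) := inferInstance
  have hdl : ∀ χ, dl univ fa fb χ = r (DL Γ (fun f => χ (some f))) := by
    intro χ
    funext e
    rw [hf, dl_pos (mem_univ e)]
  have hD : Dual (univ : Set K.E) fa fb := by
    constructor
    · intro χ
      rw [hdl]
      exact mem_Zc.1 (hcyc _)
    · intro z _ hz
      obtain ⟨y, ⟨φ, rfl⟩, rfl⟩ := h z (mem_Zc.2 hz)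
      exact ⟨fun o => o.elim 0 φ, (hdl (fun o => o.elim 0 φ)).symm⟩
  have hP : PConn (univ : Set K.E) := by
    intro E1 _ ⟨e1, he1⟩ ⟨e2, _, he2⟩
    by_contra hcon
    push Not at hcon
    have := hconn (X := VS E1) (fun e => by
      by_cases he : e ∈ E1
      · exact ⟨fun _ => VS_2 he, fun _ => VS_1 he⟩
      · have he' : e ∈ univ \ E1 := ⟨mem_univ _, he⟩
        exact ⟨fun h => (hcon _ h (VS_1 he')).elim, fun h => (hcon _ h (VS_2 he')).elim⟩) (VS_1 he1) (K.ends e2).1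
    exact hcon _ this (VS_1 ⟨mem_univ _, he2⟩)
  have hV : ∀ u, u ∈ VS (univ : Set K.E) :=
    hconn (fun e => ⟨fun _ => VS_2 (mem_univ e), fun _ => VS_1 (mem_univ e)⟩) (VS_1 (mem_univ e0))
  obtain ⟨D, hDr, -⟩ := PP_main _ univ le_rfl hP hD v0 (hV v0)
  let I := Complex.orthonormalBasisOneI.repr
  refine ⟨mkEmb (fun v => I (D (Sum.inl v))) (fun e t => I (D (nrm e t))) ?_ ?_ ?_ ?_ ?_ ?_⟩
  · intro e
    exact I.continuous.comp_continuousOn (hDr.cont e (mem_univ e))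
  · intro e; simp only [nrm_zero]
  · intro e; simp only [nrm_one]
  · intro a b hab
    exact Sum.inl_injective (hDr.inj (inl_mem.2 (hV a)) (inl_mem.2 (hV b)) (I.injective hab))
  · intro e e' t ht t' ht' hh
    have hh := hDr.inj (nrm_mem (mem_univ e) (Ioo_subset_Icc_self ht)) (nrm_mem (mem_univ e') (Ioo_subset_Icc_self ht'))
      (I.injective hh)
    rw [nrm_mid e ht, nrm_mid e' ht'] at hh
    have := Sum.inr_injective hh
    exact ⟨congrArg Prod.fst this, congrArg Prod.snd this⟩
  · intro e t ht v hh
    have hh := hDr.inj (nrm_mem (mem_univ e) (Ioo_subset_Icc_self ht)) (inl_mem.2 (hV v)) (I.injective hh)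
    rw [nrm_mid e ht] at hh
    cases hh

end NPG

/-- If a finite graph `G` embeds into a closed surface `S` of Euler
genus `g`, then at most `g` connected components of `G` are non-planar. -/
theorem nonplanar_components_le_genus
    (S : Type*) [TopologicalSpace S] [ChartedSpace (EuclideanSpace ℝ (Fin 2)) S]
    [CompactSpace S] [ConnectedSpace S] [T2Space S]
    (g : ℕ) (hg : eulerGenusClosed S = (g : ℤ))
    (G : FinGraph) (Γ : GraphEmb G S) :
    Nat.card {c : G.Comp // ¬ G.IsPlanarComponent c} ≤ g := by
  refine NPG.final_bound Γ g hg fun c hc => ?_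
  by_contra hcon
  push Not at hcon
  exact hc (NPG.planar_of Γ c hcon)
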